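/- Let H be a bounded hyperbolic component of S_p of Type B, i.e., for (c,a) ∈ H the critical point −c lies in U_{c,a}(f_{c,a}^l(c)) for some 1 ≤ l < p. Then the map Φ: H → 𝔻 defined by Φ(c,a) = B_{c,a}(−c), where B_{c,a} is the Böttcher coordinate of f_{c,a}^p at its superattracting fixed point f_{c,a}^l(c), is a proper triple cover onto the unit disk ramified at exactly one point. -/

import Mathlib

open Set Function Filter Topology Metric

noncomputable section

/-- The cubic polynomial `f_{c,a}(z) = z^3 - 3c^2 z + a`, with critical points `c` and `-c`. -/
def cubic (c a : ℂ) : ℂ → ℂ := fun z => z ^ 3 - 3 * c ^ 2 * z + a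

/-- The critically periodic curve `S_p`: parameters for which the critical point `c`
has exact period `p`. -/
def Sp (p : ℕ) : Set (ℂ × ℂ) :=
  {w | (cubic w.1 w.2)^[p] w.1 = w.1 ∧ ∀ k, 1 ≤ k → k < p → (cubic w.1 w.2)^[k] w.1 ≠ w.1}

/-- `S_p^*`: the curve `S_p` minus the finitely many parameters for which `-c` meets
the orbit of `c`. -/
def SpStar (p : ℕ) : Set (ℂ × ℂ) :=
  {w ∈ Sp p | ∀ k, 0 < k → k ≤ p → (cubic w.1 w.2)^[k] w.1 ≠ -w.1}

/-- The filled Julia set of a polynomial: points with bounded forward orbit. -/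
def filledJulia (f : ℂ → ℂ) : Set ℂ :=
  {z | Bornology.IsBounded (range fun n => f^[n] z)}

/-- The Julia set of a polynomial: the boundary of the filled Julia set. -/
def juliaSet (f : ℂ → ℂ) : Set ℂ := frontier (filledJulia f)

/-- The Fatou set of a polynomial. -/
def fatouSet (f : ℂ → ℂ) : Set ℂ := (juliaSet f)ᶜ

/-- The Fatou component containing a point `z`. -/
def fatouComponent (f : ℂ → ℂ) (z : ℂ) : Set ℂ := connectedComponentIn (fatouSet f) z

/-- The orbit of `z` converges to an attracting periodic cycle of `f`. -/
def AttractedToAttractingCycle (f : ℂ → ℂ) (z : ℂ) : Prop :=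
  ∃ n : ℕ, 0 < n ∧ ∃ w : ℂ, f^[n] w = w ∧ ‖deriv (f^[n]) w‖ < 1 ∧
    Tendsto (fun k => f^[n * k] z) atTop (𝓝 w)

/-- A parameter `(c,a)` is hyperbolic if both critical points `c`, `-c` of `f_{c,a}`
are attracted to attracting cycles. -/
def IsHyperbolicParam (w : ℂ × ℂ) : Prop :=
  AttractedToAttractingCycle (cubic w.1 w.2) w.1 ∧
    AttractedToAttractingCycle (cubic w.1 w.2) (-w.1)

/-- The hyperbolic locus on `S_p`. -/
def hypLocus (p : ℕ) : Set (ℂ × ℂ) := {w ∈ Sp p | IsHyperbolicParam w}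

/-- A hyperbolic component on `S_p`: a connected component of the hyperbolic locus. -/
def IsHyperbolicComponent (p : ℕ) (H : Set (ℂ × ℂ)) : Prop :=
  ∃ w ∈ hypLocus p, H = connectedComponentIn (hypLocus p) w

/-- A Jordan curve: a homeomorphic image of the unit circle. -/
def IsJordanCurve {X : Type*} [TopologicalSpace X] (Γ : Set X) : Prop :=
  ∃ φ : ↥(sphere (0 : ℂ) 1) → X, Continuous φ ∧ Injective φ ∧ range φ = Γ

/-- A Jordan disk in `ℂ`: an open connected set bounded by a Jordan curve. -/
def IsJordanDisk (S : Set ℂ) : Prop :=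
  IsOpen S ∧ IsConnected S ∧ IsJordanCurve (frontier S)

/-- `A_{c,a}`: the union of the `p` Fatou components containing the superattracting
orbit of `c`. -/
def critBasin (p : ℕ) (w : ℂ × ℂ) : Set ℂ :=
  ⋃ k ∈ Finset.range p, fatouComponent (cubic w.1 w.2) ((cubic w.1 w.2)^[k] w.1)

/-- The connectedness locus `C(S_p)`. -/
def connLocus (p : ℕ) : Set (ℂ × ℂ) :=
  {w ∈ Sp p | IsConnected (juliaSet (cubic w.1 w.2))}

/-- `C₀(S_p)`: parameters in `C(S_p)` whose free critical orbit never enters `A_{c,a}`. -/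
def connLocus0 (p : ℕ) : Set (ℂ × ℂ) :=
  {w ∈ connLocus p | ∀ k : ℕ, (cubic w.1 w.2)^[k] (-w.1) ∉ critBasin p w}

/-- A Böttcher coordinate of `g` at a superattracting fixed point `z₀`, defined on an
open set `U`, conjugating `g` to `z ↦ z^d`, injective near `z₀`. -/
structure IsBottcherAt (g : ℂ → ℂ) (z₀ : ℂ) (B : ℂ → ℂ) (U : Set ℂ) (d : ℕ) : Prop where
  open_dom : IsOpen U
  mem : z₀ ∈ U
  mapsTo : MapsTo g U U
  analytic : AnalyticOnNhd ℂ B U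
  zero : B z₀ = 0
  two_le : 2 ≤ d
  conj : ∀ z ∈ U, B (g z) = B z ^ d
  inj : ∃ V ⊆ U, IsOpen V ∧ z₀ ∈ V ∧ InjOn B V

/-- A Böttcher coordinate of `g` defined on a whole (super)attracting Fatou
component `U`, a conformal isomorphism onto the unit disk conjugating `g` to `z ↦ z^d`. -/
structure IsFullBottcher (g : ℂ → ℂ) (z₀ : ℂ) (U : Set ℂ) (B : ℂ → ℂ) (d : ℕ) : Prop where
  two_le : 2 ≤ d
  analytic : AnalyticOnNhd ℂ B U
  bij : BijOn B U (ball (0 : ℂ) 1)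
  zero : B z₀ = 0
  conj : ∀ z ∈ U, B (g z) = B z ^ d

/-- The basin of infinity of a polynomial. -/
def basinInf (f : ℂ → ℂ) : Set ℂ := {z | Tendsto (fun n => ‖f^[n] z‖) atTop atTop}

/-- A Böttcher coordinate of a cubic polynomial near infinity, tangent to the identity. -/
structure IsBottcherInf (f : ℂ → ℂ) (B : ℂ → ℂ) (R₀ : ℝ) : Prop where
  one_le : 1 ≤ R₀
  analytic : AnalyticOnNhd ℂ B {z : ℂ | R₀ < ‖z‖}
  inj : InjOn B {z : ℂ | R₀ < ‖z‖}
  mapsTo : ∀ z : ℂ, R₀ < ‖z‖ → R₀ < ‖f z‖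
  conj : ∀ z : ℂ, R₀ < ‖z‖ → B (f z) = B z ^ 3
  asymp : Tendsto (fun z => B z / z) (Bornology.cobounded ℂ) (𝓝 1)

/-- A Böttcher coordinate of a cubic polynomial defined on the whole basin of infinity
(available when the Julia set is connected). -/
structure IsFullBottcherInf (f : ℂ → ℂ) (B : ℂ → ℂ) : Prop where
  analytic : AnalyticOnNhd ℂ B (basinInf f)
  inj : InjOn B (basinInf f)
  conj : ∀ z ∈ basinInf f, B (f z) = B z ^ 3
  asymp : Tendsto (fun z => B z / z) (Bornology.cobounded ℂ) (𝓝 1)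

/-- The external ray of angle `θ` (for a cubic polynomial), described through a Böttcher
coordinate `B` near infinity: points whose large iterates lie on the straight part of the
ray of angle `3^n θ`. -/
def extRaySet (f B : ℂ → ℂ) (R₀ : ℝ) (θ : ℝ) : Set ℂ :=
  {z | ∃ N : ℕ, ∀ n, N ≤ n → R₀ < ‖f^[n] z‖ ∧
    ∃ r : ℝ, 1 < r ∧
      B (f^[n] z) = (r : ℂ) * Complex.exp (2 * Real.pi * Complex.I * ((3 : ℂ) ^ n * (θ : ℂ)))}

/-- `R` is the external ray of angle `θ` of `f`. -/
def IsExternalRaySet (f : ℂ → ℂ) (θ : ℝ) (R : Set ℂ) : Prop :=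
  ∃ B R₀, IsBottcherInf f B R₀ ∧ R = extRaySet f B R₀ θ

/-- The internal ray of angle `θ` (w.r.t. a Böttcher coordinate `B` of `f^p` at the
superattracting periodic point `z₀`) in the Fatou component of `z₀`. -/
def intRaySet (p : ℕ) (f : ℂ → ℂ) (z₀ : ℂ) (B : ℂ → ℂ) (U : Set ℂ) (θ : ℝ) : Set ℂ :=
  {z ∈ fatouComponent f z₀ | ∃ N : ℕ, ∀ n, N ≤ n → f^[p * n] z ∈ U ∧
    ∃ r : ℝ, 0 ≤ r ∧ r < 1 ∧
      B (f^[p * n] z) = (r : ℂ) * Complex.exp (2 * Real.pi * Complex.I * ((2 : ℂ) ^ n * (θ : ℂ)))}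

/-- `R` is the internal ray of angle `θ` of `f` in the periodic Fatou component of `z₀`. -/
def IsInternalRaySet (p : ℕ) (f : ℂ → ℂ) (z₀ : ℂ) (θ : ℝ) (R : Set ℂ) : Prop :=
  ∃ B U d, IsBottcherAt (f^[p]) z₀ B U d ∧ R = intRaySet p f z₀ B U θ

/-- A ray `R` (as a set) lands at the point `q`. -/
def LandsAt (R : Set ℂ) (q : ℂ) : Prop := IsConnected R ∧ closure R \ R = {q}

/-- `q` is a repelling periodic point of `f`. -/
def IsRepellingPeriodicPt (f : ℂ → ℂ) (q : ℂ) : Prop :=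
  ∃ n : ℕ, 0 < n ∧ f^[n] q = q ∧ 1 < ‖deriv (f^[n]) q‖

/-- `q` is a parabolic periodic point of `f`: its multiplier is a root of unity. -/
def IsParabolicPeriodicPt (f : ℂ → ℂ) (q : ℂ) : Prop :=
  ∃ n : ℕ, 0 < n ∧ f^[n] q = q ∧ ∃ m : ℕ, 0 < m ∧ (deriv (f^[n]) q) ^ m = 1

/-- `f` has a parabolic periodic point. -/
def HasParabolicPoint (f : ℂ → ℂ) : Prop := ∃ q, IsParabolicPeriodicPt f q

/-- The Green function of the basin of infinity. -/
def greenInf (f : ℂ → ℂ) (z : ℂ) : ℝ :=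
  limUnder atTop fun n : ℕ => Real.log ‖f^[n] z‖ / 3 ^ n

/-- The Green function of a periodic Fatou component containing the orbit point `w₀`. -/
def greenComp (p : ℕ) (f : ℂ → ℂ) (w₀ z : ℂ) : ℝ :=
  limUnder atTop fun n : ℕ => Real.log ‖f^[p * n] z - w₀‖ / 2 ^ n

/-- The truncated plane `X_{c,a}`: the plane minus the equipotential trap near infinity
and near the superattracting cycle. -/
def Xset (p : ℕ) (c a : ℂ) : Set ℂ :=
  {z | ¬ (z ∈ basinInf (cubic c a) ∧ 1 ≤ greenInf (cubic c a) z) ∧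
    ∀ k, k < p → ¬ (z ∈ fatouComponent (cubic c a) ((cubic c a)^[k] c) ∧
      greenComp p (cubic c a) ((cubic c a)^[k] c) z ≤ -1)}

/-- `G = γ_{c,a}(θ)`: the forward invariant graph generated by the closed internal ray of
angle `θ` in `U_{c,a}(c)` together with the closures of all external rays landing at its
landing point. -/
def IsGammaGraph (p : ℕ) (c a : ℂ) (θ : ℝ) (G : Set ℂ) : Prop :=
  ∃ (Rint : Set ℂ) (ζ : ℂ), IsInternalRaySet p (cubic c a) c θ Rint ∧
    closure Rint \ Rint = {ζ} ∧
    G = ⋃ k : ℕ, (cubic c a)^[k] ''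
      (closure Rint ∪ ⋃₀ {S | ∃ t R, IsExternalRaySet (cubic c a) t R ∧
        closure R \ R = {ζ} ∧ S = closure R})

/-- A puzzle for `f` (with periodic critical point of period `p`) relative to the
truncated plane `X`. -/
structure IsPuzzle (p : ℕ) (f : ℂ → ℂ) (X Γ : Set ℂ) : Prop where
  subset_closure : Γ ⊆ closure X
  boundary_subset : frontier X ⊆ Γ
  compact : IsCompact Γ
  forward_inv : f '' (Γ ∩ f^[p] ⁻¹' X) ⊆ Γ
  crit_avoid : ∀ c' : ℂ, deriv f c' = 0 → ∀ k : ℕ, f^[k] c' ∉ Γ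

/-- The puzzle piece of depth `n` containing `z`. -/
def pieceAt (f : ℂ → ℂ) (X Γ : Set ℂ) (n : ℕ) (z : ℂ) : Set ℂ :=
  connectedComponentIn (f^[n] ⁻¹' (X \ Γ)) z

/-- An `ℓ`-admissible puzzle. -/
structure IsAdmissiblePuzzle (ℓ p : ℕ) (f : ℂ → ℂ) (X Γ : Set ℂ) : Prop where
  puzzle : IsPuzzle p f X Γ
  nondeg : ∀ c' : ℂ, deriv f c' = 0 → c' ∈ juliaSet f →
    ∃ d : ℕ, closure (pieceAt f X Γ (d + ℓ) c') ⊆ pieceAt f X Γ d c'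
  repelling : ∀ z ∈ Γ ∩ juliaSet f, ∀ n : ℕ, 0 < n → f^[n] z = z →
    1 < ‖deriv (f^[n]) z‖
  jordan : ∀ (n : ℕ) (z : ℂ), z ∈ f^[n] ⁻¹' (X \ Γ) → IsJordanDisk (pieceAt f X Γ n z)

/-- The tableau `T_f(z)` is periodic. -/
def TableauPeriodic (f : ℂ → ℂ) (X Γ : Set ℂ) (z : ℂ) : Prop :=
  ∃ k : ℕ, 1 ≤ k ∧ ∀ n : ℕ, pieceAt f X Γ n z = f^[k] '' pieceAt f X Γ (n + k) z

/-- `x` combinatorially accumulates to `y` (for `f`). -/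
def CombAcc (f : ℂ → ℂ) (X Γ : Set ℂ) (x y : ℂ) : Prop :=
  ∀ n : ℕ, ∃ j : ℕ, 0 < j ∧ f^[j] '' pieceAt f X Γ (n + j) x = pieceAt f X Γ n y

/-- `x` combinatorially accumulates to `y` for `g = f^p` (puzzle depths in `pℕ`). -/
def CombAccG (p : ℕ) (f : ℂ → ℂ) (X Γ : Set ℂ) (x y : ℂ) : Prop :=
  ∀ n : ℕ, ∃ j : ℕ, 0 < j ∧
    f^[p * j] '' pieceAt f X Γ (p * n + p * j) x = pieceAt f X Γ (p * n) y

/-- Critical points of `f` on the Julia set. -/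
def critJulia (f : ℂ → ℂ) : Set ℂ := {z | deriv f z = 0 ∧ z ∈ juliaSet f}

/-- `[x]_f`: critical points combinatorially bi-accumulating with `x`. -/
def critClass (f : ℂ → ℂ) (X Γ : Set ℂ) (x : ℂ) : Set ℂ :=
  {c' ∈ critJulia f | CombAcc f X Γ x c' ∧ CombAcc f X Γ c' x}

/-- `P_{n+k}(c')` is a child of `P_n(c₁)`: the map
`f^(k-1) : P_{n+k-1}(f(c')) → P_n(c₁)` is conformal. -/
def IsChild (f : ℂ → ℂ) (X Γ : Set ℂ) (n k : ℕ) (c' c₁ : ℂ) : Prop :=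
  0 < k ∧ f^[k - 1] '' pieceAt f X Γ (n + k - 1) (f c') = pieceAt f X Γ n c₁ ∧
    InjOn (f^[k - 1]) (pieceAt f X Γ (n + k - 1) (f c'))

/-- The critical piece `P_n(c₁)` has only finitely many children. -/
def FinitelyManyChildren (f : ℂ → ℂ) (X Γ : Set ℂ) (n : ℕ) (c₁ : ℂ) : Prop :=
  Set.Finite {q : ℂ × ℕ | q.1 ∈ critJulia f ∧ IsChild f X Γ n q.2 q.1 c₁}

/-- The tableau of `x` is persistently recurrent. -/
def PersistentlyRecurrent (f : ℂ → ℂ) (X Γ : Set ℂ) (x : ℂ) : Prop :=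
  CombAcc f X Γ x x ∧ ∀ c₁ ∈ critClass f X Γ x, ∀ n : ℕ, FinitelyManyChildren f X Γ n c₁

/-- A function on a subset of `ℂ²` is analytic along every analytic disc contained in it
(this expresses holomorphy of a function on an analytic curve in `ℂ²`). -/
def AnalyticOnSlice (Φ : ℂ × ℂ → ℂ) (H : Set (ℂ × ℂ)) : Prop :=
  ∀ (U : Set ℂ) (γ : ℂ → ℂ × ℂ), IsOpen U →
    AnalyticOnNhd ℂ (fun t => (γ t).1) U → AnalyticOnNhd ℂ (fun t => (γ t).2) U →
    (∀ t ∈ U, γ t ∈ H) → AnalyticOnNhd ℂ (fun t => Φ (γ t)) U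

/-- A quasiconformal homeomorphism of the plane (metric definition: bounded circular
distortion). -/
def IsQCHomeo (φ : ℂ → ℂ) : Prop :=
  Continuous φ ∧ Bijective φ ∧ ∃ K : ℝ, ∀ x : ℂ,
    Filter.limsup (fun r : ℝ =>
        sSup ((fun y => dist (φ y) (φ x)) '' sphere x r) /
          sInf ((fun y => dist (φ y) (φ x)) '' sphere x r)) (𝓝[>] (0 : ℝ)) ≤ K

/-- The sector of the parameter disk coordinate `Φ`, of radii `> 1 - 1/(k+1)` and
angles within `1/(k+1)` of `t`. -/
def paramSector (Φ : ℂ × ℂ → ℂ) (H : Set (ℂ × ℂ)) (t : ℝ) (k : ℕ) : Set (ℂ × ℂ) :=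
  {w ∈ H | ∃ r θ' : ℝ, 1 - 1 / (k + 1) < r ∧ r < 1 ∧ |θ' - t| < 1 / (k + 1) ∧
    Φ w = (r : ℂ) * Complex.exp (2 * Real.pi * Complex.I * (θ' : ℂ))}

/-- The impression of the parameter ray of angle `t`. -/
def impression (Φ : ℂ × ℂ → ℂ) (H : Set (ℂ × ℂ)) (t : ℝ) : Set (ℂ × ℂ) :=
  ⋂ k : ℕ, closure (paramSector Φ H t k)

end

section roots
variable {E : Type*} [NormedAddCommGroup E] [NormedSpace ℂ E]

theorem Convex.exists_differentiableOn_log {X : Set E} (hX : Convex ℝ X) (hXo : IsOpen X)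
    {F : E → ℂ} (hF : DifferentiableOn ℂ F X) (h0 : ∀ x ∈ X, F x ≠ 0) :
    ∃ L : E → ℂ, DifferentiableOn ℂ L X ∧ ∀ x ∈ X, Complex.exp (L x) = F x := by
  rcases X.eq_empty_or_nonempty with rfl | hne
  · exact ⟨0, by simp [DifferentiableOn], by simp⟩
  have hsc : IsSimplyConnected X := by
    have := hX.contractibleSpace hne
    show SimplyConnectedSpace X
    infer_instance
  obtain ⟨L, hLc, hL⟩ := Complex.exists_continuousOn_eqOn_exp_comp hsc hXo hF.continuousOn
    (by rintro ⟨x, hx, h⟩; exact h0 x hx h)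
  refine ⟨L, fun x hx => ?_, fun x hx => hL hx⟩
  have hLx : ContinuousAt L x := hLc.continuousAt (hXo.mem_nhds hx)
  have hFx : DifferentiableAt ℂ F x := hF.differentiableAt (hXo.mem_nhds hx)
  have h1 : ∀ᶠ y in 𝓝 x, ‖L y - L x‖ < 1 := by
    have : Tendsto (fun y => ‖L y - L x‖) (𝓝 x) (𝓝 0) := by
      have := (hLx.sub (continuousAt_const (y := L x))).norm
      simpa [ContinuousAt] using this
    exact this.eventually_lt_const one_pos
  have h2 : L =ᶠ[𝓝 x] fun y => L x + Complex.log (F y / F x) := by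
    filter_upwards [h1, hXo.mem_nhds hx] with y hy hyX
    have hy1 : F y = Complex.exp (L y) := (hL hyX).symm
    have hy2 : F x = Complex.exp (L x) := (hL hx).symm
    rw [hy1, hy2, ← Complex.exp_sub]
    have him : |(L y - L x).im| < 1 := (Complex.abs_im_le_norm _).trans_lt hy
    have := Real.pi_gt_three
    rw [abs_lt] at him
    rw [Complex.log_exp (by linarith) (by linarith)]
    ring
  refine DifferentiableAt.differentiableWithinAt ?_
  refine DifferentiableAt.congr_of_eventuallyEq ?_ h2
  refine (DifferentiableAt.clog (by simpa [div_eq_mul_inv] using hFx.mul_const (F x)⁻¹) ?_).const_add _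
  rw [div_self (h0 x hx)]
  simp

theorem Convex.exists_differentiableOn_pow_eq {X : Set E} (hX : Convex ℝ X) (hXo : IsOpen X)
    {F : E → ℂ} (hF : DifferentiableOn ℂ F X) (h0 : ∀ x ∈ X, F x ≠ 0) {n : ℕ} (hn : n ≠ 0) :
    ∃ L : E → ℂ, DifferentiableOn ℂ L X ∧ ∀ x ∈ X, L x ^ n = F x := by
  obtain ⟨L, hL, hLF⟩ := hX.exists_differentiableOn_log hXo hF h0
  refine ⟨fun x => Complex.exp (L x / n), by simpa [div_eq_mul_inv] using (hL.mul_const (n : ℂ)⁻¹).cexp, fun x hx => ?_⟩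
  rw [← Complex.exp_nat_mul, mul_div_cancel₀ _ (by exact_mod_cast hn), hLF x hx]

/-- Holomorphic solutions of `Y³ - 3e²Y = T` with prescribed value at a point, when the
discriminant `T² - 4e⁶` is a square up to a nonvanishing factor. -/
theorem Convex.exists_cubic_lift {X : Set E} (hX : Convex ℝ X) (hXo : IsOpen X)
    {e T κ K : E → ℂ} (he : DifferentiableOn ℂ e X) (hT : DifferentiableOn ℂ T X)
    (hκ : DifferentiableOn ℂ κ X) (hK : DifferentiableOn ℂ K X)
    (he0 : ∀ x ∈ X, e x ≠ 0) (hK0 : ∀ x ∈ X, K x ≠ 0)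
    (hd : ∀ x ∈ X, T x ^ 2 - 4 * e x ^ 6 = κ x ^ 2 * K x)
    {x₀ : E} (hx₀ : x₀ ∈ X) {y₀ : ℂ} (hy₀ : y₀ ^ 3 - 3 * e x₀ ^ 2 * y₀ = T x₀) :
    ∃ Y : E → ℂ, DifferentiableOn ℂ Y X ∧ (∀ x ∈ X, Y x ^ 3 - 3 * e x ^ 2 * Y x = T x) ∧
      Y x₀ = y₀ := by
  obtain ⟨k, hk, hkK⟩ := hX.exists_differentiableOn_pow_eq hXo hK hK0 two_ne_zero
  have hprod : ∀ x ∈ X, ((T x + κ x * k x) / e x ^ 3 / 2) * ((T x - κ x * k x) / e x ^ 3 / 2) = 1 := by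
    intro x hx
    have h1 := he0 x hx
    have h2 := hd x hx
    rw [← hkK x hx] at h2
    field_simp
    linear_combination h2
  obtain ⟨s, hs, hsX⟩ := hX.exists_differentiableOn_pow_eq hXo
    (F := fun x => (T x + κ x * k x) / e x ^ 3 / 2) (n := 3)
    (by
      simp only [div_eq_mul_inv]
      exact ((hT.add (hκ.mul hk)).mul ((he.pow 3).inv (fun x hx => pow_ne_zero _ (he0 x hx)))).mul_const _)
    (fun x hx h => by have := hprod x hx; rw [h, zero_mul] at this; exact zero_ne_one this)
    three_ne_zero
  have hs0 : ∀ x ∈ X, s x ≠ 0 := by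
    intro x hx h
    have h1 := hsX x hx
    have := hprod x hx
    rw [← h1, h] at this
    simp at this
  -- a value of the uniformizing parameter over `y₀`
  obtain ⟨s₀, hs₀0, hs₀, hs₀X⟩ : ∃ s₀ : ℂ, s₀ ≠ 0 ∧ y₀ = e x₀ * (s₀ + s₀⁻¹) ∧ s₀ ^ 3 = s x₀ ^ 3 := by
    obtain ⟨d, hd'⟩ := IsAlgClosed.exists_pow_nat_eq ((y₀ / e x₀) ^ 2 - 4) (n := 2) two_pos
    have h1 := he0 x₀ hx₀
    set t := (y₀ / e x₀ + d) / 2 with ht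
    have htq : t * (y₀ / e x₀ - t) = 1 := by rw [ht]; linear_combination -(1/4) * hd'
    have ht0 : t ≠ 0 := by rintro h; rw [h, zero_mul] at htq; exact zero_ne_one htq
    have htinv : t⁻¹ = y₀ / e x₀ - t := by field_simp; field_simp at htq; linear_combination -htq
    have hy : y₀ = e x₀ * (t + t⁻¹) := by rw [htinv]; field_simp; ring
    have hs0' := hs0 x₀ hx₀
    have hsum : t ^ 3 + (t ^ 3)⁻¹ = s x₀ ^ 3 + (s x₀ ^ 3)⁻¹ := by
      have h3 : (s x₀ ^ 3)⁻¹ = (T x₀ - κ x₀ * k x₀) / e x₀ ^ 3 / 2 := by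
        rw [hsX x₀ hx₀]; exact inv_eq_of_mul_eq_one_right (hprod x₀ hx₀)
      rw [h3, hsX x₀ hx₀]
      have : t ^ 3 + (t ^ 3)⁻¹ = T x₀ / e x₀ ^ 3 := by
        rw [← hy₀, hy]; field_simp; ring
      rw [this]; ring
    have hfac : (t ^ 3 - s x₀ ^ 3) * (t ^ 3 * s x₀ ^ 3 - 1) = 0 := by
      field_simp at hsum
      linear_combination hsum
    rcases mul_eq_zero.mp hfac with h | h
    · exact ⟨t, ht0, hy, sub_eq_zero.mp h⟩
    · refine ⟨t⁻¹, inv_ne_zero ht0, by rw [inv_inv, add_comm]; exact hy, ?_⟩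
      rw [inv_pow]; exact inv_eq_of_mul_eq_one_right (sub_eq_zero.mp h)
  have hsx := hs0 x₀ hx₀
  set ω := s₀ / s x₀ with hω
  have hω3 : ω ^ 3 = 1 := by rw [hω, div_pow, hs₀X]; exact div_self (pow_ne_zero _ hsx)
  have hω0 : ω ≠ 0 := div_ne_zero hs₀0 hsx
  refine ⟨fun x => e x * (ω * s x + (ω * s x)⁻¹), ?_, fun x hx => ?_, ?_⟩
  · exact he.mul (((hs.const_mul _)).add ((hs.const_mul _).inv
      (fun x hx => mul_ne_zero hω0 (hs0 x hx))))
  · have h1 := he0 x hx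
    have h2 := hs0 x hx
    set S := ω * s x with hS
    have hS0 : S ≠ 0 := mul_ne_zero hω0 h2
    have hS3 : S ^ 3 = (T x + κ x * k x) / e x ^ 3 / 2 := by
      rw [hS, mul_pow, hω3, one_mul, hsX x hx]
    have hS3' : (S ^ 3)⁻¹ = (T x - κ x * k x) / e x ^ 3 / 2 := by
      rw [hS3]; exact inv_eq_of_mul_eq_one_right (hprod x hx)
    have : (e x * (S + S⁻¹)) ^ 3 - 3 * e x ^ 2 * (e x * (S + S⁻¹)) = e x ^ 3 * (S ^ 3 + (S ^ 3)⁻¹) := by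
      field_simp; ring
    refine this.trans ?_
    rw [hS3', hS3]
    field_simp; ring
  · have : ω * s x₀ = s₀ := by rw [hω]; field_simp
    simp only [this, hs₀]

end roots

section basics

theorem cubic_apply (c a z : ℂ) : cubic c a z = z ^ 3 - 3 * c ^ 2 * z + a := rfl

theorem cubic_sub (c a x y : ℂ) :
    cubic c a x - cubic c a y = (x - y) * (x ^ 2 + x * y + y ^ 2 - 3 * c ^ 2) := by
  simp only [cubic]; ring

theorem cubic_sub_crit (c a z : ℂ) : cubic c a z - cubic c a c = (z - c) ^ 2 * (z + 2 * c) := by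
  simp only [cubic]; ring

theorem cubic_sub_crit' (c a z : ℂ) :
    cubic c a z - cubic c a (-c) = (z + c) ^ 2 * (z - 2 * c) := by
  simp only [cubic]; ring

theorem contDiff_cubic_iterate (n : ℕ) {k : WithTop ℕ∞} :
    ContDiff ℂ k fun q : (ℂ × ℂ) × ℂ => (cubic q.1.1 q.1.2)^[n] q.2 := by
  induction n with
  | zero => simpa using contDiff_snd
  | succ n ih =>
    simp only [iterate_succ_apply', cubic] at ih ⊢
    fun_prop

theorem continuous_cubic_iterate (n : ℕ) :
    Continuous fun q : (ℂ × ℂ) × ℂ => (cubic q.1.1 q.1.2)^[n] q.2 :=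
  (contDiff_cubic_iterate n (k := 0)).continuous

theorem differentiable_iterate_cubic (c a : ℂ) (n : ℕ) : Differentiable ℂ (cubic c a)^[n] := by
  have h := (contDiff_cubic_iterate n (k := 1)).differentiable (by norm_num)
  exact h.comp (f := fun z : ℂ => ((c, a), z)) (by fun_prop)

theorem differentiable_cubic (c a : ℂ) : Differentiable ℂ (cubic c a) :=
  differentiable_iterate_cubic c a 1

theorem continuous_iterate_cubic (c a : ℂ) (n : ℕ) : Continuous (cubic c a)^[n] :=
  (differentiable_iterate_cubic c a n).continuous

theorem hasDerivAt_cubic (c a z : ℂ) : HasDerivAt (cubic c a) (3 * (z ^ 2 - c ^ 2)) z := by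
  have := (((hasDerivAt_id z).pow 3).sub ((hasDerivAt_id z).const_mul (3 * c ^ 2))).add_const a
  refine this.congr_deriv ?_
  simp; ring

/-- The quotient `(f^[n+1] z - f^[n+1] c) / (z - c)^2`. -/
noncomputable def critQuot (n : ℕ) (c a z : ℂ) : ℂ :=
  (z + 2 * c) * ∏ j ∈ Finset.range n,
    (((cubic c a)^[j + 1] z) ^ 2 + ((cubic c a)^[j + 1] z) * ((cubic c a)^[j + 1] c) +
      ((cubic c a)^[j + 1] c) ^ 2 - 3 * c ^ 2)

theorem iterate_sub_iterate_crit (n : ℕ) (c a z : ℂ) :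
    (cubic c a)^[n + 1] z - (cubic c a)^[n + 1] c = (z - c) ^ 2 * critQuot n c a z := by
  induction n with
  | zero => simp [critQuot, cubic_sub_crit]
  | succ n ih =>
    rw [iterate_succ_apply', iterate_succ_apply' _ (n + 1) c, cubic_sub, ih, critQuot, critQuot,
      Finset.prod_range_succ]
    ring

theorem continuous_critQuot (n : ℕ) :
    Continuous fun q : (ℂ × ℂ) × ℂ => critQuot n q.1.1 q.1.2 q.2 := by
  unfold critQuot
  have h1 : ∀ j, Continuous fun q : (ℂ × ℂ) × ℂ => (cubic q.1.1 q.1.2)^[j] q.2 :=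
    continuous_cubic_iterate
  have h2 : ∀ j, Continuous fun q : (ℂ × ℂ) × ℂ => (cubic q.1.1 q.1.2)^[j] q.1.1 := fun j =>
    (continuous_cubic_iterate j).comp (g := fun q : (ℂ × ℂ) × ℂ => (cubic q.1.1 q.1.2)^[j] q.2)
      (f := fun q : (ℂ × ℂ) × ℂ => (q.1, q.1.1)) (by fun_prop)
  fun_prop

/-- Half of the second derivative of `f^[p]` at `c`. -/
noncomputable def critCoeff (p : ℕ) (w : ℂ × ℂ) : ℂ := critQuot (p - 1) w.1 w.2 w.1

theorem continuous_critCoeff (p : ℕ) : Continuous (critCoeff p) :=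
  (continuous_critQuot (p - 1)).comp (f := fun w : ℂ × ℂ => (w, w.1)) (by fun_prop)

theorem iterate_eq_of_mem_Sp {p : ℕ} (hp : 1 ≤ p) {w : ℂ × ℂ} (hw : w ∈ Sp p) (z : ℂ) :
    (cubic w.1 w.2)^[p] z = w.1 + (z - w.1) ^ 2 * critQuot (p - 1) w.1 w.2 z := by
  have h := iterate_sub_iterate_crit (p - 1) w.1 w.2 z
  rw [Nat.sub_add_cancel hp, hw.1] at h
  linear_combination h

/-- Locally uniform quadratic contraction near the periodic critical point. -/
theorem exists_trap {p : ℕ} (w₀ : ℂ × ℂ) : ∃ C : ℝ, 1 ≤ C ∧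
    ∀ᶠ w in 𝓝 w₀, ∀ z, ‖z - w.1‖ ≤ 1 → ‖critQuot (p - 1) w.1 w.2 z‖ ≤ C := by
  have hcomp : IsCompact (closedBall w₀ 1 ×ˢ closedBall (0 : ℂ) (‖w₀.1‖ + 2)) :=
    (isCompact_closedBall _ _).prod (isCompact_closedBall _ _)
  obtain ⟨C, hC⟩ := hcomp.exists_bound_of_continuousOn (continuous_critQuot (p - 1)).continuousOn
  refine ⟨max C 1, le_max_right _ _, ?_⟩
  filter_upwards [closedBall_mem_nhds w₀ one_pos] with w hw z hz
  refine (hC (w, z) ⟨hw, ?_⟩).trans (le_max_left _ _)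
  have h1 : ‖w.1 - w₀.1‖ ≤ 1 := by
    have : ‖(w - w₀).1‖ ≤ ‖w - w₀‖ := norm_fst_le _
    exact this.trans (by simpa [dist_eq_norm] using hw)
  rw [mem_closedBall_zero_iff]
  calc ‖z‖ = ‖(z - w.1) + (w.1 - w₀.1) + w₀.1‖ := by ring_nf
    _ ≤ _ := (norm_add₃_le).trans (by linarith)

end basics

section filled

/-- An escape radius for all cubics with coefficients bounded by `M`. -/
theorem norm_cubic_ge {M : ℝ} {c a z : ℂ} (hc : ‖c‖ ≤ M) (ha : ‖a‖ ≤ M)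
    (hz : 3 * M ^ 2 + M + 2 ≤ ‖z‖) : 2 * ‖z‖ ≤ ‖cubic c a z‖ := by
  have hM : 0 ≤ M := (norm_nonneg c).trans hc
  have h1 : ‖z‖ ^ 3 ≤ ‖cubic c a z‖ + 3 * ‖c‖ ^ 2 * ‖z‖ + ‖a‖ := by
    have : z ^ 3 = cubic c a z + 3 * c ^ 2 * z - a := by rw [cubic]; ring
    rw [← norm_pow, this]
    refine (norm_sub_le _ _).trans ?_
    gcongr
    refine (norm_add_le _ _).trans ?_
    simp
  have h2 : ‖c‖ ^ 2 ≤ M ^ 2 := by gcongr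
  have h3 : 1 ≤ ‖z‖ := by nlinarith
  nlinarith [mul_le_mul_of_nonneg_right h2 (norm_nonneg z), mul_le_mul h3 hz (by positivity) (by positivity), mul_nonneg hM (norm_nonneg z)]

theorem norm_iterate_ge {M : ℝ} {c a z : ℂ} (hc : ‖c‖ ≤ M) (ha : ‖a‖ ≤ M)
    (hz : 3 * M ^ 2 + M + 2 ≤ ‖z‖) (n : ℕ) : 2 ^ n * ‖z‖ ≤ ‖(cubic c a)^[n] z‖ := by
  have hM : 0 ≤ M := (norm_nonneg c).trans hc
  induction n with
  | zero => simp
  | succ n ih =>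
    have h0 : (1 : ℝ) ≤ 2 ^ n := one_le_pow₀ (by norm_num)
    have := norm_cubic_ge hc ha (z := (cubic c a)^[n] z)
      (hz.trans (le_trans (by nlinarith [norm_nonneg z]) ih))
    rw [iterate_succ_apply', pow_succ]
    linarith

theorem tendsto_norm_iterate_atTop {M : ℝ} {c a z : ℂ} (hc : ‖c‖ ≤ M) (ha : ‖a‖ ≤ M)
    (hz : 3 * M ^ 2 + M + 2 ≤ ‖z‖) : Tendsto (fun n => ‖(cubic c a)^[n] z‖) atTop atTop := by
  have hM : 0 ≤ M := (norm_nonneg c).trans hc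
  have : Tendsto (fun n : ℕ => (2 : ℝ) ^ n * ‖z‖) atTop atTop :=
    (tendsto_pow_atTop_atTop_of_one_lt (by norm_num)).atTop_mul_const (by nlinarith)
  exact tendsto_atTop_mono (norm_iterate_ge hc ha hz) this

theorem mem_filledJulia_def {f : ℂ → ℂ} {z : ℂ} :
    z ∈ filledJulia f ↔ Bornology.IsBounded (range fun n => f^[n] z) := Iff.rfl

theorem norm_lt_of_mem_filledJulia {M : ℝ} {c a z : ℂ} (hc : ‖c‖ ≤ M) (ha : ‖a‖ ≤ M)
    (hz : z ∈ filledJulia (cubic c a)) : ‖z‖ < 3 * M ^ 2 + M + 2 := by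
  rw [mem_filledJulia_def] at hz
  by_contra! h
  have h1 := tendsto_norm_iterate_atTop hc ha h
  obtain ⟨B, hB⟩ := hz.exists_norm_le
  obtain ⟨n, hn⟩ := (h1.eventually_gt_atTop B).exists
  exact absurd (hB _ ⟨n, rfl⟩) (not_le.mpr hn)

theorem mem_filledJulia_of_forall {f : ℂ → ℂ} {z : ℂ} {R : ℝ} (h : ∀ n, ‖f^[n] z‖ ≤ R) :
    z ∈ filledJulia f :=
  mem_filledJulia_def.mpr <| isBounded_iff_forall_norm_le.mpr ⟨R, by rintro _ ⟨n, rfl⟩; exact h n⟩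

theorem apply_mem_filledJulia_iff {f : ℂ → ℂ} {z : ℂ} :
    f z ∈ filledJulia f ↔ z ∈ filledJulia f := by
  constructor
  · intro h
    obtain ⟨B, hB⟩ := (mem_filledJulia_def.mp h).exists_norm_le
    refine mem_filledJulia_of_forall (R := max B ‖z‖) fun n => ?_
    cases n with
    | zero => simp
    | succ n => exact (hB _ ⟨n, rfl⟩).trans (le_max_left _ _)
  · intro h
    refine mem_filledJulia_def.mpr ((mem_filledJulia_def.mp h).subset ?_)
    rintro _ ⟨n, rfl⟩
    exact ⟨n + 1, rfl⟩

theorem iterate_mem_filledJulia_iff {f : ℂ → ℂ} {z : ℂ} (n : ℕ) :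
    f^[n] z ∈ filledJulia f ↔ z ∈ filledJulia f := by
  induction n with
  | zero => rfl
  | succ n ih => rw [iterate_succ_apply', apply_mem_filledJulia_iff, ih]

theorem mem_filledJulia_iff {M : ℝ} {c a z : ℂ} (hc : ‖c‖ ≤ M) (ha : ‖a‖ ≤ M) :
    z ∈ filledJulia (cubic c a) ↔ ∀ n, ‖(cubic c a)^[n] z‖ ≤ 3 * M ^ 2 + M + 2 :=
  ⟨fun h n => (norm_lt_of_mem_filledJulia hc ha ((iterate_mem_filledJulia_iff n).mpr h)).le,
    mem_filledJulia_of_forall⟩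

theorem isClosed_filledJulia (c a : ℂ) : IsClosed (filledJulia (cubic c a)) := by
  have : filledJulia (cubic c a) = ⋂ n, {z | ‖(cubic c a)^[n] z‖ ≤
      3 * (max ‖c‖ ‖a‖) ^ 2 + (max ‖c‖ ‖a‖) + 2} := by
    ext z
    rw [mem_filledJulia_iff (le_max_left _ _) (le_max_right _ _)]
    simp
  rw [this]
  exact isClosed_iInter fun n =>
    isClosed_le (continuous_iterate_cubic c a n).norm continuous_const

theorem mem_filledJulia_of_tendsto {c a z z₀ : ℂ} {p : ℕ} (hp : 1 ≤ p)
    (h : Tendsto (fun n => ((cubic c a)^[p])^[n] z) atTop (𝓝 z₀)) :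
    z ∈ filledJulia (cubic c a) := by
  rw [mem_filledJulia_iff (le_max_left ‖c‖ ‖a‖) (le_max_right _ _)]
  by_contra! hcon
  obtain ⟨m, hm⟩ := hcon
  have h1 := tendsto_norm_iterate_atTop (le_max_left ‖c‖ ‖a‖) (le_max_right _ _) hm.le
  have h2 : Tendsto (fun n => p * n - m) atTop atTop :=
    tendsto_atTop_mono (fun n => Nat.sub_le_sub_right (Nat.le_mul_of_pos_left n hp) m)
      (tendsto_sub_atTop_nat m)
  have h3 := h1.comp h2
  have h4 : (fun n => ‖((cubic c a)^[p])^[n] z‖) =ᶠ[atTop]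
      ((fun n => ‖(cubic c a)^[n] ((cubic c a)^[m] z)‖) ∘ fun n => p * n - m) := by
    filter_upwards [eventually_ge_atTop m] with n hn
    have : m ≤ p * n := hn.trans (Nat.le_mul_of_pos_left n hp)
    simp only [comp_apply, ← iterate_add_apply, Nat.sub_add_cancel this, iterate_mul]
  exact not_tendsto_nhds_of_tendsto_atTop (h3.congr' h4.symm) _ h.norm

theorem isOpenMap_cubic (c a : ℂ) : IsOpenMap (cubic c a) := by
  have hA : AnalyticOnNhd ℂ (cubic c a) univ := fun z _ =>
    (differentiable_cubic c a).analyticAt z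
  rcases hA.is_constant_or_isOpen isPreconnected_univ with ⟨v, hv⟩ | h
  · exfalso
    have h1 := hv 0 trivial
    have h2 := hv 1 trivial
    have h3 := hv (-1) trivial
    have h4 := hv 2 trivial
    simp only [cubic] at h1 h2 h3 h4
    have : (6 : ℂ) = 0 := by linear_combination h4 - 2 * h2 + h1 + (h4 - h2 - h2 + h1) * 0 - (h2 + h3 - 2 * h1) * 0
    norm_num at this
  · exact fun s hs => h s (subset_univ _) hs

theorem apply_mem_fatouSet_iff {c a z : ℂ} :
    cubic c a z ∈ fatouSet (cubic c a) ↔ z ∈ fatouSet (cubic c a) := by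
  have h := (isOpenMap_cubic c a).preimage_frontier_eq_frontier_preimage
    (differentiable_cubic c a).continuous (filledJulia (cubic c a))
  have h2 : cubic c a ⁻¹' filledJulia (cubic c a) = filledJulia (cubic c a) := by
    ext z; exact apply_mem_filledJulia_iff
  rw [h2] at h
  simp only [fatouSet, juliaSet, mem_compl_iff, not_iff_not]
  rw [← mem_preimage, h]

theorem isOpen_fatouSet (f : ℂ → ℂ) : IsOpen (fatouSet f) := isClosed_frontier.isOpen_compl

theorem apply_mem_fatouComponent {c a z x : ℂ} (hx : x ∈ fatouComponent (cubic c a) z) :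
    cubic c a x ∈ fatouComponent (cubic c a) (cubic c a z) := by
  have hz : z ∈ fatouSet (cubic c a) := by
    by_contra h; simp [fatouComponent, connectedComponentIn_eq_empty h] at hx
  have h1 : IsPreconnected (cubic c a '' fatouComponent (cubic c a) z) :=
    isPreconnected_connectedComponentIn.image _ (differentiable_cubic c a).continuous.continuousOn
  refine h1.subset_connectedComponentIn (mem_image_of_mem _ (mem_connectedComponentIn hz)) ?_
    (mem_image_of_mem _ hx)
  rintro _ ⟨y, hy, rfl⟩
  exact apply_mem_fatouSet_iff.mpr (connectedComponentIn_subset _ _ hy)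

theorem iterate_mem_fatouComponent {c a z x : ℂ} (hx : x ∈ fatouComponent (cubic c a) z) (n : ℕ) :
    (cubic c a)^[n] x ∈ fatouComponent (cubic c a) ((cubic c a)^[n] z) := by
  induction n with
  | zero => exact hx
  | succ n ih => rw [iterate_succ_apply', iterate_succ_apply']; exact apply_mem_fatouComponent ih

end filled

section vitali

/-- Bounded holomorphic functions on a disc which tend to zero uniformly near the centre
tend to zero on the whole disc. -/
theorem tendsto_zero_of_tendsto_zero_near_center {ι : Type*} {l : Filter ι} {F : ι → ℂ → ℂ}
    {z₀ : ℂ} {r s M : ℝ} (hs : 0 < s)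
    (hd : ∀ i, DifferentiableOn ℂ (F i) (ball z₀ r)) (hM : ∀ i, ∀ z ∈ ball z₀ r, ‖F i z‖ ≤ M)
    (h0 : ∀ ε > 0, ∀ᶠ i in l, ∀ z ∈ ball z₀ s, ‖F i z‖ ≤ ε) {z : ℂ} (hz : z ∈ ball z₀ r) :
    Tendsto (fun i => F i z) l (𝓝 0) := by
  obtain ⟨r', hr1, hr2⟩ := exists_between (mem_ball.mp hz)
  have hr'0 : 0 < r' := dist_nonneg.trans_lt hr1
  have key : ∀ i k, ‖((k.factorial : ℂ)⁻¹ • (z - z₀) ^ k • iteratedDeriv k (F i) z₀)‖ ≤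
      M * (‖z - z₀‖ / r') ^ k := by
    intro i k
    have h1 := Complex.norm_iteratedDeriv_le_of_forall_mem_sphere_norm_le k hr'0
      ((hd i).diffContOnCl_ball (closedBall_subset_ball hr2))
      (fun x hx => hM i x (sphere_subset_closedBall.trans (closedBall_subset_ball hr2) hx))
    have hk : (0 : ℝ) < k.factorial := by exact_mod_cast k.factorial_pos
    rw [norm_smul, norm_smul, norm_inv, norm_pow, Complex.norm_natCast, div_pow]
    calc _ ≤ (k.factorial : ℝ)⁻¹ * (‖z - z₀‖ ^ k * (k.factorial * M / r' ^ k)) := by gcongr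
      _ = _ := by field_simp
  have hsum : ∀ i, HasSum (fun k : ℕ => ((k.factorial : ℂ)⁻¹ • (z - z₀) ^ k • iteratedDeriv k (F i) z₀))
      (F i z) := fun i => Complex.hasSum_taylorSeries_on_ball (hd i) hz
  have hlim : Tendsto (fun i => ∑' k : ℕ, ((k.factorial : ℂ)⁻¹ • (z - z₀) ^ k • iteratedDeriv k (F i) z₀)) l
      (𝓝 (∑' _ : ℕ, 0)) := by
    refine tendsto_tsum_of_dominated_convergence (bound := fun k => M * (‖z - z₀‖ / r') ^ k) ?_ ?_ ?_
    · refine (summable_geometric_of_lt_one (by positivity) ?_).mul_left _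
      rw [div_lt_one hr'0, ← dist_eq_norm]; exact hr1
    · intro k
      have : Tendsto (fun i => iteratedDeriv k (F i) z₀) l (𝓝 0) := by
        rw [NormedAddGroup.tendsto_nhds_zero]
        intro ε hε
        set t := min (s / 2) r' with ht
        have ht0 : 0 < t := lt_min (by linarith) hr'0
        have hts : t < s := (min_le_left _ _).trans_lt (by linarith)
        have htr : t < r := (min_le_right _ _).trans_lt hr2
        have hk : (0 : ℝ) < k.factorial := by exact_mod_cast k.factorial_pos
        filter_upwards [h0 (ε / 2 * t ^ k / k.factorial) (by positivity)] with i hi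
        have h1 := Complex.norm_iteratedDeriv_le_of_forall_mem_sphere_norm_le k ht0
          ((hd i).diffContOnCl_ball (closedBall_subset_ball htr))
          (fun x hx => hi x (sphere_subset_closedBall.trans (closedBall_subset_ball hts) hx))
        have h2 : (k.factorial : ℝ) * (ε / 2 * t ^ k / k.factorial) / t ^ k = ε / 2 := by field_simp
        rw [h2] at h1
        linarith
      simpa using (this.const_smul ((z - z₀) ^ k)).const_smul ((k.factorial : ℂ)⁻¹)
    · exact Eventually.of_forall fun i k => key i k
  rw [tsum_zero] at hlim
  exact hlim.congr fun i => (hsum i).tsum_eq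

end vitali

section fatou
variable {p : ℕ} {w : ℂ × ℂ}

theorem norm_iterate_sub_le_of_trap (hp : 1 ≤ p) (hw : w ∈ Sp p) {C : ℝ} (hC1 : 1 ≤ C)
    (hC : ∀ z, ‖z - w.1‖ ≤ 1 → ‖critQuot (p - 1) w.1 w.2 z‖ ≤ C) {z : ℂ}
    (hz : ‖z - w.1‖ ≤ 1 / (2 * C)) :
    ‖(cubic w.1 w.2)^[p] z - w.1‖ ≤ C * ‖z - w.1‖ ^ 2 ∧
      ‖(cubic w.1 w.2)^[p] z - w.1‖ ≤ ‖z - w.1‖ / 2 := by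
  have h1 : 1 / (2 * C) ≤ 1 := by rw [div_le_one (by linarith)]; linarith
  have h2 := hC z (hz.trans h1)
  have h3 : ‖(cubic w.1 w.2)^[p] z - w.1‖ ≤ C * ‖z - w.1‖ ^ 2 := by
    rw [iterate_eq_of_mem_Sp hp hw, add_sub_cancel_left, norm_mul, norm_pow, mul_comm]
    gcongr
  refine ⟨h3, h3.trans ?_⟩
  rw [le_div_iff₀ (by linarith)] at hz
  nlinarith [norm_nonneg (z - w.1)]

theorem norm_iterate_iterate_sub_le_of_trap (hp : 1 ≤ p) (hw : w ∈ Sp p) {C : ℝ} (hC1 : 1 ≤ C)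
    (hC : ∀ z, ‖z - w.1‖ ≤ 1 → ‖critQuot (p - 1) w.1 w.2 z‖ ≤ C) {z : ℂ}
    (hz : ‖z - w.1‖ ≤ 1 / (2 * C)) (n : ℕ) :
    ‖((cubic w.1 w.2)^[p])^[n] z - w.1‖ ≤ ‖z - w.1‖ / 2 ^ n := by
  induction n with
  | zero => simp
  | succ n ih =>
    have h0 : (1 : ℝ) ≤ 2 ^ n := one_le_pow₀ (by norm_num)
    have h1 := (norm_iterate_sub_le_of_trap hp hw hC1 hC
      (ih.trans ((div_le_self (norm_nonneg _) h0).trans hz))).2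
    rw [iterate_succ_apply', pow_succ]
    refine h1.trans ((div_le_div_of_nonneg_right ih zero_le_two).trans (le_of_eq ?_))
    field_simp

theorem exists_trap_nhds (hp : 1 ≤ p) (hw : w ∈ Sp p) {i : ℕ} (hi : i ≤ p) :
    ∃ V : Set ℂ, IsOpen V ∧ (cubic w.1 w.2)^[i] w.1 ∈ V ∧ ∀ ε > 0, ∃ N, ∀ n ≥ N, ∀ z ∈ V,
      ‖((cubic w.1 w.2)^[p])^[n] z - (cubic w.1 w.2)^[i] w.1‖ ≤ ε := by
  obtain ⟨C, hC1, hC⟩ := exists_trap (p := p) w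
  have hC := hC.self_of_nhds
  have hC0 : 0 < C := by linarith
  refine ⟨(cubic w.1 w.2)^[p - i] ⁻¹' ball w.1 (1 / (2 * C)),
    isOpen_ball.preimage (continuous_iterate_cubic _ _ _), ?_, ?_⟩
  · rw [mem_preimage, ← iterate_add_apply, Nat.sub_add_cancel hi, hw.1]
    exact mem_ball_self (by positivity)
  · intro ε hε
    have hcont := (continuous_iterate_cubic w.1 w.2 i).continuousAt (x := w.1)
    obtain ⟨δ, hδ, hδε⟩ := Metric.continuousAt_iff.mp hcont ε hε
    obtain ⟨N, hN⟩ := exists_pow_lt_of_lt_one hδ (y := (1 / 2 : ℝ)) (by norm_num)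
    refine ⟨N + 1, fun n hn z hz => ?_⟩
    obtain ⟨m, rfl⟩ : ∃ m, n = m + 1 := ⟨n - 1, by omega⟩
    have hz' : ‖(cubic w.1 w.2)^[p - i] z - w.1‖ ≤ 1 / (2 * C) := by
      rw [← dist_eq_norm]; exact (mem_ball.mp hz).le
    have h1 := norm_iterate_iterate_sub_le_of_trap hp hw hC1 hC hz' m
    have h2 : ((cubic w.1 w.2)^[p])^[m + 1] z =
        (cubic w.1 w.2)^[i] (((cubic w.1 w.2)^[p])^[m] ((cubic w.1 w.2)^[p - i] z)) := by
      rw [← iterate_mul, ← iterate_mul, ← iterate_add_apply, ← iterate_add_apply]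
      congr 2; rw [mul_add, mul_one]; omega
    rw [h2, ← dist_eq_norm]
    refine (hδε ?_).le
    rw [dist_eq_norm]
    refine h1.trans_lt (lt_of_le_of_lt ?_ hN)
    have h3 : 1 / (2 * C) ≤ 1 := by rw [div_le_one (by linarith)]; linarith
    rw [div_pow, one_pow]
    gcongr
    · exact hz'.trans h3
    · norm_num
    · omega

theorem tendsto_iterate_of_mem_fatouComponent (hp : 1 ≤ p) (hw : w ∈ Sp p) {i : ℕ} (hi : i ≤ p)
    {z : ℂ} (hz : z ∈ fatouComponent (cubic w.1 w.2) ((cubic w.1 w.2)^[i] w.1)) :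
    Tendsto (fun n => ((cubic w.1 w.2)^[p])^[n] z) atTop (𝓝 ((cubic w.1 w.2)^[i] w.1)) := by
  set f := cubic w.1 w.2 with hf
  set z₀ := f^[i] w.1 with hz₀
  obtain ⟨V, hVo, hzV, hV⟩ := exists_trap_nhds hp hw hi
  set B : Set ℂ := {z | Tendsto (fun n => (f^[p])^[n] z) atTop (𝓝 z₀)} with hB
  have hBdef : ∀ z, z ∈ B ↔ Tendsto (fun n => (f^[p])^[n] z) atTop (𝓝 z₀) := fun z => Iff.rfl
  have hgc : ∀ n, Differentiable ℂ ((f^[p])^[n]) := fun n => by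
    rw [← iterate_mul]; exact differentiable_iterate_cubic _ _ _
  have hBiff : ∀ z, z ∈ B ↔ ∃ n, (f^[p])^[n] z ∈ V := by
    intro z
    constructor
    · intro h
      exact (Tendsto.eventually h (hVo.mem_nhds hzV)).exists
    · rintro ⟨n, hn⟩
      rw [hBdef, ← tendsto_add_atTop_iff_nat n, Metric.tendsto_atTop]
      intro ε hε
      obtain ⟨N, hN⟩ := hV (ε / 2) (by linarith)
      refine ⟨N, fun m hm => ?_⟩
      rw [iterate_add_apply, dist_eq_norm]
      exact (hN m hm _ hn).trans_lt (by linarith)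
  have hBo : IsOpen B := by
    have : B = ⋃ n, (f^[p])^[n] ⁻¹' V := by ext z; rw [hBiff]; simp
    rw [this]
    exact isOpen_iUnion fun n => hVo.preimage (hgc n).continuous
  have hBK : B ⊆ filledJulia f := fun z hz => mem_filledJulia_of_tendsto hp hz
  have hz₀B : z₀ ∈ B := (hBiff _).mpr ⟨0, hzV⟩
  have hBF : B ⊆ fatouSet f := by
    intro z hz hzJ
    exact (disjoint_interior_frontier (s := filledJulia f)).le_bot
      ⟨(interior_maximal hBK hBo) hz, hzJ⟩
  refine (isPreconnected_connectedComponentIn (F := fatouSet f) (x := z₀)).subset_of_closure_inter_subset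
    hBo ⟨z₀, mem_connectedComponentIn (hBF hz₀B), hz₀B⟩ ?_ hz
  rintro x ⟨hxB, hxU⟩
  have hxF := connectedComponentIn_subset _ _ hxU
  have hxK : x ∈ filledJulia f := closure_minimal hBK (isClosed_filledJulia _ _) hxB
  have hxI : x ∈ interior (filledJulia f) := by
    by_contra h
    exact hxF ⟨subset_closure hxK, h⟩
  obtain ⟨r, hr, hrK⟩ := Metric.isOpen_iff.mp isOpen_interior x hxI
  obtain ⟨y, hyB, hxy⟩ := Metric.mem_closure_iff.mp hxB (r / 2) (by linarith)
  have hyr : ball y (r / 2) ⊆ filledJulia f := by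
    refine Subset.trans ?_ (hrK.trans interior_subset)
    refine ball_subset_ball' ?_
    rw [dist_comm]; linarith
  obtain ⟨N, hN⟩ := (hBiff y).mp hyB
  obtain ⟨s, hs, hsV⟩ := Metric.isOpen_iff.mp (hVo.preimage (hgc N).continuous) y hN
  have := tendsto_zero_of_tendsto_zero_near_center (l := atTop)
    (F := fun n z => (f^[p])^[n] z - z₀) (z₀ := y) (r := r / 2) (s := s)
    (M := 3 * (max ‖w.1‖ ‖w.2‖) ^ 2 + (max ‖w.1‖ ‖w.2‖) + 2 + ‖z₀‖) hs
    (fun n => ((hgc n).sub_const _).differentiableOn)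
    (fun n z hz => by
      refine (norm_sub_le _ _).trans (add_le_add_left ?_ _)
      rw [← iterate_mul]
      exact (mem_filledJulia_iff (le_max_left _ _) (le_max_right _ _)).mp (hyr hz) _)
    (fun ε hε => by
      obtain ⟨M, hM⟩ := hV ε hε
      filter_upwards [eventually_ge_atTop (M + N)] with n hn z hz
      have h1 := hM (n - N) (by omega) _ (hsV hz)
      rwa [← iterate_add_apply, Nat.sub_add_cancel (by omega)] at h1)
    (z := x) hxy
  have h2 := this.add_const z₀
  rw [hBdef]
  simpa using h2

theorem iterate_mem_fatouSet (hp : 1 ≤ p) (hw : w ∈ Sp p) {i : ℕ} (hi : i ≤ p) :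
    (cubic w.1 w.2)^[i] w.1 ∈ fatouSet (cubic w.1 w.2) := by
  obtain ⟨V, hVo, hzV, hV⟩ := exists_trap_nhds hp hw hi
  intro hJ
  have hVK : V ⊆ filledJulia (cubic w.1 w.2) := fun z hz =>
    mem_filledJulia_of_tendsto hp (z₀ := (cubic w.1 w.2)^[i] w.1) (by
      rw [Metric.tendsto_atTop]
      intro ε hε
      obtain ⟨N, hN⟩ := hV (ε / 2) (by linarith)
      refine ⟨N, fun m hm => ?_⟩
      rw [dist_eq_norm]
      exact (hN m hm _ hz).trans_lt (by linarith))
  exact (disjoint_interior_frontier (s := filledJulia (cubic w.1 w.2))).le_bot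
      ⟨(interior_maximal hVK hVo) hzV, hJ⟩

theorem iterate_crit_injOn (hw : w ∈ Sp p) {i j : ℕ} (hi : i < p) (hj : j < p)
    (h : (cubic w.1 w.2)^[i] w.1 = (cubic w.1 w.2)^[j] w.1) : i = j := by
  wlog hij : i < j generalizing i j
  · rcases lt_trichotomy i j with h1 | h1 | h1
    · exact this hi hj h h1
    · exact h1
    · exact (this hj hi h.symm h1).symm
  exfalso
  have h1 := congrArg ((cubic w.1 w.2)^[p - j]) h
  rw [← iterate_add_apply, ← iterate_add_apply, Nat.sub_add_cancel hj.le, hw.1] at h1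
  exact hw.2 (p - j + i) (by omega) (by omega) h1

theorem fatouComponent_index_unique (hp : 1 ≤ p) (hw : w ∈ Sp p) {i j : ℕ} (hi : i < p)
    (hj : j < p) {z : ℂ} (h1 : z ∈ fatouComponent (cubic w.1 w.2) ((cubic w.1 w.2)^[i] w.1))
    (h2 : z ∈ fatouComponent (cubic w.1 w.2) ((cubic w.1 w.2)^[j] w.1)) : i = j :=
  iterate_crit_injOn hw hi hj (tendsto_nhds_unique
    (tendsto_iterate_of_mem_fatouComponent hp hw hi.le h1)
    (tendsto_iterate_of_mem_fatouComponent hp hw hj.le h2))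

end fatou

section inverse

theorem exists_local_inverse {E F : Type*} [NormedAddCommGroup E] [NormedSpace ℂ E]
    [NormedAddCommGroup F] [NormedSpace ℂ F] [CompleteSpace E] {G : E → F} {G' : E ≃L[ℂ] F} {a : E}
    (hG : ContDiffAt ℂ 1 G a) (hG' : HasFDerivAt G (G' : E →L[ℂ] F) a) {U : Set E} (hU : U ∈ 𝓝 a) :
    ∃ r > 0, ∃ ψ : F → E, DifferentiableOn ℂ ψ (ball (G a) r) ∧ ψ (G a) = a ∧
      (∀ y ∈ ball (G a) r, ψ y ∈ U ∧ G (ψ y) = y) ∧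
      ∃ V ⊆ U, IsOpen V ∧ a ∈ V ∧ ∀ x ∈ V, G x ∈ ball (G a) r ∧ ψ (G x) = x := by
  have hs := hG.hasStrictFDerivAt' hG' one_ne_zero
  set ψ := hG.localInverse hG' one_ne_zero with hψ
  have h1 : ContDiffAt ℂ 1 ψ (G a) := hG.to_localInverse hG' one_ne_zero
  have h2 : ψ (G a) = a := hG.localInverse_apply_image hG' one_ne_zero
  have h3 : ∀ᶠ y in 𝓝 (G a), DifferentiableAt ℂ ψ y :=
    (h1.eventually (by simp)).mono fun y hy => hy.differentiableAt one_ne_zero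
  have h4 : ∀ᶠ y in 𝓝 (G a), ψ y ∈ U := h1.continuousAt.eventually_mem (by rwa [h2])
  have h5 : ∀ᶠ y in 𝓝 (G a), G (ψ y) = y := hs.eventually_right_inverse
  obtain ⟨r, hr, hball⟩ := Metric.eventually_nhds_iff_ball.mp (h3.and (h4.and h5))
  refine ⟨r, hr, ψ, fun y hy => (hball y hy).1.differentiableWithinAt, h2,
    fun y hy => (hball y hy).2, ?_⟩
  have h6 : ∀ᶠ x in 𝓝 a, ψ (G x) = x := hs.eventually_left_inverse
  have h7 : ∀ᶠ x in 𝓝 a, G x ∈ ball (G a) r :=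
    hG.continuousAt.eventually_mem (ball_mem_nhds _ hr)
  obtain ⟨V, hV, hVo, haV⟩ := _root_.eventually_nhds_iff.mp (h7.and (h6.and (eventually_mem_set.mpr hU)))
  exact ⟨V, fun x hx => (hV x hx).2.2, hVo, haV, fun x hx => ⟨(hV x hx).1, (hV x hx).2.1⟩⟩

theorem exists_local_inverse_complex {G : ℂ → ℂ} {a : ℂ} (hG : AnalyticAt ℂ G a)
    (hG' : deriv G a ≠ 0) {U : Set ℂ} (hU : U ∈ 𝓝 a) :
    ∃ r > 0, ∃ ψ : ℂ → ℂ, DifferentiableOn ℂ ψ (ball (G a) r) ∧ ψ (G a) = a ∧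
      (∀ y ∈ ball (G a) r, ψ y ∈ U ∧ G (ψ y) = y) ∧
      ∃ V ⊆ U, IsOpen V ∧ a ∈ V ∧ ∀ x ∈ V, G x ∈ ball (G a) r ∧ ψ (G x) = x :=
  exists_local_inverse (G' := .unitsEquivAut ℂ (.mk0 _ hG')) hG.contDiffAt
    hG.differentiableAt.hasDerivAt.hasFDerivAt hU

end inverse

section bottcher

/-- A local Böttcher coordinate at a superattracting fixed point of local degree `d`. -/
theorem exists_local_bottcher {G u : ℂ → ℂ} {z₀ : ℂ} {d : ℕ} (hd : 2 ≤ d)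
    (hu : Differentiable ℂ u) (hu0 : u z₀ ≠ 0) (hG : ∀ z, G z = z₀ + (z - z₀) ^ d * u z) :
    ∃ δ > 0, ∃ B : ℂ → ℂ, DifferentiableOn ℂ B (ball z₀ δ) ∧ B z₀ = 0 ∧ deriv B z₀ ≠ 0 ∧
      MapsTo G (ball z₀ δ) (ball z₀ δ) ∧ ∀ z ∈ ball z₀ δ, B (G z) = B z ^ d := by
  have hcu : ContinuousAt u z₀ := hu.continuous.continuousAt
  have h1 : ∀ᶠ z in 𝓝 z₀, u z ≠ 0 := hcu.eventually_ne hu0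
  have h2 : ∀ᶠ z in 𝓝 z₀, ‖u z‖ ≤ ‖u z₀‖ + 1 :=
    hcu.norm.eventually_le_const (by linarith)
  obtain ⟨r, hr, hball⟩ := Metric.eventually_nhds_iff_ball.mp (h1.and h2)
  obtain ⟨L, hL, hLu⟩ := (convex_ball z₀ r).exists_differentiableOn_log isOpen_ball
    hu.differentiableOn (fun x hx => (hball x hx).1)
  have hLc : ContinuousAt L z₀ := (hL.differentiableAt (ball_mem_nhds _ hr)).continuousAt
  have h3 : ∀ᶠ z in 𝓝 z₀, ‖L z‖ ≤ ‖L z₀‖ + 1 := hLc.norm.eventually_le_const (by linarith)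
  obtain ⟨r', hr', hball'⟩ := Metric.eventually_nhds_iff_ball.mp h3
  set Cu := ‖u z₀‖ + 1 with hCu
  have hCu0 : 0 < Cu := by positivity
  set δ := min (min r r') (min 1 (1 / (2 * Cu))) with hδ
  have hδ0 : 0 < δ := by simp only [hδ, lt_min_iff]; exact ⟨⟨hr, hr'⟩, one_pos, by positivity⟩
  have hδr : ball z₀ δ ⊆ ball z₀ r := ball_subset_ball ((min_le_left _ _).trans (min_le_left _ _))
  have hδr' : ball z₀ δ ⊆ ball z₀ r' :=
    ball_subset_ball ((min_le_left _ _).trans (min_le_right _ _))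
  have hδ1 : δ ≤ 1 := (min_le_right _ _).trans (min_le_left _ _)
  have hδ2 : δ ≤ 1 / (2 * Cu) := (min_le_right _ _).trans (min_le_right _ _)
  have hmaps : MapsTo G (ball z₀ δ) (ball z₀ δ) := by
    intro z hz
    have hzu := (hball z (hδr hz)).2
    rw [mem_ball, dist_eq_norm] at hz ⊢
    rw [hG, add_sub_cancel_left, norm_mul, norm_pow]
    have hz1 : ‖z - z₀‖ ≤ 1 := (hz.trans_le hδ1).le
    have h4 : ‖z - z₀‖ ^ d ≤ ‖z - z₀‖ ^ 2 := pow_le_pow_of_le_one (norm_nonneg _) hz1 hd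
    have h5 : ‖z - z₀‖ * (2 * Cu) ≤ 1 := by
      rw [le_div_iff₀ (by positivity)] at hδ2
      nlinarith
    calc ‖z - z₀‖ ^ d * ‖u z‖ ≤ ‖z - z₀‖ ^ 2 * Cu := by gcongr
      _ ≤ ‖z - z₀‖ := by nlinarith [norm_nonneg (z - z₀)]
      _ < δ := hz
  have hGd : Differentiable ℂ G := by
    have : G = fun z => z₀ + (z - z₀) ^ d * u z := funext hG
    rw [this]
    exact (((differentiable_id.sub_const _).pow _).mul hu).const_add _
  have hit : ∀ n, MapsTo G^[n] (ball z₀ δ) (ball z₀ δ) := fun n => hmaps.iterate n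
  have hdR : (2 : ℝ) ≤ d := by exact_mod_cast hd
  have hdC : (d : ℂ) ≠ 0 := by
    have : d ≠ 0 := by omega
    exact_mod_cast this
  set S : ℂ → ℂ := fun z => ∑' n : ℕ, ((d : ℂ)⁻¹) ^ (n + 1) * L (G^[n] z) with hS
  have hsumm : Summable fun n : ℕ => ((d : ℝ)⁻¹) ^ (n + 1) * (‖L z₀‖ + 1) := by
    refine Summable.mul_right _ ?_
    refine (summable_nat_add_iff 1).mpr (summable_geometric_of_lt_one (by positivity) ?_)
    exact inv_lt_one_of_one_lt₀ (by linarith)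
  have hbd : ∀ (n : ℕ), ∀ z ∈ ball z₀ δ,
      ‖((d : ℂ)⁻¹) ^ (n + 1) * L (G^[n] z)‖ ≤ ((d : ℝ)⁻¹) ^ (n + 1) * (‖L z₀‖ + 1) := by
    intro n z hz
    rw [norm_mul, norm_pow, norm_inv, Complex.norm_natCast]
    gcongr
    exact hball' _ (hδr' (hit n hz))
  have hSd : DifferentiableOn ℂ S (ball z₀ δ) := by
    refine Complex.differentiableOn_tsum_of_summable_norm hsumm (fun n => ?_) isOpen_ball hbd
    refine DifferentiableOn.const_mul ?_ _
    exact hL.comp (hGd.iterate n).differentiableOn (fun z hz => hδr (hit n hz))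
  have hSG : ∀ z ∈ ball z₀ δ, L z + S (G z) = d * S z := by
    intro z hz
    have hs : Summable fun n : ℕ => ((d : ℂ)⁻¹) ^ (n + 1) * L (G^[n] z) :=
      Summable.of_norm_bounded hsumm (fun n => hbd n z hz)
    simp only [hS]
    rw [hs.tsum_eq_zero_add, mul_add, ← tsum_mul_left]
    congr 1
    · simp [hdC]
    · refine tsum_congr fun n => ?_
      rw [iterate_succ_apply, pow_succ _ (n + 1)]
      field_simp
  refine ⟨δ, hδ0, fun z => (z - z₀) * Complex.exp (S z), ?_, by simp, ?_, hmaps, fun z hz => ?_⟩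
  · exact (differentiableOn_id.sub_const _).mul hSd.cexp
  · have hSz : DifferentiableAt ℂ S z₀ := hSd.differentiableAt (ball_mem_nhds _ hδ0)
    have := ((hasDerivAt_id z₀).sub_const z₀).mul hSz.hasDerivAt.cexp
    have h6 : deriv (fun z => (z - z₀) * Complex.exp (S z)) z₀ = Complex.exp (S z₀) := by
      refine (HasDerivAt.congr_deriv this ?_).deriv
      simp
    rw [h6]; exact Complex.exp_ne_zero _
  · simp only
    rw [mul_pow, ← Complex.exp_nat_mul, ← hSG z hz, Complex.exp_add, hLu z (hδr hz), hG z]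
    ring

end bottcher

section lin
variable {p : ℕ} {w : ℂ × ℂ}

theorem contDiff_critQuot (n : ℕ) {k : WithTop ℕ∞} :
    ContDiff ℂ k fun q : (ℂ × ℂ) × ℂ => critQuot n q.1.1 q.1.2 q.2 := by
  unfold critQuot
  have h1 : ∀ j, ContDiff ℂ k fun q : (ℂ × ℂ) × ℂ => (cubic q.1.1 q.1.2)^[j] q.2 := fun j =>
    contDiff_cubic_iterate j
  have h2 : ∀ j, ContDiff ℂ k fun q : (ℂ × ℂ) × ℂ => (cubic q.1.1 q.1.2)^[j] q.1.1 := fun j =>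
    (contDiff_cubic_iterate j).comp (g := fun q : (ℂ × ℂ) × ℂ => (cubic q.1.1 q.1.2)^[j] q.2)
      (f := fun q : (ℂ × ℂ) × ℂ => (q.1, q.1.1)) (by fun_prop)
  fun_prop

theorem contDiff_critQuot_right (n : ℕ) (c a : ℂ) {k : WithTop ℕ∞} :
    ContDiff ℂ k (critQuot n c a) :=
  (contDiff_critQuot n).comp (f := fun z : ℂ => ((c, a), z)) (by fun_prop)

/-- `ψ` conjugates squaring on the disc of radius `ρ` to `f^[p]` near the critical point. -/
structure IsLin (p : ℕ) (w : ℂ × ℂ) (ρ : ℝ) (ψ : ℂ → ℂ) : Prop where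
  pos : 0 < ρ
  le_one : ρ ≤ 1
  diff : DifferentiableOn ℂ ψ (ball 0 ρ)
  zero : ψ 0 = w.1
  deriv_ne : deriv ψ 0 ≠ 0
  conj : ∀ ζ ∈ ball (0 : ℂ) ρ, (cubic w.1 w.2)^[p] (ψ ζ) = ψ (ζ ^ 2)

theorem pow_mem_ball_zero {ρ : ℝ} (hρ : ρ ≤ 1) {ζ : ℂ} (hζ : ζ ∈ ball (0 : ℂ) ρ) {n : ℕ} (hn : n ≠ 0) :
    ζ ^ n ∈ ball (0 : ℂ) ρ := by
  rw [mem_ball_zero_iff] at hζ ⊢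
  rw [norm_pow]
  exact (pow_le_of_le_one (norm_nonneg _) (hζ.le.trans hρ) hn).trans_lt hζ

theorem tendsto_pow_two_pow {ζ : ℂ} (hζ : ‖ζ‖ < 1) :
    Tendsto (fun n : ℕ => ζ ^ 2 ^ n) atTop (𝓝 0) :=
  (tendsto_pow_atTop_nhds_zero_of_norm_lt_one hζ).comp
    (tendsto_pow_atTop_atTop_of_one_lt one_lt_two)

theorem eq_add_mul_dslope_zero (ψ : ℂ → ℂ) (ζ : ℂ) : ψ ζ = ψ 0 + ζ * dslope ψ 0 ζ := by
  have := sub_smul_dslope ψ 0 ζ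
  rw [sub_zero, smul_eq_mul] at this
  rw [this]; ring

theorem eventually_norm_dslope_sub_le {ψ₁ ψ₂ : ℂ → ℂ} (h₁ : DifferentiableAt ℂ ψ₁ 0)
    (h₁0 : ψ₁ 0 = w.1) (h₂ : DifferentiableAt ℂ ψ₂ 0) (h₂0 : ψ₂ 0 = w.1)
    (hc1 : ContinuousAt (dslope ψ₁ 0) 0) (hc2 : ContinuousAt (dslope ψ₂ 0) 0)
    (hd1 : critCoeff p w * deriv ψ₁ 0 = 1) (hd2 : critCoeff p w * deriv ψ₂ 0 = 1) :
    ∀ᶠ ζ in 𝓝 (0 : ℂ), 3 / 2 * ‖dslope ψ₁ 0 ζ - dslope ψ₂ 0 ζ‖ ≤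
      ‖dslope ψ₁ 0 ζ ^ 2 * critQuot (p - 1) w.1 w.2 (ψ₁ ζ) -
        dslope ψ₂ 0 ζ ^ 2 * critQuot (p - 1) w.1 w.2 (ψ₂ ζ)‖ := by
  set U := critQuot (p - 1) w.1 w.2 with hU
  set q₁ := dslope ψ₁ 0 with hq₁
  set q₂ := dslope ψ₂ 0 with hq₂
  have hUc : ContinuousAt U (ψ₁ 0) :=
    (contDiff_critQuot_right _ _ _ (k := 0)).continuous.continuousAt
  have hq10 : q₁ 0 = deriv ψ₁ 0 := dslope_same _ _
  have hq20 : q₂ 0 = deriv ψ₂ 0 := dslope_same _ _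
  obtain ⟨K, t, ht, hK⟩ := (contDiff_critQuot_right (p - 1) w.1 w.2 (k := 1)).contDiffAt
    (x := w.1) |>.exists_lipschitzOnWith
  set b := ‖q₂ 0‖ ^ 2 + 1 with hb
  have hb0 : 0 < b := by positivity
  have e1 : ∀ᶠ ζ in 𝓝 (0 : ℂ), ‖(q₁ ζ + q₂ ζ) * U (ψ₁ ζ)‖ > 7 / 4 := by
    have : ContinuousAt (fun ζ => ‖(q₁ ζ + q₂ ζ) * U (ψ₁ ζ)‖) 0 :=
      ((hc1.add hc2).mul (hUc.comp h₁.continuousAt)).norm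
    refine this.eventually_const_lt ?_
    have h4 : (q₁ 0 + q₂ 0) * U (ψ₁ 0) = 2 := by
      rw [h₁0, hq10, hq20]
      rw [critCoeff] at hd1 hd2
      linear_combination hd1 + hd2
    simp only [h4]; norm_num
  have e2 : ∀ᶠ ζ in 𝓝 (0 : ℂ), ‖q₂ ζ‖ ^ 2 ≤ b := by
    have : ContinuousAt (fun ζ => ‖q₂ ζ‖ ^ 2) 0 := hc2.norm.pow 2
    exact this.eventually_le_const (by linarith)
  have e3 : ∀ᶠ ζ in 𝓝 (0 : ℂ), ψ₁ ζ ∈ t := h₁.continuousAt.eventually_mem (by rwa [h₁0])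
  have e4 : ∀ᶠ ζ in 𝓝 (0 : ℂ), ψ₂ ζ ∈ t := h₂.continuousAt.eventually_mem (by rwa [h₂0])
  have e5 : ∀ᶠ ζ in 𝓝 (0 : ℂ), b * K * ‖ζ‖ < 1 / 4 := by
    have : ContinuousAt (fun ζ : ℂ => b * K * ‖ζ‖) 0 := by fun_prop
    exact this.eventually_lt_const (by simp)
  filter_upwards [e1, e2, e3, e4, e5] with ζ a1 a2 a3 a4 a5
  have i3 : q₁ ζ ^ 2 * U (ψ₁ ζ) - q₂ ζ ^ 2 * U (ψ₂ ζ) = (q₁ ζ - q₂ ζ) * ((q₁ ζ + q₂ ζ) * U (ψ₁ ζ)) -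
      - (q₂ ζ ^ 2 * (U (ψ₁ ζ) - U (ψ₂ ζ))) := by
    ring
  have i4 : ‖U (ψ₁ ζ) - U (ψ₂ ζ)‖ ≤ K * (‖ζ‖ * ‖q₁ ζ - q₂ ζ‖) := by
    have := hK.dist_le_mul _ a3 _ a4
    rw [dist_eq_norm, dist_eq_norm] at this
    refine this.trans_eq ?_
    rw [eq_add_mul_dslope_zero ψ₁ ζ, eq_add_mul_dslope_zero ψ₂ ζ, ← norm_mul, h₁0, h₂0]
    congr 2
    ring
  have i5 : ‖-(q₂ ζ ^ 2 * (U (ψ₁ ζ) - U (ψ₂ ζ)))‖ ≤ 1 / 4 * ‖q₁ ζ - q₂ ζ‖ := by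
    rw [norm_neg, norm_mul, norm_pow]
    calc ‖q₂ ζ‖ ^ 2 * ‖U (ψ₁ ζ) - U (ψ₂ ζ)‖ ≤ b * (K * (‖ζ‖ * ‖q₁ ζ - q₂ ζ‖)) := by gcongr
      _ = (b * K * ‖ζ‖) * ‖q₁ ζ - q₂ ζ‖ := by ring
      _ ≤ 1 / 4 * ‖q₁ ζ - q₂ ζ‖ := by gcongr
  rw [i3]
  refine le_trans ?_ (norm_sub_norm_le _ _)
  rw [norm_mul]
  nlinarith [norm_nonneg (q₁ ζ - q₂ ζ)]

theorem iterate_mem_fatouSet_iff {c a z : ℂ} (m : ℕ) :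
    (cubic c a)^[m] z ∈ fatouSet (cubic c a) ↔ z ∈ fatouSet (cubic c a) := by
  induction m with
  | zero => rfl
  | succ m ih => rw [iterate_succ_apply', apply_mem_fatouSet_iff, ih]

namespace IsLin
variable {ρ : ℝ} {ψ : ℂ → ℂ} (h : IsLin p w ρ ψ)
include h

theorem zero_mem : (0 : ℂ) ∈ ball (0 : ℂ) ρ := mem_ball_self h.pos

theorem mono {ρ' : ℝ} (h0 : 0 < ρ') (hρ : ρ' ≤ ρ) : IsLin p w ρ' ψ :=
  ⟨h0, hρ.trans h.le_one, h.diff.mono (ball_subset_ball hρ), h.zero, h.deriv_ne,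
    fun ζ hζ => h.conj ζ (ball_subset_ball hρ hζ)⟩

theorem iterate (n : ℕ) {ζ : ℂ} (hζ : ζ ∈ ball (0 : ℂ) ρ) :
    ((cubic w.1 w.2)^[p])^[n] (ψ ζ) = ψ (ζ ^ 2 ^ n) := by
  induction n with
  | zero => simp
  | succ n ih =>
    rw [iterate_succ_apply', ih, h.conj _ (pow_mem_ball_zero h.le_one hζ (by positivity)), ← pow_mul,
      pow_succ]

theorem continuousAt_zero : ContinuousAt ψ 0 :=
  (h.diff.differentiableAt (ball_mem_nhds _ h.pos)).continuousAt

theorem tendsto_iterate {ζ : ℂ} (hζ : ζ ∈ ball (0 : ℂ) ρ) :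
    Tendsto (fun n => ((cubic w.1 w.2)^[p])^[n] (ψ ζ)) atTop (𝓝 w.1) := by
  simp only [h.iterate _ hζ]
  have h1 := h.continuousAt_zero.tendsto
  rw [h.zero] at h1
  exact h1.comp (tendsto_pow_two_pow ((mem_ball_zero_iff.mp hζ).trans_le h.le_one))

theorem mem_filledJulia (hp : 1 ≤ p) {ζ : ℂ} (hζ : ζ ∈ ball (0 : ℂ) ρ) :
    ψ ζ ∈ filledJulia (cubic w.1 w.2) :=
  mem_filledJulia_of_tendsto hp (h.tendsto_iterate hζ)

theorem mem_fatouComponent (hp : 1 ≤ p) (hw : w ∈ Sp p) {ζ : ℂ} (hζ : ζ ∈ ball (0 : ℂ) ρ) :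
    ψ ζ ∈ fatouComponent (cubic w.1 w.2) w.1 := by
  have hfat : ψ '' ball 0 ρ ⊆ fatouSet (cubic w.1 w.2) := by
    rintro _ ⟨ξ, hξ, rfl⟩
    have h1 := (h.tendsto_iterate hξ).eventually_mem
      ((isOpen_fatouSet _).mem_nhds (iterate_mem_fatouSet hp hw (Nat.zero_le p)))
    obtain ⟨n, hn⟩ := h1.exists
    rw [← iterate_mul] at hn
    exact (iterate_mem_fatouSet_iff _).mp hn
  have hpre : IsPreconnected (ψ '' ball 0 ρ) :=
    (convex_ball (0 : ℂ) ρ).isPreconnected.image _ h.diff.continuousOn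
  have h0 : w.1 ∈ ψ '' ball 0 ρ := ⟨0, h.zero_mem, h.zero⟩
  exact hpre.subset_connectedComponentIn h0 hfat (mem_image_of_mem _ hζ)

theorem differentiableOn_dslope : DifferentiableOn ℂ (dslope ψ 0) (ball 0 ρ) :=
  (Complex.differentiableOn_dslope (ball_mem_nhds _ h.pos)).mpr h.diff

theorem eq_add_mul_dslope (ζ : ℂ) : ψ ζ = w.1 + ζ * dslope ψ 0 ζ := by
  have := sub_smul_dslope ψ 0 ζ
  rw [h.zero, sub_zero, smul_eq_mul] at this
  rw [this]; ring

theorem dslope_sq (hp : 1 ≤ p) (hw : w ∈ Sp p) {ζ : ℂ} (hζ : ζ ∈ ball (0 : ℂ) ρ) (h0 : ζ ≠ 0) :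
    dslope ψ 0 (ζ ^ 2) = dslope ψ 0 ζ ^ 2 * critQuot (p - 1) w.1 w.2 (ψ ζ) := by
  have h1 := h.conj ζ hζ
  rw [iterate_eq_of_mem_Sp hp hw, h.eq_add_mul_dslope (ζ ^ 2)] at h1
  have h2 : ψ ζ - w.1 = ζ * dslope ψ 0 ζ := by rw [h.eq_add_mul_dslope ζ]; ring
  rw [h2] at h1
  have h3 : ζ ^ 2 ≠ 0 := pow_ne_zero _ h0
  refine mul_left_cancel₀ h3 ?_
  linear_combination -h1

theorem critCoeff_mul_deriv (hp : 1 ≤ p) (hw : w ∈ Sp p) : critCoeff p w * deriv ψ 0 = 1 := by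
  have hc : ContinuousAt (dslope ψ 0) 0 :=
    (h.differentiableOn_dslope.differentiableAt (ball_mem_nhds _ h.pos)).continuousAt
  have hq : Continuous (critQuot (p - 1) w.1 w.2) := (contDiff_critQuot_right _ _ _ (k := 0)).continuous
  have h1 : Tendsto (fun ζ => dslope ψ 0 (ζ ^ 2)) (𝓝[≠] 0) (𝓝 (dslope ψ 0 0)) := by
    refine hc.tendsto.comp (tendsto_nhdsWithin_of_tendsto_nhds ?_)
    exact (continuous_pow 2).tendsto' 0 0 (by simp)
  have h2 : Tendsto (fun ζ => dslope ψ 0 ζ ^ 2 * critQuot (p - 1) w.1 w.2 (ψ ζ)) (𝓝[≠] 0)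
      (𝓝 (dslope ψ 0 0 ^ 2 * critQuot (p - 1) w.1 w.2 (ψ 0))) :=
    ((hc.tendsto.pow 2).mul (hq.continuousAt.tendsto.comp h.continuousAt_zero.tendsto)).mono_left
      nhdsWithin_le_nhds
  have h3 := tendsto_nhds_unique_of_eventuallyEq h1 h2 (by
    filter_upwards [self_mem_nhdsWithin, mem_nhdsWithin_of_mem_nhds (ball_mem_nhds _ h.pos)]
      with ζ hζ hζ'
    exact h.dslope_sq hp hw hζ' hζ)
  rw [dslope_same, h.zero] at h3
  refine mul_left_cancel₀ h.deriv_ne ?_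
  rw [critCoeff]
  linear_combination -h3

theorem critCoeff_ne_zero (hp : 1 ≤ p) (hw : w ∈ Sp p) : critCoeff p w ≠ 0 := by
  intro h0
  have := h.critCoeff_mul_deriv hp hw
  simp [h0] at this

omit h in
/-- Two linearizing maps agree near the origin. -/
theorem eventuallyEq {ρ₁ ρ₂ : ℝ} {ψ₁ ψ₂ : ℂ → ℂ} (h₁ : IsLin p w ρ₁ ψ₁) (h₂ : IsLin p w ρ₂ ψ₂)
    (hp : 1 ≤ p) (hw : w ∈ Sp p) : ψ₁ =ᶠ[𝓝 0] ψ₂ := by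
  have hA0 := h₁.critCoeff_ne_zero hp hw
  have hd1 := h₁.critCoeff_mul_deriv hp hw
  have hd2 := h₂.critCoeff_mul_deriv hp hw
  set q₁ := dslope ψ₁ 0 with hq₁
  set q₂ := dslope ψ₂ 0 with hq₂
  have hc1 : ContinuousAt q₁ 0 :=
    (h₁.differentiableOn_dslope.differentiableAt (ball_mem_nhds _ h₁.pos)).continuousAt
  have hc2 : ContinuousAt q₂ 0 :=
    (h₂.differentiableOn_dslope.differentiableAt (ball_mem_nhds _ h₂.pos)).continuousAt
  have hq12 : q₁ 0 = q₂ 0 := by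
    rw [hq₁, hq₂, dslope_same, dslope_same]
    exact mul_left_cancel₀ hA0 (hd1.trans hd2.symm)
  have e1 := eventually_norm_dslope_sub_le (h₁.diff.differentiableAt (ball_mem_nhds _ h₁.pos))
    h₁.zero (h₂.diff.differentiableAt (ball_mem_nhds _ h₂.pos)) h₂.zero hc1 hc2 hd1 hd2
  have e6 : ∀ᶠ ζ in 𝓝 (0 : ℂ), ‖q₁ ζ - q₂ ζ‖ ≤ 1 :=
    (hc1.sub hc2).norm.eventually_le_const (by simp [hq12])
  obtain ⟨δ, hδ, hball⟩ := Metric.eventually_nhds_iff_ball.mp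
    (e1.and (e6.and ((eventually_mem_set.mpr (ball_mem_nhds _ h₁.pos)).and
      ((eventually_mem_set.mpr (ball_mem_nhds _ h₂.pos)).and
      (eventually_mem_set.mpr (ball_mem_nhds _ one_pos))))))
  have hδ1 : ∀ ζ ∈ ball (0 : ℂ) δ, ‖ζ‖ < 1 := fun ζ hζ =>
    mem_ball_zero_iff.mp (hball ζ hζ).2.2.2.2
  have hpow : ∀ ζ ∈ ball (0 : ℂ) δ, ζ ^ 2 ∈ ball (0 : ℂ) δ := by
    intro ζ hζ
    have := hδ1 ζ hζ
    rw [mem_ball_zero_iff] at hζ ⊢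
    rw [norm_pow]
    nlinarith [norm_nonneg ζ]
  have key : ∀ ζ ∈ ball (0 : ℂ) δ, 3 / 2 * ‖q₁ ζ - q₂ ζ‖ ≤ ‖q₁ (ζ ^ 2) - q₂ (ζ ^ 2)‖ := by
    intro ζ hζ
    rcases eq_or_ne ζ 0 with rfl | hne
    · simp [hq12]
    obtain ⟨a1, a6, a7, a8, a9⟩ := hball ζ hζ
    have i1 := h₁.dslope_sq hp hw a7 hne
    have i2 := h₂.dslope_sq hp hw a8 hne
    rw [hq₁, hq₂, i1, i2]
    exact a1
  have key2 : ∀ n : ℕ, ∀ ζ ∈ ball (0 : ℂ) δ, (3 / 2) ^ n * ‖q₁ ζ - q₂ ζ‖ ≤ 1 := by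
    intro n
    induction n with
    | zero => intro ζ hζ; simpa using (hball ζ hζ).2.1
    | succ n ih =>
      intro ζ hζ
      have j1 := ih _ (hpow ζ hζ)
      have j2 := key ζ hζ
      refine le_trans ?_ j1
      rw [pow_succ, mul_assoc]
      gcongr
  filter_upwards [ball_mem_nhds (0 : ℂ) hδ] with ζ hζ
  have h5 : ‖q₁ ζ - q₂ ζ‖ = 0 := by
    by_contra hne
    have hpos : 0 < ‖q₁ ζ - q₂ ζ‖ := lt_of_le_of_ne (norm_nonneg _) (Ne.symm hne)
    have hlim : Tendsto (fun n : ℕ => (3 / 2 : ℝ) ^ n * ‖q₁ ζ - q₂ ζ‖) atTop atTop :=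
      (tendsto_pow_atTop_atTop_of_one_lt (by norm_num)).atTop_mul_const hpos
    obtain ⟨n, hn⟩ := (hlim.eventually_gt_atTop 1).exists
    exact absurd (key2 n ζ hζ) (not_le.mpr hn)
  rw [norm_eq_zero, sub_eq_zero] at h5
  rw [h₁.eq_add_mul_dslope ζ, h₂.eq_add_mul_dslope ζ, ← hq₁, ← hq₂, h5]

omit h in
theorem eqOn {ρ₁ ρ₂ : ℝ} {ψ₁ ψ₂ : ℂ → ℂ} (h₁ : IsLin p w ρ₁ ψ₁) (h₂ : IsLin p w ρ₂ ψ₂)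
    (hp : 1 ≤ p) (hw : w ∈ Sp p) (hρ : ρ₁ ≤ ρ₂) : EqOn ψ₁ ψ₂ (ball 0 ρ₁) :=
  (h₁.diff.analyticOnNhd isOpen_ball).eqOn_of_preconnected_of_eventuallyEq
    ((h₂.mono h₁.pos hρ).diff.analyticOnNhd isOpen_ball) (convex_ball _ _).isPreconnected
    h₁.zero_mem (h₁.eventuallyEq h₂ hp hw)

section bounds
variable {R : ℝ} (hp : 1 ≤ p) (hw : w ∈ Sp p) (hR : ∀ z ∈ filledJulia (cubic w.1 w.2), ‖z‖ ≤ R)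
include hp hR

theorem mapsTo_closedBall : MapsTo ψ (ball 0 ρ) (closedBall (ψ 0) (2 * R)) := by
  intro ζ hζ
  rw [mem_closedBall, dist_eq_norm]
  have h1 := hR _ (h.mem_filledJulia hp hζ)
  have h2 := hR _ (h.mem_filledJulia hp h.zero_mem)
  linarith [norm_sub_le (ψ ζ) (ψ 0)]

theorem norm_sub_le {ζ : ℂ} (hζ : ζ ∈ ball (0 : ℂ) ρ) : ‖ψ ζ - w.1‖ ≤ 2 * R / ρ * ‖ζ‖ := by
  have := Complex.dist_le_div_mul_dist_of_mapsTo_ball h.diff (h.mapsTo_closedBall hp hR) hζ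
  rwa [h.zero, dist_eq_norm, dist_zero_right] at this

theorem norm_deriv_le : ‖deriv ψ 0‖ ≤ 2 * R / ρ :=
  Complex.norm_deriv_le_div_of_mapsTo_ball h.diff (h.mapsTo_closedBall hp hR) h.pos

theorem norm_sub_sub_le {ζ : ℂ} (hζ : ζ ∈ ball (0 : ℂ) ρ) :
    ‖ψ ζ - w.1 - ζ * deriv ψ 0‖ ≤ 4 * R / ρ ^ 2 * ‖ζ‖ ^ 2 := by
  have h1 : MapsTo (dslope ψ 0) (ball 0 ρ) (closedBall (dslope ψ 0 0) (2 * (2 * R / ρ))) := by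
    intro ξ hξ
    have h2 := Complex.norm_dslope_le_div_of_mapsTo_ball h.diff (h.mapsTo_closedBall hp hR) hξ
    have h3 := Complex.norm_dslope_le_div_of_mapsTo_ball h.diff (h.mapsTo_closedBall hp hR)
      h.zero_mem
    rw [mem_closedBall, dist_eq_norm]
    linarith [_root_.norm_sub_le (dslope ψ 0 ξ) (dslope ψ 0 0)]
  have h4 := Complex.dist_le_div_mul_dist_of_mapsTo_ball h.differentiableOn_dslope h1 hζ
  rw [dist_eq_norm, dist_zero_right, dslope_same] at h4
  have h5 : ψ ζ - w.1 - ζ * deriv ψ 0 = ζ * (dslope ψ 0 ζ - deriv ψ 0) := by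
    rw [h.eq_add_mul_dslope ζ]; ring
  rw [h5, norm_mul]
  have hρ := h.pos
  calc ‖ζ‖ * ‖dslope ψ 0 ζ - deriv ψ 0‖ ≤ ‖ζ‖ * (2 * (2 * R / ρ) / ρ * ‖ζ‖) := by gcongr
    _ = 4 * R / ρ ^ 2 * ‖ζ‖ ^ 2 := by field_simp; ring

end bounds

end IsLin

end lin

/-- Parameters of Type B: the free critical point lies in the Fatou component of `f^[l] c`. -/
structure TypeB (p l : ℕ) (w : ℂ × ℂ) : Prop where
  one_le : 1 ≤ l
  lt : l < p
  mem : w ∈ Sp p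
  crit : -w.1 ∈ fatouComponent (cubic w.1 w.2) ((cubic w.1 w.2)^[l] w.1)

section typeB
variable {p l : ℕ} {w : ℂ × ℂ}

theorem iterate_mem_fatouComponent_self (hp : 1 ≤ p) (hw : w ∈ Sp p) {i : ℕ} (hi : i ≤ p) :
    (cubic w.1 w.2)^[i] w.1 ∈ fatouComponent (cubic w.1 w.2) ((cubic w.1 w.2)^[i] w.1) :=
  mem_connectedComponentIn (iterate_mem_fatouSet hp hw hi)

theorem fatouComponent_index_unique' (hp : 1 ≤ p) (hw : w ∈ Sp p) {i j : ℕ} (hi0 : 1 ≤ i)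
    (hi : i ≤ p) (hj0 : 1 ≤ j) (hj : j ≤ p) {z : ℂ}
    (h1 : z ∈ fatouComponent (cubic w.1 w.2) ((cubic w.1 w.2)^[i] w.1))
    (h2 : z ∈ fatouComponent (cubic w.1 w.2) ((cubic w.1 w.2)^[j] w.1)) : i = j := by
  have h0 : (cubic w.1 w.2)^[p] w.1 = (cubic w.1 w.2)^[0] w.1 := hw.1
  rcases hi.lt_or_eq with hi | rfl <;> rcases hj.lt_or_eq with hj | rfl
  · exact fatouComponent_index_unique hp hw hi hj h1 h2
  · rw [h0] at h2
    have := fatouComponent_index_unique hp hw hi hp h1 h2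
    omega
  · rw [h0] at h1
    have := fatouComponent_index_unique hp hw hp hj h1 h2
    omega
  · rfl

namespace TypeB
variable (h : TypeB p l w)
include h

theorem one_le_p : 1 ≤ p := h.one_le.trans h.lt.le

theorem fst_ne_zero : w.1 ≠ 0 := by
  intro h0
  have h1 := h.crit
  have h2 := iterate_mem_fatouComponent_self h.one_le_p h.mem (Nat.zero_le p)
  have h3 : -w.1 = (cubic w.1 w.2)^[0] w.1 := by simp [h0]
  rw [h3] at h1
  have := fatouComponent_index_unique h.one_le_p h.mem h.lt h.one_le_p h1 h2
  have := h.one_le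
  omega

theorem eq_of_iterate_eq_neg {j : ℕ} (hj : j < p) (hjc : (cubic w.1 w.2)^[j] w.1 = -w.1) :
    j = l := by
  have h2 := iterate_mem_fatouComponent_self h.one_le_p h.mem hj.le
  have h1 := h.crit
  rw [← hjc] at h1
  exact fatouComponent_index_unique h.one_le_p h.mem hj h.lt h2 h1

theorem iterate_neg_mem : (cubic w.1 w.2)^[p - l] (-w.1) ∈ fatouComponent (cubic w.1 w.2) w.1 := by
  have h1 := iterate_mem_fatouComponent h.crit (p - l)
  rwa [← iterate_add_apply, Nat.sub_add_cancel h.lt.le, h.mem.1] at h1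

theorem tendsto_iterate : Tendsto (fun n => ((cubic w.1 w.2)^[p])^[n]
    ((cubic w.1 w.2)^[p - l] (-w.1))) atTop (𝓝 w.1) :=
  tendsto_iterate_of_mem_fatouComponent h.one_le_p h.mem (Nat.zero_le p) h.iterate_neg_mem

theorem iterate_sq_ne {j : ℕ} (hj0 : 1 ≤ j) (hj : j < p)
    (hnc : (cubic w.1 w.2)^[l] w.1 ≠ -w.1) : ((cubic w.1 w.2)^[j] w.1) ^ 2 ≠ w.1 ^ 2 := by
  intro h1
  rcases sq_eq_sq_iff_eq_or_eq_neg.mp h1 with h2 | h2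
  · exact h.mem.2 j hj0 hj h2
  · have := h.eq_of_iterate_eq_neg hj h2
    subst this
    exact hnc h2

theorem critCoeff_ne_zero (hnc : (cubic w.1 w.2)^[l] w.1 ≠ -w.1) : critCoeff p w ≠ 0 := by
  rw [critCoeff, critQuot]
  refine mul_ne_zero ?_ (Finset.prod_ne_zero_iff.mpr fun j hj => ?_)
  · have : w.1 + 2 * w.1 = 3 * w.1 := by ring
    rw [this]
    exact mul_ne_zero (by norm_num) h.fst_ne_zero
  · have hj' := Finset.mem_range.mp hj
    have h1 := h.iterate_sq_ne (j := j + 1) (by omega) (by omega) hnc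
    intro h2
    refine h1 ?_
    linear_combination h2 / 3

theorem critCoeff_eq_zero (hc : (cubic w.1 w.2)^[l] w.1 = -w.1) : critCoeff p w = 0 := by
  rw [critCoeff, critQuot]
  refine mul_eq_zero_of_right _ (Finset.prod_eq_zero (i := l - 1) ?_ ?_)
  · have := h.one_le; have := h.lt
    exact Finset.mem_range.mpr (by omega)
  · rw [Nat.sub_add_cancel h.one_le, hc]; ring

end TypeB

/-- Existence of an injective linearizing map near a critical point of local degree two. -/
theorem exists_isLin_injOn (hp : 1 ≤ p) (hw : w ∈ Sp p) (hA : critCoeff p w ≠ 0) :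
    ∃ ρ ψ, IsLin p w ρ ψ ∧ InjOn ψ (ball 0 ρ) := by
  obtain ⟨δ, hδ, B, hB, hB0, hB', hmaps, hconj⟩ := exists_local_bottcher (G := (cubic w.1 w.2)^[p])
    le_rfl ((contDiff_critQuot_right (p - 1) w.1 w.2 (k := 1)).differentiable (by simp)) hA
    (iterate_eq_of_mem_Sp hp hw)
  have hBan : AnalyticAt ℂ B w.1 := hB.analyticAt (ball_mem_nhds _ hδ)
  obtain ⟨r, hr, ψ, hψd, hψ0, hψ, V, hVδ, hVo, hcV, hV⟩ := exists_local_inverse_complex hBan hB'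
    (ball_mem_nhds w.1 hδ)
  rw [hB0] at hψd hψ0 hψ hV
  have hψc : ContinuousAt ψ 0 := (hψd.differentiableAt (ball_mem_nhds _ hr)).continuousAt
  have h1 : ∀ᶠ ζ in 𝓝 (0 : ℂ), (cubic w.1 w.2)^[p] (ψ ζ) ∈ V := by
    refine (((continuous_iterate_cubic w.1 w.2 p).continuousAt).comp hψc).eventually_mem ?_
    rw [comp_apply, hψ0, hw.1]
    exact hVo.mem_nhds hcV
  obtain ⟨s, hs, hball⟩ := Metric.eventually_nhds_iff_ball.mp h1
  set ρ := min (min r s) 1 with hρ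
  have hρ0 : 0 < ρ := by simp [hρ, hr, hs]
  have hρr : ball (0 : ℂ) ρ ⊆ ball 0 r :=
    ball_subset_ball ((min_le_left _ _).trans (min_le_left _ _))
  have hρs : ball (0 : ℂ) ρ ⊆ ball 0 s :=
    ball_subset_ball ((min_le_left _ _).trans (min_le_right _ _))
  have hd : DifferentiableAt ℂ ψ 0 := hψd.differentiableAt (ball_mem_nhds _ hr)
  refine ⟨ρ, ψ, ⟨hρ0, min_le_right _ _, hψd.mono hρr, hψ0, ?_, fun ζ hζ => ?_⟩, ?_⟩
  · intro h0
    have h2 : (fun ζ => B (ψ ζ)) =ᶠ[𝓝 0] id := by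
      filter_upwards [ball_mem_nhds (0 : ℂ) hr] with ζ hζ
      exact (hψ ζ hζ).2
    have h3 : HasDerivAt (fun ζ => B (ψ ζ)) (deriv B w.1 * deriv ψ 0) 0 := by
      have := hBan.differentiableAt.hasDerivAt
      rw [← hψ0] at this
      simpa [hψ0, comp_def] using this.comp (0 : ℂ) hd.hasDerivAt
    have h4 := h3.unique ((hasDerivAt_id (0 : ℂ)).congr_of_eventuallyEq h2)
    simp [h0] at h4
  · obtain ⟨h2, h3⟩ := hψ ζ (hρr hζ)
    have h4 := (hV _ (hball ζ (hρs hζ))).2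
    rw [hconj _ h2, h3] at h4
    exact h4.symm
  · intro x hx y hy hxy
    rw [← (hψ x (hρr hx)).2, ← (hψ y (hρr hy)).2, hxy]

end typeB

section extension

theorem ContinuousAt.eq_of_eventuallyEq_punctured {f g : ℂ → ℂ} {z : ℂ} (hf : ContinuousAt f z)
    (hg : ContinuousAt g z) (h : ∀ᶠ x in 𝓝[≠] z, f x = g x) : f z = g z :=
  tendsto_nhds_unique_of_eventuallyEq (hf.tendsto.mono_left nhdsWithin_le_nhds)
    (hg.tendsto.mono_left nhdsWithin_le_nhds) h

variable {ρ : ℝ} {c a : ℂ}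

/-- Lifting a map of the disc through a cubic polynomial, when the critical values are only
attained at the origin, to exact order two. -/
theorem exists_cubic_lift_disc (hρ : 0 < ρ) (hc : c ≠ 0) {y k : ℂ → ℂ} {z₀ : ℂ}
    (hy : DifferentiableOn ℂ y (ball 0 ρ)) (hk : DifferentiableOn ℂ k (ball 0 ρ))
    (hyk : ∀ ζ ∈ ball (0 : ℂ) ρ, y ζ = cubic c a z₀ + ζ ^ 2 * k ζ) (hk0 : k 0 ≠ 0)
    (hv : ∀ ζ ∈ ball (0 : ℂ) ρ, ζ ≠ 0 → y ζ ≠ cubic c a c ∧ y ζ ≠ cubic c a (-c)) :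
    ∃ Y : ℂ → ℂ, DifferentiableOn ℂ Y (ball 0 ρ) ∧ (∀ ζ ∈ ball (0 : ℂ) ρ, cubic c a (Y ζ) = y ζ) ∧
      Y 0 = z₀ := by
  have h0 : (0 : ℂ) ∈ ball (0 : ℂ) ρ := mem_ball_self hρ
  have hy0 : y 0 = cubic c a z₀ := by simpa using hyk 0 h0
  have hne : cubic c a c ≠ cubic c a (-c) := by
    intro h
    have h1 : c ^ 3 = 0 := by simp only [cubic] at h; linear_combination -h / 4
    exact hc (pow_eq_zero_iff (by norm_num) |>.mp h1)
  have hdisc : ∀ ζ, (y ζ - a) ^ 2 - 4 * c ^ 6 =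
      (y ζ - cubic c a c) * (y ζ - cubic c a (-c)) := by
    intro ζ; simp only [cubic]; ring
  have main : ∀ κ K : ℂ → ℂ, DifferentiableOn ℂ κ (ball 0 ρ) → DifferentiableOn ℂ K (ball 0 ρ) →
      (∀ ζ ∈ ball (0 : ℂ) ρ, K ζ ≠ 0) → (∀ ζ ∈ ball (0 : ℂ) ρ,
        (y ζ - cubic c a c) * (y ζ - cubic c a (-c)) = κ ζ ^ 2 * K ζ) →
      ∃ Y : ℂ → ℂ, DifferentiableOn ℂ Y (ball 0 ρ) ∧
        (∀ ζ ∈ ball (0 : ℂ) ρ, cubic c a (Y ζ) = y ζ) ∧ Y 0 = z₀ := by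
    intro κ K hκ hK hK0 heq
    obtain ⟨Y, hY, hYe, hY0⟩ := (convex_ball (0 : ℂ) ρ).exists_cubic_lift isOpen_ball
      (e := fun _ => c) (T := fun ζ => y ζ - a) (κ := κ) (K := K) (differentiableOn_const _)
      (hy.sub_const a) hκ hK (fun _ _ => hc) hK0 (fun ζ hζ => by rw [hdisc, heq ζ hζ]) h0
      (y₀ := z₀) (by rw [hy0]; simp [cubic])
    refine ⟨Y, hY, fun ζ hζ => ?_, hY0⟩
    have := hYe ζ hζ
    simp only [cubic]
    linear_combination this
  by_cases h1 : cubic c a z₀ = cubic c a c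
  · refine main (fun ζ => ζ) (fun ζ => k ζ * (y ζ - cubic c a (-c))) differentiableOn_id
      (hk.mul (hy.sub_const _)) (fun ζ hζ => ?_) (fun ζ hζ => ?_)
    · rcases eq_or_ne ζ 0 with rfl | hζ0
      · refine mul_ne_zero hk0 (sub_ne_zero.mpr ?_)
        rw [hy0, h1]; exact hne
      · refine mul_ne_zero (fun h2 => ?_) (sub_ne_zero.mpr (hv ζ hζ hζ0).2)
        refine (hv ζ hζ hζ0).1 ?_
        rw [hyk ζ hζ, h2, h1]; ring
    · rw [← h1]; nth_rewrite 1 [hyk ζ hζ]; ring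
  by_cases h2 : cubic c a z₀ = cubic c a (-c)
  · refine main (fun ζ => ζ) (fun ζ => k ζ * (y ζ - cubic c a c)) differentiableOn_id
      (hk.mul (hy.sub_const _)) (fun ζ hζ => ?_) (fun ζ hζ => ?_)
    · rcases eq_or_ne ζ 0 with rfl | hζ0
      · refine mul_ne_zero hk0 (sub_ne_zero.mpr ?_)
        rw [hy0, h2]; exact hne.symm
      · refine mul_ne_zero (fun h3 => ?_) (sub_ne_zero.mpr (hv ζ hζ hζ0).1)
        refine (hv ζ hζ hζ0).2 ?_
        rw [hyk ζ hζ, h3, h2]; ring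
    · rw [← h2]; nth_rewrite 2 [hyk ζ hζ]; ring
  · refine main (fun _ => 1) (fun ζ => (y ζ - cubic c a c) * (y ζ - cubic c a (-c)))
      (differentiableOn_const _) ((hy.sub_const _).mul (hy.sub_const _)) (fun ζ hζ => ?_)
      (fun ζ hζ => by ring)
    rcases eq_or_ne ζ 0 with rfl | hζ0
    · rw [hy0]; exact mul_ne_zero (sub_ne_zero.mpr h1) (sub_ne_zero.mpr h2)
    · exact mul_ne_zero (sub_ne_zero.mpr (hv ζ hζ hζ0).1) (sub_ne_zero.mpr (hv ζ hζ hζ0).2)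

theorem exists_order_two_of_cubic (hρ : 0 < ρ) {Y k : ℂ → ℂ} {z₀ : ℂ}
    (hY : DifferentiableOn ℂ Y (ball 0 ρ)) (hk : DifferentiableOn ℂ k (ball 0 ρ))
    (hYk : ∀ ζ ∈ ball (0 : ℂ) ρ, cubic c a (Y ζ) = cubic c a z₀ + ζ ^ 2 * k ζ) (hk0 : k 0 ≠ 0)
    (hY0 : Y 0 = z₀) (hz₀ : z₀ ^ 2 ≠ c ^ 2) :
    ∃ k' : ℂ → ℂ, DifferentiableOn ℂ k' (ball 0 ρ) ∧ k' 0 ≠ 0 ∧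
      ∀ ζ, Y ζ = z₀ + ζ ^ 2 * k' ζ := by
  have hn := ball_mem_nhds (0 : ℂ) hρ
  have hd1 : DifferentiableOn ℂ (dslope Y 0) (ball 0 ρ) :=
    (Complex.differentiableOn_dslope hn).mpr hY
  have hd2 : DifferentiableOn ℂ (dslope (dslope Y 0) 0) (ball 0 ρ) :=
    (Complex.differentiableOn_dslope hn).mpr hd1
  set d := dslope Y 0 with hd
  set k' := dslope d 0 with hk'
  have hYc : ContinuousAt Y 0 := (hY.differentiableAt hn).continuousAt
  have hdc : ContinuousAt d 0 := (hd1.differentiableAt hn).continuousAt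
  have hkc' : ContinuousAt k' 0 := (hd2.differentiableAt hn).continuousAt
  have hkc : ContinuousAt k 0 := (hk.differentiableAt hn).continuousAt
  have eY : ∀ ζ, Y ζ = z₀ + ζ * d ζ := fun ζ => by rw [eq_add_mul_dslope_zero Y ζ, hY0]
  have ed : ∀ ζ, d ζ = d 0 + ζ * k' ζ := fun ζ => eq_add_mul_dslope_zero d ζ
  set Q : ℂ → ℂ := fun ζ => Y ζ ^ 2 + Y ζ * z₀ + z₀ ^ 2 - 3 * c ^ 2 with hQ
  have hQc : ContinuousAt Q 0 :=
    (((hYc.pow 2).add (hYc.mul continuousAt_const)).add continuousAt_const).sub continuousAt_const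
  have hQ0 : Q 0 ≠ 0 := by
    simp only [hQ, hY0]
    intro h
    refine hz₀ ?_
    linear_combination h / 3
  have h1 : ∀ ζ ∈ ball (0 : ℂ) ρ, ζ ≠ 0 → d ζ * Q ζ = ζ * k ζ := by
    intro ζ hζ hζ0
    have h2 := hYk ζ hζ
    have h3 := cubic_sub c a (Y ζ) z₀
    refine mul_left_cancel₀ hζ0 ?_
    have h4 : Y ζ - z₀ = ζ * d ζ := by rw [eY]; ring
    calc ζ * (d ζ * Q ζ) = (Y ζ - z₀) * Q ζ := by rw [h4]; ring
      _ = ζ * (ζ * k ζ) := by rw [← h3, h2]; ring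
  have hnear : ∀ᶠ ζ in 𝓝[≠] (0 : ℂ), ζ ∈ ball (0 : ℂ) ρ ∧ ζ ≠ 0 :=
    (mem_nhdsWithin_of_mem_nhds hn : ball (0 : ℂ) ρ ∈ 𝓝[≠] 0) |> fun h =>
      (eventually_mem_set.mpr h).and self_mem_nhdsWithin
  have h2 : d 0 * Q 0 = 0 * k 0 := ContinuousAt.eq_of_eventuallyEq_punctured
    (f := fun ζ => d ζ * Q ζ) (g := fun ζ => ζ * k ζ) (hdc.mul hQc) (continuousAt_id.mul hkc)
    (hnear.mono fun ζ hζ => h1 ζ hζ.1 hζ.2)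
  have hd0 : d 0 = 0 := by
    rw [zero_mul] at h2
    exact (mul_eq_zero.mp h2).resolve_right hQ0
  have h3 : k' 0 * Q 0 = k 0 := ContinuousAt.eq_of_eventuallyEq_punctured
    (f := fun ζ => k' ζ * Q ζ) (g := k) (hkc'.mul hQc) hkc (hnear.mono fun ζ hζ => by
      have h4 := h1 ζ hζ.1 hζ.2
      rw [ed, hd0, zero_add] at h4
      refine mul_left_cancel₀ hζ.2 ?_
      linear_combination h4)
  refine ⟨k', hd2, fun h4 => hk0 ?_, fun ζ => ?_⟩
  · rw [← h3, h4, zero_mul]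
  · rw [eY, ed, hd0]; ring

end extension

section normalform

theorem exists_pow_normal_form {u : ℂ → ℂ} {z₀ : ℂ} (hu : AnalyticAt ℂ u z₀) (hu0 : u z₀ ≠ 0)
    {n : ℕ} (hn : n ≠ 0) : ∃ φ : ℂ → ℂ, AnalyticAt ℂ φ z₀ ∧ φ z₀ = 0 ∧ deriv φ z₀ ≠ 0 ∧
      ∀ᶠ z in 𝓝 z₀, φ z ^ n = (z - z₀) ^ n * u z := by
  obtain ⟨r, hr, hball⟩ := Metric.eventually_nhds_iff_ball.mp
    (hu.eventually_analyticAt.and (hu.continuousAt.eventually_ne hu0))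
  have hmem := mem_ball_self (x := z₀) hr
  obtain ⟨L, hL, hLu⟩ := (convex_ball z₀ r).exists_differentiableOn_pow_eq isOpen_ball
    (fun z hz => (hball z hz).1.differentiableAt.differentiableWithinAt)
    (fun z hz => (hball z hz).2) hn
  have hLa : AnalyticAt ℂ L z₀ := hL.analyticAt (ball_mem_nhds _ hr)
  have hid : HasDerivAt (fun z : ℂ => z - z₀) 1 z₀ := (hasDerivAt_id z₀).sub_const z₀
  refine ⟨fun z => (z - z₀) * L z, (analyticAt_id.sub analyticAt_const).mul hLa, by simp, ?_, ?_⟩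
  · have h1 := hid.mul hLa.differentiableAt.hasDerivAt
    have h2 : deriv (fun z => (z - z₀) * L z) z₀ = L z₀ :=
      h1.deriv.trans (by simp)
    rw [h2]
    intro h0
    have := hLu z₀ hmem
    rw [h0, zero_pow hn] at this
    exact hu0 this.symm
  · filter_upwards [ball_mem_nhds z₀ hr] with z hz
    rw [mul_pow, hLu z hz]

/-- A holomorphic map that is injective near a point has nonzero derivative there. -/
theorem AnalyticAt.deriv_ne_zero_of_injOn {f : ℂ → ℂ} {z₀ : ℂ} (hf : AnalyticAt ℂ f z₀)
    {U : Set ℂ} (hU : U ∈ 𝓝 z₀) (hinj : InjOn f U) : deriv f z₀ ≠ 0 := by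
  have hg : AnalyticAt ℂ (fun z => f z - f z₀) z₀ := hf.sub analyticAt_const
  have hz₀ : z₀ ∈ U := mem_of_mem_nhds hU
  have hnz : ¬ ∀ᶠ z in 𝓝 z₀, f z - f z₀ = 0 := by
    intro h
    have h1 : ∀ᶠ z in 𝓝[≠] z₀, False := by
      filter_upwards [mem_nhdsWithin_of_mem_nhds h, mem_nhdsWithin_of_mem_nhds hU,
        self_mem_nhdsWithin] with z h1 h2 h3
      exact h3 (hinj h2 hz₀ (sub_eq_zero.mp h1))
    exact (NeBot.ne inferInstance : 𝓝[≠] z₀ ≠ ⊥) (by simpa using h1)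
  obtain ⟨n, u, hu, hu0, he⟩ := hg.exists_eventuallyEq_pow_smul_nonzero_iff.mpr hnz
  have hn : n ≠ 0 := by
    rintro rfl
    have := he.self_of_nhds
    simp at this
    exact hu0 this.symm
  obtain ⟨φ, hφ, hφ0, hφd, hφe⟩ := exists_pow_normal_form hu hu0 hn
  obtain ⟨r, hr, φi, hφi, -, hφi1, -⟩ := exists_local_inverse_complex hφ hφd
    (inter_mem hU (he.and hφe))
  rw [hφ0] at hφi1
  have hroot := Complex.isPrimitiveRoot_exp n hn
  set ω := Complex.exp (2 * Real.pi * Complex.I / n) with hω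
  have hωn : ‖ω‖ = 1 := hroot.norm'_eq_one hn
  have hs : ((r / 2 : ℝ) : ℂ) ∈ ball (0 : ℂ) r := by
    rw [mem_ball_zero_iff, Complex.norm_real, Real.norm_of_nonneg (by positivity)]; linarith
  have hs' : ω * ((r / 2 : ℝ) : ℂ) ∈ ball (0 : ℂ) r := by
    rw [mem_ball_zero_iff] at hs ⊢; rwa [norm_mul, hωn, one_mul]
  have key : ∀ y ∈ ball (0 : ℂ) r, f (φi y) = f z₀ + y ^ n := by
    intro y hy
    obtain ⟨⟨-, h1, h2⟩, h3⟩ := hφi1 y hy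
    rw [h3] at h2
    rw [smul_eq_mul] at h1
    rw [h2]; linear_combination h1
  have heq : φi (ω * ((r / 2 : ℝ) : ℂ)) = φi ((r / 2 : ℝ) : ℂ) := by
    refine hinj (hφi1 _ hs').1.1 (hφi1 _ hs).1.1 ?_
    rw [key _ hs', key _ hs, mul_pow, hroot.pow_eq_one, one_mul]
  have h1 : ω * ((r / 2 : ℝ) : ℂ) = ((r / 2 : ℝ) : ℂ) := by
    rw [← (hφi1 _ hs').2, heq, (hφi1 _ hs).2]
  have hω1 : ω = 1 := by
    have : ((r / 2 : ℝ) : ℂ) ≠ 0 := by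
      rw [Ne, Complex.ofReal_eq_zero]; positivity
    exact mul_right_cancel₀ this (by rw [h1, one_mul])
  have hn1 : n = 1 := by
    have := hroot.eq_orderOf
    rw [hω1, orderOf_one] at this
    exact this
  subst hn1
  have h2 : (fun z => f z - f z₀) =ᶠ[𝓝 z₀] φ := by
    filter_upwards [he, hφe] with z h1 h2
    rw [pow_one] at h2
    rw [h1, h2, smul_eq_mul]
  have h3 := h2.deriv_eq
  rw [deriv_sub_const] at h3
  rwa [h3]

end normalform

section extend
variable {p l : ℕ} {w : ℂ × ℂ}

/-- One step of the backward lift: the map `y` lands at `f^[i] c` and `f^[p-i] ∘ y = ψ ∘ sq`. -/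
structure IsBackLift (p : ℕ) (w : ℂ × ℂ) (ρ : ℝ) (ψ : ℂ → ℂ) (i : ℕ) (y k : ℂ → ℂ) : Prop where
  diff : DifferentiableOn ℂ y (ball 0 ρ)
  diff' : DifferentiableOn ℂ k (ball 0 ρ)
  ne : k 0 ≠ 0
  eq : ∀ ζ ∈ ball (0 : ℂ) ρ, y ζ = (cubic w.1 w.2)^[i] w.1 + ζ ^ 2 * k ζ
  conj : ∀ ζ ∈ ball (0 : ℂ) ρ, (cubic w.1 w.2)^[p - i] (y ζ) = ψ (ζ ^ 2)

theorem IsBackLift.mem_fatouComponent {ρ : ℝ} {ψ y k : ℂ → ℂ} {i : ℕ}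
    (h : IsBackLift p w ρ ψ i y k) (hρ : 0 < ρ)
    (hψ : ∀ ζ ∈ ball (0 : ℂ) ρ, ψ (ζ ^ 2) ∈ fatouSet (cubic w.1 w.2)) {ζ : ℂ}
    (hζ : ζ ∈ ball (0 : ℂ) ρ) :
    y ζ ∈ fatouComponent (cubic w.1 w.2) ((cubic w.1 w.2)^[i] w.1) := by
  have hpre : IsPreconnected (y '' ball 0 ρ) :=
    (convex_ball (0 : ℂ) ρ).isPreconnected.image _ h.diff.continuousOn
  have h0 : (cubic w.1 w.2)^[i] w.1 ∈ y '' ball 0 ρ :=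
    ⟨0, mem_ball_self hρ, by simpa using h.eq 0 (mem_ball_self hρ)⟩
  refine hpre.subset_connectedComponentIn h0 ?_ (mem_image_of_mem _ hζ)
  rintro _ ⟨ξ, hξ, rfl⟩
  rw [← iterate_mem_fatouSet_iff (p - i), h.conj ξ hξ]
  exact hψ ξ hξ

theorem mem_fatouSet_of_mem_fatouComponent {f : ℂ → ℂ} {x z : ℂ} (h : z ∈ fatouComponent f x) :
    z ∈ fatouSet f := connectedComponentIn_subset _ _ h

theorem IsBackLift.exists_pred (hB : TypeB p l w) (hnc : (cubic w.1 w.2)^[l] w.1 ≠ -w.1)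
    {ρ : ℝ} (hρ : 0 < ρ) {ψ y k : ℂ → ℂ} {i : ℕ} (hi0 : 1 ≤ i) (hi : i < p)
    (h : IsBackLift p w ρ ψ (i + 1) y k)
    (hψ : ∀ ζ ∈ ball (0 : ℂ) ρ, ψ (ζ ^ 2) ∈ fatouSet (cubic w.1 w.2))
    (hv : ∀ ζ ∈ ball (0 : ℂ) ρ, ζ ≠ 0 → ψ (ζ ^ 2) ≠ (cubic w.1 w.2)^[p - l] (-w.1)) :
    ∃ y' k', IsBackLift p w ρ ψ i y' k' := by
  have hp := hB.one_le_p
  have e1 : (cubic w.1 w.2)^[i + 1] w.1 = cubic w.1 w.2 ((cubic w.1 w.2)^[i] w.1) :=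
    iterate_succ_apply' _ _ _
  have hyU := fun ζ (hζ : ζ ∈ ball (0 : ℂ) ρ) => h.mem_fatouComponent hρ hψ hζ
  obtain ⟨Y, hY, hYy, hY0⟩ := exists_cubic_lift_disc (c := w.1) (a := w.2) hρ hB.fst_ne_zero
    h.diff h.diff' (z₀ := (cubic w.1 w.2)^[i] w.1) (fun ζ hζ => by rw [h.eq ζ hζ, e1]) h.ne
    (fun ζ hζ hζ0 => by
      constructor
      · intro h1
        have h2 := hyU ζ hζ
        have h3 := iterate_mem_fatouComponent_self hp hB.mem (i := 1) hp
        rw [h1] at h2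
        have := fatouComponent_index_unique' hp hB.mem (by omega) hi le_rfl hp h2 h3
        omega
      · intro h1
        have h2 := hyU ζ hζ
        have h3 := iterate_mem_fatouComponent hB.crit 1
        rw [iterate_one, ← h1, ← iterate_succ_apply' (cubic w.1 w.2) l w.1] at h3
        have h4 := fatouComponent_index_unique' hp hB.mem (by omega) hi (by omega)
          (Nat.succ_le_of_lt hB.lt) h2 h3
        have h5 : i = l := by omega
        subst h5
        refine hv ζ hζ hζ0 ?_
        rw [← h.conj ζ hζ, h1, ← iterate_succ_apply]
        congr 2
        omega)
  obtain ⟨k', hk', hk0', hYk⟩ := exists_order_two_of_cubic (c := w.1) (a := w.2) hρ hY h.diff'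
    (fun ζ hζ => by rw [hYy ζ hζ, h.eq ζ hζ, e1]) h.ne hY0 (hB.iterate_sq_ne hi0 hi hnc)
  refine ⟨Y, k', hY, hk', hk0', fun ζ _ => hYk ζ, fun ζ hζ => ?_⟩
  rw [← h.conj ζ hζ, ← hYy ζ hζ, ← iterate_succ_apply]
  congr 2
  omega

/-- Extension of a linearizing map to a larger disc, as long as the free critical value is not
met. -/
theorem IsLin.exists_extension (hB : TypeB p l w) (hnc : (cubic w.1 w.2)^[l] w.1 ≠ -w.1)
    {ρ : ℝ} {ψ : ℂ → ℂ} (h : IsLin p w ρ ψ) (hinj : InjOn ψ (ball 0 ρ)) {ρ₁ : ℝ} (hρρ₁ : ρ ≤ ρ₁)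
    (hρ₁1 : ρ₁ ≤ 1) (hρ₁ : ρ₁ ^ 2 ≤ ρ)
    (hv : ∀ ζ ∈ ball (0 : ℂ) ρ₁, ζ ≠ 0 → ψ (ζ ^ 2) ≠ (cubic w.1 w.2)^[p - l] (-w.1)) :
    ∃ ψ', IsLin p w ρ₁ ψ' ∧ InjOn ψ' (ball 0 ρ₁) := by
  have hp := hB.one_le_p
  have hw := hB.mem
  have hρ₁0 : 0 < ρ₁ := h.pos.trans_le hρρ₁
  have hsq : ∀ ζ ∈ ball (0 : ℂ) ρ₁, ζ ^ 2 ∈ ball (0 : ℂ) ρ := by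
    intro ζ hζ
    rw [mem_ball_zero_iff] at hζ ⊢
    rw [norm_pow]
    refine lt_of_lt_of_le ?_ hρ₁
    gcongr
  have hψF : ∀ ζ ∈ ball (0 : ℂ) ρ₁, ψ (ζ ^ 2) ∈ fatouSet (cubic w.1 w.2) := fun ζ hζ =>
    mem_fatouSet_of_mem_fatouComponent (h.mem_fatouComponent hp hw (hsq ζ hζ))
  have hback : ∀ j, j < p → ∃ y k, IsBackLift p w ρ₁ ψ (p - j) y k := by
    intro j
    induction j with
    | zero =>
      intro _
      refine ⟨fun ζ => ψ (ζ ^ 2), fun ζ => dslope ψ 0 (ζ ^ 2), ?_, ?_, ?_, ?_, ?_⟩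
      · exact h.diff.comp (by fun_prop) hsq
      · exact h.differentiableOn_dslope.comp (by fun_prop) hsq
      · simpa using h.deriv_ne
      · intro ζ _
        rw [Nat.sub_zero, hw.1, h.eq_add_mul_dslope]
      · intro ζ _
        simp
    | succ j ih =>
      intro hj
      obtain ⟨y, k, hyk⟩ := ih (by omega)
      have e : p - j = p - (j + 1) + 1 := by omega
      rw [e] at hyk
      exact hyk.exists_pred hB hnc hρ₁0 (by omega) (by omega) hψF hv
  obtain ⟨y, k, hyk⟩ := hback (p - 1) (by omega)
  have e1 : p - (p - 1) = 1 := by omega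
  rw [e1] at hyk
  have hyU := fun ζ (hζ : ζ ∈ ball (0 : ℂ) ρ₁) => hyk.mem_fatouComponent hρ₁0 hψF hζ
  have hycrit : ∀ ζ ∈ ball (0 : ℂ) ρ₁, ζ ≠ 0 →
      y ζ ≠ cubic w.1 w.2 w.1 ∧ y ζ ≠ cubic w.1 w.2 (-w.1) := by
    intro ζ hζ hζ0
    constructor
    · intro h1
      have h2 := hyk.conj ζ hζ
      rw [h1, ← iterate_succ_apply, Nat.succ_eq_add_one, Nat.sub_add_cancel hp, hw.1, ← h.zero]
        at h2
      have h3 := hinj h.zero_mem (hsq ζ hζ) h2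
      exact hζ0 (pow_eq_zero_iff two_ne_zero |>.mp h3.symm)
    · intro h1
      have h2 := hyU ζ hζ
      have h3 := iterate_mem_fatouComponent hB.crit 1
      rw [iterate_one, ← h1, ← iterate_succ_apply' (cubic w.1 w.2) l w.1] at h3
      have h4 := fatouComponent_index_unique' hp hB.mem le_rfl hp (by omega)
        (Nat.succ_le_of_lt hB.lt) h2 h3
      have := hB.one_le
      omega
  obtain ⟨Y, hY, hYy, hY0⟩ := exists_cubic_lift_disc (c := w.1) (a := w.2) hρ₁0 hB.fst_ne_zero
    hyk.diff hyk.diff' (z₀ := w.1) (fun ζ hζ => hyk.eq ζ hζ) hyk.ne hycrit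
  have hYg : ∀ ζ ∈ ball (0 : ℂ) ρ₁, (cubic w.1 w.2)^[p] (Y ζ) = ψ (ζ ^ 2) := by
    intro ζ hζ
    rw [← hyk.conj ζ hζ, ← hYy ζ hζ, ← iterate_succ_apply, Nat.succ_eq_add_one,
      Nat.sub_add_cancel hp]
  have hn := ball_mem_nhds (0 : ℂ) hρ₁0
  have hYd : DifferentiableAt ℂ Y 0 := hY.differentiableAt hn
  -- the derivative at the origin is determined up to sign
  have hdY : (critCoeff p w * deriv Y 0) ^ 2 = 1 := by
    have hc1 : ContinuousAt (dslope Y 0) 0 := continuousAt_dslope_same.mpr hYd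
    have hU : Continuous (critQuot (p - 1) w.1 w.2) :=
      (contDiff_critQuot_right _ _ _ (k := 0)).continuous
    have hc2 : ContinuousAt (fun ζ => dslope ψ 0 (ζ ^ 2)) 0 := by
      have h1 : ContinuousAt (dslope ψ 0) ((0 : ℂ) ^ 2) := by
        rw [zero_pow two_ne_zero]
        exact (h.differentiableOn_dslope.differentiableAt (ball_mem_nhds _ h.pos)).continuousAt
      exact ContinuousAt.comp (f := fun ζ : ℂ => ζ ^ 2) h1 (by fun_prop)
    have h1 := ContinuousAt.eq_of_eventuallyEq_punctured
      (f := fun ζ => dslope Y 0 ζ ^ 2 * critQuot (p - 1) w.1 w.2 (Y ζ))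
      ((hc1.pow 2).mul (hU.continuousAt.comp hYd.continuousAt)) hc2 (by
        filter_upwards [self_mem_nhdsWithin, mem_nhdsWithin_of_mem_nhds hn] with ζ hζ0 hζ
        have h2 := hYg ζ hζ
        rw [iterate_eq_of_mem_Sp hp hw, h.eq_add_mul_dslope] at h2
        have h3 : Y ζ - w.1 = ζ * dslope Y 0 ζ := by
          rw [eq_add_mul_dslope_zero Y ζ, hY0]; ring
        rw [h3] at h2
        refine mul_left_cancel₀ (pow_ne_zero 2 hζ0) ?_
        linear_combination h2)
    simp only [dslope_same, hY0] at h1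
    rw [zero_pow two_ne_zero, dslope_same] at h1
    have h2 := h.critCoeff_mul_deriv hp hw
    rw [← h1] at h2
    rw [← h2, critCoeff]
    ring
  obtain ⟨σ, hσ, hσY⟩ : ∃ σ : ℂ, (σ = 1 ∨ σ = -1) ∧ critCoeff p w * (σ * deriv Y 0) = 1 := by
    rcases sq_eq_one_iff.mp hdY with h1 | h1
    · exact ⟨1, Or.inl rfl, by rw [one_mul, h1]⟩
    · exact ⟨-1, Or.inr rfl, by linear_combination -h1⟩
  have hσ1 : ‖σ‖ = 1 := by rcases hσ with rfl | rfl <;> simp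
  have hσ2 : σ ^ 2 = 1 := by rcases hσ with rfl | rfl <;> norm_num
  have hσ0 : σ ≠ 0 := by rcases hσ with rfl | rfl <;> norm_num
  have hσm : ∀ ζ ∈ ball (0 : ℂ) ρ₁, σ * ζ ∈ ball (0 : ℂ) ρ₁ := by
    intro ζ hζ
    rw [mem_ball_zero_iff] at hζ ⊢
    rwa [norm_mul, hσ1, one_mul]
  set Z : ℂ → ℂ := fun ζ => Y (σ * ζ) with hZ
  have hZd : DifferentiableOn ℂ Z (ball 0 ρ₁) := hY.comp (by fun_prop) hσm
  have hZ0 : Z 0 = w.1 := by simp [hZ, hY0]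
  have hZd0 : DifferentiableAt ℂ Z 0 := hZd.differentiableAt hn
  have hZderiv : deriv Z 0 = σ * deriv Y 0 := by
    have : HasDerivAt Y (deriv Y 0) (σ * 0) := by rw [mul_zero]; exact hYd.hasDerivAt
    have h1 := this.comp (0 : ℂ) ((hasDerivAt_id (0 : ℂ)).const_mul σ)
    rw [mul_one] at h1
    rw [mul_comm]; exact h1.deriv
  have hZg : ∀ ζ ∈ ball (0 : ℂ) ρ₁, (cubic w.1 w.2)^[p] (Z ζ) = ψ (ζ ^ 2) := by
    intro ζ hζ
    rw [hZ]
    simp only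
    rw [hYg _ (hσm ζ hζ), mul_pow, hσ2, one_mul]
  have hZψ : Z =ᶠ[𝓝 0] ψ := by
    have hψd0 : DifferentiableAt ℂ ψ 0 := h.diff.differentiableAt (ball_mem_nhds _ h.pos)
    have e := eventually_norm_dslope_sub_le hZd0 hZ0 hψd0 h.zero
      (continuousAt_dslope_same.mpr hZd0) (continuousAt_dslope_same.mpr hψd0)
      (by rw [hZderiv]; exact hσY) (h.critCoeff_mul_deriv hp hw)
    filter_upwards [e, hn, ball_mem_nhds (0 : ℂ) h.pos] with ζ hζ hζ1 hζ2
    rcases eq_or_ne ζ 0 with rfl | hζ0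
    · rw [hZ0, h.zero]
    have h1 : (cubic w.1 w.2)^[p] (Z ζ) = (cubic w.1 w.2)^[p] (ψ ζ) := by
      rw [hZg ζ hζ1, h.conj ζ hζ2]
    rw [iterate_eq_of_mem_Sp hp hw, iterate_eq_of_mem_Sp hp hw] at h1
    have h2 : Z ζ - w.1 = ζ * dslope Z 0 ζ := by
      rw [eq_add_mul_dslope_zero Z ζ, hZ0]; ring
    have h3 : ψ ζ - w.1 = ζ * dslope ψ 0 ζ := by
      rw [h.eq_add_mul_dslope ζ]; ring
    have h4 : dslope Z 0 ζ ^ 2 * critQuot (p - 1) w.1 w.2 (Z ζ) -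
        dslope ψ 0 ζ ^ 2 * critQuot (p - 1) w.1 w.2 (ψ ζ) = 0 := by
      rw [h2, h3] at h1
      refine mul_left_cancel₀ (pow_ne_zero 2 hζ0) ?_
      linear_combination h1
    rw [h4, norm_zero] at hζ
    have h5 : dslope Z 0 ζ = dslope ψ 0 ζ := by
      rw [← sub_eq_zero, ← norm_eq_zero]
      linarith [norm_nonneg (dslope Z 0 ζ - dslope ψ 0 ζ)]
    rw [eq_add_mul_dslope_zero Z ζ, hZ0, h5, ← h.eq_add_mul_dslope]
  have hZψ' : EqOn Z ψ (ball 0 ρ) :=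
    ((hZd.mono (ball_subset_ball hρρ₁)).analyticOnNhd isOpen_ball).eqOn_of_preconnected_of_eventuallyEq
      (h.diff.analyticOnNhd isOpen_ball) (convex_ball _ _).isPreconnected h.zero_mem hZψ
  have hZderiv_ne : deriv Z 0 ≠ 0 := by
    intro h0
    rw [hZderiv] at h0
    simp [h0] at hσY
  refine ⟨Z, ⟨hρ₁0, hρ₁1, hZd, hZ0, hZderiv_ne, fun ζ hζ => ?_⟩, ?_⟩
  · rw [hZg ζ hζ, hZψ' (hsq ζ hζ)]
  · intro x hx x' hx' hxx
    have h1 : x ^ 2 = x' ^ 2 := by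
      refine hinj (hsq x hx) (hsq x' hx') ?_
      rw [← hZg x hx, ← hZg x' hx', hxx]
    rcases sq_eq_sq_iff_eq_or_eq_neg.mp h1 with h2 | h2
    · exact h2
    by_cases hx0 : x = 0
    · subst hx0
      rw [eq_comm, neg_eq_zero] at h2
      exact h2.symm
    exfalso
    have hneg : ∀ ζ ∈ ball (0 : ℂ) ρ₁, -ζ ∈ ball (0 : ℂ) ρ₁ := by
      intro ζ hζ
      simpa using hζ
    have hxx' : Z (-x) = Z x := by rw [h2, neg_neg, ← hxx, h2]
    have hx2 := hsq x hx
    have hgan : AnalyticAt ℂ (cubic w.1 w.2)^[p] (Z x) :=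
      (differentiable_iterate_cubic _ _ _).analyticAt _
    have hgd : deriv (cubic w.1 w.2)^[p] (Z x) ≠ 0 := by
      intro h0
      have h3 := (hgan.differentiableAt.hasDerivAt).comp x
        (hZd.differentiableAt (isOpen_ball.mem_nhds hx)).hasDerivAt
      have hψx := (h.diff.analyticAt (isOpen_ball.mem_nhds hx2))
      have h4 : HasDerivAt (fun ζ => ψ (ζ ^ 2)) (deriv ψ (x ^ 2) * (2 * x)) x := by
        have h5 := hψx.differentiableAt.hasDerivAt.comp x (hasDerivAt_pow 2 x)
        simp only [Nat.cast_ofNat, Nat.add_one_sub_one, pow_one] at h5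
        exact h5
      have h6 : (cubic w.1 w.2)^[p] ∘ Z =ᶠ[𝓝 x] fun ζ => ψ (ζ ^ 2) := by
        filter_upwards [isOpen_ball.mem_nhds hx] with ζ hζ using hZg ζ hζ
      have h7 := h6.deriv_eq
      rw [h3.deriv, h4.deriv, h0, zero_mul, eq_comm] at h7
      refine mul_ne_zero ?_ (mul_ne_zero two_ne_zero hx0) h7
      exact hψx.deriv_ne_zero_of_injOn (isOpen_ball.mem_nhds hx2) hinj
    obtain ⟨r, hr, φ, -, -, -, V, -, hVo, hxV, hV⟩ := exists_local_inverse_complex hgan hgd univ_mem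
    have hZc : ContinuousAt Z x := (hZd.differentiableAt (isOpen_ball.mem_nhds hx)).continuousAt
    have hZd' : DifferentiableOn ℂ (fun ζ => Z (-ζ)) (ball 0 ρ₁) := hZd.comp (by fun_prop) hneg
    have hZc' : ContinuousAt (fun ζ => Z (-ζ)) x :=
      (hZd'.differentiableAt (isOpen_ball.mem_nhds hx)).continuousAt
    have hev : Z =ᶠ[𝓝 x] fun ζ => Z (-ζ) := by
      filter_upwards [hZc.eventually_mem (hVo.mem_nhds hxV),
        hZc'.eventually_mem (hVo.mem_nhds (by rwa [hxx'])), isOpen_ball.mem_nhds hx]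
        with ζ h3 h4 hζ
      have h5 : (cubic w.1 w.2)^[p] (Z ζ) = (cubic w.1 w.2)^[p] (Z (-ζ)) := by
        rw [hZg _ hζ, hZg _ (hneg ζ hζ), neg_sq]
      rw [← (hV _ h3).2, ← (hV _ h4).2, h5]
    have hall : EqOn Z (fun ζ => Z (-ζ)) (ball 0 ρ₁) :=
      (hZd.analyticOnNhd isOpen_ball).eqOn_of_preconnected_of_eventuallyEq
      (hZd'.analyticOnNhd isOpen_ball) (convex_ball _ _).isPreconnected hx hev
    have h10 : deriv Z 0 = -deriv Z 0 := by
      have h11 : Z =ᶠ[𝓝 0] fun ζ => Z (-ζ) := hall.eventuallyEq_of_mem hn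
      have h12 : deriv (fun ζ => Z (-ζ)) 0 = -deriv Z 0 := by
        rw [deriv_comp_neg Z 0, neg_zero]
      rw [← h12]
      exact h11.deriv_eq
    exact hZderiv_ne (by linear_combination h10 / 2)

end extend

section surj
variable {p l : ℕ} {w : ℂ × ℂ}

theorem InjOn.isOpen_image_of_differentiableOn {ψ : ℂ → ℂ} {U : Set ℂ} (hinj : InjOn ψ U)
    (hd : DifferentiableOn ℂ ψ U) {V : Set ℂ} (hVU : V ⊆ U) (hV : IsOpen V) : IsOpen (ψ '' V) := by
  rw [isOpen_iff_mem_nhds]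
  rintro _ ⟨z, hz, rfl⟩
  have hVn := hV.mem_nhds hz
  have ha : AnalyticAt ℂ ψ z := (hd.mono hVU).analyticAt hVn
  rcases ha.eventually_constant_or_nhds_le_map_nhds with h | h
  · exfalso
    have h1 : ∀ᶠ x in 𝓝[≠] z, False := by
      filter_upwards [mem_nhdsWithin_of_mem_nhds h, mem_nhdsWithin_of_mem_nhds hVn,
        self_mem_nhdsWithin] with x h1 h2 h3
      exact h3 (hinj (hVU h2) (hVU hz) h1)
    exact (NeBot.ne inferInstance : 𝓝[≠] z ≠ ⊥) (by simpa using h1)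
  · exact h (image_mem_map hVn)

theorem IsLin.exists_preimage {ψ : ℂ → ℂ} (h : IsLin p w 1 ψ) (hinj : InjOn ψ (ball 0 1))
    (hp : 1 ≤ p) (hw : w ∈ Sp p) {i : ℕ} (hi : i ≤ p) {z : ℂ}
    (hz : z ∈ fatouComponent (cubic w.1 w.2) ((cubic w.1 w.2)^[i] w.1)) :
    ∃ ζ ∈ ball (0 : ℂ) 1, (cubic w.1 w.2)^[i] (ψ ζ) = z := by
  set f := cubic w.1 w.2 with hf
  set T := f^[i] '' (ψ '' ball 0 1) with hT
  have hfo : ∀ n, IsOpenMap f^[n] := fun n => by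
    induction n with
    | zero => exact IsOpenMap.id
    | succ n ih => rw [iterate_succ]; exact ih.comp (isOpenMap_cubic _ _)
  have hTo : IsOpen T :=
    hfo i _ (InjOn.isOpen_image_of_differentiableOn hinj h.diff Subset.rfl isOpen_ball)
  have hsub : fatouComponent f (f^[i] w.1) ⊆ T := by
    refine IsPreconnected.subset_of_closure_inter_subset isPreconnected_connectedComponentIn hTo
      ⟨f^[i] w.1, iterate_mem_fatouComponent_self hp hw hi, mem_image_of_mem _
        ⟨0, h.zero_mem, h.zero⟩⟩ ?_
    rintro y ⟨hyT, hyU⟩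
    have hV : IsOpen (ψ '' ball 0 (1 / 2)) := InjOn.isOpen_image_of_differentiableOn hinj h.diff
      (ball_subset_ball (by norm_num)) isOpen_ball
    have hcV : w.1 ∈ ψ '' ball 0 (1 / 2) := ⟨0, mem_ball_self (by norm_num), h.zero⟩
    have ht := tendsto_iterate_of_mem_fatouComponent hp hw hi hyU
    have ht2 : Tendsto (fun n => f^[p - i] ((f^[p])^[n] y)) atTop (𝓝 w.1) := by
      have h1 := ((continuous_iterate_cubic w.1 w.2 (p - i)).tendsto _).comp ht
      rw [← iterate_add_apply, Nat.sub_add_cancel hi, hw.1] at h1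
      exact h1
    obtain ⟨n, hn⟩ := (ht2.eventually (hV.mem_nhds hcV)).exists
    have hcont : Continuous fun y => f^[p - i] ((f^[p])^[n] y) :=
      (continuous_iterate_cubic w.1 w.2 _).comp ((continuous_iterate_cubic w.1 w.2 _).iterate n)
    have hev : ∀ᶠ x in 𝓝 y, f^[p - i] ((f^[p])^[n] x) ∈ ψ '' ball 0 (1 / 2) :=
      hcont.continuousAt.eventually_mem (hV.mem_nhds hn)
    set K : Set ℂ := {ζ | ‖ζ‖ ^ 2 ^ (n + 1) ≤ 1 / 2} with hK
    have hKb : K ⊆ ball 0 1 := by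
      intro ζ hζ
      have hζ : ‖ζ‖ ^ 2 ^ (n + 1) ≤ 1 / 2 := hζ
      rw [mem_ball_zero_iff]
      by_contra! h1
      have := one_le_pow₀ h1 (n := 2 ^ (n + 1))
      linarith
    have hKc : IsCompact K := by
      refine (isCompact_closedBall (0 : ℂ) 1).of_isClosed_subset ?_
        (hKb.trans ball_subset_closedBall)
      exact isClosed_le (by fun_prop) continuous_const
    have hKi : IsCompact (f^[i] '' (ψ '' K)) :=
      (hKc.image_of_continuousOn (h.diff.continuousOn.mono hKb)).image
        (continuous_iterate_cubic w.1 w.2 i)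
    suffices y ∈ closure (f^[i] '' (ψ '' K)) by
      rw [hKi.isClosed.closure_eq] at this
      exact image_mono (image_mono hKb) this
    rw [mem_closure_iff_frequently] at hyT ⊢
    refine (hyT.and_eventually hev).mono ?_
    rintro _ ⟨⟨_, ⟨ζ, hζ, rfl⟩, rfl⟩, ζ', hζ', he⟩
    refine mem_image_of_mem _ (mem_image_of_mem _ ?_)
    have e2 : f^[p - i] ((f^[p])^[n] (f^[i] (ψ ζ))) = (f^[p])^[n + 1] (ψ ζ) := by
      have e3 : p - i + p * n + i = p * (n + 1) := by rw [mul_add]; omega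
      rw [← iterate_mul, ← iterate_mul, ← iterate_add_apply, ← iterate_add_apply, e3]
    rw [e2, h.iterate _ hζ] at he
    have h3 := hinj (ball_subset_ball (by norm_num) hζ')
      (pow_mem_ball_zero le_rfl hζ (by positivity)) he
    rw [mem_ball_zero_iff, h3, norm_pow] at hζ'
    exact hζ'.le
  obtain ⟨_, ⟨ζ, hζ, rfl⟩, h1⟩ := hsub hz
  exact ⟨ζ, hζ, h1⟩

theorem exists_isLin_one (hp : 1 ≤ p) (hw : w ∈ Sp p)
    (hS : ∀ t < (1 : ℝ), ∃ ρ > t, ∃ ψ, IsLin p w ρ ψ ∧ InjOn ψ (ball 0 ρ)) :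
    ∃ ψ, IsLin p w 1 ψ ∧ InjOn ψ (ball 0 1) := by
  have hS' : ∀ t : ℝ, ∃ ρ ψ, t < 1 → t < ρ ∧ IsLin p w ρ ψ ∧ InjOn ψ (ball 0 ρ) := by
    intro t
    by_cases ht : t < 1
    · obtain ⟨ρ, hρ, ψ, h⟩ := hS t ht
      exact ⟨ρ, ψ, fun _ => ⟨hρ, h⟩⟩
    · exact ⟨0, 0, fun h => absurd h ht⟩
  choose ρ ψ hψ using hS'
  set Ψ : ℂ → ℂ := fun ζ => ψ ‖ζ‖ ζ with hΨ
  have heq : ∀ t < 1, EqOn Ψ (ψ t) (ball 0 (ρ t)) := by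
    intro t ht ζ hζ
    obtain ⟨h1, h2, -⟩ := hψ t ht
    have hζ1 : ‖ζ‖ < 1 := (mem_ball_zero_iff.mp hζ).trans_le h2.le_one
    obtain ⟨h3, h4, -⟩ := hψ ‖ζ‖ hζ1
    have hζ2 : ζ ∈ ball (0 : ℂ) (ρ ‖ζ‖) := mem_ball_zero_iff.mpr h3
    rcases le_total (ρ t) (ρ ‖ζ‖) with h5 | h5
    · exact (h2.eqOn h4 hp hw h5 hζ).symm
    · exact h4.eqOn h2 hp hw h5 hζ2
  have hmem : ∀ t < 1, ∀ ζ : ℂ, ‖ζ‖ ≤ t → ζ ∈ ball (0 : ℂ) (ρ t) := fun t ht ζ hζ =>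
    mem_ball_zero_iff.mpr (hζ.trans_lt (hψ t ht).1)
  have hev : ∀ ζ ∈ ball (0 : ℂ) 1, Ψ =ᶠ[𝓝 ζ] ψ ‖ζ‖ := fun ζ hζ => by
    have hζ1 := mem_ball_zero_iff.mp hζ
    exact (heq _ hζ1).eventuallyEq_of_mem (isOpen_ball.mem_nhds (hmem _ hζ1 ζ le_rfl))
  have h0 : (0 : ℂ) ∈ ball (0 : ℂ) 1 := mem_ball_self one_pos
  obtain ⟨-, h1, -⟩ := hψ ‖(0 : ℂ)‖ (by simp)
  refine ⟨Ψ, ⟨one_pos, le_rfl, fun ζ hζ => ?_, h1.zero, ?_, fun ζ hζ => ?_⟩, fun x hx y hy hxy => ?_⟩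
  · have hζ1 := mem_ball_zero_iff.mp hζ
    have := (hψ _ hζ1).2.1.diff.differentiableAt (isOpen_ball.mem_nhds (hmem _ hζ1 ζ le_rfl))
    exact (this.congr_of_eventuallyEq (hev ζ hζ)).differentiableWithinAt
  · rw [(hev 0 h0).deriv_eq]
    exact h1.deriv_ne
  · have hζ1 := mem_ball_zero_iff.mp hζ
    have h2 := hmem _ hζ1 ζ le_rfl
    have h3 := (hψ _ hζ1).2.1
    rw [heq _ hζ1 h2, heq _ hζ1 (pow_mem_ball_zero h3.le_one h2 two_ne_zero)]
    exact h3.conj ζ h2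
  · have hm : max ‖x‖ ‖y‖ < 1 := max_lt (mem_ball_zero_iff.mp hx) (mem_ball_zero_iff.mp hy)
    have h2 := hmem _ hm x (le_max_left _ _)
    have h3 := hmem _ hm y (le_max_right _ _)
    rw [heq _ hm h2, heq _ hm h3] at hxy
    exact (hψ _ hm).2.2 h2 h3 hxy

/-- The position of the free critical value in the linearizing coordinate. -/
structure IsPos (p l : ℕ) (w : ℂ × ℂ) (ρ : ℝ) (ψ : ℂ → ℂ) (x : ℂ) : Prop where
  lin : IsLin p w ρ ψ
  inj : InjOn ψ (ball 0 ρ)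
  ne_zero : x ≠ 0
  norm_le : ‖x‖ ≤ ρ ^ 2
  norm_lt : ‖x‖ < ρ
  eq : ψ x = (cubic w.1 w.2)^[p - l] (-w.1)

theorem TypeB.exists_isPos (hB : TypeB p l w) (hnc : (cubic w.1 w.2)^[l] w.1 ≠ -w.1) :
    ∃ ρ ψ x, IsPos p l w ρ ψ x := by
  have hp := hB.one_le_p
  have hw := hB.mem
  set v := (cubic w.1 w.2)^[p - l] (-w.1) with hv
  by_contra hno
  have hno : ∀ ρ ψ x, ¬ IsPos p l w ρ ψ x := fun ρ ψ x h => hno ⟨ρ, ψ, x, h⟩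
  obtain ⟨ρ₀, ψ₀, h₀, hi₀⟩ := exists_isLin_injOn hp hw (hB.critCoeff_ne_zero hnc)
  have hstep : ∀ ρ ψ, IsLin p w ρ ψ → InjOn ψ (ball 0 ρ) →
      ∃ ψ', IsLin p w √ρ ψ' ∧ InjOn ψ' (ball 0 √ρ) := by
    intro ρ ψ h hi
    have hsq : √ρ ^ 2 = ρ := Real.sq_sqrt h.pos.le
    have hρs : ρ ≤ √ρ := by
      rw [Real.le_sqrt h.pos.le h.pos.le]
      nlinarith [h.pos, h.le_one]
    refine h.exists_extension hB hnc hi hρs (Real.sqrt_le_one.mpr h.le_one) hsq.le ?_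
    by_contra! hcon
    obtain ⟨ζ, hζ, hζ0, hζv⟩ := hcon
    rw [mem_ball_zero_iff] at hζ
    have hx : ‖ζ ^ 2‖ < ρ := by
      rw [norm_pow, ← hsq]
      gcongr
    have hx0 : ζ ^ 2 ≠ 0 := pow_ne_zero 2 hζ0
    rcases le_or_gt (‖ζ ^ 2‖) (ρ ^ 2) with h1 | h1
    · exact hno ρ ψ (ζ ^ 2) ⟨h, hi, hx0, h1, hx, hζv⟩
    · have hn0 : 0 < ‖ζ‖ := norm_pos_iff.mpr hζ0
      rw [norm_pow] at h1 hx
      have hρn : ρ ≤ ‖ζ‖ := (lt_of_pow_lt_pow_left₀ 2 hn0.le h1).le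
      have hn1 : ‖ζ‖ < 1 := hζ.trans_le (Real.sqrt_le_one.mpr h.le_one)
      obtain ⟨ψ', h', hi'⟩ := h.exists_extension hB hnc hi (ρ₁ := ‖ζ‖) hρn hn1.le hx.le (by
        intro ξ hξ _ hξv
        rw [mem_ball_zero_iff] at hξ
        have h4 : ‖ξ‖ ^ 2 < ‖ζ‖ ^ 2 := by gcongr
        have h2 := hi (mem_ball_zero_iff.mpr ((norm_pow ξ 2).trans_lt (h4.trans hx)))
          (mem_ball_zero_iff.mpr ((norm_pow ζ 2).trans_lt hx)) (hξv.trans hζv.symm)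
        have h3 := congrArg norm h2
        rw [norm_pow, norm_pow] at h3
        exact h4.ne h3)
      refine hno ‖ζ‖ ψ' (ζ ^ 2) ⟨h', hi', hx0, by rw [norm_pow], ?_, ?_⟩
      · rw [norm_pow]; nlinarith
      · rw [← h.eqOn h' hp hw hρn (mem_ball_zero_iff.mpr (by rwa [norm_pow])), hζv]
  have hiter : ∀ n : ℕ, ∃ ρ ψ, IsLin p w ρ ψ ∧ InjOn ψ (ball 0 ρ) ∧ ρ ^ 2 ^ n = ρ₀ := by
    intro n
    induction n with
    | zero => exact ⟨ρ₀, ψ₀, h₀, hi₀, by simp⟩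
    | succ n ih =>
      obtain ⟨ρ, ψ, h, hi, hρ⟩ := ih
      obtain ⟨ψ', h', hi'⟩ := hstep ρ ψ h hi
      refine ⟨√ρ, ψ', h', hi', ?_⟩
      rw [pow_succ', pow_mul, Real.sq_sqrt h.pos.le, hρ]
  obtain ⟨ψ, h, hi⟩ := exists_isLin_one hp hw (by
    intro t ht
    rcases le_or_gt t 0 with ht0 | ht0
    · exact ⟨ρ₀, ht0.trans_lt h₀.pos, ψ₀, h₀, hi₀⟩
    have h1 : Tendsto (fun n : ℕ => t ^ 2 ^ n) atTop (𝓝 0) :=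
      (tendsto_pow_atTop_nhds_zero_of_lt_one ht0.le ht).comp
        (tendsto_pow_atTop_atTop_of_one_lt one_lt_two)
    obtain ⟨n, hn⟩ := (h1.eventually_lt_const h₀.pos).exists
    obtain ⟨ρ, ψ, h, hi, hρ⟩ := hiter n
    rw [← hρ] at hn
    exact ⟨ρ, lt_of_pow_lt_pow_left₀ _ h.pos.le hn, ψ, h, hi⟩)
  obtain ⟨x, hx, hxv⟩ := h.exists_preimage hi hp hw (Nat.zero_le p) (z := v) hB.iterate_neg_mem
  have hx1 := mem_ball_zero_iff.mp hx
  rw [iterate_zero, id] at hxv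
  have hx0 : x ≠ 0 := by
    rintro rfl
    rw [h.zero] at hxv
    obtain ⟨ζ, hζ, hζc⟩ := h.exists_preimage hi hp hw hB.lt.le hB.crit
    have h1 : ψ (ζ ^ 2) = ψ 0 := by
      have h4 : (cubic w.1 w.2)^[p] (ψ ζ) = v := by
        rw [hv, ← hζc, ← iterate_add_apply, Nat.sub_add_cancel hB.lt.le]
      rw [← h.conj ζ hζ, h.zero, h4, hxv]
    have h2 := hi (pow_mem_ball_zero le_rfl hζ two_ne_zero) h.zero_mem h1
    have h3 : ζ = 0 := pow_eq_zero_iff two_ne_zero |>.mp h2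
    rw [h3, h.zero] at hζc
    exact hnc hζc
  exact hno 1 ψ x ⟨h, hi, hx0, by rw [one_pow]; exact hx1.le, hx1, hxv⟩

end surj

section position
variable {p l : ℕ} {w : ℂ × ℂ}

theorem IsPos.unique {ρ₁ ρ₂ : ℝ} {ψ₁ ψ₂ : ℂ → ℂ} {x₁ x₂ : ℂ} (h₁ : IsPos p l w ρ₁ ψ₁ x₁)
    (h₂ : IsPos p l w ρ₂ ψ₂ x₂) (hp : 1 ≤ p) (hw : w ∈ Sp p) : x₁ = x₂ := by
  rcases le_total ρ₁ ρ₂ with h | h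
  · have h3 := h₁.lin.eqOn h₂.lin hp hw h (mem_ball_zero_iff.mpr h₁.norm_lt)
    exact h₂.inj (mem_ball_zero_iff.mpr (h₁.norm_lt.trans_le h)) (mem_ball_zero_iff.mpr h₂.norm_lt)
      (by rw [← h3, h₁.eq, h₂.eq])
  · have h3 := h₂.lin.eqOn h₁.lin hp hw h (mem_ball_zero_iff.mpr h₂.norm_lt)
    exact h₁.inj (mem_ball_zero_iff.mpr h₁.norm_lt) (mem_ball_zero_iff.mpr (h₂.norm_lt.trans_le h))
      (by rw [← h3, h₁.eq, h₂.eq])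

open Classical in
/-- The Böttcher position of the free critical point: the Böttcher coordinate of
`f^(p-l)(-c)` near `c`, and `0` when it is not defined. -/
noncomputable def posMap (p l : ℕ) (w : ℂ × ℂ) : ℂ :=
  if h : ∃ x ρ ψ, IsPos p l w ρ ψ x then h.choose else 0

theorem IsPos.posMap_eq {ρ : ℝ} {ψ : ℂ → ℂ} {x : ℂ} (h : IsPos p l w ρ ψ x)
    (hp : 1 ≤ p) (hw : w ∈ Sp p) : posMap p l w = x := by
  have h1 : ∃ x ρ ψ, IsPos p l w ρ ψ x := ⟨x, ρ, ψ, h⟩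
  rw [posMap, dif_pos h1]
  obtain ⟨ρ', ψ', h2⟩ := h1.choose_spec
  exact h2.unique h hp hw

theorem TypeB.posMap_eq_zero (hB : TypeB p l w) (hc : (cubic w.1 w.2)^[l] w.1 = -w.1) :
    posMap p l w = 0 := by
  rw [posMap, dif_neg]
  rintro ⟨x, ρ, ψ, h⟩
  exact h.lin.critCoeff_ne_zero hB.one_le_p hB.mem (hB.critCoeff_eq_zero hc)

theorem TypeB.exists_isPos_posMap (hB : TypeB p l w) (hnc : (cubic w.1 w.2)^[l] w.1 ≠ -w.1) :
    ∃ ρ ψ, IsPos p l w ρ ψ (posMap p l w) := by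
  obtain ⟨ρ, ψ, x, h⟩ := hB.exists_isPos hnc
  rw [h.posMap_eq hB.one_le_p hB.mem]
  exact ⟨ρ, ψ, h⟩

theorem TypeB.posMap_eq_zero_iff (hB : TypeB p l w) :
    posMap p l w = 0 ↔ (cubic w.1 w.2)^[l] w.1 = -w.1 := by
  refine ⟨fun h => ?_, hB.posMap_eq_zero⟩
  by_contra hnc
  obtain ⟨ρ, ψ, h1⟩ := hB.exists_isPos_posMap hnc
  exact h1.ne_zero h

theorem TypeB.norm_posMap_lt_one (hB : TypeB p l w) : ‖posMap p l w‖ < 1 := by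
  by_cases hc : (cubic w.1 w.2)^[l] w.1 = -w.1
  · rw [hB.posMap_eq_zero hc]; simp
  · obtain ⟨ρ, ψ, h1⟩ := hB.exists_isPos_posMap hc
    exact h1.norm_lt.trans_le h1.lin.le_one

theorem deriv_iterate_cubic (c a z : ℂ) (n : ℕ) : HasDerivAt (cubic c a)^[n]
    (∏ j ∈ Finset.range n, 3 * (((cubic c a)^[j] z) ^ 2 - c ^ 2)) z := by
  induction n with
  | zero => simpa using hasDerivAt_id z
  | succ n ih =>
    rw [iterate_succ', Finset.prod_range_succ, mul_comm]
    exact (hasDerivAt_cubic c a _).comp z ih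

theorem cubic_neg (c a : ℂ) : cubic (-c) a = cubic c a := by
  ext z; simp [cubic]

theorem iterate_sub_iterate_neg (n : ℕ) (c a z : ℂ) :
    (cubic c a)^[n + 1] z - (cubic c a)^[n + 1] (-c) = (z + c) ^ 2 * critQuot n (-c) a z := by
  rw [← cubic_neg, iterate_sub_iterate_crit, sub_neg_eq_add]

theorem exists_local_inverse_injOn {ψ : ℂ → ℂ} {ρ : ℝ} (hd : DifferentiableOn ℂ ψ (ball 0 ρ))
    (hinj : InjOn ψ (ball 0 ρ)) : ∃ φ : ℂ → ℂ, AnalyticOnNhd ℂ φ (ψ '' ball 0 ρ) ∧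
      ∀ ζ ∈ ball (0 : ℂ) ρ, φ (ψ ζ) = ζ := by
  have hl : ∀ ζ ∈ ball (0 : ℂ) ρ, invFunOn ψ (ball 0 ρ) (ψ ζ) = ζ := hinj.leftInvOn_invFunOn
  refine ⟨invFunOn ψ (ball 0 ρ), ?_, hl⟩
  rintro _ ⟨ζ, hζ, rfl⟩
  have hn := isOpen_ball.mem_nhds hζ
  have ha := hd.analyticAt hn
  obtain ⟨r, hr, φ, hφ, -, h1, -⟩ := exists_local_inverse_complex ha
    (ha.deriv_ne_zero_of_injOn hn hinj) hn
  have hr' : ball (ψ ζ) r ∈ 𝓝 (ψ ζ) := ball_mem_nhds _ hr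
  refine (hφ.analyticAt hr').congr ?_
  filter_upwards [hr'] with y hy
  obtain ⟨h2, h3⟩ := h1 y hy
  rw [← hl _ h2, h3]

theorem TypeB.exists_isBottcherAt_of_ne (hB : TypeB p l w)
    (hnc : (cubic w.1 w.2)^[l] w.1 ≠ -w.1) : ∃ B U d,
      IsBottcherAt ((cubic w.1 w.2)^[p]) ((cubic w.1 w.2)^[l] w.1) B U d ∧
        -w.1 ∈ U ∧ posMap p l w = B (-w.1) := by
  obtain ⟨ρ, ψ, h⟩ := hB.exists_isPos_posMap hnc
  obtain ⟨φ, hφ, hφψ⟩ := exists_local_inverse_injOn h.lin.diff h.inj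
  set f := cubic w.1 w.2 with hf
  have hx := mem_ball_zero_iff.mpr h.norm_lt
  have hlp := hB.lt.le
  have hfc : f^[p - l] (f^[l] w.1) = w.1 := by
    rw [← iterate_add_apply, Nat.sub_add_cancel hlp]; exact hB.mem.1
  have hW : IsOpen (ψ '' ball 0 ρ) :=
    InjOn.isOpen_image_of_differentiableOn h.inj h.lin.diff Subset.rfl isOpen_ball
  have hU : IsOpen (f^[p - l] ⁻¹' (ψ '' ball 0 ρ)) := hW.preimage (continuous_iterate_cubic _ _ _)
  have hmem : f^[l] w.1 ∈ f^[p - l] ⁻¹' (ψ '' ball 0 ρ) := ⟨0, h.lin.zero_mem, by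
    rw [hfc, h.lin.zero]⟩
  have hcomm : ∀ z, f^[p - l] (f^[p] z) = f^[p] (f^[p - l] z) := fun z => by
    rw [← iterate_add_apply, ← iterate_add_apply, add_comm]
  have hd := deriv_iterate_cubic w.1 w.2 (f^[l] w.1) (p - l)
  obtain ⟨r, hr, φ', -, -, -, V, hVU, hV, hmV, hV'⟩ := exists_local_inverse_complex
    ((differentiable_iterate_cubic w.1 w.2 (p - l)).analyticAt (f^[l] w.1)) (by
      rw [hd.deriv]
      refine Finset.prod_ne_zero_iff.mpr fun j hj => ?_
      rw [Finset.mem_range] at hj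
      rw [← hf, ← iterate_add_apply]
      have h3 : (1 : ℕ) ≤ l := hB.one_le
      exact mul_ne_zero three_ne_zero (sub_ne_zero.mpr
        (hB.iterate_sq_ne (by omega) (by omega) hnc))) (hU.mem_nhds hmem)
  refine ⟨φ ∘ f^[p - l], f^[p - l] ⁻¹' (ψ '' ball 0 ρ), 2, ⟨hU, hmem, ?_, ?_, ?_, le_rfl, ?_, ?_⟩,
    ?_, ?_⟩
  · rintro z ⟨ζ, hζ, hz⟩
    refine ⟨ζ ^ 2, pow_mem_ball_zero h.lin.le_one hζ two_ne_zero, ?_⟩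
    rw [hcomm, ← hz, h.lin.conj ζ hζ]
  · intro z hz
    exact (hφ _ hz).comp ((differentiable_iterate_cubic w.1 w.2 (p - l)).analyticAt z)
  · rw [comp_apply, hfc, ← h.lin.zero, hφψ _ h.lin.zero_mem]
  · rintro z ⟨ζ, hζ, hz⟩
    rw [comp_apply, comp_apply, hcomm, ← hz, hφψ _ hζ, h.lin.conj ζ hζ,
      hφψ _ (pow_mem_ball_zero h.lin.le_one hζ two_ne_zero)]
  · refine ⟨V, hVU, hV, hmV, fun y hy z hz hyz => ?_⟩
    obtain ⟨ζ, hζ, e1⟩ := hVU hy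
    obtain ⟨ξ, hξ, e2⟩ := hVU hz
    rw [comp_apply, comp_apply, ← e1, ← e2, hφψ _ hζ, hφψ _ hξ] at hyz
    rw [← (hV' y hy).2, ← (hV' z hz).2]
    change φ' (f^[p - l] y) = φ' (f^[p - l] z)
    rw [← e1, ← e2, hyz]
  · exact ⟨_, hx, h.eq⟩
  · rw [comp_apply, ← h.eq, hφψ _ hx]

theorem critQuot_crit (n : ℕ) (c a : ℂ) : critQuot n c a c =
    3 * c * ∏ j ∈ Finset.range n, (3 * (((cubic c a)^[j + 1] c) ^ 2 - c ^ 2)) := by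
  rw [critQuot]
  congr 1
  · ring
  · exact Finset.prod_congr rfl fun j _ => by ring

theorem TypeB.iterate_sq_ne_of_ne (hB : TypeB p l w) {j : ℕ} (hj0 : 1 ≤ j) (hj : j < p)
    (hjl : j ≠ l) : ((cubic w.1 w.2)^[j] w.1) ^ 2 ≠ w.1 ^ 2 := by
  rw [Ne, sq_eq_sq_iff_eq_or_eq_neg]
  rintro (h | h)
  · exact hB.mem.2 j hj0 hj h
  · exact hjl (hB.eq_of_iterate_eq_neg hj h)

theorem TypeB.critQuot_crit_ne_zero (hB : TypeB p l w) {n : ℕ} (hn : n + 1 ≤ l) :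
    critQuot n w.1 w.2 w.1 ≠ 0 := by
  rw [critQuot_crit]
  refine mul_ne_zero (mul_ne_zero three_ne_zero hB.fst_ne_zero)
    (Finset.prod_ne_zero_iff.mpr fun j hj => mul_ne_zero three_ne_zero (sub_ne_zero.mpr ?_))
  rw [Finset.mem_range] at hj
  have := hB.lt
  exact hB.iterate_sq_ne_of_ne (by omega) (by omega) (by omega)

theorem TypeB.critQuot_neg_ne_zero (hB : TypeB p l w) (hc : (cubic w.1 w.2)^[l] w.1 = -w.1)
    {n : ℕ} (hn : n + 1 + l ≤ p) : critQuot n (-w.1) w.2 (-w.1) ≠ 0 := by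
  rw [critQuot_crit]
  refine mul_ne_zero (mul_ne_zero three_ne_zero (neg_ne_zero.mpr hB.fst_ne_zero))
    (Finset.prod_ne_zero_iff.mpr fun j hj => mul_ne_zero three_ne_zero (sub_ne_zero.mpr ?_))
  rw [Finset.mem_range] at hj
  rw [cubic_neg, neg_sq]
  rw [← hc]
  rw [← iterate_add_apply]
  exact hB.iterate_sq_ne_of_ne (by omega) (by omega) (by omega)

theorem TypeB.exists_isBottcherAt (hB : TypeB p l w) : ∃ B U d,
      IsBottcherAt ((cubic w.1 w.2)^[p]) ((cubic w.1 w.2)^[l] w.1) B U d ∧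
        -w.1 ∈ U ∧ posMap p l w = B (-w.1) := by
  by_cases hc : (cubic w.1 w.2)^[l] w.1 = -w.1
  swap
  · exact hB.exists_isBottcherAt_of_ne hc
  rw [hB.posMap_eq_zero hc, hc]
  set f := cubic w.1 w.2 with hf
  have hlp := hB.lt
  have hl1 := hB.one_le
  have hfc : f^[p - l] (-w.1) = w.1 := by
    nth_rewrite 1 [← hc]
    rw [← iterate_add_apply, Nat.sub_add_cancel hlp.le]; exact hB.mem.1
  obtain ⟨δ, hδ, B, hBd, hB0, hB', hm, hconj⟩ := exists_local_bottcher (d := 4) (G := f^[p])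
    (z₀ := -w.1) (by norm_num)
    (u := fun z => critQuot (p - l - 1) (-w.1) w.2 z ^ 2 * critQuot (l - 1) w.1 w.2 (f^[p - l] z))
    (by
      have h1 : Differentiable ℂ (critQuot (p - l - 1) (-w.1) w.2) :=
        (contDiff_critQuot_right _ _ _).differentiable one_ne_zero
      have h2 : Differentiable ℂ (critQuot (l - 1) w.1 w.2) :=
        (contDiff_critQuot_right _ _ _).differentiable one_ne_zero
      exact (h1.pow 2).mul (h2.comp (differentiable_iterate_cubic w.1 w.2 (p - l))))
    (by
      simp only [hfc]
      exact mul_ne_zero (pow_ne_zero 2 (hB.critQuot_neg_ne_zero hc (by omega)))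
        (hB.critQuot_crit_ne_zero (by omega)))
    (fun z => by
      have h1 := iterate_sub_iterate_neg (p - l - 1) w.1 w.2 z
      have h2 := iterate_sub_iterate_crit (l - 1) w.1 w.2 (f^[p - l] z)
      rw [Nat.sub_add_cancel (by omega), ← hf] at h1 h2
      rw [hfc] at h1
      rw [hc, h1, ← iterate_add_apply, Nat.add_sub_cancel' hlp.le] at h2
      linear_combination h2)
  have hn : ball (-w.1) δ ∈ 𝓝 (-w.1) := ball_mem_nhds _ hδ
  have ha := hBd.analyticAt hn
  obtain ⟨r, hr, φ', -, -, -, V, hVU, hV, hmV, hV'⟩ := exists_local_inverse_complex ha hB' hn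
  refine ⟨B, ball (-w.1) δ, 4, ⟨isOpen_ball, mem_ball_self hδ, hm,
    fun z hz => hBd.analyticAt (isOpen_ball.mem_nhds hz), hB0, by norm_num, hconj,
    V, hVU, hV, hmV, fun y hy z hz hyz => ?_⟩, mem_ball_self hδ, hB0.symm⟩
  rw [← (hV' y hy).2, ← (hV' z hz).2, hyz]

end position

section estimates
variable {p l : ℕ} {w : ℂ × ℂ}

/-- The first return of the free critical point to the Fatou component of `c`. -/
noncomputable def critReturn (p l n : ℕ) (w : ℂ × ℂ) : ℂ :=
  ((cubic w.1 w.2)^[p])^[n] ((cubic w.1 w.2)^[p - l] (-w.1))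

theorem critReturn_eq (n : ℕ) :
    critReturn p l n w = (cubic w.1 w.2)^[p * n + (p - l)] (-w.1) := by
  rw [critReturn, ← iterate_mul, ← iterate_add_apply]

theorem contDiff_critReturn (p l n : ℕ) {k : WithTop ℕ∞} : ContDiff ℂ k (critReturn p l n) := by
  have h : critReturn p l n = (fun q : (ℂ × ℂ) × ℂ => (cubic q.1.1 q.1.2)^[p * n + (p - l)] q.2) ∘
      fun w : ℂ × ℂ => (w, -w.1) := by
    ext w; exact critReturn_eq n
  rw [h]
  exact (contDiff_cubic_iterate _).comp (contDiff_id.prodMk contDiff_fst.neg)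

theorem IsPos.critReturn_eq {ρ : ℝ} {ψ : ℂ → ℂ} {x : ℂ} (h : IsPos p l w ρ ψ x) (n : ℕ) :
    critReturn p l n w = ψ (x ^ 2 ^ n) := by
  rw [critReturn, ← h.eq, h.lin.iterate n (mem_ball_zero_iff.mpr h.norm_lt)]

theorem TypeB.critReturn_of_eq (hB : TypeB p l w) (hc : (cubic w.1 w.2)^[l] w.1 = -w.1) (n : ℕ) :
    critReturn p l n w = w.1 := by
  have h1 : (cubic w.1 w.2)^[p - l] (-w.1) = w.1 := by
    rw [← hc, ← iterate_add_apply, Nat.sub_add_cancel hB.lt.le]; exact hB.mem.1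
  rw [critReturn, h1]
  exact iterate_fixed hB.mem.1 n

variable {R : ℝ} (hB : TypeB p l w) (hR : ∀ z ∈ filledJulia (cubic w.1 w.2), ‖z‖ ≤ R)
include hB hR

theorem TypeB.radius_nonneg : 0 ≤ R :=
  (norm_nonneg _).trans (hR w.1 (mem_filledJulia_of_tendsto (z₀ := w.1) hB.one_le_p (by
    have h1 : ∀ n, ((cubic w.1 w.2)^[p])^[n] w.1 = w.1 := fun n => iterate_fixed hB.mem.1 n
    simp only [h1]
    exact tendsto_const_nhds)))

theorem TypeB.norm_critReturn_sub_le (n : ℕ) :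
    ‖critReturn p l n w - w.1‖ ≤ 2 * R * ‖posMap p l w‖ ^ (2 ^ n - 1) := by
  have hR0 := hB.radius_nonneg hR
  by_cases hc : (cubic w.1 w.2)^[l] w.1 = -w.1
  · rw [hB.critReturn_of_eq hc, sub_self, norm_zero]; positivity
  obtain ⟨ρ, ψ, h⟩ := hB.exists_isPos_posMap hc
  set x := posMap p l w
  have hx0 : 0 < ‖x‖ := norm_pos_iff.mpr h.ne_zero
  have hx := mem_ball_zero_iff.mpr h.norm_lt
  rw [h.critReturn_eq]
  have h2n : 2 ^ n ≠ 0 := by positivity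
  refine (h.lin.norm_sub_le hB.one_le_p hR (pow_mem_ball_zero h.lin.le_one hx h2n)).trans ?_
  have h1 : ‖x‖ ^ 2 ^ n = ‖x‖ * ‖x‖ ^ (2 ^ n - 1) := (mul_pow_sub_one h2n _).symm
  rw [norm_pow, h1, ← mul_assoc, div_mul_eq_mul_div]
  gcongr
  rw [div_le_iff₀ h.lin.pos]
  gcongr
  exact h.norm_lt.le

theorem TypeB.norm_posMap_le : ‖posMap p l w‖ ≤ 4 * R ^ 2 * ‖critCoeff p w‖ ^ 2 := by
  have hR0 := hB.radius_nonneg hR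
  by_cases hc : (cubic w.1 w.2)^[l] w.1 = -w.1
  · rw [hB.posMap_eq_zero hc, norm_zero]; positivity
  obtain ⟨ρ, ψ, h⟩ := hB.exists_isPos_posMap hc
  have hρ := h.lin.pos
  have h1 := congrArg norm (h.lin.critCoeff_mul_deriv hB.one_le_p hB.mem)
  rw [norm_mul, norm_one] at h1
  have h2 := h.lin.norm_deriv_le hB.one_le_p hR
  have h3 : ρ ≤ 2 * R * ‖critCoeff p w‖ := by
    have h4 : 1 ≤ ‖critCoeff p w‖ * (2 * R / ρ) := h1.symm.le.trans (by gcongr)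
    rw [← mul_div_assoc, le_div_iff₀ hρ] at h4
    linarith
  calc ‖posMap p l w‖ ≤ ρ ^ 2 := h.norm_le
    _ ≤ (2 * R * ‖critCoeff p w‖) ^ 2 := by gcongr
    _ = _ := by ring

theorem TypeB.norm_critCoeff_mul_sub_le (n : ℕ) :
    ‖critCoeff p w * (critReturn p l n w - w.1) - posMap p l w ^ 2 ^ n‖ ≤
      4 * R * ‖critCoeff p w‖ * ‖posMap p l w‖ ^ (2 ^ (n + 1) - 1) := by
  have hR0 := hB.radius_nonneg hR
  by_cases hc : (cubic w.1 w.2)^[l] w.1 = -w.1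
  · rw [hB.critReturn_of_eq hc, hB.posMap_eq_zero hc, sub_self, mul_zero, zero_pow (by positivity),
      sub_zero, norm_zero]
    positivity
  obtain ⟨ρ, ψ, h⟩ := hB.exists_isPos_posMap hc
  set x := posMap p l w
  have hρ := h.lin.pos
  have hx := mem_ball_zero_iff.mpr h.norm_lt
  have h2n : 2 ^ n ≠ 0 := by positivity
  have h3 := h.lin.norm_sub_sub_le hB.one_le_p hR (pow_mem_ball_zero h.lin.le_one hx h2n)
  rw [h.critReturn_eq]
  have e1 : critCoeff p w * (ψ (x ^ 2 ^ n) - w.1) - x ^ 2 ^ n =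
      critCoeff p w * (ψ (x ^ 2 ^ n) - w.1 - x ^ 2 ^ n * deriv ψ 0) := by
    linear_combination (x ^ 2 ^ n) * h.lin.critCoeff_mul_deriv hB.one_le_p hB.mem
  have e2 : ‖x ^ 2 ^ n‖ ^ 2 = ‖x‖ * ‖x‖ ^ (2 ^ (n + 1) - 1) := by
    rw [mul_pow_sub_one (by positivity), norm_pow, ← pow_mul, ← pow_succ]
  rw [e1, norm_mul]
  rw [e2] at h3
  have h4 : 4 * R / ρ ^ 2 * (‖x‖ * ‖x‖ ^ (2 ^ (n + 1) - 1)) ≤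
      4 * R * ‖x‖ ^ (2 ^ (n + 1) - 1) := by
    rw [← mul_assoc, div_mul_eq_mul_div]
    gcongr
    rw [div_le_iff₀ (by positivity)]
    gcongr
    exact h.norm_le
  calc _ ≤ ‖critCoeff p w‖ * (4 * R * ‖x‖ ^ (2 ^ (n + 1) - 1)) := by gcongr; exact h3.trans h4
    _ = _ := by ring

end estimates

section closedness
variable {p l : ℕ}

theorem le_norm_iterate_sub_of_mem_Sp {w : ℂ × ℂ} (hw : w ∈ Sp p) {k : ℕ} (hk : 1 ≤ k)
    (hkp : k < p) {C : ℝ} (hC1 : 1 ≤ C)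
    (hC : ∀ z, ‖z - w.1‖ ≤ 1 → ‖critQuot (k - 1) w.1 w.2 z‖ ≤ C) :
    1 / (8 * C) ≤ ‖(cubic w.1 w.2)^[k] w.1 - w.1‖ := by
  by_contra! h2
  obtain ⟨F, hF⟩ : ∃ F, F = (cubic w.1 w.2)^[k] := ⟨_, rfl⟩
  obtain ⟨ε, hεd⟩ : ∃ ε, ε = ‖F w.1 - w.1‖ := ⟨_, rfl⟩
  rw [← hF, ← hεd] at h2
  have hC0 : 0 < C := by linarith
  have hCε : 8 * C * ε < 1 := by
    rw [lt_div_iff₀ (by positivity)] at h2; linarith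
  have hε0 : 0 ≤ ε := hεd ▸ norm_nonneg _
  have hε1 : ε ≤ 1 / 8 := by nlinarith
  have hquad : ∀ z, ‖z - w.1‖ ≤ 1 → ‖F z - F w.1‖ ≤ C * ‖z - w.1‖ ^ 2 := by
    intro z hz
    have h3 := iterate_sub_iterate_crit (k - 1) w.1 w.2 z
    rw [Nat.sub_add_cancel hk] at h3
    rw [hF, h3, norm_mul, norm_pow, mul_comm]
    gcongr
    exact hC z hz
  have hb : ∀ j, ‖F^[j] w.1 - w.1‖ ≤ 2 * ε := by
    intro j
    induction j with
    | zero => simpa using hε0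
    | succ j ih =>
      rw [iterate_succ_apply']
      have h3 := hquad _ (ih.trans (by linarith))
      have h4 : C * ‖F^[j] w.1 - w.1‖ ^ 2 ≤ C * (2 * ε) ^ 2 := by gcongr
      have h5 := norm_sub_le_norm_sub_add_norm_sub (F (F^[j] w.1)) (F w.1) w.1
      nlinarith
  have hper : F^[p] w.1 = w.1 := by
    rw [hF, ← iterate_mul, mul_comm, iterate_mul]
    exact iterate_fixed hw.1 k
  have h6 : ε ≤ C * (2 * ε) ^ 2 := by
    have h3 := hquad (F^[p - 1] w.1) ((hb _).trans (by linarith))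
    have h4 : F (F^[p - 1] w.1) = w.1 := by
      rw [← iterate_succ_apply' F, Nat.succ_eq_add_one, Nat.sub_add_cancel (by omega), hper]
    rw [h4, norm_sub_rev, ← hεd] at h3
    refine h3.trans ?_
    gcongr
    exact hb _
  have h7 : ε = 0 := by nlinarith
  have h8 := hεd.symm.trans h7
  rw [hF] at h8
  exact hw.2 k hk hkp (sub_eq_zero.mp (norm_eq_zero.mp h8))

theorem continuous_iterate_crit (k : ℕ) :
    Continuous fun w : ℂ × ℂ => (cubic w.1 w.2)^[k] w.1 := by
  have h : Continuous fun w : ℂ × ℂ => (w, w.1) := continuous_id.prodMk continuous_fst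
  have h1 := (continuous_cubic_iterate k).comp h
  simpa only [comp_def] using h1

theorem isClosed_Sp (p : ℕ) : IsClosed (Sp p) := by
  rw [← closure_subset_iff_isClosed]
  intro w₀ hw₀
  have hfr := mem_closure_iff_frequently.mp hw₀
  refine ⟨?_, ?_⟩
  · have hcl : IsClosed {w : ℂ × ℂ | (cubic w.1 w.2)^[p] w.1 = w.1} :=
      isClosed_eq (continuous_iterate_crit p) continuous_fst
    exact hcl.closure_subset_iff.mpr (fun w hw => hw.1) hw₀
  · intro k hk hkp hfix
    obtain ⟨C, hC1, hC⟩ := exists_trap (p := k) w₀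
    have hε : ∀ᶠ w : ℂ × ℂ in 𝓝 w₀, ‖(cubic w.1 w.2)^[k] w.1 - w.1‖ < 1 / (8 * C) := by
      have : ContinuousAt (fun w : ℂ × ℂ => ‖(cubic w.1 w.2)^[k] w.1 - w.1‖) w₀ :=
        ((continuous_iterate_crit k).sub continuous_fst).norm.continuousAt
      refine this.eventually_lt_const ?_
      simp only [hfix, sub_self, norm_zero]
      positivity
    obtain ⟨w, hw, h1, h2⟩ := (hfr.and_eventually (hC.and hε)).exists
    exact absurd (le_norm_iterate_sub_of_mem_Sp hw hk hkp hC1 h1) (not_le.mpr h2)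

theorem mem_hypLocus_of_tendsto (hl : l ≤ p) (hp : 1 ≤ p) {w : ℂ × ℂ} (hw : w ∈ Sp p)
    (h : Tendsto (fun n => critReturn p l n w) atTop (𝓝 w.1)) : w ∈ hypLocus p := by
  have hd : ∀ j < p, HasDerivAt (cubic w.1 w.2)^[p] 0 ((cubic w.1 w.2)^[j] w.1) := by
    intro j hj
    have h1 := deriv_iterate_cubic w.1 w.2 ((cubic w.1 w.2)^[j] w.1) p
    rwa [Finset.prod_eq_zero (i := if j = 0 then 0 else p - j)] at h1
    · rw [Finset.mem_range]; split_ifs <;> omega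
    · rw [← iterate_add_apply]
      split_ifs with h0
      · simp [h0]
      · rw [Nat.sub_add_cancel hj.le, hw.1]; ring
  have hfix : ∀ j, (cubic w.1 w.2)^[p] ((cubic w.1 w.2)^[j] w.1) = (cubic w.1 w.2)^[j] w.1 := by
    intro j
    rw [← iterate_add_apply, add_comm, iterate_add_apply, hw.1]
  have hd0 : HasDerivAt (cubic w.1 w.2)^[p] 0 w.1 := hd 0 hp
  refine ⟨hw, ⟨p, hp, w.1, hw.1, ?_, ?_⟩, p, hp, (cubic w.1 w.2)^[l] w.1, hfix l, ?_, ?_⟩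
  · rw [hd0.deriv]; simp
  · have h1 : ∀ k, (cubic w.1 w.2)^[p * k] w.1 = w.1 := fun k => by
      rw [iterate_mul]; exact iterate_fixed hw.1 k
    simp only [h1]
    exact tendsto_const_nhds
  · rcases hl.lt_or_eq with h1 | rfl
    · rw [(hd l h1).deriv]; simp
    · rw [hw.1, hd0.deriv]; simp
  · rw [← tendsto_add_atTop_iff_nat 1]
    refine (((continuous_iterate_cubic w.1 w.2 l).tendsto _).comp h).congr fun n => ?_
    rw [comp_apply, critReturn_eq, ← iterate_add_apply]
    congr 1
    rw [mul_add]; omega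

theorem IsHyperbolicComponent.mem_of_mem_closure {H : Set (ℂ × ℂ)}
    (hH : IsHyperbolicComponent p H) {w : ℂ × ℂ} (hw : w ∈ hypLocus p) (hwH : w ∈ closure H) :
    w ∈ H := by
  obtain ⟨w₁, hw₁, rfl⟩ := hH
  have h1 : IsPreconnected (insert w (connectedComponentIn (hypLocus p) w₁)) :=
    isPreconnected_connectedComponentIn.subset_closure (subset_insert _ _)
      (insert_subset hwH subset_closure)
  exact h1.subset_connectedComponentIn (mem_insert_of_mem _ (mem_connectedComponentIn hw₁))
    (insert_subset hw (connectedComponentIn_subset _ _)) (mem_insert _ _)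

/-- A sublevel set of the modulus of the position map is relatively closed. -/
theorem IsHyperbolicComponent.mem_of_mem_closure_sublevel {H : Set (ℂ × ℂ)}
    (hH : IsHyperbolicComponent p H) (hT : ∀ w ∈ H, TypeB p l w) {R : ℝ}
    (hR : ∀ w ∈ H, ∀ z ∈ filledJulia (cubic w.1 w.2), ‖z‖ ≤ R) {r : ℝ} (hr : r < 1) {w : ℂ × ℂ}
    (hw : w ∈ closure {w ∈ H | ‖posMap p l w‖ ≤ r}) : w ∈ H := by
  have hsub : {w ∈ H | ‖posMap p l w‖ ≤ r} ⊆ H := fun w h => h.1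
  have hwS : w ∈ Sp p := (isClosed_Sp p).closure_subset_iff.mpr
    (fun w h => (hT w (hsub h)).mem) hw
  obtain ⟨w₁, hw₁⟩ : {w ∈ H | ‖posMap p l w‖ ≤ r}.Nonempty := closure_nonempty_iff.mp ⟨w, hw⟩
  have hB₁ := hT w₁ hw₁.1
  have hr0 : 0 ≤ r := (norm_nonneg _).trans hw₁.2
  have hR0 := hB₁.radius_nonneg (hR w₁ hw₁.1)
  refine hH.mem_of_mem_closure (mem_hypLocus_of_tendsto hB₁.lt.le hB₁.one_le_p hwS ?_)
    (closure_mono hsub hw)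
  have hle : ∀ n, ‖critReturn p l n w - w.1‖ ≤ 2 * R * r ^ (2 ^ n - 1) := by
    intro n
    have hcl : IsClosed {w : ℂ × ℂ | ‖critReturn p l n w - w.1‖ ≤ 2 * R * r ^ (2 ^ n - 1)} :=
      isClosed_le (((contDiff_critReturn p l n (k := 0)).continuous.sub continuous_fst).norm)
        continuous_const
    refine hcl.closure_subset_iff.mpr (fun w h => ?_) hw
    refine ((hT w h.1).norm_critReturn_sub_le (hR w h.1) n).trans ?_
    have := h.2
    gcongr
  rw [tendsto_iff_norm_sub_tendsto_zero]
  refine squeeze_zero (fun _ => norm_nonneg _) hle ?_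
  have h1 : Tendsto (fun n : ℕ => 2 ^ n - 1) atTop atTop :=
    (tendsto_sub_atTop_nat 1).comp (tendsto_pow_atTop_atTop_of_one_lt one_lt_two)
  simpa using ((tendsto_pow_atTop_nhds_zero_of_lt_one hr0 hr).comp h1).const_mul (2 * R)

/-- Near a parameter whose free critical point is attracted to the cycle of `c`, all parameters
of `S_p` have the same property. -/
theorem eventually_tendsto_critReturn (hp : 1 ≤ p) {w₀ : ℂ × ℂ}
    (h : Tendsto (fun n => critReturn p l n w₀) atTop (𝓝 w₀.1)) :
    ∀ᶠ w in 𝓝 w₀, w ∈ Sp p → Tendsto (fun n => critReturn p l n w) atTop (𝓝 w.1) := by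
  obtain ⟨C, hC1, hC⟩ := exists_trap (p := p) w₀
  have hC0 : 0 < C := by linarith
  have h1 := (tendsto_iff_norm_sub_tendsto_zero.mp h).eventually_lt_const
    (show (0 : ℝ) < 1 / (2 * C) by positivity)
  obtain ⟨N, hN⟩ := h1.exists
  have h2 : ∀ᶠ w : ℂ × ℂ in 𝓝 w₀, ‖critReturn p l N w - w.1‖ < 1 / (2 * C) :=
    (((contDiff_critReturn p l N (k := 0)).continuous.sub continuous_fst).norm.continuousAt
      ).eventually_lt_const hN
  filter_upwards [hC, h2] with w hw1 hw2 hw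
  rw [← tendsto_add_atTop_iff_nat N, tendsto_iff_norm_sub_tendsto_zero]
  refine squeeze_zero (fun _ => norm_nonneg _) (g := fun n : ℕ => (1 / (2 * C)) / 2 ^ n) (fun n => ?_) ?_
  · have h3 := norm_iterate_iterate_sub_le_of_trap hp hw hC1 hw1 hw2.le n
    have h4 : critReturn p l (n + N) w = ((cubic w.1 w.2)^[p])^[n] (critReturn p l N w) := by
      rw [critReturn, critReturn, iterate_add_apply]
    rw [h4]
    refine h3.trans ?_
    gcongr
  · have := (tendsto_pow_atTop_nhds_zero_of_lt_one (by norm_num) (by norm_num : (1 / 2 : ℝ) < 1)).const_mul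
      (1 / (2 * C))
    simpa [div_eq_mul_inv] using this

end closedness

theorem tendsto_iterate_cubic {ι : Type*} {F : Filter ι} {u : ι → ℂ × ℂ} {z : ι → ℂ} {w₀ : ℂ × ℂ}
    {z₀ : ℂ} (hu : Tendsto u F (𝓝 w₀)) (hz : Tendsto z F (𝓝 z₀)) (n : ℕ) :
    Tendsto (fun i => (cubic (u i).1 (u i).2)^[n] (z i)) F
      (𝓝 ((cubic w₀.1 w₀.2)^[n] z₀)) := by
  have h1 := ((continuous_cubic_iterate n).tendsto (w₀, z₀)).comp (hu.prodMk_nhds hz)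
  simpa only [comp_def] using h1

section montel

/-- Equi-Lipschitz estimate for a bounded holomorphic function. -/
theorem dist_le_of_differentiableOn_of_norm_le {F : ℂ → ℂ} {z₁ z₂ : ℂ} {d M : ℝ}
    (hF : DifferentiableOn ℂ F (ball z₁ d)) (hM : ∀ z ∈ ball z₁ d, ‖F z‖ ≤ M)
    (hz : z₂ ∈ ball z₁ d) : dist (F z₂) (F z₁) ≤ 2 * M / d * dist z₂ z₁ := by
  have hd : 0 < d := dist_nonneg.trans_lt hz
  refine Complex.dist_le_div_mul_dist_of_mapsTo_ball hF (fun z hz' => ?_) hz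
  rw [mem_closedBall, dist_eq_norm, two_mul]
  exact (norm_sub_le _ _).trans (add_le_add (hM z hz') (hM z₁ (mem_ball_self hd)))

/-- Montel's theorem along an ultrafilter. -/
theorem Ultrafilter.exists_tendstoLocallyUniformlyOn {ι : Type*} (𝒰 : Ultrafilter ι)
    {F : ι → ℂ → ℂ} {U : Set ℂ} (hU : IsOpen U) {M : ℝ}
    (hF : ∀ᶠ i in (𝒰 : Filter ι), DifferentiableOn ℂ (F i) U ∧ ∀ z ∈ U, ‖F i z‖ ≤ M) :
    ∃ G : ℂ → ℂ, DifferentiableOn ℂ G U ∧ TendstoLocallyUniformlyOn F G (𝒰 : Filter ι) U := by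
  have hlim : ∀ z, ∃ y, z ∈ U → Tendsto (fun i => F i z) 𝒰 (𝓝 y) := by
    intro z
    by_cases hz : z ∈ U
    · have h1 : ∀ᶠ i in (𝒰 : Filter ι), F i z ∈ closedBall (0 : ℂ) M := hF.mono fun i hi =>
        mem_closedBall_zero_iff.mpr (hi.2 z hz)
      obtain ⟨y, -, hy⟩ := (isCompact_closedBall (0 : ℂ) M).ultrafilter_le_nhds
        (𝒰.map fun i => F i z) (le_principal_iff.mpr h1)
      exact ⟨y, fun _ => hy⟩
    · exact ⟨0, fun h => absurd h hz⟩
  choose G hG using hlim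
  have hloc : TendstoLocallyUniformlyOn F G (𝒰 : Filter ι) U := by
    rw [Metric.tendstoLocallyUniformlyOn_iff]
    intro ε hε z hz
    obtain ⟨d, hd, hdU⟩ := Metric.isOpen_iff.mp hU z hz
    set η := min d (ε * d / (4 * (2 * |M| + 1))) with hη
    have hη0 : 0 < η := by positivity
    have hLip : ∀ᶠ i in (𝒰 : Filter ι), ∀ y ∈ ball z η, dist (F i y) (F i z) ≤ ε / 4 := by
      filter_upwards [hF] with i hi y hy
      have hyd : y ∈ ball z d := ball_subset_ball (min_le_left _ _) hy
      have h1 := dist_le_of_differentiableOn_of_norm_le (hi.1.mono hdU) (M := |M|)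
        (fun z hz => (hi.2 z (hdU hz)).trans (le_abs_self _)) hyd
      have h2 : dist y z ≤ ε * d / (4 * (2 * |M| + 1)) := hy.le.trans (min_le_right _ _)
      refine h1.trans ?_
      rw [le_div_iff₀ (by positivity)] at h2
      rw [div_mul_eq_mul_div, div_le_iff₀ hd]
      nlinarith [dist_nonneg (x := y) (y := z), abs_nonneg M]
    refine ⟨ball z η, mem_nhdsWithin_of_mem_nhds (ball_mem_nhds z hη0), ?_⟩
    have hηU : ball z η ⊆ U := (ball_subset_ball (min_le_left _ _)).trans hdU
    have hLipG : ∀ y ∈ ball z η, dist (G y) (G z) ≤ ε / 4 := fun y hy =>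
      le_of_tendsto ((hG y (hηU hy)).dist (hG z hz)) (hLip.mono fun i hi => hi y hy)
    filter_upwards [hLip, Metric.tendsto_nhds.mp (hG z hz) (ε / 4) (by positivity)] with i h1 h2 y hy
    have h3 := dist_triangle4 (G y) (G z) (F i z) (F i y)
    have h4 := h1 y hy
    have h5 := hLipG y hy
    rw [dist_comm] at h2 h4
    linarith
  exact ⟨G, hloc.differentiableOn (hF.mono fun i hi => hi.1) hU, hloc⟩

end montel

section continuity
variable {p l : ℕ} {w : ℂ × ℂ}

theorem IsLin.norm_le_half {ρ : ℝ} {ψ : ℂ → ℂ} (h : IsLin p w ρ ψ) (hp : 1 ≤ p) (hw : w ∈ Sp p)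
    {C : ℝ} (hC1 : 1 ≤ C) (hC : ∀ z, ‖z - w.1‖ ≤ 1 → ‖critQuot (p - 1) w.1 w.2 z‖ ≤ C) {ζ : ℂ}
    (hζ : ζ ∈ ball (0 : ℂ) ρ) (hψ : ‖ψ ζ - w.1‖ ≤ 1 / (2 * C)) : ‖ζ‖ ≤ 1 / 2 := by
  by_contra! hlt
  have hC0 : 0 < C := by linarith
  have hζ0 : 0 < ‖ζ‖ := by linarith
  have hq : ∀ m : ℕ, C * ‖ψ (ζ ^ 2 ^ m) - w.1‖ ≤ (1 / 2) ^ 2 ^ m := by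
    intro m
    induction m with
    | zero =>
      rw [le_div_iff₀ (by positivity)] at hψ
      simp only [pow_zero, pow_one]; linarith
    | succ m ih =>
      have h1 := norm_iterate_iterate_sub_le_of_trap hp hw hC1 hC hψ m
      rw [h.iterate m hζ] at h1
      have h2 : ‖ψ (ζ ^ 2 ^ m) - w.1‖ ≤ 1 / (2 * C) := h1.trans
        ((div_le_self (norm_nonneg _) (one_le_pow₀ one_le_two)).trans hψ)
      have h3 := (norm_iterate_sub_le_of_trap hp hw hC1 hC h2).1
      rw [h.conj _ (pow_mem_ball_zero h.le_one hζ (by positivity)), ← pow_mul, ← pow_succ] at h3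
      calc _ ≤ C * (C * ‖ψ (ζ ^ 2 ^ m) - w.1‖ ^ 2) := by gcongr
        _ = (C * ‖ψ (ζ ^ 2 ^ m) - w.1‖) ^ 2 := by ring
        _ ≤ ((1 / 2) ^ 2 ^ m) ^ 2 := by gcongr
        _ = _ := by rw [← pow_mul, ← pow_succ]
  have hζ1 : ‖ζ‖ < 1 := (mem_ball_zero_iff.mp hζ).trans_le h.le_one
  have ht : Tendsto (fun m : ℕ => C * ‖dslope ψ 0 (ζ ^ 2 ^ m)‖) atTop (𝓝 (C * ‖deriv ψ 0‖)) := by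
    have hc : ContinuousAt (dslope ψ 0) 0 :=
      (h.differentiableOn_dslope.differentiableAt (isOpen_ball.mem_nhds h.zero_mem)).continuousAt
    rw [← dslope_same]
    exact ((hc.tendsto.comp (tendsto_pow_two_pow hζ1)).norm).const_mul C
  have ht2 : Tendsto (fun m : ℕ => (1 / (2 * ‖ζ‖)) ^ 2 ^ m) atTop (𝓝 0) := by
    refine (tendsto_pow_atTop_nhds_zero_of_lt_one (by positivity) ?_).comp
      (tendsto_pow_atTop_atTop_of_one_lt one_lt_two)
    rw [div_lt_one (by positivity)]; linarith
  have hle := le_of_tendsto_of_tendsto' ht ht2 fun m => by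
    have h1 := hq m
    rw [h.eq_add_mul_dslope, add_sub_cancel_left, norm_mul, norm_pow] at h1
    have h2 : (1 / (2 * ‖ζ‖)) ^ 2 ^ m = (1 / 2) ^ 2 ^ m / ‖ζ‖ ^ 2 ^ m := by
      rw [← div_pow, div_div]
    rw [h2, le_div_iff₀ (by positivity)]
    linarith
  have := norm_pos_iff.mpr h.deriv_ne
  nlinarith

theorem IsPos.eq_of_isLin {ρ ρ₀ : ℝ} {ψ ψ₀ : ℂ → ℂ} {x x₀ : ℂ} (h₀ : IsPos p l w ρ₀ ψ₀ x₀)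
    (h : IsLin p w ρ ψ) (hp : 1 ≤ p) (hw : w ∈ Sp p) (hx : x ∈ ball (0 : ℂ) ρ)
    (hψ : ψ x = (cubic w.1 w.2)^[p - l] (-w.1)) : x = x₀ := by
  have hx₀ := mem_ball_zero_iff.mpr h₀.norm_lt
  rcases le_total ρ ρ₀ with hρ | hρ
  · refine h₀.inj (ball_subset_ball hρ hx) hx₀ ?_
    rw [← h.eqOn h₀.lin hp hw hρ hx, hψ, h₀.eq]
  · have heq := h₀.lin.eqOn h hp hw hρ
    have hx1 : ‖x‖ < 1 := (mem_ball_zero_iff.mp hx).trans_le h.le_one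
    have hx₀1 : ‖x₀‖ < 1 := h₀.norm_lt.trans_le h₀.lin.le_one
    have hb : ball (0 : ℂ) ρ₀ ∈ 𝓝 (0 : ℂ) := isOpen_ball.mem_nhds h₀.lin.zero_mem
    obtain ⟨n, hn1, hn2⟩ := (((tendsto_pow_two_pow hx1).eventually hb).and
      ((tendsto_pow_two_pow hx₀1).eventually hb)).exists
    have h1 : x ^ 2 ^ n = x₀ ^ 2 ^ n := by
      refine h₀.inj hn1 hn2 ?_
      rw [heq hn1, ← h.iterate n hx, hψ, ← h₀.eq, h₀.lin.iterate n hx₀]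
    have h2 : ‖x‖ = ‖x₀‖ := by
      have := congrArg norm h1
      rw [norm_pow, norm_pow] at this
      exact (pow_left_inj₀ (norm_nonneg _) (norm_nonneg _) (by positivity)).mp this
    have hxb : x ∈ ball (0 : ℂ) ρ₀ := mem_ball_zero_iff.mpr (h2 ▸ h₀.norm_lt)
    exact h₀.inj hxb hx₀ (by rw [heq hxb, hψ, h₀.eq])

variable {S : Set (ℂ × ℂ)} (hT : ∀ w ∈ S, TypeB p l w) {R : ℝ}
  (hR : ∀ w ∈ S, ∀ z ∈ filledJulia (cubic w.1 w.2), ‖z‖ ≤ R) {w₀ : ℂ × ℂ} (hw₀ : w₀ ∈ S)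
include hT hR hw₀

theorem continuousWithinAt_posMap_of_eq (hc : (cubic w₀.1 w₀.2)^[l] w₀.1 = -w₀.1) :
    ContinuousWithinAt (posMap p l) S w₀ := by
  rw [ContinuousWithinAt, (hT w₀ hw₀).posMap_eq_zero hc, tendsto_zero_iff_norm_tendsto_zero]
  have h1 : Tendsto (fun w => 4 * R ^ 2 * ‖critCoeff p w‖ ^ 2) (𝓝[S] w₀) (𝓝 0) := by
    have : Continuous fun w => 4 * R ^ 2 * ‖critCoeff p w‖ ^ 2 :=
      ((continuous_critCoeff p).norm.pow 2).const_mul _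
    have h2 := this.tendsto w₀
    rw [(hT w₀ hw₀).critCoeff_eq_zero hc, norm_zero, zero_pow two_ne_zero, mul_zero] at h2
    exact h2.mono_left nhdsWithin_le_nhds
  refine squeeze_zero' (Eventually.of_forall fun _ => norm_nonneg _) ?_ h1
  filter_upwards [self_mem_nhdsWithin] with w hw
  exact (hT w hw).norm_posMap_le (hR w hw)

theorem continuousWithinAt_posMap_of_ne (hc : (cubic w₀.1 w₀.2)^[l] w₀.1 ≠ -w₀.1) :
    ContinuousWithinAt (posMap p l) S w₀ := by
  have hB₀ := hT w₀ hw₀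
  have hp := hB₀.one_le_p
  obtain ⟨ρ₀, ψ₀, h₀⟩ := hB₀.exists_isPos_posMap hc
  have hx₀ := mem_ball_zero_iff.mpr h₀.norm_lt
  have hch : ∀ w : ℂ × ℂ, ∃ ρ ψ, (w ∈ S ∧ (cubic w.1 w.2)^[l] w.1 ≠ -w.1) →
      IsPos p l w ρ ψ (posMap p l w) := by
    intro w
    by_cases h : w ∈ S ∧ (cubic w.1 w.2)^[l] w.1 ≠ -w.1
    · obtain ⟨ρ, ψ, h1⟩ := (hT w h.1).exists_isPos_posMap h.2
      exact ⟨ρ, ψ, fun _ => h1⟩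
    · exact ⟨0, 0, fun h1 => absurd h1 h⟩
  choose ρ ψ hpos using hch
  rw [ContinuousWithinAt, tendsto_iff_ultrafilter]
  intro 𝒰 h𝒰
  have hS : ∀ᶠ w in (𝒰 : Filter (ℂ × ℂ)), w ∈ S := h𝒰 self_mem_nhdsWithin
  have h𝒰n : (𝒰 : Filter (ℂ × ℂ)) ≤ 𝓝 w₀ := h𝒰.trans nhdsWithin_le_nhds
  have hnc : ∀ᶠ w in (𝒰 : Filter (ℂ × ℂ)), (cubic w.1 w.2)^[l] w.1 ≠ -w.1 :=
    h𝒰n ((isOpen_ne_fun (continuous_iterate_crit l) continuous_fst.neg).mem_nhds hc)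
  have hP : ∀ᶠ w in (𝒰 : Filter (ℂ × ℂ)), IsPos p l w (ρ w) (ψ w) (posMap p l w) :=
    (hS.and hnc).mono fun w hw => hpos w hw
  have hcr : ∀ n, Tendsto (fun w => critReturn p l n w) 𝒰 (𝓝 (critReturn p l n w₀)) := fun n =>
    ((contDiff_critReturn p l n (k := 0)).continuous.tendsto w₀).mono_left h𝒰n
  have hfst : Tendsto (fun w : ℂ × ℂ => w.1) 𝒰 (𝓝 w₀.1) := (continuous_fst.tendsto w₀).mono_left h𝒰n
  obtain ⟨x, -, hx⟩ := (isCompact_closedBall (0 : ℂ) 1).ultrafilter_le_nhds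
    (𝒰.map (posMap p l)) (le_principal_iff.mpr (hS.mono fun w hw =>
      mem_closedBall_zero_iff.mpr (hT w hw).norm_posMap_lt_one.le))
  have hx : Tendsto (posMap p l) 𝒰 (𝓝 x) := hx
  have hx0 : x ≠ 0 := by
    rintro rfl
    have h1 := le_of_tendsto_of_tendsto ((hcr 1).sub hfst).norm (hx.norm.const_mul (2 * R))
      (hS.mono fun w hw => by simpa using (hT w hw).norm_critReturn_sub_le (hR w hw) 1)
    rw [norm_zero, mul_zero, norm_le_zero_iff, sub_eq_zero, h₀.critReturn_eq, ← h₀.lin.zero] at h1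
    have h2 := h₀.inj (pow_mem_ball_zero h₀.lin.le_one hx₀ (by norm_num)) h₀.lin.zero_mem h1
    exact h₀.ne_zero (pow_eq_zero_iff (by norm_num) |>.mp h2)
  have hx1 : ‖x‖ < 1 := by
    obtain ⟨C, hC1, hC⟩ := exists_trap (p := p) w₀
    have h1 := tendsto_iff_norm_sub_tendsto_zero.mp hB₀.tendsto_iterate
    obtain ⟨N, hN⟩ := (h1.eventually_lt_const (show (0 : ℝ) < 1 / (2 * C) by positivity)).exists
    have h2 : ∀ᶠ w : ℂ × ℂ in 𝒰, ‖critReturn p l N w - w.1‖ < 1 / (2 * C) :=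
      ((hcr N).sub hfst).norm.eventually_lt_const hN
    have h3 : ‖x‖ ^ 2 ^ N ≤ 1 / 2 := by
      refine le_of_tendsto (hx.norm.pow _) ?_
      filter_upwards [h2, h𝒰n hC, hP, hS] with w g1 g2 g3 g4
      rw [g3.critReturn_eq] at g1
      rw [← norm_pow]
      exact g3.lin.norm_le_half hp (hT w g4).mem hC1 g2 (pow_mem_ball_zero g3.lin.le_one
        (mem_ball_zero_iff.mpr g3.norm_lt) (by positivity)) g1.le
    by_contra! h4
    have := one_le_pow₀ h4 (n := 2 ^ N)
    linarith
  have hxp : 0 < ‖x‖ := norm_pos_iff.mpr hx0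
  obtain ⟨ρ₁, hρ₁, hρ₁'⟩ : ∃ ρ₁, ‖x‖ < ρ₁ ∧ ρ₁ < √‖x‖ := exists_between (by
    rw [Real.lt_sqrt (norm_nonneg _)]; nlinarith)
  have hρ₁0 : 0 < ρ₁ := hxp.trans hρ₁
  have hρ₁1 : ρ₁ ≤ 1 := hρ₁'.le.trans (Real.sqrt_le_one.mpr hx1.le)
  have hρw : ∀ᶠ w in (𝒰 : Filter (ℂ × ℂ)), ρ₁ ≤ ρ w := by
    have h1 : ∀ᶠ w in (𝒰 : Filter (ℂ × ℂ)), ρ₁ ^ 2 < ‖posMap p l w‖ :=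
      hx.norm.eventually_const_lt ((Real.lt_sqrt hρ₁0.le).mp hρ₁')
    filter_upwards [h1, hP] with w g1 g2
    exact (lt_of_pow_lt_pow_left₀ 2 g2.lin.pos.le (g1.trans_le g2.norm_le)).le
  have hlin : ∀ᶠ w in (𝒰 : Filter (ℂ × ℂ)), IsLin p w ρ₁ (ψ w) :=
    (hP.and hρw).mono fun w hw => hw.1.lin.mono hρ₁0 hw.2
  obtain ⟨G, hG, hlim⟩ := 𝒰.exists_tendstoLocallyUniformlyOn (F := ψ) (U := ball 0 ρ₁) isOpen_ball
    (M := R) (by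
      filter_upwards [hlin, hS] with w g1 g2
      exact ⟨g1.diff, fun z hz => hR w g2 _ (g1.mem_filledJulia hp hz)⟩)
  have h0 : (0 : ℂ) ∈ ball (0 : ℂ) ρ₁ := mem_ball_self hρ₁0
  have hpt : ∀ z ∈ ball (0 : ℂ) ρ₁, Tendsto (fun w => ψ w z) 𝒰 (𝓝 (G z)) := fun z hz =>
    hlim.tendsto_at hz
  have hGlin : IsLin p w₀ ρ₁ G := by
    refine ⟨hρ₁0, hρ₁1, hG, ?_, ?_, fun ζ hζ => ?_⟩
    · refine tendsto_nhds_unique (hpt 0 h0) (hfst.congr' ?_)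
      filter_upwards [hlin] with w hw using hw.zero.symm
    · have h1 : Tendsto (fun w => deriv (ψ w) 0) 𝒰 (𝓝 (deriv G 0)) :=
        (hlim.deriv (hlin.mono fun w hw => hw.diff) isOpen_ball).tendsto_at h0
      have h2 : Tendsto (fun w => critCoeff p w * deriv (ψ w) 0) 𝒰
          (𝓝 (critCoeff p w₀ * deriv G 0)) :=
        (((continuous_critCoeff p).tendsto w₀).mono_left h𝒰n).mul h1
      have h3 : critCoeff p w₀ * deriv G 0 = 1 := by
        refine tendsto_nhds_unique h2 (tendsto_const_nhds.congr' ?_)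
        filter_upwards [hlin, hS] with w g1 g2
        exact (g1.critCoeff_mul_deriv hp (hT w g2).mem).symm
      exact right_ne_zero_of_mul_eq_one h3
    · have h1 : Tendsto (fun w : ℂ × ℂ => (cubic w.1 w.2)^[p] (ψ w ζ)) 𝒰
          (𝓝 ((cubic w₀.1 w₀.2)^[p] (G ζ))) :=
        tendsto_iterate_cubic h𝒰n (hpt ζ hζ) p
      refine tendsto_nhds_unique h1 ((hpt _ (pow_mem_ball_zero hρ₁1 hζ two_ne_zero)).congr' ?_)
      filter_upwards [hlin] with w hw using (hw.conj ζ hζ).symm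
  have hxb : x ∈ ball (0 : ℂ) ρ₁ := mem_ball_zero_iff.mpr hρ₁
  have hGx : G x = (cubic w₀.1 w₀.2)^[p - l] (-w₀.1) := by
    have h1 := hlim.tendsto_comp (hG.continuousOn.continuousWithinAt hxb) hxb
      (tendsto_nhdsWithin_iff.mpr ⟨hx, hx.eventually (isOpen_ball.mem_nhds hxb)⟩)
    refine tendsto_nhds_unique h1 ((hcr 0).congr' ?_)
    filter_upwards [hP] with w hw
    exact hw.eq.symm
  rw [← h₀.eq_of_isLin hGlin hp hB₀.mem hxb hGx]
  exact hx

theorem continuousWithinAt_posMap : ContinuousWithinAt (posMap p l) S w₀ := by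
  by_cases hc : (cubic w₀.1 w₀.2)^[l] w₀.1 = -w₀.1
  · exact continuousWithinAt_posMap_of_eq hT hR hw₀ hc
  · exact continuousWithinAt_posMap_of_ne hT hR hw₀ hc

end continuity

section hartogs

theorem continuousAt_dslope_of_separately {F : ℂ → ℂ → ℂ} {t₀ z₀ : ℂ} {r M : ℝ} (hr : 0 < r)
    (ht : ∀ z ∈ ball z₀ r, DifferentiableOn ℂ (fun t => F t z) (ball t₀ r))
    (hz : ∀ t ∈ ball t₀ r, DifferentiableOn ℂ (F t) (ball z₀ r))
    (hM : ∀ t ∈ ball t₀ r, ∀ z ∈ ball z₀ r, ‖F t z‖ ≤ M) :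
    ContinuousAt (fun q : ℂ × ℂ => dslope (fun t => F t q.2) t₀ q.1) (t₀, z₀) := by
  have ht₀ : t₀ ∈ ball t₀ r := mem_ball_self hr
  have hz₀ : z₀ ∈ ball z₀ r := mem_ball_self hr
  have hM0 : 0 ≤ M := (norm_nonneg _).trans (hM t₀ ht₀ z₀ hz₀)
  obtain ⟨G, hG⟩ : ∃ G : ℂ → ℂ → ℂ, G = fun t z => dslope (fun t => F t z) t₀ t := ⟨_, rfl⟩
  have hGd : ∀ z ∈ ball z₀ r, DifferentiableOn ℂ (fun t => G t z) (ball t₀ r) := fun z hz' => by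
    rw [hG]
    exact (Complex.differentiableOn_dslope (ball_mem_nhds _ hr)).mpr (ht z hz')
  have hGb : ∀ z ∈ ball z₀ r, ∀ t ∈ ball t₀ r, ‖G t z‖ ≤ 2 * M / r := fun z hz' t ht' => by
    rw [hG]
    refine Complex.norm_dslope_le_div_of_mapsTo_ball (ht z hz') (fun s hs => ?_) ht'
    rw [mem_closedBall, dist_eq_norm, two_mul]
    exact (norm_sub_le _ _).trans (add_le_add (hM _ hs _ hz') (hM _ ht₀ _ hz'))
  obtain ⟨L, hL⟩ : ∃ L : ℝ, L = 2 * (2 * M / r) / r := ⟨_, rfl⟩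
  have hL0 : 0 ≤ L := by rw [hL]; positivity
  have hlip : ∀ z ∈ ball z₀ r, ∀ t ∈ ball t₀ r, dist (G t z) (G t₀ z) ≤ L * dist t t₀ :=
    fun z hz' t ht' => hL ▸ dist_le_of_differentiableOn_of_norm_le (hGd z hz') (hGb z hz') ht'
  change ContinuousAt (fun q : ℂ × ℂ => dslope (fun t => F t q.2) t₀ q.1) (t₀, z₀)
  have hGq : (fun q : ℂ × ℂ => dslope (fun t => F t q.2) t₀ q.1) = fun q => G q.1 q.2 := by rw [hG]
  rw [hGq, Metric.continuousAt_iff]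
  intro ε hε
  obtain ⟨d, hd, hdr⟩ : ∃ d : ℝ, 0 < d ∧ d < r ∧ L * d ≤ ε / 6 := by
    refine ⟨min (r / 2) (ε / (6 * (L + 1))), by positivity,
      (min_le_left _ _).trans_lt (half_lt_self hr), ?_⟩
    calc L * min (r / 2) (ε / (6 * (L + 1))) ≤ (L + 1) * (ε / (6 * (L + 1))) := by
          gcongr
          · linarith
          · exact min_le_right _ _
      _ = ε / 6 := by field_simp
  obtain ⟨hdr, hLd⟩ := hdr
  set τ : ℂ := t₀ + (d : ℂ) with hτ
  have hτd : dist τ t₀ = d := by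
    rw [hτ, dist_eq_norm, add_sub_cancel_left, Complex.norm_real, Real.norm_of_nonneg hd.le]
  have hτne : τ ≠ t₀ := fun h => by rw [h, dist_self] at hτd; exact hd.ne hτd
  have hτb : τ ∈ ball t₀ r := by rw [mem_ball, hτd]; exact hdr
  have hcont : ContinuousAt (fun z => G τ z) z₀ := by
    have h1 : (fun z => G τ z) = fun z => (τ - t₀)⁻¹ * (F τ z - F t₀ z) := by
      funext z
      rw [hG]
      simp only [dslope_of_ne _ hτne, slope_def_field]
      rw [div_eq_inv_mul]
    rw [h1]
    exact ((((hz τ hτb).continuousOn.continuousAt (ball_mem_nhds _ hr)).sub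
      ((hz t₀ ht₀).continuousOn.continuousAt (ball_mem_nhds _ hr)))).const_mul _
  obtain ⟨s, hs, hsG⟩ := Metric.continuousAt_iff.mp hcont (ε / 3) (by positivity)
  refine ⟨min d s, lt_min hd hs, fun {q} hq => ?_⟩
  have hq1 : dist q.1 t₀ < d := ((le_max_left _ _).trans_lt hq).trans_le (min_le_left _ _)
  have hq2 : dist q.2 z₀ < min d s := (le_max_right _ _).trans_lt hq
  have hq2b : q.2 ∈ ball z₀ r := (hq2.trans_le (min_le_left _ _)).trans hdr
  have e1 := hlip q.2 hq2b q.1 (hq1.trans hdr)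
  have e2 := hlip q.2 hq2b τ hτb
  have e3 := hlip z₀ hz₀ τ hτb
  have e4 := hsG (hq2.trans_le (min_le_right _ _))
  rw [hτd] at e2 e3
  have e5 : L * dist q.1 t₀ ≤ L * d := by gcongr
  have e6 := dist_triangle4 (G q.1 q.2) (G t₀ q.2) (G τ q.2) (G t₀ z₀)
  have e7 := dist_triangle (G τ q.2) (G τ z₀) (G t₀ z₀)
  rw [dist_comm (G t₀ q.2)] at e6
  change dist (G q.1 q.2) (G t₀ z₀) < ε
  linarith

theorem differentiableAt_of_separately {F : ℂ → ℂ → ℂ} {t₀ z₀ : ℂ} {r M : ℝ} (hr : 0 < r)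
    (ht : ∀ z ∈ ball z₀ r, DifferentiableOn ℂ (fun t => F t z) (ball t₀ r))
    (hz : ∀ t ∈ ball t₀ r, DifferentiableOn ℂ (F t) (ball z₀ r))
    (hM : ∀ t ∈ ball t₀ r, ∀ z ∈ ball z₀ r, ‖F t z‖ ≤ M) :
    DifferentiableAt ℂ (fun q : ℂ × ℂ => F q.1 q.2) (t₀, z₀) := by
  have hc := continuousAt_dslope_of_separately hr ht hz hM
  have h1 : (fun q : ℂ × ℂ => F q.1 q.2) =
      fun q => F t₀ q.2 + (q.1 - t₀) * dslope (fun t => F t q.2) t₀ q.1 := by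
    funext q
    have := sub_smul_dslope (fun t => F t q.2) t₀ q.1
    rw [smul_eq_mul] at this
    rw [this]; ring
  rw [h1]
  refine DifferentiableAt.add ?_ ?_
  · exact DifferentiableAt.comp (t₀, z₀) (g := F t₀) (f := Prod.snd)
      ((hz t₀ (mem_ball_self hr)).differentiableAt (ball_mem_nhds z₀ hr)) differentiableAt_snd
  · have h2 : HasFDerivAt (fun q : ℂ × ℂ => q.1 - t₀) (ContinuousLinearMap.fst ℂ ℂ ℂ) (t₀, z₀) :=
      hasFDerivAt_fst.sub_const t₀
    have h3 : (fun q : ℂ × ℂ => (q.1 - t₀) * dslope (fun t => F t q.2) t₀ q.1) =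
        fun q => (q.1 - t₀) * dslope (fun t => F t z₀) t₀ t₀ + (q.1 - t₀) *
          (dslope (fun t => F t q.2) t₀ q.1 - dslope (fun t => F t z₀) t₀ t₀) := by
      funext q; ring
    rw [h3]
    refine (h2.differentiableAt.mul_const _).add (HasFDerivAt.differentiableAt
      (f' := (0 : ℂ × ℂ →L[ℂ] ℂ)) (HasFDerivAt.of_isLittleO ?_))
    have h4 : (fun q : ℂ × ℂ => q.1 - t₀) =O[𝓝 (t₀, z₀)] fun q => q - (t₀, z₀) :=
      Asymptotics.isBigO_of_le _ fun q => norm_fst_le (q - (t₀, z₀))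
    have h5 : (fun q : ℂ × ℂ => dslope (fun t => F t q.2) t₀ q.1 - dslope (fun t => F t z₀) t₀ t₀)
        =o[𝓝 (t₀, z₀)] fun _ => (1 : ℝ) := by
      rw [Asymptotics.isLittleO_one_iff]
      simpa using hc.tendsto.sub_const (dslope (fun t => F t z₀) t₀ t₀)
    rw [← Asymptotics.isLittleO_norm_right]
    simpa using h4.norm_right.mul_isLittleO h5

/-- A bounded function, holomorphic in each variable separately except possibly in the first
variable on one exceptional fibre, is jointly holomorphic. -/
theorem differentiableOn_of_separately {F : ℂ → ℂ → ℂ} {U V : Set ℂ} (hU : IsOpen U)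
    (hV : IsOpen V) {a : ℂ} {M : ℝ}
    (ht : ∀ z ∈ V, z ≠ a → DifferentiableOn ℂ (fun t => F t z) U)
    (hz : ∀ t ∈ U, DifferentiableOn ℂ (F t) V) (hM : ∀ t ∈ U, ∀ z ∈ V, ‖F t z‖ ≤ M) :
    DifferentiableOn ℂ (fun q : ℂ × ℂ => F q.1 q.2) (U ×ˢ V) := by
  have ht' : ∀ z ∈ V, DifferentiableOn ℂ (fun t => F t z) U := by
    intro z hzV
    by_cases hza : z = a
    · subst hza
      have hcont : ∀ t ∈ U, Tendsto (fun y => F t y) (𝓝[≠] z) (𝓝 (F t z)) := fun t ht =>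
        ((hz t ht).continuousOn.continuousAt (hV.mem_nhds hzV)).tendsto.mono_left
          nhdsWithin_le_nhds
      have hle : (Ultrafilter.of (𝓝[≠] z) : Filter ℂ) ≤ 𝓝[≠] z := Ultrafilter.of_le _
      obtain ⟨G, hG, hlim⟩ := (Ultrafilter.of (𝓝[≠] z)).exists_tendstoLocallyUniformlyOn
        (F := fun y t => F t y) hU (M := M) (by
          filter_upwards [hle self_mem_nhdsWithin,
            hle (mem_nhdsWithin_of_mem_nhds (hV.mem_nhds hzV))] with y hy hyV
          exact ⟨ht y hyV hy, fun t h => hM t h y hyV⟩)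
      refine hG.congr fun t h => ?_
      exact tendsto_nhds_unique ((hcont t h).mono_left hle) (hlim.tendsto_at h)
    · exact ht z hzV hza
  rintro ⟨t, z⟩ ⟨h1, h2⟩
  obtain ⟨r, hr, hrs⟩ := Metric.isOpen_iff.mp (hU.prod hV) (t, z) ⟨h1, h2⟩
  rw [← ball_prod_same] at hrs
  have hrU : ball t r ⊆ U := fun s hs => (hrs (mk_mem_prod hs (mem_ball_self hr))).1
  have hrV : ball z r ⊆ V := fun s hs => (hrs (mk_mem_prod (mem_ball_self hr) hs)).2
  exact (differentiableAt_of_separately hr (fun y hy => (ht' y (hrV hy)).mono hrU)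
    (fun s hs => (hz s (hrU hs)).mono hrV)
    fun s hs y hy => hM s (hrU hs) y (hrV hy)).differentiableWithinAt

end hartogs

section uniqueness
variable {E : Type*} [NormedAddCommGroup E] [NormedSpace ℂ E]

/-- On a convex open set, a product of holomorphic functions vanishes identically only if
each point where one factor does not vanish forces the other factor to vanish identically. -/
theorem Convex.eq_zero_of_mul_eq_zero {X : Set E} (hX : Convex ℝ X) (hXo : IsOpen X) {F G : E → ℂ}
    (hF : DifferentiableOn ℂ F X) (hG : DifferentiableOn ℂ G X) (h : ∀ x ∈ X, F x * G x = 0)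
    {x₀ : E} (hx₀ : x₀ ∈ X) (hG0 : G x₀ ≠ 0) : ∀ x ∈ X, F x = 0 := by
  intro x hx
  set A : ℂ → E := fun s => x₀ + s • (x - x₀) with hA
  have hAd : Differentiable ℂ A := by rw [hA]; fun_prop
  have hpre : IsOpen (A ⁻¹' X) := hXo.preimage hAd.continuous
  have hconv : Convex ℝ (A ⁻¹' X) := by
    intro s hs t ht a b ha hb hab
    have h1 := hX hs ht ha hb hab
    have h2 : A (a • s + b • t) = a • A s + b • A t := by
      simp only [hA, smul_add, add_smul, smul_assoc]
      have h3 : x₀ = a • x₀ + b • x₀ := by rw [← add_smul, hab, one_smul]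
      nth_rewrite 1 [h3]
      abel
    rw [mem_preimage, h2]
    exact h1
  have hF' : AnalyticOnNhd ℂ (F ∘ A) (A ⁻¹' X) :=
    (hF.comp hAd.differentiableOn fun s hs => hs).analyticOnNhd hpre
  have hG' : AnalyticOnNhd ℂ (G ∘ A) (A ⁻¹' X) :=
    (hG.comp hAd.differentiableOn fun s hs => hs).analyticOnNhd hpre
  have h0 : (0 : ℂ) ∈ A ⁻¹' X := by simpa [hA] using hx₀
  have h1 : (1 : ℂ) ∈ A ⁻¹' X := by simpa [hA] using hx
  rcases AnalyticOnNhd.eq_zero_or_eq_zero_of_mul_eq_zero hF' hG' (fun s hs => h _ hs)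
    hconv.isPreconnected with h2 | h2
  · simpa [hA] using h2 1 h1
  · exact absurd (by simpa [hA] using h2 0 h0) hG0

theorem Convex.cubic_lift_unique {X : Set E} (hX : Convex ℝ X) (hXo : IsOpen X)
    {e T Y₁ Y₂ : E → ℂ} (he : DifferentiableOn ℂ e X)
    (h₁ : DifferentiableOn ℂ Y₁ X) (h₂ : DifferentiableOn ℂ Y₂ X)
    (hY₁ : ∀ x ∈ X, Y₁ x ^ 3 - 3 * e x ^ 2 * Y₁ x = T x)
    (hY₂ : ∀ x ∈ X, Y₂ x ^ 3 - 3 * e x ^ 2 * Y₂ x = T x) {x₀ : E} (hx₀ : x₀ ∈ X)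
    (h0 : Y₁ x₀ = Y₂ x₀) (hne : Y₁ x₀ ^ 2 ≠ e x₀ ^ 2) : ∀ x ∈ X, Y₁ x = Y₂ x := by
  have h := hX.eq_zero_of_mul_eq_zero hXo (F := fun x => Y₁ x - Y₂ x)
    (G := fun x => Y₁ x ^ 2 + Y₁ x * Y₂ x + Y₂ x ^ 2 - 3 * e x ^ 2) (h₁.sub h₂)
    ((((h₁.pow 2).add (h₁.mul h₂)).add (h₂.pow 2)).sub ((he.pow 2).const_mul 3))
    (fun x hx => by linear_combination hY₁ x hx - hY₂ x hx) hx₀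
    (fun h => hne (by rw [← h0] at h; linear_combination h / 3))
  exact fun x hx => sub_eq_zero.mp (h x hx)

end uniqueness

section motion

/-- A bounded holomorphic motion of `Ω` over the unit disc, with initial velocity `ν`. -/
structure IsMotion (R : ℝ) (Ω : Set ℂ) (ν : ℂ → ℂ) (h : ℂ × ℂ → ℂ) : Prop where
  diff : DifferentiableOn ℂ h (ball 0 1 ×ˢ Ω)
  zero : ∀ z ∈ Ω, h (0, z) = z
  inj : ∀ t ∈ ball (0 : ℂ) 1, InjOn (fun z => h (t, z)) Ω
  bound : ∀ t ∈ ball (0 : ℂ) 1, ∀ z ∈ Ω, ‖h (t, z)‖ ≤ R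
  vel : ∀ z ∈ Ω, HasDerivAt (fun t => h (t, z)) (ν z) 0

variable {R : ℝ} {Ω Ω' : Set ℂ} {ν ν' : ℂ → ℂ} {h : ℂ × ℂ → ℂ} {c a : ℂ}

theorem IsMotion.diff_fst (hm : IsMotion R Ω ν h) {z : ℂ} (hz : z ∈ Ω) :
    DifferentiableOn ℂ (fun t => h (t, z)) (ball 0 1) :=
  hm.diff.comp (f := fun t => (t, z)) (by fun_prop) fun t ht => ⟨ht, hz⟩

theorem IsMotion.diff_snd (hm : IsMotion R Ω ν h) {t : ℂ} (ht : t ∈ ball (0 : ℂ) 1) :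
    DifferentiableOn ℂ (fun z => h (t, z)) Ω :=
  hm.diff.comp (f := fun z => (t, z)) (by fun_prop) fun z hz => ⟨ht, hz⟩

theorem cubic_ne_critVal {c a z : ℂ} (h1 : z ≠ c) (h2 : z ≠ -c) (h3 : z ≠ 2 * c) (h4 : z ≠ -(2 * c)) :
    cubic c a z ≠ cubic c a c ∧ cubic c a z ≠ cubic c a (-c) := by
  constructor
  · intro h
    have h5 := cubic_sub_crit c a z
    rw [h, sub_self, zero_eq_mul] at h5
    rcases h5 with h5 | h5
    · exact h1 (sub_eq_zero.mp (pow_eq_zero_iff two_ne_zero |>.mp h5))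
    · exact h4 (eq_neg_of_add_eq_zero_left h5)
  · intro h
    have h5 := cubic_sub_crit' c a z
    rw [h, sub_self, zero_eq_mul] at h5
    rcases h5 with h5 | h5
    · exact h2 (eq_neg_of_add_eq_zero_left (pow_eq_zero_iff two_ne_zero |>.mp h5))
    · exact h3 (sub_eq_zero.mp h5)

theorem IsMotion.exists_critPt (hm : IsMotion R Ω ν h) (hc : c ≠ 0) (hv₁ : cubic c a c ∈ Ω)
    (hv₂ : cubic c a (-c) ∈ Ω) : ∃ E : ℂ → ℂ, DifferentiableOn ℂ E (ball 0 1) ∧ E 0 = c ∧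
      ∀ t ∈ ball (0 : ℂ) 1, E t ≠ 0 ∧ 4 * E t ^ 3 = h (t, cubic c a (-c)) - h (t, cubic c a c) := by
  have h0 : (0 : ℂ) ∈ ball (0 : ℂ) 1 := mem_ball_self one_pos
  have hne : cubic c a (-c) ≠ cubic c a c := by
    intro h
    have h1 : 4 * c ^ 3 = 0 := by simp only [cubic] at h; linear_combination h
    exact hc (by simpa using h1)
  obtain ⟨L, hL, hL3⟩ := (convex_ball (0 : ℂ) 1).exists_differentiableOn_pow_eq isOpen_ball
    (F := fun t => (h (t, cubic c a (-c)) - h (t, cubic c a c)) / 4)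
    (((hm.diff_fst hv₂).sub (hm.diff_fst hv₁)).div_const 4)
    (fun t ht => div_ne_zero (sub_ne_zero.mpr fun h => hne (hm.inj t ht hv₂ hv₁ h)) (by norm_num))
    (n := 3) three_ne_zero
  have hL0 : L 0 ^ 3 = c ^ 3 := by
    rw [hL3 0 h0, hm.zero _ hv₁, hm.zero _ hv₂]; simp only [cubic]; ring
  have hL00 : L 0 ≠ 0 := fun h => by
    rw [h] at hL0
    exact hc (by simpa using hL0.symm)
  have hE : ∀ t ∈ ball (0 : ℂ) 1, 4 * (c / L 0 * L t) ^ 3 =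
      h (t, cubic c a (-c)) - h (t, cubic c a c) := fun t ht => by
    rw [mul_pow, div_pow, hL0, div_self (pow_ne_zero 3 hc), one_mul, hL3 t ht]; ring
  refine ⟨fun t => c / L 0 * L t, hL.const_mul _, div_mul_cancel₀ _ hL00, fun t ht => ⟨?_, hE t ht⟩⟩
  intro h0
  have h1 := hE t ht
  have h2 : c / L 0 * L t = 0 := h0
  rw [h2] at h1
  exact hne (hm.inj t ht hv₂ hv₁ (sub_eq_zero.mp (by rw [← h1]; ring)))

variable {E : ℂ → ℂ}

theorem IsMotion.exists_critFactor (hm : IsMotion R Ω ν h) (hΩ : IsOpen Ω) (hv₁ : cubic c a c ∈ Ω) :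
    ∃ r > 0, ball (cubic c a c) r ⊆ Ω ∧ ∃ D : ℂ × ℂ → ℂ,
      DifferentiableOn ℂ D (ball 0 1 ×ˢ ball (cubic c a c) r) ∧
      (∀ t ∈ ball (0 : ℂ) 1, ∀ u ∈ ball (cubic c a c) r, D (t, u) ≠ 0) ∧
      ∀ t u, h (t, u) - h (t, cubic c a c) = (u - cubic c a c) * D (t, u) := by
  set v := cubic c a c with hv
  obtain ⟨r, hr, hrΩ⟩ := Metric.isOpen_iff.mp hΩ v hv₁
  have hvr : v ∈ ball v r := mem_ball_self hr
  refine ⟨r, hr, hrΩ, fun q => dslope (fun u => h (q.1, u)) v q.2, ?_, fun t ht u hu => ?_,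
    fun t u => ?_⟩
  · refine differentiableOn_of_separately (F := fun t u => dslope (fun u => h (t, u)) v u)
      isOpen_ball isOpen_ball (a := v) (M := 2 * R / r) (fun u hu huv => ?_) (fun t ht => ?_)
      (fun t ht u hu => ?_)
    · simp only [dslope_of_ne _ huv, slope_def_field]
      exact ((hm.diff_fst (hrΩ hu)).sub (hm.diff_fst hv₁)).div_const _
    · exact (Complex.differentiableOn_dslope (ball_mem_nhds _ hr)).mpr ((hm.diff_snd ht).mono hrΩ)
    · refine Complex.norm_dslope_le_div_of_mapsTo_ball ((hm.diff_snd ht).mono hrΩ)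
        (fun s hs => ?_) hu
      rw [mem_closedBall, dist_eq_norm, two_mul]
      exact (norm_sub_le _ _).trans (add_le_add (hm.bound _ ht _ (hrΩ hs)) (hm.bound _ ht _ hv₁))
  · by_cases huv : u = v
    · rw [huv]
      simp only [dslope_same]
      exact (((hm.diff_snd ht).analyticOnNhd hΩ) v hv₁).deriv_ne_zero_of_injOn (hΩ.mem_nhds hv₁)
        (hm.inj t ht)
    · simp only [dslope_of_ne _ huv, slope_def_field]
      exact div_ne_zero (sub_ne_zero.mpr fun h => huv (hm.inj t ht (hrΩ hu) hv₁ h))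
        (sub_ne_zero.mpr huv)
  · have := sub_smul_dslope (fun u => h (t, u)) v u
    rw [smul_eq_mul] at this
    exact this.symm

variable (hm : IsMotion R Ω ν h) (hΩ : IsOpen Ω) (hΩ' : IsOpen Ω')
  (hmaps : MapsTo (cubic c a) Ω' Ω) (hco : ∀ z ∈ Ω', z ≠ -c ∧ z ≠ 2 * c ∧ z ≠ -(2 * c))
  (hv₁ : cubic c a c ∈ Ω) (hv₂ : cubic c a (-c) ∈ Ω) (hE : DifferentiableOn ℂ E (ball 0 1))
  (hE0 : E 0 = c) (hE4 : ∀ t ∈ ball (0 : ℂ) 1,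
    E t ≠ 0 ∧ 4 * E t ^ 3 = h (t, cubic c a (-c)) - h (t, cubic c a c))
include hm hΩ hΩ' hmaps hco hv₁ hv₂ hE hE0 hE4

theorem IsMotion.exists_local_lift {z₀ : ℂ} (hz₀ : z₀ ∈ Ω') :
    ∃ r > 0, ball z₀ r ⊆ Ω' ∧ ∃ Y : ℂ × ℂ → ℂ, DifferentiableOn ℂ Y (ball 0 1 ×ˢ ball z₀ r) ∧
      (∀ t ∈ ball (0 : ℂ) 1, ∀ z ∈ ball z₀ r, Y (t, z) ^ 3 - 3 * E t ^ 2 * Y (t, z) =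
        h (t, cubic c a z) - (h (t, cubic c a c) + h (t, cubic c a (-c))) / 2) ∧
      ∀ z ∈ ball z₀ r, Y (0, z) = z := by
  have h0 : (0 : ℂ) ∈ ball (0 : ℂ) 1 := mem_ball_self one_pos
  have hbase : ∀ z ∈ Ω', z ^ 3 - 3 * E 0 ^ 2 * z =
      h (0, cubic c a z) - (h (0, cubic c a c) + h (0, cubic c a (-c))) / 2 := fun z hz => by
    rw [hE0, hm.zero _ (hmaps hz), hm.zero _ hv₁, hm.zero _ hv₂]; simp only [cubic]; ring
  have hEd : ∀ r, DifferentiableOn ℂ (fun q : ℂ × ℂ => E q.1) (ball 0 1 ×ˢ ball z₀ r) := fun r =>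
    hE.comp (f := Prod.fst) differentiableOn_fst fun q hq => hq.1
  have hfst : ∀ r, ∀ u ∈ Ω, DifferentiableOn ℂ (fun q : ℂ × ℂ => h (q.1, u))
      (ball 0 1 ×ˢ ball z₀ r) := fun r u hu =>
    (hm.diff_fst hu).comp (f := Prod.fst) differentiableOn_fst fun q hq => hq.1
  have hcub : Differentiable ℂ fun q : ℂ × ℂ => (q.1, cubic c a q.2) := by
    simp only [cubic]; fun_prop
  have hsnd : ∀ r, ball z₀ r ⊆ Ω' → DifferentiableOn ℂ (fun q : ℂ × ℂ => h (q.1, cubic c a q.2))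
      (ball 0 1 ×ˢ ball z₀ r) := fun r hr =>
    hm.diff.comp (f := fun q : ℂ × ℂ => (q.1, cubic c a q.2)) hcub.differentiableOn fun q hq =>
      ⟨hq.1, hmaps (hr hq.2)⟩
  have hconv : ∀ r, Convex ℝ (ball (0 : ℂ) 1 ×ˢ ball z₀ r) := fun r =>
    (convex_ball _ _).prod (convex_ball _ _)
  have key : ∃ r > 0, ball z₀ r ⊆ Ω' ∧ ∃ κ K : ℂ × ℂ → ℂ,
      DifferentiableOn ℂ κ (ball 0 1 ×ˢ ball z₀ r) ∧
      DifferentiableOn ℂ K (ball 0 1 ×ˢ ball z₀ r) ∧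
      (∀ q ∈ ball (0 : ℂ) 1 ×ˢ ball z₀ r, K q ≠ 0) ∧
      ∀ q ∈ ball (0 : ℂ) 1 ×ˢ ball z₀ r,
        (h (q.1, cubic c a q.2) - h (q.1, cubic c a c)) *
          (h (q.1, cubic c a q.2) - h (q.1, cubic c a (-c))) = κ q ^ 2 * K q := by
    have hne2 : ∀ t ∈ ball (0 : ℂ) 1, ∀ z ∈ Ω', h (t, cubic c a z) - h (t, cubic c a (-c)) ≠ 0 := by
      intro t ht z hz h1
      have h2 := hm.inj t ht (hmaps hz) hv₂ (sub_eq_zero.mp h1)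
      have h5 := cubic_sub_crit' c a z
      rw [h2, sub_self, zero_eq_mul] at h5
      rcases h5 with h5 | h5
      · exact (hco z hz).1 (eq_neg_of_add_eq_zero_left (pow_eq_zero_iff two_ne_zero |>.mp h5))
      · exact (hco z hz).2.1 (sub_eq_zero.mp h5)
    by_cases hzc : z₀ = c
    · subst hzc
      obtain ⟨s, hs, hsΩ, D, hD, hD0, hDe⟩ := hm.exists_critFactor hΩ hv₁
      have hnb : Ω' ∩ cubic z₀ a ⁻¹' ball (cubic z₀ a z₀) s ∈ 𝓝 z₀ :=
        inter_mem (hΩ'.mem_nhds hz₀)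
          ((differentiable_cubic z₀ a).continuous.continuousAt (ball_mem_nhds _ hs))
      obtain ⟨r, hr, hrs⟩ := Metric.mem_nhds_iff.mp hnb
      have hrΩ : ball z₀ r ⊆ Ω' := fun z hz => (hrs hz).1
      refine ⟨r, hr, hrΩ, fun q => q.2 - z₀, fun q => (q.2 + 2 * z₀) * D (q.1, cubic z₀ a q.2) *
        (h (q.1, cubic z₀ a q.2) - h (q.1, cubic z₀ a (-z₀))), by fun_prop, ?_, ?_, ?_⟩
      · refine DifferentiableOn.mul (DifferentiableOn.mul (by fun_prop) ?_)
          ((hsnd r hrΩ).sub (hfst r _ hv₂))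
        exact hD.comp (f := fun q : ℂ × ℂ => (q.1, cubic z₀ a q.2)) hcub.differentiableOn
          fun q hq => ⟨hq.1, (hrs hq.2).2⟩
      · rintro ⟨t, z⟩ ⟨ht, hz⟩
        refine mul_ne_zero (mul_ne_zero (fun h => ?_) (hD0 t ht _ (hrs hz).2))
          (hne2 t ht z (hrΩ hz))
        exact (hco z (hrΩ hz)).2.2 (eq_neg_of_add_eq_zero_left h)
      · rintro ⟨t, z⟩ -
        have h1 := hDe t (cubic z₀ a z)
        have h2 := cubic_sub_crit z₀ a z
        simp only at h1 ⊢
        rw [h1, h2]; ring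
    · have hnb : Ω' ∩ {c}ᶜ ∈ 𝓝 z₀ := inter_mem (hΩ'.mem_nhds hz₀) (isOpen_ne.mem_nhds hzc)
      obtain ⟨r, hr, hrs⟩ := Metric.mem_nhds_iff.mp hnb
      have hrΩ : ball z₀ r ⊆ Ω' := fun z hz => (hrs hz).1
      refine ⟨r, hr, hrΩ, fun _ => 1, fun q => (h (q.1, cubic c a q.2) - h (q.1, cubic c a c)) *
          (h (q.1, cubic c a q.2) - h (q.1, cubic c a (-c))), differentiableOn_const _,
          ((hsnd r hrΩ).sub (hfst r _ hv₁)).mul ((hsnd r hrΩ).sub (hfst r _ hv₂)), ?_,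
          fun q hq => by simp⟩
      rintro ⟨t, z⟩ ⟨ht, hz⟩
      refine mul_ne_zero (fun h1 => ?_) (hne2 t ht z (hrΩ hz))
      have h2 := hco z (hrΩ hz)
      exact (cubic_ne_critVal (a := a) (hrs hz).2 h2.1 h2.2.1 h2.2.2).1
        (hm.inj t ht (hmaps (hrΩ hz)) hv₁ (sub_eq_zero.mp h1))
  obtain ⟨r, hr, hrΩ, κ, K, hκ, hK, hK0, hd⟩ := key
  obtain ⟨z₁, hz₁, hz₁c⟩ : ∃ z₁ ∈ ball z₀ r, z₁ ≠ c := by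
    obtain ⟨z₁, h1, h2⟩ := (inferInstance : (𝓝[≠] c).NeBot).nonempty_of_mem
      (inter_mem_nhdsWithin {c}ᶜ (ball_mem_nhds c hr))
    by_cases hzc : z₀ = c
    · exact ⟨z₁, hzc ▸ h2, h1⟩
    · exact ⟨z₀, mem_ball_self hr, hzc⟩
  obtain ⟨Y, hY, hYe, hY0⟩ := (hconv r).exists_cubic_lift (isOpen_ball.prod isOpen_ball) (hEd r)
    (T := fun q => h (q.1, cubic c a q.2) - (h (q.1, cubic c a c) + h (q.1, cubic c a (-c))) / 2)
    (by
      simp only [div_eq_mul_inv]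
      exact (hsnd r hrΩ).sub (((hfst r _ hv₁).add (hfst r _ hv₂)).mul_const _)) hκ hK
    (fun q hq => (hE4 q.1 hq.1).1) hK0 (fun q hq => by
      rw [← hd q hq]
      have h1 := (hE4 q.1 hq.1).2
      linear_combination (-(1 / 4 : ℂ)) * (4 * E q.1 ^ 3 +
        (h (q.1, cubic c a (-c)) - h (q.1, cubic c a c))) * h1)
    (x₀ := (0, z₁)) ⟨h0, hz₁⟩ (y₀ := z₁) (hbase z₁ (hrΩ hz₁))
  refine ⟨r, hr, hrΩ, Y, hY, fun t ht z hz => hYe (t, z) ⟨ht, hz⟩, ?_⟩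
  refine (convex_ball z₀ r).cubic_lift_unique isOpen_ball (e := fun _ => E 0)
    (differentiableOn_const _) (hY.comp (f := fun z => ((0 : ℂ), z)) (by fun_prop)
      fun z hz => ⟨h0, hz⟩) differentiableOn_id (fun z hz => hYe (0, z) ⟨h0, hz⟩)
    (fun z hz => hbase z (hrΩ hz)) hz₁ hY0 ?_
  rw [hY0, hE0]
  intro h1
  rcases sq_eq_sq_iff_eq_or_eq_neg.mp h1 with h2 | h2
  · exact hz₁c h2
  · exact (hco z₁ (hrΩ hz₁)).1 h2

end motion

section motion

variable {R : ℝ} {Ω Ω' : Set ℂ} {ν ν' : ℂ → ℂ} {h : ℂ × ℂ → ℂ} {c a dc da : ℂ} {E : ℂ → ℂ}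

/-- `G` lifts the motion of `cubic c a z` through the family of cubics with critical points `±E`. -/
structure IsLiftAt (h : ℂ × ℂ → ℂ) (E : ℂ → ℂ) (c a z : ℂ) (G : ℂ → ℂ) : Prop where
  diff : DifferentiableOn ℂ G (ball 0 1)
  eq : ∀ t ∈ ball (0 : ℂ) 1, G t ^ 3 - 3 * E t ^ 2 * G t =
    h (t, cubic c a z) - (h (t, cubic c a c) + h (t, cubic c a (-c))) / 2
  zero : G 0 = z

theorem IsLiftAt.eqOn_crit {G : ℂ → ℂ} (hG : IsLiftAt h E c a c G) (hc : c ≠ 0)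
    (hE : DifferentiableOn ℂ E (ball 0 1)) (hE0 : E 0 = c) (hE4 : ∀ t ∈ ball (0 : ℂ) 1,
      E t ≠ 0 ∧ 4 * E t ^ 3 = h (t, cubic c a (-c)) - h (t, cubic c a c)) :
    ∀ t ∈ ball (0 : ℂ) 1, G t = E t := by
  intro t ht
  have := (convex_ball (0 : ℂ) 1).eq_zero_of_mul_eq_zero isOpen_ball
    (F := fun t => (G t - E t) ^ 2) (G := fun t => G t + 2 * E t)
    ((hG.diff.sub hE).pow 2) (hG.diff.add (hE.const_mul 2)) (fun t ht => by
      have h1 := hG.eq t ht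
      have h2 := (hE4 t ht).2
      linear_combination h1 + (1 / 2 : ℂ) * h2) (x₀ := 0) (mem_ball_self one_pos)
    (by rw [hG.zero, hE0]; intro h; apply hc; linear_combination (1 / 3 : ℂ) * h) t ht
  exact sub_eq_zero.mp (pow_eq_zero_iff two_ne_zero |>.mp this)

theorem IsLiftAt.eqOn {z : ℂ} {G₁ G₂ : ℂ → ℂ} (h₁ : IsLiftAt h E c a z G₁)
    (h₂ : IsLiftAt h E c a z G₂) (hz : z ≠ -c) (hc : c ≠ 0)
    (hE : DifferentiableOn ℂ E (ball 0 1)) (hE0 : E 0 = c) (hE4 : ∀ t ∈ ball (0 : ℂ) 1,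
      E t ≠ 0 ∧ 4 * E t ^ 3 = h (t, cubic c a (-c)) - h (t, cubic c a c)) :
    ∀ t ∈ ball (0 : ℂ) 1, G₁ t = G₂ t := by
  by_cases hzc : z = c
  · subst hzc
    intro t ht
    rw [h₁.eqOn_crit hc hE hE0 hE4 t ht, h₂.eqOn_crit hc hE hE0 hE4 t ht]
  · refine (convex_ball (0 : ℂ) 1).cubic_lift_unique isOpen_ball hE h₁.diff h₂.diff h₁.eq h₂.eq
      (mem_ball_self one_pos) (by rw [h₁.zero, h₂.zero]) ?_
    rw [h₁.zero, hE0]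
    exact fun h => (sq_eq_sq_iff_eq_or_eq_neg.mp h).elim hzc hz

/-- Lifting a bounded holomorphic motion through the cubic map. -/
theorem IsMotion.exists_lift (hm : IsMotion R Ω ν h) (hR : 3 ≤ R) (hΩ : IsOpen Ω)
    (hΩ' : IsOpen Ω') (hc : c ≠ 0) (hmaps : MapsTo (cubic c a) Ω' Ω)
    (hco : ∀ z ∈ Ω', z ≠ -c ∧ z ≠ 2 * c ∧ z ≠ -(2 * c))
    (hv₁ : cubic c a c ∈ Ω) (hv₂ : cubic c a (-c) ∈ Ω)
    (hν₁ : ν (cubic c a c) = -6 * c * dc * c + da)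
    (hν₂ : ν (cubic c a (-c)) = -6 * c * dc * (-c) + da)
    (hν : ∀ z ∈ Ω', ν (cubic c a z) = 3 * (z ^ 2 - c ^ 2) * ν' z + (-6 * c * dc * z + da))
    (hνc : c ∈ Ω' → ν' c = dc) : ∃ h', IsMotion R Ω' ν' h' := by
  have h0 : (0 : ℂ) ∈ ball (0 : ℂ) 1 := mem_ball_self one_pos
  obtain ⟨E, hE, hE0, hE4⟩ := hm.exists_critPt hc hv₁ hv₂
  choose r hr hsub Y hYd hYe hY0 using fun (z₀ : ℂ) (hz₀ : z₀ ∈ Ω') =>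
    hm.exists_local_lift hΩ hΩ' hmaps hco hv₁ hv₂ hE hE0 hE4 hz₀
  have hYL : ∀ z₀ (hz₀ : z₀ ∈ Ω'), ∀ z ∈ ball z₀ (r z₀ hz₀),
      IsLiftAt h E c a z fun t => Y z₀ hz₀ (t, z) := fun z₀ hz₀ z hz =>
    ⟨(hYd z₀ hz₀).comp (f := fun t => (t, z)) (by fun_prop) fun t ht => ⟨ht, hz⟩,
      fun t ht => hYe z₀ hz₀ t ht z hz, hY0 z₀ hz₀ z hz⟩
  classical
  obtain ⟨h', hh'⟩ : ∃ h' : ℂ × ℂ → ℂ, h' = fun q => if hq : q.2 ∈ Ω' then Y q.2 hq q else 0 :=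
    ⟨_, rfl⟩
  have hL : ∀ z ∈ Ω', IsLiftAt h E c a z fun t => h' (t, z) := fun z hz => by
    have : (fun t => h' (t, z)) = fun t => Y z hz (t, z) := by
      funext t; rw [hh']; simp only [hz, dite_true]
    rw [this]
    exact hYL z hz z (mem_ball_self (hr z hz))
  have hcrit : ∀ t ∈ ball (0 : ℂ) 1, ∀ z ∈ Ω', z ≠ c → h' (t, z) ^ 2 ≠ E t ^ 2 := by
    intro t ht z hz hzc hsq
    have h1 := (hL z hz).eq t ht
    have h2 := (hE4 t ht).2
    have h3 := hco z hz
    have h4 := cubic_ne_critVal (a := a) hzc h3.1 h3.2.1 h3.2.2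
    rcases sq_eq_sq_iff_eq_or_eq_neg.mp hsq with h5 | h5
    · refine h4.1 (hm.inj t ht (hmaps hz) hv₁ ?_)
      simp only [h5] at h1
      linear_combination -h1 - (1 / 2 : ℂ) * h2
    · refine h4.2 (hm.inj t ht (hmaps hz) hv₂ ?_)
      simp only [h5] at h1
      linear_combination -h1 + (1 / 2 : ℂ) * h2
  refine ⟨h', ?_, fun z hz => (hL z hz).zero, ?_, ?_, ?_⟩
  · rintro ⟨t, z⟩ ⟨ht, hz⟩
    have h1 : DifferentiableAt ℂ (Y z hz) (t, z) := (hYd z hz).differentiableAt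
      ((isOpen_ball.prod isOpen_ball).mem_nhds ⟨ht, mem_ball_self (hr z hz)⟩)
    refine (h1.congr_of_eventuallyEq ?_).differentiableWithinAt
    filter_upwards [(isOpen_ball.prod isOpen_ball).mem_nhds
      (⟨ht, mem_ball_self (hr z hz)⟩ : (t, z) ∈ ball (0 : ℂ) 1 ×ˢ ball z (r z hz))] with q hq
    exact (hL q.2 (hsub z hz hq.2)).eqOn (hYL z hz q.2 hq.2) (hco _ (hsub z hz hq.2)).1 hc hE hE0
      hE4 q.1 hq.1
  · intro t ht z hz z' hz' he
    have he : h' (t, z) = h' (t, z') := he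
    have h1 : cubic c a z = cubic c a z' := by
      refine hm.inj t ht (hmaps hz) (hmaps hz') ?_
      have h2 := (hL z hz).eq t ht
      have h3 := (hL z' hz').eq t ht
      simp only [he] at h2 h3
      linear_combination h3 - h2
    by_contra hne
    have hne' : ∀ z ∈ Ω', z ≠ c → cubic c a z ≠ cubic c a c := fun z hz hzc =>
      (cubic_ne_critVal hzc (hco z hz).1 (hco z hz).2.1 (hco z hz).2.2).1
    have hzc : z ≠ c := fun h => hne' z' hz' (fun h' => hne (h.trans h'.symm)) (by rw [← h1, h])
    have h4 := (convex_ball (0 : ℂ) 1).cubic_lift_unique isOpen_ball hE (hL z hz).diff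
      (hL z' hz').diff (hL z hz).eq (by rw [h1]; exact (hL z' hz').eq) ht he
      (hcrit t ht z hz hzc) 0 h0
    rw [(hL z hz).zero, (hL z' hz').zero] at h4
    exact hne h4
  · intro t ht z hz
    by_contra! hlt
    have h1 := (hL z hz).eq t ht
    have h2 := (hE4 t ht).2
    have b1 := hm.bound t ht _ (hmaps hz)
    have b2 := hm.bound t ht _ hv₁
    have b3 := hm.bound t ht _ hv₂
    have e1 : 4 * ‖E t‖ ^ 3 ≤ 2 * R := by
      have : ‖4 * E t ^ 3‖ ≤ R + R := by
        rw [h2]; exact (norm_sub_le _ _).trans (add_le_add b3 b2)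
      rw [norm_mul, norm_pow] at this
      norm_num at this
      linarith
    have e2 : ‖h' (t, z)‖ ^ 3 ≤ 3 * ‖E t‖ ^ 2 * ‖h' (t, z)‖ + 2 * R := by
      have h3 : h' (t, z) ^ 3 = 3 * E t ^ 2 * h' (t, z) + (h (t, cubic c a z) -
        (h (t, cubic c a c) + h (t, cubic c a (-c))) / 2) := by linear_combination h1
      have h4 : ‖h (t, cubic c a z) - (h (t, cubic c a c) + h (t, cubic c a (-c))) / 2‖ ≤ 2 * R := by
        refine (norm_sub_le _ _).trans ?_
        rw [norm_div]
        have := norm_add_le (h (t, cubic c a c)) (h (t, cubic c a (-c)))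
        norm_num
        linarith
      calc ‖h' (t, z)‖ ^ 3 = ‖h' (t, z) ^ 3‖ := (norm_pow _ _).symm
        _ ≤ _ := by
          rw [h3]
          refine (norm_add_le _ _).trans (add_le_add (le_of_eq ?_) h4)
          simp
    generalize ‖h' (t, z)‖ = y at *
    have he0 : 0 ≤ ‖E t‖ := norm_nonneg _
    generalize ‖E t‖ = e at *
    have hy : 3 < y := by linarith
    have e3 : y * y ^ 2 < y * (3 * e ^ 2 + 2) := by nlinarith
    have e4 := lt_of_mul_lt_mul_left e3 (by linarith)
    rcases le_total e 1 with h1 | h1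
    · nlinarith
    · have : e ^ 2 ≤ e ^ 3 := pow_le_pow_right₀ h1 (by norm_num)
      nlinarith
  · intro z hz
    have hEd : HasDerivAt E (deriv E 0) 0 :=
      (hE.differentiableAt (ball_mem_nhds _ one_pos)).hasDerivAt
    have hE' : deriv E 0 = dc := by
      have h1 : HasDerivAt (fun t => 4 * E t ^ 3) (4 * (3 * E 0 ^ 2 * deriv E 0)) 0 := by
        simpa using (hEd.pow 3).const_mul 4
      have h2 : HasDerivAt (fun t => 4 * E t ^ 3) (ν (cubic c a (-c)) - ν (cubic c a c)) 0 := by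
        refine ((hm.vel _ hv₂).sub (hm.vel _ hv₁)).congr_of_eventuallyEq ?_
        filter_upwards [ball_mem_nhds (0 : ℂ) one_pos] with t ht using (hE4 t ht).2
      have h3 := h1.unique h2
      rw [hν₁, hν₂, hE0] at h3
      refine mul_left_cancel₀ (mul_ne_zero (by norm_num : (12 : ℂ) ≠ 0) (pow_ne_zero 2 hc)) ?_
      linear_combination h3
    have hG := hL z hz
    by_cases hzc : z = c
    · subst hzc
      rw [hνc hz, ← hE']
      refine hEd.congr_of_eventuallyEq ?_
      filter_upwards [ball_mem_nhds (0 : ℂ) one_pos] with t ht using hG.eqOn_crit hc hE hE0 hE4 t ht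
    · have hGd := (hG.diff.differentiableAt (ball_mem_nhds _ one_pos)).hasDerivAt
      obtain ⟨δ, hδ⟩ : ∃ δ, δ = deriv (fun t => h' (t, z)) 0 := ⟨_, rfl⟩
      rw [← hδ] at hGd
      have h1 : HasDerivAt (fun t => h' (t, z) ^ 3 - 3 * E t ^ 2 * h' (t, z))
          (3 * z ^ 2 * δ - (6 * c * dc * z + 3 * c ^ 2 * δ)) 0 := by
        have := (hGd.pow 3).sub (((hEd.pow 2).const_mul 3).mul hGd)
        refine this.congr_deriv ?_
        have hz0 : h' (0, z) = z := hG.zero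
        simp only [Pi.pow_apply, hz0, hE0, hE', Nat.reduceSub, pow_one]
        push_cast
        ring
      have h2 : HasDerivAt (fun t => h' (t, z) ^ 3 - 3 * E t ^ 2 * h' (t, z))
          (ν (cubic c a z) - (ν (cubic c a c) + ν (cubic c a (-c))) / 2) 0 := by
        refine ((hm.vel _ (hmaps hz)).sub
          (((hm.vel _ hv₁).add (hm.vel _ hv₂)).div_const 2)).congr_of_eventuallyEq ?_
        filter_upwards [ball_mem_nhds (0 : ℂ) one_pos] with t ht using hG.eq t ht
      have h3 := h1.unique h2
      rw [hν₁, hν₂, hν z hz] at h3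
      have hne : 3 * (z ^ 2 - c ^ 2) ≠ 0 := by
        refine mul_ne_zero (by norm_num) (sub_ne_zero.mpr fun h => ?_)
        exact (sq_eq_sq_iff_eq_or_eq_neg.mp h).elim hzc (hco z hz).1
      have h4 : δ = ν' z := mul_left_cancel₀ hne (by linear_combination h3)
      rwa [h4] at hGd

end motion

section motion

variable {R : ℝ} {Ω Ω₁ : Set ℂ} {ν ξ : ℂ → ℂ} {h : ℂ × ℂ → ℂ} {c a dc da : ℂ}

theorem IsMotion.mono (hm : IsMotion R Ω ν h) (hs : Ω₁ ⊆ Ω) : IsMotion R Ω₁ ν h :=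
  ⟨hm.diff.mono (prod_mono_right hs), fun z hz => hm.zero z (hs hz),
    fun t ht => (hm.inj t ht).mono hs, fun t ht z hz => hm.bound t ht z (hs hz),
    fun z hz => hm.vel z (hs hz)⟩

/-- Precomposing a motion with a short linear flow adds the velocities. -/
theorem IsMotion.comp_flow (hm : IsMotion R Ω₁ ν h) (hΩ₁ : IsOpen Ω₁) (hs : Ω ⊆ Ω₁)
    (hξ : DifferentiableOn ℂ ξ Ω) (hmem : ∀ t ∈ ball (0 : ℂ) 1, ∀ z ∈ Ω, z + t * ξ z ∈ Ω₁)
    (hinj : ∀ t ∈ ball (0 : ℂ) 1, InjOn (fun z => z + t * ξ z) Ω) :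
    IsMotion R Ω (fun z => ν z + ξ z) fun q => h (q.1, q.2 + q.1 * ξ q.2) := by
  have h0 : (0 : ℂ) ∈ ball (0 : ℂ) 1 := mem_ball_self one_pos
  refine ⟨?_, fun z hz => ?_, fun t ht z hz z' hz' he => ?_, fun t ht z hz => ?_, fun z hz => ?_⟩
  · refine hm.diff.comp (f := fun q : ℂ × ℂ => (q.1, q.2 + q.1 * ξ q.2)) ?_
      fun q hq => ⟨hq.1, hmem _ hq.1 _ hq.2⟩
    have : DifferentiableOn ℂ (fun q : ℂ × ℂ => ξ q.2) (ball 0 1 ×ˢ Ω) :=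
      hξ.comp (f := Prod.snd) differentiableOn_snd fun q hq => hq.2
    exact differentiableOn_fst.prodMk (differentiableOn_snd.add (differentiableOn_fst.mul this))
  · simp only [zero_mul, add_zero]
    exact hm.zero z (hs hz)
  · exact hinj t ht hz hz' (hm.inj t ht (hmem t ht z hz) (hmem t ht z' hz') he)
  · exact hm.bound t ht _ (hmem t ht z hz)
  · have hd : DifferentiableAt ℂ h (0, z) :=
      hm.diff.differentiableAt ((isOpen_ball.prod hΩ₁).mem_nhds ⟨h0, hs hz⟩)
    have h1 : fderiv ℂ h (0, z) (1, 0) = ν z := by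
      refine HasDerivAt.unique ?_ (hm.vel z (hs hz))
      exact hd.hasFDerivAt.comp_hasDerivAt (f := fun t : ℂ => (t, z)) 0
        ((hasDerivAt_id (0 : ℂ)).prodMk (hasDerivAt_const (0 : ℂ) z))
    have h2 : fderiv ℂ h (0, z) (0, 1) = 1 := by
      have h3 : HasDerivAt (fun s => h (0, s)) (fderiv ℂ h (0, z) (0, 1)) z :=
        hd.hasFDerivAt.comp_hasDerivAt (f := fun s : ℂ => ((0 : ℂ), s)) z
          ((hasDerivAt_const z (0 : ℂ)).prodMk (hasDerivAt_id z))
      refine h3.unique ((hasDerivAt_id z).congr_of_eventuallyEq ?_)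
      filter_upwards [hΩ₁.mem_nhds (hs hz)] with s hs using hm.zero s hs
    have h3 : fderiv ℂ h (0, z) (1, ξ z) = ν z + ξ z := by
      have : ((1 : ℂ), ξ z) = (1, 0) + ξ z • ((0 : ℂ), (1 : ℂ)) := by simp
      rw [this, map_add, map_smul, h1, h2]; simp
    have hd' : HasFDerivAt h (fderiv ℂ h (0, z)) ((0 : ℂ), z + 0 * ξ z) := by
      simpa using hd.hasFDerivAt
    have h4 := hd'.comp_hasDerivAt (f := fun t : ℂ => (t, z + t * ξ z)) 0
      ((hasDerivAt_id (0 : ℂ)).prodMk (((hasDerivAt_id (0 : ℂ)).mul_const (ξ z)).const_add z))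
    rw [one_mul, h3] at h4
    exact h4

theorem IsMotion.norm_vel_le (hm : IsMotion R Ω ν h) {z : ℂ} (hz : z ∈ Ω) : ‖ν z‖ ≤ 2 * R := by
  have h1 := Complex.norm_deriv_le_div_of_mapsTo_ball (f := fun t => h (t, z)) (c := 0) (R₁ := 1)
    (R₂ := 2 * R) (hm.diff_fst hz) (fun t ht => ?_) one_pos
  · rwa [(hm.vel z hz).deriv, div_one] at h1
  · rw [mem_closedBall, dist_eq_norm, two_mul]
    exact (norm_sub_le _ _).trans (add_le_add (hm.bound _ ht _ hz)
      (hm.bound _ (mem_ball_self one_pos) _ hz))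

/-- Infinitesimal rigidity: an invariant holomorphic deformation field on a neighbourhood of the
postcritical set that is eventually mapped compactly inside itself is trivial. -/
theorem eq_zero_of_invariant_field (hc : c ≠ 0) (hΩ : IsOpen Ω) (hΩ₁ : IsOpen Ω₁)
    (hΩc : IsCompact (closure Ω)) (hcl : closure Ω ⊆ Ω₁) (hmaps : MapsTo (cubic c a) Ω₁ Ω₁)
    (hco : ∀ z ∈ Ω₁, z ≠ -c ∧ z ≠ 2 * c ∧ z ≠ -(2 * c)) {N : ℕ}
    (hN : ∀ z ∈ Ω₁, (cubic c a)^[N] z ∈ Ω)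
    (hP₁ : ∀ k, (cubic c a)^[k] (cubic c a c) ∈ Ω)
    (hP₂ : ∀ k, (cubic c a)^[k] (cubic c a (-c)) ∈ Ω) (hξ : DifferentiableOn ℂ ξ Ω₁)
    (hξf : ∀ z ∈ Ω₁, ξ (cubic c a z) = 3 * (z ^ 2 - c ^ 2) * ξ z + (-6 * c * dc * z + da))
    (hξ₁ : ξ (cubic c a c) = -6 * c * dc * c + da)
    (hξ₂ : ξ (cubic c a (-c)) = -6 * c * dc * (-c) + da) (hξc : c ∈ Ω₁ → ξ c = dc) :
    dc = 0 ∧ da = 0 := by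
  have hsub : Ω ⊆ Ω₁ := subset_closure.trans hcl
  have hsm : ContDiffOn ℝ 1 ξ Ω₁ := (hξ.contDiffOn hΩ₁ (n := 1)).restrict_scalars ℝ
  obtain ⟨L, hL⟩ := LocallyLipschitzOn.exists_lipschitzOnWith_of_compact hΩc
    (f := ξ) (fun z hz => by
      obtain ⟨K, t, ht, hK⟩ := (hsm.contDiffAt (hΩ₁.mem_nhds (hcl hz))).exists_lipschitzOnWith
      exact ⟨K, t, mem_nhdsWithin_of_mem_nhds ht, hK⟩)
  obtain ⟨R₀, hR₀⟩ := hΩc.isBounded.exists_norm_le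
  obtain ⟨R, hR3, hR⟩ : ∃ R : ℝ, 3 ≤ R ∧ ∀ z ∈ Ω, ‖z‖ ≤ R :=
    ⟨max 3 R₀, le_max_left _ _, fun z hz => (hR₀ z (subset_closure hz)).trans (le_max_right _ _)⟩
  obtain ⟨B, hB⟩ := (hΩc.image_of_continuousOn (hξ.continuousOn.mono hcl)).isBounded.exists_norm_le
  obtain ⟨δ, hδ, hthick⟩ := hΩc.exists_thickening_subset_open hΩ₁ hcl
  obtain ⟨η, hη, hηL, hηB⟩ : ∃ η : ℝ, 0 < η ∧ η * L < 1 ∧ η * |B| < δ := by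
    refine ⟨min (1 / (L + 1)) (δ / (|B| + 1)), by positivity, ?_, ?_⟩
    · refine (mul_le_mul_of_nonneg_right (min_le_left _ _) L.2).trans_lt ?_
      rw [div_mul_eq_mul_div, div_lt_one (by positivity)]
      change 1 * (L : ℝ) < L + 1
      linarith
    · refine (mul_le_mul_of_nonneg_right (min_le_right _ _) (abs_nonneg B)).trans_lt ?_
      rw [div_mul_eq_mul_div, div_lt_iff₀ (by positivity)]
      nlinarith [abs_nonneg B]
  have hflow : ∀ t ∈ ball (0 : ℂ) 1, ∀ z ∈ Ω, z + t * (η * ξ z) ∈ Ω₁ := by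
    intro t ht z hz
    refine hthick (mem_thickening_iff.mpr ⟨z, subset_closure hz, ?_⟩)
    rw [dist_eq_norm, add_sub_cancel_left, norm_mul, norm_mul, Complex.norm_real,
      Real.norm_of_nonneg hη.le]
    have h1 : ‖ξ z‖ ≤ |B| := (hB _ ⟨z, subset_closure hz, rfl⟩).trans (le_abs_self B)
    have h2 : ‖t‖ < 1 := mem_ball_zero_iff.mp ht
    calc ‖t‖ * (η * ‖ξ z‖) ≤ 1 * (η * |B|) := by gcongr
      _ < δ := by rwa [one_mul]
  have hflowinj : ∀ t ∈ ball (0 : ℂ) 1, InjOn (fun z => z + t * (η * ξ z)) Ω := by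
    intro t ht z hz z' hz' he
    by_contra hne
    have h1 : z - z' = -(t * (η * (ξ z - ξ z'))) := by
      simp only at he
      linear_combination he
    have h2 : ‖ξ z - ξ z'‖ ≤ L * ‖z - z'‖ := by
      simpa only [dist_eq_norm] using hL.dist_le_mul z (subset_closure hz) z' (subset_closure hz')
    have h3 : 0 < ‖z - z'‖ := norm_pos_iff.mpr (sub_ne_zero.mpr hne)
    have h4 : ‖t‖ < 1 := mem_ball_zero_iff.mp ht
    have h5 : ‖z - z'‖ ≤ 1 * (η * (L * ‖z - z'‖)) := by
      conv_lhs => rw [h1]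
      rw [norm_neg, norm_mul, norm_mul, Complex.norm_real, Real.norm_of_nonneg hη.le]
      gcongr
    nlinarith
  have hηξ : DifferentiableOn ℂ (fun z => (η : ℂ) * ξ z) Ω := (hξ.mono hsub).const_mul _
  have main : ∀ n : ℕ, ∃ h, IsMotion R Ω (fun z => n * (η * ξ z)) h := by
    intro n
    induction n with
    | zero =>
      refine ⟨fun q => q.2, differentiableOn_snd, fun z hz => rfl, fun t ht z hz z' hz' he => he,
        fun t ht z hz => hR z hz, fun z hz => ?_⟩
      simp only [Nat.cast_zero, zero_mul]
      exact hasDerivAt_const _ _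
    | succ n ih =>
      have lift : ∀ k : ℕ, ∃ h, IsMotion R (Ω₁ ∩ (cubic c a)^[k] ⁻¹' Ω)
          (fun z => n * (η * ξ z)) h := by
        intro k
        induction k with
        | zero =>
          obtain ⟨h, hm⟩ := ih
          exact ⟨h, hm.mono fun z hz => hz.2⟩
        | succ k ihk =>
          obtain ⟨h, hm⟩ := ihk
          have hop : ∀ k, IsOpen (Ω₁ ∩ (cubic c a)^[k] ⁻¹' Ω) := fun k =>
            hΩ₁.inter (hΩ.preimage (continuous_iterate_cubic c a k))
          refine hm.exists_lift (dc := n * (η * dc)) (da := n * (η * da)) hR3 (hop k) (hop (k + 1))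
            hc (fun z hz => ⟨hmaps hz.1, ?_⟩) (fun z hz => hco z hz.1) ⟨hsub (hP₁ 0), hP₁ k⟩
            ⟨hsub (hP₂ 0), hP₂ k⟩ ?_ ?_ ?_ ?_
          · have := hz.2
            rwa [mem_preimage, iterate_succ_apply] at this
          · simp only [hξ₁]; ring
          · simp only [hξ₂]; ring
          · intro z hz
            simp only [hξf z hz.1]; ring
          · intro hz
            simp only [hξc hz.1]
      obtain ⟨h, hm⟩ := lift N
      have h1 := (hm.mono fun z hz => ⟨hz, hN z hz⟩).comp_flow hΩ₁ hsub hηξ hflow hflowinj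
      have h2 : (fun z => ((n + 1 : ℕ) : ℂ) * (η * ξ z)) = fun z => n * (η * ξ z) + η * ξ z := by
        funext z; push_cast; ring
      exact ⟨_, h2 ▸ h1⟩
  have hzero : ∀ z ∈ Ω, ξ z = 0 := by
    intro z hz
    by_contra hne
    have hpos : 0 < η * ‖ξ z‖ := mul_pos hη (norm_pos_iff.mpr hne)
    obtain ⟨n, hn⟩ := exists_nat_gt (2 * R / (η * ‖ξ z‖))
    obtain ⟨h, hm⟩ := main n
    have h1 := hm.norm_vel_le hz
    rw [norm_mul, norm_mul, Complex.norm_real, Real.norm_of_nonneg hη.le, Complex.norm_natCast]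
      at h1
    rw [div_lt_iff₀ hpos] at hn
    linarith
  have e1 := hzero _ (hP₁ 0)
  have e2 := hzero _ (hP₂ 0)
  simp only [iterate_zero, id_eq] at e1 e2
  rw [hξ₁] at e1
  rw [hξ₂] at e2
  constructor
  · refine mul_left_cancel₀ (mul_ne_zero (by norm_num : (12 : ℂ) ≠ 0) (pow_ne_zero 2 hc)) ?_
    linear_combination e2 - e1
  · linear_combination (1 / 2 : ℂ) * e1 + (1 / 2 : ℂ) * e2

end motion

section cocycle

/-- The multiplier of the `n`-th iterate. -/
noncomputable def multIter (c a : ℂ) (n : ℕ) (z : ℂ) : ℂ :=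
  ∏ j ∈ Finset.range n, 3 * (((cubic c a)^[j] z) ^ 2 - c ^ 2)

/-- The parameter derivative of the `n`-th iterate in the direction `(dc, da)`. -/
noncomputable def paramIter (c a dc da : ℂ) : ℕ → ℂ → ℂ
  | 0, _ => 0
  | n + 1, z => 3 * (((cubic c a)^[n] z) ^ 2 - c ^ 2) * paramIter c a dc da n z +
      (-6 * c * dc * (cubic c a)^[n] z + da)

variable {c a dc da : ℂ}

theorem multIter_succ (n : ℕ) (z : ℂ) :
    multIter c a (n + 1) z = 3 * (((cubic c a)^[n] z) ^ 2 - c ^ 2) * multIter c a n z := by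
  rw [multIter, Finset.prod_range_succ, mul_comm, multIter]

theorem multIter_add (m n : ℕ) (z : ℂ) :
    multIter c a (m + n) z = multIter c a n ((cubic c a)^[m] z) * multIter c a m z := by
  induction n with
  | zero => simp [multIter]
  | succ n ih =>
    rw [← add_assoc, multIter_succ, ih, multIter_succ, ← iterate_add_apply, add_comm n m]; ring

theorem multIter_one (z : ℂ) : multIter c a 1 z = 3 * (z ^ 2 - c ^ 2) := by simp [multIter]

theorem multIter_ne_zero_iff {n : ℕ} {z : ℂ} :
    multIter c a n z ≠ 0 ↔ ∀ j < n, ((cubic c a)^[j] z) ^ 2 ≠ c ^ 2 := by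
  rw [multIter, Finset.prod_ne_zero_iff]
  simp [sub_eq_zero]

theorem paramIter_succ (n : ℕ) (z : ℂ) : paramIter c a dc da (n + 1) z =
    3 * (((cubic c a)^[n] z) ^ 2 - c ^ 2) * paramIter c a dc da n z +
      (-6 * c * dc * (cubic c a)^[n] z + da) := rfl

theorem paramIter_add (m n : ℕ) (z : ℂ) : paramIter c a dc da (m + n) z =
    multIter c a n ((cubic c a)^[m] z) * paramIter c a dc da m z +
      paramIter c a dc da n ((cubic c a)^[m] z) := by
  induction n with
  | zero => simp [multIter, paramIter]
  | succ n ih =>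
    rw [← add_assoc, paramIter_succ, ih, multIter_succ, paramIter_succ, ← iterate_add_apply,
      add_comm n m]
    ring

theorem paramIter_one (z : ℂ) : paramIter c a dc da 1 z = -6 * c * dc * z + da := by
  simp [paramIter]

theorem differentiable_multIter (n : ℕ) : Differentiable ℂ (multIter c a n) := by
  induction n with
  | zero =>
    have : multIter c a 0 = fun _ => 1 := by funext z; simp [multIter]
    rw [this]; exact differentiable_const _
  | succ n ih =>
    have : multIter c a (n + 1) = fun z => 3 * (((cubic c a)^[n] z) ^ 2 - c ^ 2) *
      multIter c a n z := funext fun z => multIter_succ n z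
    rw [this]
    exact ((((differentiable_iterate_cubic c a n).pow 2).sub_const _).const_mul 3).mul ih

theorem differentiable_paramIter (n : ℕ) : Differentiable ℂ (paramIter c a dc da n) := by
  induction n with
  | zero =>
    have : paramIter c a dc da 0 = fun _ => 0 := rfl
    rw [this]; exact differentiable_const _
  | succ n ih =>
    have : paramIter c a dc da (n + 1) = fun z => 3 * (((cubic c a)^[n] z) ^ 2 - c ^ 2) *
      paramIter c a dc da n z + (-6 * c * dc * (cubic c a)^[n] z + da) := rfl
    rw [this]
    have h := differentiable_iterate_cubic c a n
    exact ((((h.pow 2).sub_const _).const_mul 3).mul ih).add ((h.const_mul _).add_const _)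

/-- The derivative of an iterate along a curve of parameters and starting points. -/
theorem hasDerivAt_iterate_curve {γ₁ γ₂ z : ℂ → ℂ} {s dz : ℂ} (h₁ : HasDerivAt γ₁ dc s)
    (h₂ : HasDerivAt γ₂ da s) (hz : HasDerivAt z dz s) (n : ℕ) :
    HasDerivAt (fun s => (cubic (γ₁ s) (γ₂ s))^[n] (z s))
      (multIter (γ₁ s) (γ₂ s) n (z s) * dz + paramIter (γ₁ s) (γ₂ s) dc da n (z s)) s := by
  induction n with
  | zero => simpa [multIter, paramIter] using hz
  | succ n ih =>
    have h := ((ih.pow 3).sub (((h₁.pow 2).const_mul 3).mul ih)).add h₂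
    refine (h.congr_deriv ?_).congr_of_eventuallyEq (Eventually.of_forall fun t => ?_)
    · simp only [multIter_succ, paramIter_succ, Pi.pow_apply, Nat.reduceSub, pow_one]
      push_cast; ring
    · simp only [iterate_succ_apply', cubic, Pi.add_apply, Pi.sub_apply, Pi.mul_apply,
        Pi.pow_apply]

end cocycle

section extension

variable {c a dc da : ℂ} {p M : ℕ} {N : Set ℂ} {ξ₀ : ℂ → ℂ}

/-- The points that reach `N` within `M` steps without meeting a critical point. -/
def pullSet (c a : ℂ) (M : ℕ) (N : Set ℂ) : Set ℂ :=
  {z | ∃ m ≤ M, (cubic c a)^[m] z ∈ N ∧ multIter c a m z ≠ 0}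

theorem mem_pullSet {z : ℂ} : z ∈ pullSet c a M N ↔
    ∃ m ≤ M, (cubic c a)^[m] z ∈ N ∧ multIter c a m z ≠ 0 := Iff.rfl

theorem isOpen_validSet (hN : IsOpen N) (m : ℕ) :
    IsOpen {z | (cubic c a)^[m] z ∈ N ∧ multIter c a m z ≠ 0} :=
  (hN.preimage (continuous_iterate_cubic c a m)).inter
    (isOpen_ne_fun (differentiable_multIter m).continuous continuous_const)

theorem isOpen_pullSet (hN : IsOpen N) : IsOpen (pullSet c a M N) := by
  rw [isOpen_iff_mem_nhds]
  rintro z ⟨m, hm, hz⟩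
  filter_upwards [(isOpen_validSet hN m).mem_nhds hz] with y hy using ⟨m, hm, hy⟩

variable (hp : 1 ≤ p) (hM : p ≤ M + 1) (hN : IsOpen N)
  (hNp : ∀ u ∈ N, (cubic c a)^[p] u ∈ N)
  (hidx : ∀ u ∈ N, ∀ j, (cubic c a)^[j] u ∈ N → p ∣ j)
  (hcrit : ∀ u ∈ N, multIter c a (p - 1) (cubic c a u) ≠ 0) (hξ₀ : DifferentiableOn ℂ ξ₀ N)
  (hξp : ∀ u ∈ N, ξ₀ ((cubic c a)^[p] u) = multIter c a p u * ξ₀ u + paramIter c a dc da p u)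

include hp hM hNp hcrit in
theorem apply_mem_pullSet {z : ℂ} (hz : z ∈ pullSet c a M N) :
    ∃ m ≤ M, (cubic c a)^[m] (cubic c a z) ∈ N ∧ multIter c a m (cubic c a z) ≠ 0 ∧
      (((cubic c a)^[m + 1] z ∈ N ∧ multIter c a (m + 1) z ≠ 0) ∨ (m + 1 = p ∧ z ∈ N)) := by
  obtain ⟨m, hm, hmN, hm0⟩ := hz
  cases m with
  | zero =>
    have hzN : z ∈ N := hmN
    refine ⟨p - 1, by omega, ?_, hcrit z hzN, Or.inr ⟨by omega, hzN⟩⟩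
    rw [← iterate_succ_apply, Nat.succ_eq_add_one, Nat.sub_add_cancel hp]
    exact hNp z hzN
  | succ m =>
    refine ⟨m, by omega, by rwa [← iterate_succ_apply], ?_, Or.inl ⟨hmN, hm0⟩⟩
    rw [add_comm, multIter_add] at hm0
    exact left_ne_zero_of_mul hm0

include hNp hidx hξp in
theorem invariant_of_iterate_mem {u : ℂ} (hu : u ∈ N) {j : ℕ} (hj : (cubic c a)^[j] u ∈ N) :
    ξ₀ ((cubic c a)^[j] u) = multIter c a j u * ξ₀ u + paramIter c a dc da j u := by
  obtain ⟨k, rfl⟩ := hidx u hu j hj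
  have hmem : ∀ k, (cubic c a)^[p * k] u ∈ N := fun k => by
    induction k with
    | zero => exact hu
    | succ k ih => rw [mul_add, mul_one, add_comm, iterate_add_apply]; exact hNp _ ih
  clear hj
  induction k with
  | zero => simp [multIter, paramIter]
  | succ k ih =>
    rw [mul_add, mul_one, multIter_add, paramIter_add, add_comm (p * k) p, iterate_add_apply,
      hξp _ (hmem k), ih]
    ring

include hp hM hN hNp hidx hcrit hξ₀ hξp in
/-- An invariant deformation field near the cycle extends to all points that reach the cycle
without meeting a critical point. -/
theorem exists_invariant_extension : ∃ ξ : ℂ → ℂ, DifferentiableOn ℂ ξ (pullSet c a M N) ∧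
    (∀ m ≤ M, ∀ z, (cubic c a)^[m] z ∈ N → multIter c a m z ≠ 0 →
      multIter c a m z * ξ z + paramIter c a dc da m z = ξ₀ ((cubic c a)^[m] z)) ∧
    ∀ z ∈ pullSet c a M N, ξ (cubic c a z) = 3 * (z ^ 2 - c ^ 2) * ξ z +
      (-6 * c * dc * z + da) := by
  have hind : ∀ z m m', m ≤ m' → (cubic c a)^[m] z ∈ N → multIter c a m z ≠ 0 →
      (cubic c a)^[m'] z ∈ N → ∀ y, multIter c a m z * y + paramIter c a dc da m z =
        ξ₀ ((cubic c a)^[m] z) → multIter c a m' z * y + paramIter c a dc da m' z =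
        ξ₀ ((cubic c a)^[m'] z) := by
    intro z m m' hmm h1 h2 h3 y hy
    obtain ⟨j, rfl⟩ := Nat.exists_eq_add_of_le hmm
    rw [add_comm m j, iterate_add_apply] at h3 ⊢
    rw [invariant_of_iterate_mem hNp hidx hξp h1 h3, ← hy, add_comm j m, multIter_add,
      paramIter_add]
    ring
  classical
  obtain ⟨ξ, hξ⟩ : ∃ ξ : ℂ → ℂ, ∀ m ≤ M, ∀ z, (cubic c a)^[m] z ∈ N → multIter c a m z ≠ 0 →
      multIter c a m z * ξ z + paramIter c a dc da m z = ξ₀ ((cubic c a)^[m] z) := by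
    have : ∀ z, ∃ y, ∀ m ≤ M, (cubic c a)^[m] z ∈ N → multIter c a m z ≠ 0 →
        multIter c a m z * y + paramIter c a dc da m z = ξ₀ ((cubic c a)^[m] z) := by
      intro z
      by_cases hz : ∃ m, (cubic c a)^[m] z ∈ N ∧ multIter c a m z ≠ 0
      · obtain ⟨h1, h2⟩ := Nat.find_spec hz
        refine ⟨(ξ₀ ((cubic c a)^[Nat.find hz] z) - paramIter c a dc da (Nat.find hz) z) /
          multIter c a (Nat.find hz) z, fun m _ h3 h4 => ?_⟩
        refine hind z _ m (Nat.find_min' hz ⟨h3, h4⟩) h1 h2 h3 _ ?_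
        rw [mul_div_cancel₀ _ h2]; ring
      · exact ⟨0, fun m _ h3 h4 => absurd ⟨m, h3, h4⟩ hz⟩
    choose ξ hξ using this
    exact ⟨ξ, fun m hm z => hξ z m hm⟩
  refine ⟨ξ, ?_, hξ, ?_⟩
  · rintro z ⟨m, hm, hz⟩
    have hop := isOpen_validSet (c := c) (a := a) hN m
    have h1 : DifferentiableAt ℂ (fun z => (ξ₀ ((cubic c a)^[m] z) - paramIter c a dc da m z) /
        multIter c a m z) z := by
      refine DifferentiableAt.div (DifferentiableAt.sub ?_ (differentiable_paramIter m z))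
        (differentiable_multIter m z) hz.2
      exact ((hξ₀.differentiableAt (hN.mem_nhds hz.1)).comp z
        (differentiable_iterate_cubic c a m z))
    refine (h1.congr_of_eventuallyEq ?_).differentiableWithinAt
    filter_upwards [hop.mem_nhds hz] with y hy
    rw [eq_div_iff hy.2, ← hξ m hm y hy.1 hy.2]; ring
  · intro z hz
    obtain ⟨m, hm, h1, h2, h3⟩ := apply_mem_pullSet hp hM hNp hcrit hz
    have e1 := hξ m hm _ h1 h2
    have e2 : multIter c a (m + 1) z * ξ z + paramIter c a dc da (m + 1) z =
        ξ₀ ((cubic c a)^[m + 1] z) := by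
      rcases h3 with ⟨h3, h4⟩ | ⟨h3, h4⟩
      · obtain ⟨m', hm', h5, h6⟩ := hz
        rcases le_total m' (m + 1) with h7 | h7
        · exact hind z m' _ h7 h5 h6 h3 _ (hξ m' hm' z h5 h6)
        · exact hξ (m + 1) (h7.trans hm') z h3 h4
      · rw [h3, hξp z h4]
        have := hξ 0 (Nat.zero_le _) z h4 (by simp [multIter])
        simp only [multIter, Finset.range_zero, Finset.prod_empty, one_mul, paramIter, add_zero,
          iterate_zero, id_eq] at this
        rw [this]
    rw [add_comm m 1, multIter_add, paramIter_add, multIter_one, paramIter_one, add_comm 1 m,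
      iterate_succ_apply, iterate_zero, id_eq, iterate_succ_apply, ← e1] at e2
    exact mul_left_cancel₀ h2 (by linear_combination -e2)

end extension

section avoidance
variable {p l : ℕ} {w : ℂ × ℂ} {ρ : ℝ} {ψ : ℂ → ℂ} {x : ℂ}

theorem cubic_two_mul (c a : ℂ) : cubic c a (2 * c) = cubic c a (-c) := by
  simp only [cubic_apply]; ring

theorem cubic_neg_two_mul (c a : ℂ) : cubic c a (-(2 * c)) = cubic c a c := by
  simp only [cubic_apply]; ring

theorem isPeriodicPt_of_mem_Sp (hp : 1 ≤ p) (hw : w ∈ Sp p) :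
    IsPeriodicPt (cubic w.1 w.2) p w.1 := by
  have := iterate_eq_of_mem_Sp hp hw w.1
  rw [IsPeriodicPt, IsFixedPt]; simpa using this

namespace IsPos
variable (h : IsPos p l w ρ ψ x)
include h

theorem norm_lt_one : ‖x‖ < 1 := h.norm_lt.trans_le h.lin.le_one

theorem pow_mem_ball (n : ℕ) : x ^ 2 ^ n ∈ ball (0 : ℂ) ρ :=
  pow_mem_ball_zero h.lin.le_one (mem_ball_zero_iff.2 h.norm_lt) (by positivity)

theorem critReturn_ne {m n : ℕ} (hmn : m < n) : critReturn p l n w ≠ critReturn p l m w := by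
  intro he
  rw [h.critReturn_eq, h.critReturn_eq] at he
  have h1 := congrArg norm (h.inj (h.pow_mem_ball n) (h.pow_mem_ball m) he)
  rw [norm_pow, norm_pow] at h1
  exact (pow_lt_pow_right_of_lt_one₀ (norm_pos_iff.2 h.ne_zero) h.norm_lt_one
    (Nat.pow_lt_pow_right (by norm_num) hmn)).ne h1

/-- The orbit of the free critical point never meets the critical cycle. -/
theorem iterate_neg_ne_iterate (hp : 1 ≤ p) (hw : w ∈ Sp p) (k j : ℕ) :
    (cubic w.1 w.2)^[k] (-w.1) ≠ (cubic w.1 w.2)^[j] w.1 := by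
  intro he
  have hpk : k ≤ p * k + (p - l) := le_add_right (Nat.le_mul_of_pos_left k hp)
  have key : ∀ s, critReturn p l (k + s) w =
      (cubic w.1 w.2)^[p * k + (p - l) - k + j] w.1 := by
    intro s
    rw [_root_.critReturn_eq, show p * (k + s) + (p - l) = (p * k + (p - l) - k) + p * s + k by
      rw [mul_add]; omega, iterate_add_apply, he, ← iterate_add_apply,
      show p * k + (p - l) - k + p * s + j = (p * k + (p - l) - k + j) + p * s by ring,
      iterate_add_apply]
    congr 1
    exact (isPeriodicPt_of_mem_Sp hp hw).mul_const s
  exact h.critReturn_ne (lt_add_one k) ((key 1).trans (key 0).symm)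

theorem iterate_crit_ne (hB : TypeB p l w) (hnc : (cubic w.1 w.2)^[l] w.1 ≠ -w.1) (k : ℕ) :
    (cubic w.1 w.2)^[k] w.1 ≠ -w.1 ∧ (cubic w.1 w.2)^[k] w.1 ≠ 2 * w.1 ∧
      (cubic w.1 w.2)^[k] w.1 ≠ -(2 * w.1) := by
  have hper := isPeriodicPt_of_mem_Sp hB.one_le_p hB.mem
  refine ⟨fun h1 => ?_, fun h1 => ?_, fun h1 => ?_⟩
  · rw [← hper.iterate_mod_apply k] at h1
    have := hB.eq_of_iterate_eq_neg (Nat.mod_lt _ hB.one_le_p) h1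
    rw [this] at h1
    exact hnc h1
  · refine h.iterate_neg_ne_iterate hB.one_le_p hB.mem 1 (k + 1) ?_
    rw [iterate_succ_apply' _ k, h1, cubic_two_mul]; rfl
  · have h2 : (cubic w.1 w.2)^[k + 1] w.1 = cubic w.1 w.2 w.1 := by
      rw [iterate_succ_apply', h1, cubic_neg_two_mul]
    have h3 := congrArg ((cubic w.1 w.2)^[p - 1]) h2
    rw [← iterate_add_apply, ← iterate_succ_apply, Nat.succ_eq_add_one,
      Nat.sub_add_cancel hB.one_le_p,
      show p - 1 + (k + 1) = k + p by have := hB.one_le_p; omega, iterate_add_apply,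
      hper.eq, h1] at h3
    exact hB.fst_ne_zero (by linear_combination -(1 / 3 : ℂ) * h3)

theorem iterate_neg_ne (hB : TypeB p l w) {k : ℕ} (hk : 1 ≤ k) :
    (cubic w.1 w.2)^[k] (-w.1) ≠ w.1 ∧ (cubic w.1 w.2)^[k] (-w.1) ≠ -w.1 ∧
      (cubic w.1 w.2)^[k] (-w.1) ≠ 2 * w.1 ∧ (cubic w.1 w.2)^[k] (-w.1) ≠ -(2 * w.1) := by
  have hlp := hB.lt
  have key : cubic w.1 w.2 ((cubic w.1 w.2)^[k] (-w.1)) ≠ cubic w.1 w.2 (-w.1) := by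
    intro h1
    have h2 : IsPeriodicPt (cubic w.1 w.2) k (cubic w.1 w.2 (-w.1)) := by
      rw [IsPeriodicPt, IsFixedPt, ← iterate_succ_apply, iterate_succ_apply', h1]
    have h3 := (h2.apply_iterate (p - l - 1)).const_mul p
    rw [IsPeriodicPt, IsFixedPt, ← iterate_succ_apply _ (p - l - 1), Nat.succ_eq_add_one,
      Nat.sub_add_cancel (by omega), ← iterate_add_apply, ← _root_.critReturn_eq] at h3
    refine h.critReturn_ne hk (h3.trans ?_)
    rw [_root_.critReturn_eq, mul_zero, zero_add]
  refine ⟨fun h1 => ?_, fun h1 => key (by rw [h1]), fun h1 => key ?_, fun h1 => ?_⟩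
  · exact h.iterate_neg_ne_iterate hB.one_le_p hB.mem k 0 h1
  · rw [h1, cubic_two_mul]
  · refine h.iterate_neg_ne_iterate hB.one_le_p hB.mem (k + 1) 1 ?_
    rw [iterate_succ_apply' _ k, h1, cubic_neg_two_mul]; rfl

end IsPos
end avoidance

section conjugation

theorem exists_add_conj_sq {G : ℂ → ℂ} {ρ r : ℝ} (hρ : ρ ≤ 1) (hr : 0 < r) (hrρ : r < ρ)
    (hG : DifferentiableOn ℂ G (ball 0 ρ)) (h0 : deriv G 0 = -2 * G 0) :
    ∃ b : ℂ → ℂ, DifferentiableOn ℂ b (ball 0 r) ∧ b 0 = G 0 ∧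
      ∀ ζ ∈ ball (0 : ℂ) r, b (ζ ^ 2) = 2 * ζ * b ζ + G ζ := by
  have hnhds : ball (0 : ℂ) ρ ∈ 𝓝 (0 : ℂ) := ball_mem_nhds _ (hr.trans hrρ)
  obtain ⟨G₂, hG₂⟩ : ∃ G₂, G₂ = dslope (dslope G 0) 0 := ⟨_, rfl⟩
  have hd₂ : DifferentiableOn ℂ G₂ (ball 0 ρ) := by
    rw [hG₂, Complex.differentiableOn_dslope hnhds, Complex.differentiableOn_dslope hnhds]
    exact hG
  have hGe : ∀ ζ, G ζ = G 0 - 2 * G 0 * ζ + ζ ^ 2 * G₂ ζ := by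
    intro ζ
    have e1 := eq_add_mul_dslope_zero G ζ
    have e2 := eq_add_mul_dslope_zero (dslope G 0) ζ
    rw [← hG₂, dslope_same, h0] at e2
    rw [e1, e2]; ring
  obtain ⟨C, hC⟩ := (isCompact_closedBall (0 : ℂ) r).exists_bound_of_continuousOn
    (hd₂.continuousOn.mono (closedBall_subset_ball hrρ))
  have hpow : ∀ n : ℕ, ∀ ζ ∈ ball (0 : ℂ) r, ζ ^ 2 ^ n ∈ ball (0 : ℂ) r := fun n ζ hζ =>
    pow_mem_ball_zero (hrρ.le.trans hρ) hζ (by positivity)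
  have hbd : ∀ n : ℕ, ∀ ζ ∈ ball (0 : ℂ) r, ‖G₂ (ζ ^ 2 ^ n) / 2 ^ (n + 1)‖ ≤ C / 2 / 2 ^ n := by
    intro n ζ hζ
    rw [norm_div, norm_pow, Complex.norm_ofNat, pow_succ', div_div]
    gcongr
    exact hC _ (ball_subset_closedBall (hpow n ζ hζ))
  have hsum : Summable fun n : ℕ => C / 2 / 2 ^ n := summable_geometric_two' C
  have hsumm : ∀ ζ ∈ ball (0 : ℂ) r, Summable fun n : ℕ => G₂ (ζ ^ 2 ^ n) / 2 ^ (n + 1) :=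
    fun ζ hζ => Summable.of_norm_bounded hsum fun n => hbd n ζ hζ
  obtain ⟨T, hT⟩ : ∃ T : ℂ → ℂ, T = fun ζ => ∑' n : ℕ, G₂ (ζ ^ 2 ^ n) / 2 ^ (n + 1) := ⟨_, rfl⟩
  have hTd : DifferentiableOn ℂ T (ball 0 r) := by
    rw [hT]
    refine Complex.differentiableOn_tsum_of_summable_norm hsum (fun n => ?_) isOpen_ball hbd
    refine DifferentiableOn.div_const ?_ _
    exact (hd₂.mono (ball_subset_ball hrρ.le)).comp (by fun_prop) (hpow n)
  have hTe : ∀ ζ ∈ ball (0 : ℂ) r, T (ζ ^ 2) = 2 * T ζ - G₂ ζ := by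
    intro ζ hζ
    have e1 : T ζ = G₂ (ζ ^ 2 ^ 0) / 2 ^ (0 + 1) +
        ∑' n : ℕ, G₂ (ζ ^ 2 ^ (n + 1)) / 2 ^ (n + 1 + 1) := by
      rw [hT]; exact (hsumm ζ hζ).tsum_eq_zero_add
    have e2 : T (ζ ^ 2) = 2 * ∑' n : ℕ, G₂ (ζ ^ 2 ^ (n + 1)) / 2 ^ (n + 1 + 1) := by
      rw [hT, ← tsum_mul_left]
      refine tsum_congr fun n => ?_
      rw [← pow_mul, ← pow_succ', pow_succ _ (n + 1)]
      field_simp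
    rw [e2, e1, pow_zero, pow_one, zero_add, pow_one]; ring
  refine ⟨fun ζ => G 0 - ζ * T ζ, ?_, by simp, fun ζ hζ => ?_⟩
  · exact (differentiableOn_const _).sub (differentiableOn_id.mul hTd)
  · simp only [hTe ζ hζ]
    rw [hGe ζ]; ring

end conjugation

section field
variable {p l : ℕ} {w : ℂ × ℂ} {ρ : ℝ} {ψ : ℂ → ℂ} {dc da : ℂ}

theorem deriv_ne_zero_of_injOn_ball (hd : DifferentiableOn ℂ ψ (ball 0 ρ))
    (hinj : InjOn ψ (ball 0 ρ)) {ζ : ℂ} (hζ : ζ ∈ ball (0 : ℂ) ρ) : deriv ψ ζ ≠ 0 :=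
  AnalyticAt.deriv_ne_zero_of_injOn (hd.analyticAt (isOpen_ball.mem_nhds hζ))
    (isOpen_ball.mem_nhds hζ) hinj

theorem hasDerivAt_iterate_cubic (c a z : ℂ) (n : ℕ) :
    HasDerivAt (cubic c a)^[n] (multIter c a n z) z := deriv_iterate_cubic c a z n

theorem IsLin.multIter_mul_deriv (h : IsLin p w ρ ψ) {ζ : ℂ} (hζ : ζ ∈ ball (0 : ℂ) ρ) :
    multIter w.1 w.2 p (ψ ζ) * deriv ψ ζ = 2 * ζ * deriv ψ (ζ ^ 2) := by
  have hd : ∀ ζ ∈ ball (0 : ℂ) ρ, HasDerivAt ψ (deriv ψ ζ) ζ := fun ζ hζ =>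
    (h.diff.differentiableAt (isOpen_ball.mem_nhds hζ)).hasDerivAt
  have h1 := (hasDerivAt_iterate_cubic w.1 w.2 (ψ ζ) p).comp ζ (hd ζ hζ)
  have h2 : HasDerivAt (fun ζ : ℂ => ψ (ζ ^ 2)) (deriv ψ (ζ ^ 2) * (2 * ζ)) ζ := by
    have := (hd _ (pow_mem_ball_zero h.le_one hζ two_ne_zero)).comp ζ (hasDerivAt_pow 2 ζ)
    exact this.congr_deriv (by simp)
  have h3 : (cubic w.1 w.2)^[p] ∘ ψ =ᶠ[𝓝 ζ] fun ζ => ψ (ζ ^ 2) := by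
    filter_upwards [isOpen_ball.mem_nhds hζ] with y hy using h.conj y hy
  rw [(h1.congr_of_eventuallyEq h3.symm).unique h2]; ring

theorem critCoeff_eq_multIter :
    critCoeff p w = 3 * w.1 * multIter w.1 w.2 (p - 1) (cubic w.1 w.2 w.1) := by
  rw [critCoeff, critQuot_crit, multIter]
  rfl

theorem hasDerivAt_paramIter_crit (hp : 1 ≤ p) :
    HasDerivAt (paramIter w.1 w.2 dc da p) (-2 * critCoeff p w * dc) w.1 := by
  have e : paramIter w.1 w.2 dc da p = fun z => multIter w.1 w.2 (p - 1) (cubic w.1 w.2 z) *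
      (-6 * w.1 * dc * z + da) + paramIter w.1 w.2 dc da (p - 1) (cubic w.1 w.2 z) := by
    funext z
    obtain ⟨q, rfl⟩ : ∃ q, p = 1 + q := ⟨p - 1, by omega⟩
    rw [paramIter_add, paramIter_one, Nat.add_sub_cancel_left]; rfl
  rw [e]
  have hf : HasDerivAt (cubic w.1 w.2) 0 w.1 := by
    have := hasDerivAt_iterate_cubic w.1 w.2 w.1 1
    rw [multIter_one] at this
    simpa using this
  have h1 := ((differentiable_multIter (c := w.1) (a := w.2) (p - 1)).differentiableAt
    (x := cubic w.1 w.2 w.1)).hasDerivAt.comp w.1 hf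
  have h2 := ((differentiable_paramIter (c := w.1) (a := w.2) (dc := dc) (da := da)
    (p - 1)).differentiableAt (x := cubic w.1 w.2 w.1)).hasDerivAt.comp w.1 hf
  have h3 : HasDerivAt (fun z : ℂ => -6 * w.1 * dc * z + da) (-6 * w.1 * dc) w.1 := by
    simpa using ((hasDerivAt_id w.1).const_mul (-6 * w.1 * dc)).add_const da
  refine ((h1.mul h3).add h2).congr_deriv ?_
  rw [critCoeff_eq_multIter]
  simp only [comp_apply]
  ring

/-- The infinitesimal conjugacy near the cycle. -/
theorem IsLin.exists_field (h : IsLin p w ρ ψ) (hinj : InjOn ψ (ball 0 ρ)) (hp : 1 ≤ p)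
    (hw : w ∈ Sp p) {r : ℝ} (hr : 0 < r) (hrρ : r < ρ)
    (hF : paramIter w.1 w.2 dc da p w.1 = dc) :
    ∃ b : ℂ → ℂ, DifferentiableOn ℂ b (ball 0 r) ∧ deriv ψ 0 * b 0 = dc ∧
      ∀ ζ ∈ ball (0 : ℂ) r, deriv ψ (ζ ^ 2) * b (ζ ^ 2) =
        multIter w.1 w.2 p (ψ ζ) * (deriv ψ ζ * b ζ) + paramIter w.1 w.2 dc da p (ψ ζ) := by
  have hne : ∀ ζ ∈ ball (0 : ℂ) ρ, deriv ψ ζ ≠ 0 := fun ζ hζ =>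
    deriv_ne_zero_of_injOn_ball h.diff hinj hζ
  have hsq : ∀ ζ ∈ ball (0 : ℂ) ρ, ζ ^ 2 ∈ ball (0 : ℂ) ρ := fun ζ hζ =>
    pow_mem_ball_zero h.le_one hζ two_ne_zero
  have hψ' : DifferentiableOn ℂ (deriv ψ) (ball 0 ρ) := h.diff.deriv isOpen_ball
  have hGd : DifferentiableOn ℂ (fun ζ => paramIter w.1 w.2 dc da p (ψ ζ) / deriv ψ (ζ ^ 2))
      (ball 0 ρ) := by
    refine DifferentiableOn.div ?_ ?_ fun ζ hζ => hne _ (hsq ζ hζ)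
    · exact (differentiable_paramIter p).comp_differentiableOn h.diff
    · exact hψ'.comp (by fun_prop) hsq
  obtain ⟨b, hb, hb0, hbe⟩ := exists_add_conj_sq h.le_one hr hrρ hGd (by
    have hd0 : HasDerivAt ψ (deriv ψ 0) 0 :=
      (h.diff.differentiableAt (isOpen_ball.mem_nhds h.zero_mem)).hasDerivAt
    have h1 : HasDerivAt (fun ζ => paramIter w.1 w.2 dc da p (ψ ζ))
        (-2 * critCoeff p w * dc * deriv ψ 0) 0 := by
      refine HasDerivAt.comp (0 : ℂ) ?_ hd0
      rw [h.zero]; exact hasDerivAt_paramIter_crit hp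
    have h2 : HasDerivAt (fun ζ : ℂ => deriv ψ (ζ ^ 2)) 0 0 := by
      have h3 : HasDerivAt (deriv ψ) (deriv (deriv ψ) 0) ((0 : ℂ) ^ 2) := by
        rw [zero_pow two_ne_zero]
        exact (hψ'.differentiableAt (isOpen_ball.mem_nhds h.zero_mem)).hasDerivAt
      have := h3.comp (0 : ℂ) (hasDerivAt_pow 2 (0 : ℂ))
      exact this.congr_deriv (by simp)
    have h4 := h1.div h2 (hne _ (hsq 0 h.zero_mem))
    have h5 := h4.deriv
    simp only [Pi.div_def] at h5
    rw [h5, h.zero, hF]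
    have h6 := h.critCoeff_mul_deriv hp hw
    have h7 := h.deriv_ne
    simp only [ne_eq, OfNat.ofNat_ne_zero, not_false_eq_true, zero_pow, mul_zero, sub_zero]
    field_simp
    linear_combination (-dc) * h6)
  refine ⟨b, hb, ?_, fun ζ hζ => ?_⟩
  · rw [hb0, h.zero, hF, zero_pow two_ne_zero, mul_div_cancel₀ _ h.deriv_ne]
  · have hζ' := ball_subset_ball hrρ.le hζ
    have h8 := hne _ (hsq ζ hζ')
    rw [hbe ζ hζ, ← mul_assoc, h.multIter_mul_deriv hζ']
    field_simp

end field

section mismatch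
variable {p l : ℕ} {w : ℂ × ℂ} {ρ : ℝ} {ψ : ℂ → ℂ} {x dc da : ℂ}

theorem IsPos.paramIter_return (h : IsPos p l w ρ ψ x) {r : ℝ} (hxr : ‖x‖ < r) (hrρ : r < ρ)
    {b : ℂ → ℂ} (hb : ∀ ζ ∈ ball (0 : ℂ) r, deriv ψ (ζ ^ 2) * b (ζ ^ 2) =
        multIter w.1 w.2 p (ψ ζ) * (deriv ψ ζ * b ζ) + paramIter w.1 w.2 dc da p (ψ ζ)) {D : ℂ}
    (hD : paramIter w.1 w.2 dc da (p - l) (-w.1) = deriv ψ x * b x + deriv ψ x * D) (n : ℕ) :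
    paramIter w.1 w.2 dc da (p * n + (p - l)) (-w.1) =
      deriv ψ (x ^ 2 ^ n) * b (x ^ 2 ^ n) + deriv ψ (x ^ 2 ^ n) * (2 ^ n * x ^ (2 ^ n - 1) * D) := by
  induction n with
  | zero => simpa using hD
  | succ n ih =>
    have hr1 : r ≤ 1 := hrρ.le.trans h.lin.le_one
    have hmem : x ^ 2 ^ n ∈ ball (0 : ℂ) r :=
      pow_mem_ball_zero hr1 (mem_ball_zero_iff.2 hxr) (by positivity)
    have e1 := hb _ hmem
    have e2 := h.lin.multIter_mul_deriv (ball_subset_ball hrρ.le hmem)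
    have e3 : (x ^ 2 ^ n) ^ 2 = x ^ 2 ^ (n + 1) := by rw [← pow_mul, ← pow_succ]
    have e4 : x ^ (2 ^ (n + 1) - 1) = x ^ 2 ^ n * x ^ (2 ^ n - 1) := by
      rw [← pow_add]
      congr 1
      have : 1 ≤ 2 ^ n := Nat.one_le_two_pow
      rw [pow_succ]; omega
    rw [e3] at e1 e2
    rw [show p * (n + 1) + (p - l) = (p * n + (p - l)) + p by ring, paramIter_add,
      ← _root_.critReturn_eq, h.critReturn_eq, ih, e1, e4, pow_succ (2 : ℂ)]
    linear_combination (2 ^ n * x ^ (2 ^ n - 1) * D) * e2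

/-- Every neighbourhood of the cycle absorbs the points reaching a disc around the center. -/
theorem IsLin.exists_absorption (h : IsLin p w ρ ψ) (hp : 1 ≤ p) {r : ℝ} (hr : 0 < r)
    (hrρ : r < ρ) (M : ℕ) {U : Set ℂ} (hU : IsOpen U)
    (hcU : ∀ i, (cubic w.1 w.2)^[i] w.1 ∈ U) :
    ∃ N₁, ∀ j ≥ N₁, ∀ z ∈ pullSet w.1 w.2 M (ψ '' ball 0 r), (cubic w.1 w.2)^[j] z ∈ U := by
  have h1 : ∀ᶠ ζ in 𝓝 (0 : ℂ), ∀ i ∈ Finset.range p, (cubic w.1 w.2)^[i] (ψ ζ) ∈ U := by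
    rw [Filter.eventually_all_finset]
    intro i _
    have h2 : ContinuousAt (fun ζ => (cubic w.1 w.2)^[i] (ψ ζ)) 0 :=
      (continuous_iterate_cubic w.1 w.2 i).continuousAt.comp h.continuousAt_zero
    refine h2.eventually_mem (hU.mem_nhds ?_)
    simp only [h.zero]
    exact hcU i
  obtain ⟨s, hs, h1⟩ := Metric.eventually_nhds_iff_ball.1 h1
  obtain ⟨n₀, hn₀⟩ := exists_pow_lt_of_lt_one hs (hrρ.trans_le h.le_one)
  refine ⟨M + p * n₀, fun j hj z hz => ?_⟩
  obtain ⟨m, hm, ⟨ζ, hζ, hζm⟩, -⟩ := mem_pullSet.1 hz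
  have hq : p * n₀ ≤ j - m := by omega
  have hq' : n₀ ≤ (j - m) / p := (Nat.le_div_iff_mul_le hp).2 (by rwa [mul_comm])
  have e1 : (cubic w.1 w.2)^[j] z =
      (cubic w.1 w.2)^[(j - m) % p] (ψ (ζ ^ 2 ^ ((j - m) / p))) := by
    rw [← h.iterate _ (ball_subset_ball hrρ.le hζ), ← iterate_mul, ← iterate_add_apply, hζm,
      ← iterate_add_apply, Nat.mod_add_div, Nat.sub_add_cancel (by omega)]
  rw [e1]
  refine h1 _ ?_ _ (Finset.mem_range.2 (Nat.mod_lt _ hp))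
  rw [mem_ball_zero_iff] at hζ ⊢
  rw [norm_pow]
  have hr1 : r ≤ 1 := hrρ.le.trans h.le_one
  calc ‖ζ‖ ^ 2 ^ ((j - m) / p) ≤ r ^ 2 ^ ((j - m) / p) := by gcongr
    _ ≤ r ^ n₀ := pow_le_pow_of_le_one hr.le hr1 (hq'.trans (Nat.lt_two_pow_self).le)
    _ < s := hn₀

end mismatch

section rigidity
variable {p l : ℕ} {w : ℂ × ℂ} {ρ : ℝ} {ψ : ℂ → ℂ} {x dc da : ℂ}

/-- A small disc around the center whose return map is free of further critical points. -/
theorem IsPos.exists_radius (h : IsPos p l w ρ ψ x) (hp : 1 ≤ p) (hw : w ∈ Sp p) {r : ℝ}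
    (hr : 0 < r) :
    ∃ r', 0 < r' ∧ r' ≤ r ∧
      ∀ u ∈ ψ '' ball 0 r', multIter w.1 w.2 (p - 1) (cubic w.1 w.2 u) ≠ 0 := by
  have h0 : multIter w.1 w.2 (p - 1) (cubic w.1 w.2 (ψ 0)) ≠ 0 := by
    have := h.lin.critCoeff_ne_zero hp hw
    rw [critCoeff_eq_multIter] at this
    rw [h.lin.zero]
    exact right_ne_zero_of_mul this
  have hc : ContinuousAt (fun ζ => multIter w.1 w.2 (p - 1) (cubic w.1 w.2 (ψ ζ))) 0 :=
    ((differentiable_multIter (p - 1)).continuous.comp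
      (differentiable_cubic w.1 w.2).continuous).continuousAt.comp h.lin.continuousAt_zero
  obtain ⟨s, hs, h1⟩ := Metric.eventually_nhds_iff_ball.1 (hc.eventually_ne h0)
  refine ⟨min s r, lt_min hs hr, min_le_right _ _, ?_⟩
  rintro _ ⟨ζ, hζ, rfl⟩
  exact h1 ζ (ball_subset_ball (min_le_left _ _) hζ)

theorem IsPos.multIter_iterate_neg_ne_zero (h : IsPos p l w ρ ψ x) (hB : TypeB p l w) (m : ℕ) :
    multIter w.1 w.2 m (cubic w.1 w.2 (-w.1)) ≠ 0 := by
  rw [multIter_ne_zero_iff]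
  intro j _ hsq
  rw [← iterate_succ_apply] at hsq
  obtain ⟨h1, h2, -⟩ := h.iterate_neg_ne hB (Nat.succ_le_succ (Nat.zero_le j))
  rcases sq_eq_sq_iff_eq_or_eq_neg.1 hsq with h3 | h3
  exacts [h1 h3, h2 h3]

/-- The closure of the postcritical set is a compact subset of any forward invariant set that
contains a critical point of period `p` and the free critical value. -/
theorem TypeB.exists_compact_postcritical (hB : TypeB p l w) {V : Set ℂ}
    (hV : MapsTo (cubic w.1 w.2) V V) (hc : w.1 ∈ V) (hv : cubic w.1 w.2 (-w.1) ∈ V) :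
    ∃ P, IsCompact P ∧ P ⊆ V ∧ (∀ k, (cubic w.1 w.2)^[k] w.1 ∈ P) ∧
      ∀ k, (cubic w.1 w.2)^[k] (cubic w.1 w.2 (-w.1)) ∈ P := by
  have hlp := hB.lt
  have hp := hB.one_le_p
  have hVi : ∀ k, MapsTo (cubic w.1 w.2)^[k] V V := fun k => hV.iterate k
  have hQ : IsCompact (insert w.1 (range fun n => critReturn p l n w)) :=
    Tendsto.isCompact_insert_range hB.tendsto_iterate
  refine ⟨(⋃ i ∈ Finset.range p, (cubic w.1 w.2)^[i] ''
    insert w.1 (range fun n => critReturn p l n w)) ∪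
    (fun k => (cubic w.1 w.2)^[k] (cubic w.1 w.2 (-w.1))) '' Iio (p - l), ?_, ?_, ?_, ?_⟩
  · refine IsCompact.union (Finset.isCompact_biUnion _ fun i _ => ?_) ?_
    · exact hQ.image (continuous_iterate_cubic w.1 w.2 i)
    · exact ((finite_Iio (p - l)).image _).isCompact
  · refine union_subset (iUnion₂_subset fun i _ => ?_) ?_
    · rintro _ ⟨z, hz | ⟨n, rfl⟩, rfl⟩
      · rw [hz]; exact hVi i hc
      · refine hVi i ?_
        simp only []
        rw [critReturn_eq, show p * n + (p - l) = (p * n + (p - l) - 1) + 1 by omega,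
          iterate_succ_apply]
        exact hVi _ hv
    · rintro _ ⟨k, -, rfl⟩
      exact hVi k hv
  · intro k
    left
    rw [← (isPeriodicPt_of_mem_Sp hp hB.mem).iterate_mod_apply k]
    exact mem_iUnion₂.2 ⟨k % p, Finset.mem_range.2 (Nat.mod_lt _ hp), _, mem_insert _ _, rfl⟩
  · intro k
    rcases lt_or_ge k (p - l) with hk | hk
    · exact Or.inr ⟨k, hk, rfl⟩
    · left
      refine mem_iUnion₂.2 ⟨(k + 1 - (p - l)) % p, Finset.mem_range.2 (Nat.mod_lt _ hp),
        critReturn p l ((k + 1 - (p - l)) / p) w, mem_insert_of_mem _ (mem_range_self _), ?_⟩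
      rw [critReturn_eq, ← iterate_add_apply, ← iterate_succ_apply]
      congr 1
      have := Nat.mod_add_div (k + 1 - (p - l)) p
      omega

/-- A tangent vector to the curve that preserves the position of the free critical point
vanishes. -/
theorem IsPos.eq_zero_of_mismatch (h : IsPos p l w ρ ψ x) (hB : TypeB p l w)
    (hnc : (cubic w.1 w.2)^[l] w.1 ≠ -w.1) {r : ℝ} (hxr : ‖x‖ < r) (hrρ : r < ρ)
    {b : ℂ → ℂ} (hbd : DifferentiableOn ℂ b (ball 0 r)) (hb0 : deriv ψ 0 * b 0 = dc)
    (hb : ∀ ζ ∈ ball (0 : ℂ) r, deriv ψ (ζ ^ 2) * b (ζ ^ 2) =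
        multIter w.1 w.2 p (ψ ζ) * (deriv ψ ζ * b ζ) + paramIter w.1 w.2 dc da p (ψ ζ))
    (hD : paramIter w.1 w.2 dc da (p - l) (-w.1) = deriv ψ x * b x) : dc = 0 ∧ da = 0 := by
  have hp := hB.one_le_p
  have hw := hB.mem
  have hlp := hB.lt
  have hr : 0 < r := (norm_nonneg x).trans_lt hxr
  have hper := isPeriodicPt_of_mem_Sp hp hw
  obtain ⟨r', hr', hr'r, hcrit⟩ := h.exists_radius hp hw hr
  have hr'ρ : r' < ρ := hr'r.trans_lt hrρ
  have hr'1 : r' ≤ 1 := hr'ρ.le.trans h.lin.le_one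
  have hψr : DifferentiableOn ℂ ψ (ball 0 r') := h.lin.diff.mono (ball_subset_ball hr'ρ.le)
  obtain ⟨N, hNdef⟩ : ∃ N, N = ψ '' ball 0 r' := ⟨_, rfl⟩
  have hN : IsOpen N := by
    rw [hNdef]
    exact InjOn.isOpen_image_of_differentiableOn h.inj h.lin.diff (ball_subset_ball hr'ρ.le) isOpen_ball
  have hNp : ∀ u ∈ N, (cubic w.1 w.2)^[p] u ∈ N := by
    rw [hNdef]
    rintro _ ⟨ζ, hζ, rfl⟩
    rw [h.lin.conj ζ (ball_subset_ball hr'ρ.le hζ)]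
    exact ⟨_, pow_mem_ball_zero hr'1 hζ two_ne_zero, rfl⟩
  have hNF : ∀ u ∈ N, u ∈ fatouComponent (cubic w.1 w.2) ((cubic w.1 w.2)^[0] w.1) := by
    rw [hNdef]
    rintro _ ⟨ζ, hζ, rfl⟩
    exact h.lin.mem_fatouComponent hp hw (ball_subset_ball hr'ρ.le hζ)
  have hidx : ∀ u ∈ N, ∀ j, (cubic w.1 w.2)^[j] u ∈ N → p ∣ j := by
    intro u hu j hj
    have h1 := iterate_mem_fatouComponent (hNF u hu) j
    rw [← iterate_add_apply, add_zero, ← hper.iterate_mod_apply j] at h1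
    have := fatouComponent_index_unique hp hw (Nat.mod_lt _ hp) hp h1 (hNF _ hj)
    exact Nat.dvd_of_mod_eq_zero this
  rw [← hNdef] at hcrit
  obtain ⟨φ, hφ, hφψ⟩ := exists_local_inverse_injOn h.lin.diff h.inj
  obtain ⟨ξ₀, hξ₀def⟩ : ∃ ξ₀ : ℂ → ℂ, ξ₀ = fun u => deriv ψ (φ u) * b (φ u) := ⟨_, rfl⟩
  have hξ₀ψ : ∀ ζ ∈ ball (0 : ℂ) r', ξ₀ (ψ ζ) = deriv ψ ζ * b ζ := by
    intro ζ hζ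
    rw [hξ₀def]
    simp only [hφψ ζ (ball_subset_ball hr'ρ.le hζ)]
  have hξ₀ : DifferentiableOn ℂ ξ₀ N := by
    have hφN : DifferentiableOn ℂ φ N := by
      rw [hNdef]
      exact hφ.differentiableOn.mono (image_mono (ball_subset_ball hr'ρ.le))
    have hφm : MapsTo φ N (ball 0 r) := by
      rw [hNdef]
      rintro _ ⟨ζ, hζ, rfl⟩
      rw [hφψ ζ (ball_subset_ball hr'ρ.le hζ)]
      exact ball_subset_ball hr'r hζ
    rw [hξ₀def]
    exact (((h.lin.diff.deriv isOpen_ball).mono (ball_subset_ball hrρ.le)).comp hφN hφm).mul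
      (hbd.comp hφN hφm)
  have hξp : ∀ u ∈ N, ξ₀ ((cubic w.1 w.2)^[p] u) =
      multIter w.1 w.2 p u * ξ₀ u + paramIter w.1 w.2 dc da p u := by
    intro u hu
    rw [hNdef] at hu
    obtain ⟨ζ, hζ, rfl⟩ := hu
    rw [h.lin.conj ζ (ball_subset_ball hr'ρ.le hζ), hξ₀ψ ζ hζ,
      hξ₀ψ _ (pow_mem_ball_zero hr'1 hζ two_ne_zero), hb ζ (ball_subset_ball hr'r hζ)]
  obtain ⟨n₀, hn₀⟩ : ∃ n₀ : ℕ, x ^ 2 ^ n₀ ∈ ball (0 : ℂ) r' :=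
    ((tendsto_pow_two_pow h.norm_lt_one).eventually_mem (ball_mem_nhds _ hr')).exists
  obtain ⟨ξ, hξ, hξN, hξinv⟩ := exists_invariant_extension (M := p * n₀ + p) hp (by omega) hN hNp
    hidx hcrit hξ₀ hξp
  have hcN : w.1 ∈ N := by
    rw [hNdef]
    exact ⟨0, mem_ball_self hr', h.lin.zero⟩
  have hyN : (cubic w.1 w.2)^[p * n₀ + (p - l) - 1] (cubic w.1 w.2 (-w.1)) = ψ (x ^ 2 ^ n₀) := by
    rw [← iterate_succ_apply, Nat.succ_eq_add_one, Nat.sub_add_cancel (by omega),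
      ← _root_.critReturn_eq, h.critReturn_eq]
  have hyN' : (cubic w.1 w.2)^[p * n₀ + (p - l) - 1] (cubic w.1 w.2 (-w.1)) ∈ N := by
    rw [hyN, hNdef]; exact ⟨_, hn₀, rfl⟩
  have hmaps : MapsTo (cubic w.1 w.2) (pullSet w.1 w.2 (p * n₀ + p) N)
      (pullSet w.1 w.2 (p * n₀ + p) N) := by
    intro z hz
    obtain ⟨m, hm, h1, h2, -⟩ := apply_mem_pullSet hp (by omega) hNp hcrit hz
    exact mem_pullSet.2 ⟨m, hm, h1, h2⟩
  have hcm : w.1 ∈ pullSet w.1 w.2 (p * n₀ + p) N :=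
    mem_pullSet.2 ⟨0, Nat.zero_le _, hcN, by simp [multIter]⟩
  have hvm : cubic w.1 w.2 (-w.1) ∈ pullSet w.1 w.2 (p * n₀ + p) N :=
    mem_pullSet.2 ⟨_, by omega, hyN', h.multIter_iterate_neg_ne_zero hB _⟩
  obtain ⟨T, hT⟩ : ∃ T : Set ℂ, T = {z | z ≠ -w.1 ∧ z ≠ 2 * w.1 ∧ z ≠ -(2 * w.1)} := ⟨_, rfl⟩
  have hTo : IsOpen T := by
    rw [hT]
    exact isOpen_ne.inter (isOpen_ne.inter isOpen_ne)
  have hTm : ∀ z, z ∈ T ↔ z ≠ -w.1 ∧ z ≠ 2 * w.1 ∧ z ≠ -(2 * w.1) := fun z => by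
    rw [hT]; exact Iff.rfl
  obtain ⟨N₁, hN₁⟩ := h.lin.exists_absorption hp hr' hr'ρ (p * n₀ + p) hTo
    fun i => (hTm _).2 (h.iterate_crit_ne hB hnc i)
  rw [← hNdef] at hN₁
  obtain ⟨Ω₁, hΩ₁⟩ : ∃ Ω₁ : Set ℂ, Ω₁ = pullSet w.1 w.2 (p * n₀ + p) N ∩
      ⋂ j ∈ Finset.range (N₁ + 1), (cubic w.1 w.2)^[j] ⁻¹' T := ⟨_, rfl⟩
  have hΩ₁o : IsOpen Ω₁ := by
    rw [hΩ₁]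
    exact (isOpen_pullSet hN).inter (isOpen_biInter_finset fun j _ =>
      hTo.preimage (continuous_iterate_cubic w.1 w.2 j))
  have hΩ₁m : ∀ z, z ∈ Ω₁ ↔ z ∈ pullSet w.1 w.2 (p * n₀ + p) N ∧
      ∀ j, (cubic w.1 w.2)^[j] z ∈ T := by
    intro z
    rw [hΩ₁, mem_inter_iff, mem_iInter₂]
    refine and_congr_right fun hz => ⟨fun h1 j => ?_, fun h1 j _ => h1 j⟩
    rcases lt_or_ge j N₁ with hj | hj
    · exact h1 j (Finset.mem_range.2 (by omega))
    · exact hN₁ j hj z hz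
  have hΩ₁maps : MapsTo (cubic w.1 w.2) Ω₁ Ω₁ := by
    intro z hz
    rw [hΩ₁m] at hz ⊢
    refine ⟨hmaps hz.1, fun j => ?_⟩
    rw [← iterate_succ_apply]
    exact hz.2 _
  have hcΩ : w.1 ∈ Ω₁ :=
    (hΩ₁m _).2 ⟨hcm, fun j => (hTm _).2 (h.iterate_crit_ne hB hnc j)⟩
  have hvΩ : cubic w.1 w.2 (-w.1) ∈ Ω₁ := by
    refine (hΩ₁m _).2 ⟨hvm, fun j => (hTm _).2 ?_⟩
    rw [← iterate_succ_apply]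
    exact (h.iterate_neg_ne hB (Nat.succ_le_succ (Nat.zero_le j))).2
  obtain ⟨P, hPc, hPΩ, hP₁, hP₂⟩ := hB.exists_compact_postcritical hΩ₁maps hcΩ hvΩ
  obtain ⟨K, hK, hPK, hKΩ⟩ := exists_compact_between hPc hΩ₁o hPΩ
  obtain ⟨N₂, hN₂⟩ := h.lin.exists_absorption hp hr' hr'ρ (p * n₀ + p)
    (isOpen_interior (s := K)) fun i => hPK (hP₁ i)
  rw [← hNdef] at hN₂
  have hclK : closure (interior K) ⊆ K := closure_minimal interior_subset hK.isClosed
  have hξc : ξ w.1 = dc := by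
    have := hξN 0 (Nat.zero_le _) w.1 hcN (by simp [multIter])
    simp only [multIter, Finset.range_zero, Finset.prod_empty, one_mul, paramIter, add_zero,
      iterate_zero, id_eq] at this
    rw [this, ← hb0, ← hξ₀ψ 0 (mem_ball_self hr'), h.lin.zero]
  have hD' := h.paramIter_return hxr hrρ hb (D := 0) (by rw [hD]; ring) n₀
  refine eq_zero_of_invariant_field (Ω := interior K) (Ω₁ := Ω₁) (N := N₂) hB.fst_ne_zero
    isOpen_interior hΩ₁o (hK.of_isClosed_subset isClosed_closure hclK) (hclK.trans hKΩ) hΩ₁maps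
    (fun z hz => (hTm z).1 (((hΩ₁m z).1 hz).2 0))
    (fun z hz => hN₂ N₂ le_rfl z ((hΩ₁m z).1 hz).1) (fun k => ?_) (fun k => hPK (hP₂ k))
    (hξ.mono fun z hz => ((hΩ₁m z).1 hz).1) (fun z hz => hξinv z ((hΩ₁m z).1 hz).1) ?_ ?_
    fun _ => hξc
  · rw [← iterate_succ_apply]; exact hPK (hP₁ _)
  · rw [hξinv _ hcm]; ring
  · have e1 := hξN (p * n₀ + (p - l) - 1) (by omega) _ hyN' (h.multIter_iterate_neg_ne_zero hB _)
    rw [hyN, hξ₀ψ _ hn₀] at e1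
    rw [show p * n₀ + (p - l) = 1 + (p * n₀ + (p - l) - 1) by omega, paramIter_add,
      paramIter_one, iterate_one] at hD'
    refine mul_left_cancel₀ (h.multIter_iterate_neg_ne_zero hB (p * n₀ + (p - l) - 1)) ?_
    linear_combination e1 - hD'

end rigidity

section velocity
variable {p l : ℕ} {w : ℂ × ℂ} {ρ : ℝ} {ψ : ℂ → ℂ} {x dc da : ℂ}

theorem paramIter_linear (c a s t dc₁ da₁ dc₂ da₂ : ℂ) (n : ℕ) (z : ℂ) :
    paramIter c a (s * dc₁ + t * dc₂) (s * da₁ + t * da₂) n z =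
      s * paramIter c a dc₁ da₁ n z + t * paramIter c a dc₂ da₂ n z := by
  induction n with
  | zero => simp [paramIter]
  | succ n ih => simp only [paramIter_succ, ih]; ring

/-- At a noncentral parameter the curve is smooth: the defining equation has nonzero
differential. -/
theorem TypeB.exists_paramIter_ne (hB : TypeB p l w) (hnc : (cubic w.1 w.2)^[l] w.1 ≠ -w.1) :
    ∃ dc da, paramIter w.1 w.2 dc da p w.1 ≠ dc := by
  by_contra! hcon
  obtain ⟨ρ, ψ, h⟩ := hB.exists_isPos_posMap hnc
  obtain ⟨x, hx⟩ : ∃ x, x = posMap p l w := ⟨_, rfl⟩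
  rw [← hx] at h
  obtain ⟨r, hxr, hrρ⟩ := exists_between h.norm_lt
  have hr : 0 < r := (norm_nonneg x).trans_lt hxr
  have hψx : deriv ψ x ≠ 0 :=
    deriv_ne_zero_of_injOn_ball h.lin.diff h.inj (mem_ball_zero_iff.2 h.norm_lt)
  have key : ∀ dc da, ∃ b : ℂ → ℂ, ∃ D, DifferentiableOn ℂ b (ball 0 r) ∧
      deriv ψ 0 * b 0 = dc ∧
      (∀ ζ ∈ ball (0 : ℂ) r, deriv ψ (ζ ^ 2) * b (ζ ^ 2) =
        multIter w.1 w.2 p (ψ ζ) * (deriv ψ ζ * b ζ) + paramIter w.1 w.2 dc da p (ψ ζ)) ∧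
      paramIter w.1 w.2 dc da (p - l) (-w.1) = deriv ψ x * b x + deriv ψ x * D := by
    intro dc da
    obtain ⟨b, hb, hb0, hbe⟩ := h.lin.exists_field h.inj hB.one_le_p hB.mem hr hrρ (hcon dc da)
    exact ⟨b, (paramIter w.1 w.2 dc da (p - l) (-w.1) - deriv ψ x * b x) / deriv ψ x, hb, hb0,
      hbe, by field_simp; ring⟩
  obtain ⟨b₁, D₁, hb₁, hb₁0, hb₁e, hD₁⟩ := key 1 0
  obtain ⟨b₂, D₂, hb₂, hb₂0, hb₂e, hD₂⟩ := key 0 1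
  have hzero : ∀ s t, s * D₁ + t * D₂ = 0 → s = 0 ∧ t = 0 := by
    intro s t hst
    refine h.eq_zero_of_mismatch (b := fun ζ => s * b₁ ζ + t * b₂ ζ) hB hnc hxr hrρ
      ((hb₁.const_mul s).add (hb₂.const_mul t)) ?_ ?_ ?_
    · linear_combination s * hb₁0 + t * hb₂0
    · intro ζ hζ
      have := paramIter_linear w.1 w.2 s t 1 0 0 1 p (ψ ζ)
      simp only [mul_one, mul_zero, add_zero, zero_add] at this
      rw [this]
      linear_combination s * hb₁e ζ hζ + t * hb₂e ζ hζ
    · have := paramIter_linear w.1 w.2 s t 1 0 0 1 (p - l) (-w.1)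
      simp only [mul_one, mul_zero, add_zero, zero_add] at this
      rw [this]
      linear_combination s * hD₁ + t * hD₂ + deriv ψ x * hst
  obtain ⟨h1, h2⟩ := hzero D₂ (-D₁) (by ring)
  exact one_ne_zero (hzero 1 0 (by rw [neg_eq_zero.1 h2]; ring)).1

/-- The logarithmic velocity of the free critical orbit has a nonzero limit. -/
theorem TypeB.exists_tendsto_velocity (hB : TypeB p l w)
    (hnc : (cubic w.1 w.2)^[l] w.1 ≠ -w.1) (hF : paramIter w.1 w.2 dc da p w.1 = dc)
    (hne : ¬(dc = 0 ∧ da = 0)) :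
    ∃ D ≠ 0, Tendsto (fun n => (paramIter w.1 w.2 dc da (p * n + (p - l)) (-w.1) - dc) /
      (2 ^ n * (critReturn p l n w - w.1))) atTop (𝓝 D) := by
  obtain ⟨ρ, ψ, h⟩ := hB.exists_isPos_posMap hnc
  obtain ⟨x, hx⟩ : ∃ x, x = posMap p l w := ⟨_, rfl⟩
  rw [← hx] at h
  obtain ⟨r, hxr, hrρ⟩ := exists_between h.norm_lt
  have hr : 0 < r := (norm_nonneg x).trans_lt hxr
  have hψx : deriv ψ x ≠ 0 :=
    deriv_ne_zero_of_injOn_ball h.lin.diff h.inj (mem_ball_zero_iff.2 h.norm_lt)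
  obtain ⟨b, hb, hb0, hbe⟩ := h.lin.exists_field h.inj hB.one_le_p hB.mem hr hrρ hF
  obtain ⟨D, hD⟩ : ∃ D, paramIter w.1 w.2 dc da (p - l) (-w.1) =
      deriv ψ x * b x + deriv ψ x * D :=
    ⟨(paramIter w.1 w.2 dc da (p - l) (-w.1) - deriv ψ x * b x) / deriv ψ x, by field_simp; ring⟩
  have hD0 : D ≠ 0 := by
    rintro rfl
    exact hne (h.eq_zero_of_mismatch hB hnc hxr hrρ hb hb0 hbe (by rw [hD]; ring))
  refine ⟨D / x, div_ne_zero hD0 h.ne_zero, ?_⟩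
  have h0 : (0 : ℂ) ∈ ball (0 : ℂ) r := mem_ball_self hr
  have hψ'd : DifferentiableOn ℂ (deriv ψ) (ball 0 r) :=
    (h.lin.diff.deriv isOpen_ball).mono (ball_subset_ball hrρ.le)
  obtain ⟨B, hBdef⟩ : ∃ B : ℂ → ℂ, B = fun ζ => deriv ψ ζ * b ζ := ⟨_, rfl⟩
  have hBd : DifferentiableOn ℂ B (ball 0 r) := by rw [hBdef]; exact hψ'd.mul hb
  have hζ := tendsto_pow_two_pow h.norm_lt_one
  have hds : ∀ {g : ℂ → ℂ}, DifferentiableOn ℂ g (ball 0 r) → ContinuousAt (dslope g 0) 0 :=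
    fun hg => (((Complex.differentiableOn_dslope (ball_mem_nhds _ hr)).2 hg).differentiableAt
      (ball_mem_nhds _ hr)).continuousAt
  have t1 : Tendsto (fun n : ℕ => dslope B 0 (x ^ 2 ^ n)) atTop (𝓝 (dslope B 0 0)) :=
    (hds hBd).tendsto.comp hζ
  have t2 : Tendsto (fun n : ℕ => dslope ψ 0 (x ^ 2 ^ n)) atTop (𝓝 (dslope ψ 0 0)) :=
    (hds (h.lin.diff.mono (ball_subset_ball hrρ.le))).tendsto.comp hζ
  have t3 : Tendsto (fun n : ℕ => deriv ψ (x ^ 2 ^ n)) atTop (𝓝 (deriv ψ 0)) :=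
    ((hψ'd.differentiableAt (ball_mem_nhds _ hr)).continuousAt).tendsto.comp hζ
  rw [dslope_same] at t2
  have t4 : Tendsto (fun n : ℕ => ((2 : ℂ)⁻¹) ^ n) atTop (𝓝 0) :=
    tendsto_pow_atTop_nhds_zero_of_norm_lt_one (by norm_num)
  have t5 := ((t1.mul t4).add (t3.mul_const (D / x))).div t2 h.lin.deriv_ne
  rw [mul_zero, zero_add, mul_div_cancel_left₀ _ h.lin.deriv_ne] at t5
  refine t5.congr' ?_
  filter_upwards [t2.eventually_ne h.lin.deriv_ne] with n hn
  rw [h.paramIter_return hxr hrρ hbe hD n, h.critReturn_eq]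
  have e1 := eq_add_mul_dslope_zero B (x ^ 2 ^ n)
  have e2 := h.lin.eq_add_mul_dslope (x ^ 2 ^ n)
  have e3 : B 0 = dc := by rw [hBdef]; exact hb0
  have e4 : B (x ^ 2 ^ n) = deriv ψ (x ^ 2 ^ n) * b (x ^ 2 ^ n) := by rw [hBdef]
  have hxn : x ^ 2 ^ n ≠ 0 := pow_ne_zero _ h.ne_zero
  have e5 : x ^ 2 ^ n = x * x ^ (2 ^ n - 1) := by
    rw [← pow_succ', Nat.sub_add_cancel Nat.one_le_two_pow]
  simp only [Pi.div_apply]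
  rw [e2, add_sub_cancel_left, ← e4, e1, e3, inv_pow, div_eq_div_iff hn (by
    exact mul_ne_zero (pow_ne_zero _ two_ne_zero) (mul_ne_zero hxn hn))]
  have hx0 := h.ne_zero
  rw [div_eq_mul_inv D x]
  have e6 : x ^ 2 ^ n * x⁻¹ = x ^ (2 ^ n - 1) := by rw [e5]; field_simp
  rw [← e6]
  field_simp
  ring

end velocity

section roots

theorem differentiableAt_of_exp_mul {f : ℂ → ℂ} {z k : ℂ} (hk : k ≠ 0) (hf : ContinuousAt f z)
    (hg : DifferentiableAt ℂ (fun y => Complex.exp (k * f y)) z) : DifferentiableAt ℂ f z := by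
  have hs : HasStrictDerivAt (fun y => Complex.exp (k * y)) (Complex.exp (k * f z) * (k * 1)) (f z) :=
    ((hasStrictDerivAt_id (f z)).const_mul k).cexp
  have hne : Complex.exp (k * f z) * (k * 1) ≠ 0 :=
    mul_ne_zero (Complex.exp_ne_zero _) (by simpa using hk)
  have h1 := (hs.to_localInverse hne).hasDerivAt.differentiableAt
  have h2 := h1.comp z hg
  refine h2.congr_of_eventuallyEq ?_
  have h3 := (hs.hasStrictFDerivAt_equiv hne).eventually_left_inverse
  filter_upwards [hf.eventually h3] with y hy using hy.symm

variable {X : ℂ → ℂ} {F : ℕ → ℂ → ℂ} {s₀ : ℂ} {ε : ℝ} {η : ℕ → ℝ}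

/-- A nonvanishing continuous function whose `2 ^ n`-th powers are well approximated by
holomorphic functions is holomorphic. -/
theorem differentiableAt_of_pow_approx (hε : 0 < ε) (hX : ContinuousOn X (ball s₀ ε))
    (hX0 : ∀ s ∈ ball s₀ ε, X s ≠ 0) (hF : ∀ n, DifferentiableOn ℂ (F n) (ball s₀ ε))
    (hη : Tendsto η atTop (𝓝 0))
    (hFX : ∀ n, ∀ s ∈ ball s₀ ε, ‖F n s - X s ^ 2 ^ n‖ ≤ η n * ‖X s‖ ^ 2 ^ n) :
    DifferentiableAt ℂ X s₀ ∧
      Tendsto (fun n => deriv (F n) s₀ / (2 ^ n * F n s₀)) atTop (𝓝 (deriv X s₀ / X s₀)) := by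
  have hs₀ : s₀ ∈ ball s₀ ε := mem_ball_self hε
  have hX₀ := hX0 s₀ hs₀
  have hc : ContinuousAt (fun s => X s / X s₀) s₀ :=
    (hX.continuousAt (ball_mem_nhds _ hε)).div_const _
  have h1 : ∀ᶠ s in 𝓝 s₀, X s / X s₀ ∈ ball (1 : ℂ) 1 :=
    hc.eventually_mem (by rw [div_self hX₀]; exact ball_mem_nhds _ one_pos)
  obtain ⟨δ, hδ, hδX⟩ := Metric.eventually_nhds_iff_ball.1
    (h1.and (isOpen_ball.mem_nhds hs₀))
  have hsub : ball s₀ δ ⊆ ball s₀ ε := fun s hs => (hδX s hs).2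
  have hslit : ∀ {z : ℂ}, z ∈ ball (1 : ℂ) 1 → z ∈ Complex.slitPlane :=
    fun hz => Complex.ball_one_subset_slitPlane hz
  obtain ⟨L, hL⟩ : ∃ L : ℂ → ℂ, L = fun s => Complex.log (X s / X s₀) := ⟨_, rfl⟩
  obtain ⟨u, hu⟩ : ∃ u : ℕ → ℂ → ℂ, u = fun n s => F n s / X s ^ 2 ^ n := ⟨_, rfl⟩
  obtain ⟨G, hG⟩ : ∃ G : ℕ → ℂ → ℂ, G = fun n s => L s + Complex.log (u n s) / 2 ^ n := ⟨_, rfl⟩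
  have hLc : ContinuousOn L (ball s₀ δ) := by
    rw [hL]
    exact ((hX.mono hsub).div_const _).clog fun s hs => hslit (hδX s hs).1
  have hLe : ∀ s ∈ ball s₀ δ, X s = X s₀ * Complex.exp (L s) := by
    intro s hs
    rw [hL]
    simp only []
    rw [Complex.exp_log (div_ne_zero (hX0 s (hsub hs)) hX₀), mul_div_cancel₀ _ hX₀]
  obtain ⟨n₀, hn₀⟩ := eventually_atTop.1 (hη.eventually_le_const (show (0 : ℝ) < 1 / 2 by norm_num))
  have hu1 : ∀ n ≥ n₀, ∀ s ∈ ball s₀ δ, ‖u n s - 1‖ ≤ 1 / 2 := by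
    intro n hn s hs
    have h2 : 0 < ‖X s‖ ^ 2 ^ n := pow_pos (norm_pos_iff.2 (hX0 s (hsub hs))) _
    have h3 : X s ^ 2 ^ n ≠ 0 := pow_ne_zero _ (hX0 s (hsub hs))
    rw [hu]
    simp only []
    rw [div_sub_one h3, norm_div, norm_pow, div_le_iff₀ h2]
    exact (hFX n s (hsub hs)).trans (by gcongr; exact hn₀ n hn)
  have hu1' : ∀ n ≥ n₀, ∀ s ∈ ball s₀ δ, u n s ∈ ball (1 : ℂ) 1 := fun n hn s hs => by
    rw [mem_ball_iff_norm]; exact (hu1 n hn s hs).trans_lt (by norm_num)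
  have huc : ∀ n, ContinuousOn (u n) (ball s₀ δ) := by
    intro n
    rw [hu]
    exact ((hF n).continuousOn.mono hsub).div ((hX.mono hsub).pow _)
      fun s hs => pow_ne_zero _ (hX0 s (hsub hs))
  have hGc : ∀ n ≥ n₀, ContinuousOn (G n) (ball s₀ δ) := by
    intro n hn
    rw [hG]
    exact hLc.add (((huc n).clog fun s hs => hslit (hu1' n hn s hs)).div_const _)
  have hGe : ∀ n ≥ n₀, ∀ s ∈ ball s₀ δ,
      Complex.exp (2 ^ n * G n s) = F n s / X s₀ ^ 2 ^ n := by
    intro n hn s hs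
    have h4 : u n s ≠ 0 := Complex.slitPlane_ne_zero (hslit (hu1' n hn s hs))
    rw [hG]
    simp only []
    rw [mul_add, mul_div_cancel₀ _ (pow_ne_zero _ two_ne_zero), Complex.exp_add,
      Complex.exp_log h4]
    have h5 : Complex.exp (2 ^ n * L s) = (X s / X s₀) ^ 2 ^ n := by
      have := Complex.exp_nat_mul (L s) (2 ^ n)
      push_cast at this
      have h6 : Complex.exp (L s) = X s / X s₀ :=
        eq_div_of_mul_eq hX₀ (by rw [mul_comm, ← hLe s hs])
      rw [this, h6]
    rw [h5, hu, div_pow]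
    have := pow_ne_zero (2 ^ n) (hX0 s (hsub hs))
    field_simp
  have hGd : ∀ n ≥ n₀, DifferentiableOn ℂ (G n) (ball s₀ δ) := by
    intro n hn s hs
    have h6 := isOpen_ball.mem_nhds hs
    refine (differentiableAt_of_exp_mul (k := 2 ^ n) (pow_ne_zero _ two_ne_zero)
      ((hGc n hn).continuousAt h6) ?_).differentiableWithinAt
    have h7 : DifferentiableAt ℂ (fun s => F n s / X s₀ ^ 2 ^ n) s :=
      ((hF n).differentiableAt (isOpen_ball.mem_nhds (hsub hs))).div_const _
    refine h7.congr_of_eventuallyEq ?_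
    filter_upwards [h6] with y hy using hGe n hn y hy
  have hlim : TendstoLocallyUniformlyOn G L atTop (ball s₀ δ) := by
    refine TendstoUniformlyOn.tendstoLocallyUniformlyOn ?_
    rw [Metric.tendstoUniformlyOn_iff]
    intro e he
    obtain ⟨n₁, hn₁⟩ := exists_pow_lt_of_lt_one he (show (1 / 2 : ℝ) < 1 by norm_num)
    filter_upwards [eventually_ge_atTop (max n₀ n₁)] with n hn s hs
    have h8 := Complex.norm_log_one_add_half_le_self (hu1 n (le_trans (le_max_left _ _) hn) s hs)
    rw [add_sub_cancel] at h8
    rw [hG, dist_self_add_right, norm_div, norm_pow, Complex.norm_ofNat]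
    calc ‖Complex.log (u n s)‖ / 2 ^ n ≤ 1 / 2 ^ n := by
          gcongr
          linarith [hu1 n (le_trans (le_max_left _ _) hn) s hs]
      _ = (1 / 2) ^ n := by rw [one_div_pow]
      _ ≤ (1 / 2) ^ n₁ := pow_le_pow_of_le_one (by norm_num) (by norm_num)
          (le_trans (le_max_right _ _) hn)
      _ < e := hn₁
  have hev : ∀ᶠ n in atTop, DifferentiableOn ℂ (G n) (ball s₀ δ) :=
    eventually_atTop.2 ⟨n₀, hGd⟩
  have hs₀δ := ball_mem_nhds s₀ hδ
  have hLd : DifferentiableAt ℂ L s₀ :=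
    (hlim.differentiableOn hev isOpen_ball).differentiableAt hs₀δ
  have hXd : HasDerivAt X (X s₀ * (Complex.exp (L s₀) * deriv L s₀)) s₀ := by
    refine (hLd.hasDerivAt.cexp.const_mul (X s₀)).congr_of_eventuallyEq ?_
    filter_upwards [hs₀δ] with y hy using hLe y hy
  refine ⟨hXd.differentiableAt, ?_⟩
  have h9 : deriv X s₀ / X s₀ = deriv L s₀ := by
    rw [hXd.deriv, ← mul_assoc, ← hLe s₀ (mem_ball_self hδ), mul_div_cancel_left₀ _ hX₀]
  rw [h9]
  refine ((hlim.deriv hev isOpen_ball).tendsto_at (mem_ball_self hδ)).congr' ?_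
  filter_upwards [eventually_ge_atTop n₀] with n hn
  have hGn := ((hGd n hn).differentiableAt hs₀δ).hasDerivAt
  have h10 : HasDerivAt (fun s => Complex.exp (2 ^ n * G n s))
      (Complex.exp (2 ^ n * G n s₀) * (2 ^ n * deriv (G n) s₀)) s₀ :=
    (hGn.const_mul _).cexp
  have h11 : HasDerivAt (fun s => F n s / X s₀ ^ 2 ^ n) (deriv (F n) s₀ / X s₀ ^ 2 ^ n) s₀ :=
    (((hF n).differentiableAt (ball_mem_nhds _ hε)).hasDerivAt).div_const _
  have h12 := h10.unique (h11.congr_of_eventuallyEq (by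
    filter_upwards [hs₀δ] with y hy using hGe n hn y hy))
  have h13 := hGe n hn s₀ (mem_ball_self hδ)
  have h14 : F n s₀ ≠ 0 := by
    intro h0
    rw [h0, zero_div] at h13
    exact Complex.exp_ne_zero _ h13
  have h15 : X s₀ ^ 2 ^ n ≠ 0 := pow_ne_zero _ hX₀
  rw [h13] at h12
  simp only [comp_apply]
  field_simp at h12
  rw [eq_div_iff (mul_ne_zero (pow_ne_zero _ two_ne_zero) h14)]
  linear_combination h12

end roots

section holomorphy

variable {p l : ℕ} {W : ℂ → ℂ × ℂ} {s₀ : ℂ} {ε R : ℝ}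

theorem multIter_self (c a : ℂ) {n : ℕ} (hn : 1 ≤ n) : multIter c a n c = 0 := by
  by_contra h
  exact multIter_ne_zero_iff.1 h 0 hn rfl

theorem multIter_neg_self (c a : ℂ) {n : ℕ} (hn : 1 ≤ n) : multIter c a n (-c) = 0 := by
  by_contra h
  exact multIter_ne_zero_iff.1 h 0 hn (by simp)

theorem contDiff_critCoeff (p : ℕ) {k : WithTop ℕ∞} : ContDiff ℂ k (critCoeff p) :=
  (contDiff_critQuot (p - 1)).comp (contDiff_id.prodMk contDiff_fst)

theorem TypeB.critReturn_ne {w : ℂ × ℂ} (hB : TypeB p l w)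
    (hnc : (cubic w.1 w.2)^[l] w.1 ≠ -w.1) (n : ℕ) : critReturn p l n w ≠ w.1 := by
  obtain ⟨ρ, ψ, h⟩ := hB.exists_isPos_posMap hnc
  rw [critReturn_eq]
  exact h.iterate_neg_ne_iterate hB.one_le_p hB.mem _ 0

variable (hε : 0 < ε) (hW : DifferentiableOn ℂ W (ball s₀ ε))
  (hB : ∀ s ∈ ball s₀ ε, TypeB p l (W s))
  (hR : ∀ s ∈ ball s₀ ε, ∀ z ∈ filledJulia (cubic (W s).1 (W s).2), ‖z‖ ≤ R)

include hW hB hR in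
theorem continuousOn_posMap_comp : ContinuousOn (fun s => posMap p l (W s)) (ball s₀ ε) := by
  intro s hs
  have h1 : ContinuousWithinAt (posMap p l) (W '' ball s₀ ε) (W s) := by
    refine continuousWithinAt_posMap (R := R) ?_ ?_ (mem_image_of_mem W hs)
    · rintro _ ⟨t, ht, rfl⟩; exact hB t ht
    · rintro _ ⟨t, ht, rfl⟩; exact hR t ht
  exact ContinuousWithinAt.comp h1 (hW.continuousOn s hs) (mapsTo_image W _)

include hε hW hB hR

theorem differentiableAt_posMap_comp (hx : posMap p l (W s₀) ≠ 0) :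
    DifferentiableAt ℂ (fun s => posMap p l (W s)) s₀ ∧
      Tendsto (fun n => deriv (fun s => critCoeff p (W s) * (critReturn p l n (W s) - (W s).1)) s₀ /
          (2 ^ n * (critCoeff p (W s₀) * (critReturn p l n (W s₀) - (W s₀).1)))) atTop
        (𝓝 (deriv (fun s => posMap p l (W s)) s₀ / posMap p l (W s₀))) := by
  have hs₀ : s₀ ∈ ball s₀ ε := mem_ball_self hε
  have hX := continuousOn_posMap_comp hW hB hR
  have hX₀ := hX.continuousAt (ball_mem_nhds _ hε)
  have hWc := hW.continuousOn.continuousAt (ball_mem_nhds _ hε)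
  obtain ⟨r, hr, hr1⟩ := exists_between (hB s₀ hs₀).norm_posMap_lt_one
  have hr0 : 0 ≤ r := (norm_nonneg _).trans hr.le
  have hR0 := (hB s₀ hs₀).radius_nonneg (hR s₀ hs₀)
  obtain ⟨K, hK⟩ : ∃ K, K = ‖critCoeff p (W s₀)‖ + 1 := ⟨_, rfl⟩
  have hK0 : 0 ≤ K := by rw [hK]; positivity
  have e1 : ∀ᶠ s in 𝓝 s₀, ‖posMap p l (W s)‖ < r := hX₀.norm.eventually_lt_const hr
  have e2 : ∀ᶠ s in 𝓝 s₀, posMap p l (W s) ≠ 0 := hX₀.eventually_ne hx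
  have e3 : ∀ᶠ s in 𝓝 s₀, ‖critCoeff p (W s)‖ < K := by
    have : ContinuousAt (fun s => ‖critCoeff p (W s)‖) s₀ :=
      ((continuous_critCoeff p).continuousAt.comp hWc).norm
    exact this.tendsto.eventually_lt_const (by rw [hK]; linarith)
  obtain ⟨δ, hδ, hsub⟩ := Metric.eventually_nhds_iff_ball.1
    (((e1.and e2).and e3).and (ball_mem_nhds s₀ hε))
  refine differentiableAt_of_pow_approx (η := fun n => 4 * R * K * r ^ (2 ^ n - 1)) hδ
    (hX.mono fun s hs => (hsub s hs).2) (fun s hs => (hsub s hs).1.1.2) ?_ ?_ ?_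
  · intro n
    have hW' : DifferentiableOn ℂ W (ball s₀ δ) := hW.mono fun s hs => (hsub s hs).2
    have h1 : Differentiable ℂ (critCoeff p) := (contDiff_critCoeff p (k := 1)).differentiable (by simp)
    have h2 : Differentiable ℂ (critReturn p l n) :=
      (contDiff_critReturn p l n (k := 1)).differentiable (by simp)
    exact (h1.comp_differentiableOn hW').mul ((h2.comp_differentiableOn hW').sub hW'.fst)
  · have h1 : Tendsto (fun n : ℕ => 2 ^ n - 1) atTop atTop :=
      (tendsto_sub_atTop_nat 1).comp (tendsto_pow_atTop_atTop_of_one_lt one_lt_two)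
    have := ((tendsto_pow_atTop_nhds_zero_of_lt_one hr0 hr1).comp h1).const_mul (4 * R * K)
    simpa using this
  · intro n s hs
    obtain ⟨⟨⟨h1, -⟩, h3⟩, h4⟩ := hsub s hs
    refine ((hB s h4).norm_critCoeff_mul_sub_le (hR s h4) n).trans ?_
    have h5 : 2 ^ (n + 1) - 1 = (2 ^ n - 1) + 2 ^ n := by
      have := Nat.one_le_two_pow (n := n); rw [pow_succ]; omega
    rw [h5, pow_add, ← mul_assoc]
    gcongr

theorem deriv_posMap_comp_ne_zero (hx : posMap p l (W s₀) ≠ 0) (hd : deriv W s₀ ≠ 0) :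
    deriv (fun s => posMap p l (W s)) s₀ ≠ 0 := by
  have hs₀ : s₀ ∈ ball s₀ ε := mem_ball_self hε
  have hnc : (cubic (W s₀).1 (W s₀).2)^[l] (W s₀).1 ≠ -(W s₀).1 :=
    fun h => hx ((hB s₀ hs₀).posMap_eq_zero h)
  obtain ⟨-, hlim⟩ := differentiableAt_posMap_comp hε hW hB hR hx
  have hWd : HasDerivAt W (deriv W s₀) s₀ :=
    (hW.differentiableAt (ball_mem_nhds _ hε)).hasDerivAt
  obtain ⟨dc, hdc⟩ : ∃ dc, dc = (deriv W s₀).1 := ⟨_, rfl⟩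
  obtain ⟨da, hda⟩ : ∃ da, da = (deriv W s₀).2 := ⟨_, rfl⟩
  have hd1 : HasDerivAt (fun s => (W s).1) dc s₀ := hdc ▸ hWd.fst
  have hd2 : HasDerivAt (fun s => (W s).2) da s₀ := hda ▸ hWd.snd
  have hp := (hB s₀ hs₀).one_le_p
  have hlp := (hB s₀ hs₀).lt
  have hF : paramIter (W s₀).1 (W s₀).2 dc da p (W s₀).1 = dc := by
    have h1 := hasDerivAt_iterate_curve hd1 hd2 hd1 p
    rw [multIter_self _ _ hp, zero_mul, zero_add] at h1
    refine h1.unique (hd1.congr_of_eventuallyEq ?_)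
    filter_upwards [ball_mem_nhds s₀ hε] with s hs using (hB s hs).mem.1
  have hne : ¬(dc = 0 ∧ da = 0) := fun h =>
    hd (Prod.ext (hdc ▸ h.1) (hda ▸ h.2))
  obtain ⟨D, hD, hDlim⟩ := (hB s₀ hs₀).exists_tendsto_velocity hnc hF hne
  have hA : critCoeff p (W s₀) ≠ 0 := (hB s₀ hs₀).critCoeff_ne_zero hnc
  have hAd : DifferentiableAt ℂ (fun s => critCoeff p (W s)) s₀ :=
    (((contDiff_critCoeff p (k := 1)).differentiable (by simp)) _).comp s₀ hWd.differentiableAt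
  have h0 : Tendsto (fun n : ℕ => deriv (fun s => critCoeff p (W s)) s₀ / critCoeff p (W s₀) *
      (1 / 2) ^ n) atTop (𝓝 0) := by
    have := (tendsto_pow_atTop_nhds_zero_of_norm_lt_one (x := (1 / 2 : ℂ)) (by norm_num)).const_mul
      (deriv (fun s => critCoeff p (W s)) s₀ / critCoeff p (W s₀))
    simpa using this
  have h1 := h0.add hDlim
  rw [zero_add] at h1
  have h2 : deriv (fun s => posMap p l (W s)) s₀ / posMap p l (W s₀) = D := by
    refine tendsto_nhds_unique hlim (h1.congr fun n => ?_)
    have hy : HasDerivAt (fun s => critReturn p l n (W s))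
        (paramIter (W s₀).1 (W s₀).2 dc da (p * n + (p - l)) (-(W s₀).1)) s₀ := by
      have h3 := hasDerivAt_iterate_curve hd1 hd2 hd1.neg (p * n + (p - l))
      have h4 : multIter (W s₀).1 (W s₀).2 (p * n + (p - l)) ((-fun s => (W s).1) s₀) = 0 :=
        multIter_neg_self _ _ (by omega)
      rw [h4, zero_mul, zero_add] at h3
      simp only [critReturn_eq]
      exact h3
    have h5 := (hAd.hasDerivAt.mul (hy.sub hd1)).deriv
    have h6 := (hB s₀ hs₀).critReturn_ne hnc n
    have h7 := sub_ne_zero.2 h6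
    have h8 : deriv (fun s => critCoeff p (W s) * (critReturn p l n (W s) - (W s).1)) s₀ = _ := h5
    rw [h8, one_div, inv_pow]
    simp only [Pi.sub_apply]
    field_simp
  intro h
  rw [h, zero_div] at h2
  exact hD h2.symm

end holomorphy

section arithmetic

theorem exists_valuation_three_lt_one :
    ∃ B : ValuationSubring ℂ, B.valuation 3 < 1 := by
  let A : Subring ℂ := (Int.castRingHom ℂ).range
  have h3 : (3 : ℂ) ∈ A := ⟨3, by simp⟩
  obtain ⟨B, -, hB⟩ := Ideal.image_subset_nonunits_valuationSubring
    (Ideal.span {(⟨3, h3⟩ : A)}) (by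
      rw [Ne, Ideal.span_singleton_eq_top, isUnit_iff_exists_inv]
      rintro ⟨⟨_, m, rfl⟩, h⟩
      have h1 := congrArg Subtype.val h
      simp only [Subring.coe_mul, Subring.coe_one, eq_intCast] at h1
      have h2 : (3 : ℤ) * m = 1 := by exact_mod_cast h1
      omega)
  refine ⟨B, ?_⟩
  have := hB ⟨⟨3, h3⟩, Ideal.subset_span rfl, rfl⟩
  exact (ValuationSubring.mem_nonunits_iff B).1 this

variable {Γ : Type*} [LinearOrderedCommGroupWithZero Γ] {v : Valuation ℂ Γ}

theorem Valuation.map_two_eq_one (h3 : v 3 < 1) : v 2 = 1 := by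
  have h := v.map_one_add_of_lt (x := -3) (by rwa [v.map_neg])
  rw [show (1 + -3 : ℂ) = -2 by norm_num, v.map_neg] at h
  exact h

/-- The orbits of periodic points of `f_{c,a}` containing `c` and `-c` are `3`-adically bounded. -/
theorem valuation_orbit_le_one (h3 : v 3 < 1) {c a : ℂ} {p l : ℕ} (hp : 1 ≤ p)
    (hper : (cubic c a)^[p] c = c) (hl : (cubic c a)^[l] c = -c) :
    v c ≤ 1 ∧ v a ≤ 1 ∧ ∀ n, v ((cubic c a)^[n] c) ≤ 1 := by
  have h2 := Valuation.map_two_eq_one h3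
  set z : ℕ → ℂ := fun n => (cubic c a)^[n] c with hz
  have hmod : ∀ n, z n = z (n % p) := fun n =>
    (IsPeriodicPt.iterate_mod_apply (f := cubic c a) (x := c) (n := p) hper n).symm
  have hmodlt : ∀ n, n % p < p := fun n => Nat.mod_lt n hp
  obtain ⟨⟨i₀, j₀⟩, -, hmax⟩ := Finset.exists_max_image
    (Finset.range p ×ˢ Finset.range p) (fun q => v (z q.1 - z q.2))
    ⟨(0, 0), by simp [Nat.pos_iff_ne_zero, Nat.one_le_iff_ne_zero.1 hp]⟩
  obtain ⟨D, hD⟩ : ∃ D, D = v (z i₀ - z j₀) := ⟨_, rfl⟩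
  have hle : ∀ i j, v (z i - z j) ≤ D := by
    intro i j
    rw [hmod i, hmod j, hD]
    exact hmax (i % p, j % p) (by simp [hmodlt])
  have hz0 : z 0 = c := rfl
  have hzl : z l = -c := hl
  have hc : v c ≤ D := by
    have := hle 0 l
    rw [hz0, hzl, sub_neg_eq_add, ← two_mul, v.map_mul, h2, one_mul] at this
    exact this
  have hzD : ∀ n, v (z n) ≤ D := by
    intro n
    have := v.map_add_le (hle n 0) hc
    rwa [hz0, sub_add_cancel] at this
  have hz1 : ∀ n, z (n + 1) = cubic c a (z n) := fun n => iterate_succ_apply' _ _ _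
  have hD1 : D ≤ 1 := by
    by_contra! hlt
    have hD0 : 0 < D := zero_lt_one.trans hlt
    have e1 := cubic_sub c a (z i₀) (z j₀)
    have e2 : z i₀ ^ 2 + z i₀ * z j₀ + z j₀ ^ 2 - 3 * c ^ 2 =
        (z i₀ - z j₀) ^ 2 + 3 * (z i₀ * z j₀ - c ^ 2) := by ring
    have e3 : v (3 * (z i₀ * z j₀ - c ^ 2)) < v ((z i₀ - z j₀) ^ 2) := by
      have e4 : v (z i₀ * z j₀ - c ^ 2) ≤ D ^ 2 := by
        refine v.map_sub_le ?_ ?_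
        · rw [v.map_mul, sq]; exact mul_le_mul' (hzD _) (hzD _)
        · rw [v.map_pow]; exact pow_le_pow_left' hc 2
      rw [v.map_mul, v.map_pow, ← hD]
      calc v 3 * v (z i₀ * z j₀ - c ^ 2) ≤ v 3 * D ^ 2 := mul_le_mul_right e4 _
        _ < 1 * D ^ 2 := by
          exact mul_lt_mul_of_pos_right h3 (pow_pos hD0 2)
        _ = D ^ 2 := one_mul _
    have e5 := hle (i₀ + 1) (j₀ + 1)
    rw [hz1, hz1, e1, e2, v.map_mul, v.map_add_eq_of_lt_left e3, v.map_pow, ← hD] at e5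
    have e6 : D < D * D ^ 2 := by
      calc D = D * 1 := (mul_one _).symm
        _ < D * D ^ 2 := mul_lt_mul_of_pos_left (one_lt_pow₀ hlt two_ne_zero) hD0
    exact absurd e5 (not_le.2 e6)
  have hz1' : ∀ n, v (z n) ≤ 1 := fun n => (hzD n).trans hD1
  have hc1 := hc.trans hD1
  refine ⟨hc1, ?_, hz1'⟩
  have e : a = z 1 + 2 * c ^ 3 := by
    rw [hz1 0, hz0, cubic_apply]; ring
  rw [e]
  refine v.map_add_le (hz1' 1) ?_
  rw [v.map_mul, h2, one_mul, v.map_pow]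
  exact pow_le_one' hc1 3

/-- The two critical orbit relations at a parameter with both critical points in one cycle
are transverse. -/
theorem eq_zero_of_paramIter_eq {c a dc da : ℂ} {p l : ℕ} (hp : 1 ≤ p) (hl1 : 1 ≤ l)
    (hper : (cubic c a)^[p] c = c) (hl : (cubic c a)^[l] c = -c)
    (h1 : paramIter c a dc da p c = dc) (h2 : paramIter c a dc da l c = -dc) :
    dc = 0 ∧ da = 0 := by
  obtain ⟨B, h3⟩ := exists_valuation_three_lt_one
  set v := B.valuation
  obtain ⟨hc, ha, hz⟩ := valuation_orbit_le_one h3 hp hper hl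
  have hv2 := Valuation.map_two_eq_one h3
  obtain ⟨M, hM⟩ : ∃ M, M = max (v dc) (v da) := ⟨_, rfl⟩
  have hdc : v dc ≤ M := hM ▸ le_max_left _ _
  have hda : v da ≤ M := hM ▸ le_max_right _ _
  by_contra hne
  have hM0 : 0 < M := by
    rw [hM, lt_max_iff, zero_lt_iff, zero_lt_iff, Ne, Ne, v.zero_iff, v.zero_iff]
    tauto
  have h3M : ∀ u, v u ≤ M → v (3 * u) < M := by
    intro u hu
    rw [v.map_mul]
    calc v 3 * v u ≤ v 3 * M := mul_le_mul_right hu _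
      _ < 1 * M := mul_lt_mul_of_pos_right h3 hM0
      _ = M := one_mul _
  have key : ∀ n, v (paramIter c a dc da n c) ≤ M ∧
      v (paramIter c a dc da (n + 1) c - da) < M := by
    intro n
    have step : ∀ n, v (paramIter c a dc da n c) ≤ M →
        v (paramIter c a dc da (n + 1) c - da) < M := by
      intro n hn
      have e : paramIter c a dc da (n + 1) c - da = 3 * ((((cubic c a)^[n] c) ^ 2 - c ^ 2) *
          paramIter c a dc da n c + (-2) * c * dc * (cubic c a)^[n] c) := by
        rw [paramIter_succ]; ring
      rw [e]
      refine h3M _ (v.map_add_le ?_ ?_)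
      · rw [v.map_mul]
        have : v (((cubic c a)^[n] c) ^ 2 - c ^ 2) ≤ 1 :=
          v.map_sub_le (by rw [v.map_pow]; exact pow_le_one' (hz n) 2)
            (by rw [v.map_pow]; exact pow_le_one' hc 2)
        exact (mul_le_mul' this hn).trans_eq (one_mul _)
      · rw [v.map_mul, v.map_mul, v.map_mul, v.map_neg, hv2, one_mul]
        calc _ ≤ 1 * M * 1 := mul_le_mul' (mul_le_mul' hc hdc) (hz n)
          _ = M := by simp
    induction n with
    | zero => exact ⟨by simp [paramIter], step 0 (by simp [paramIter])⟩
    | succ n ih =>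
      have h4 : v (paramIter c a dc da (n + 1) c) ≤ M := by
        have := v.map_add_le ih.2.le hda
        rwa [sub_add_cancel] at this
      exact ⟨h4, step _ h4⟩
  obtain ⟨p, rfl⟩ := Nat.exists_eq_add_of_le' hp
  obtain ⟨l, rfl⟩ := Nat.exists_eq_add_of_le' hl1
  have k1 := (key p).2
  have k2 := (key l).2
  rw [h1] at k1
  rw [h2] at k2
  have k3 : v dc < M := by
    have := v.map_sub_lt k1 k2
    rwa [show dc - da - (-dc - da) = 2 * dc by ring, v.map_mul, hv2, one_mul] at this
  have k4 : v da < M := by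
    have := v.map_sub_lt k3 k1
    rwa [show dc - (dc - da) = da by ring] at this
  rw [hM] at k3 k4
  rcases max_choice (v dc) (v da) with h | h <;> rw [h] at k3 k4
  · exact lt_irrefl _ k3
  · exact lt_irrefl _ k4

end arithmetic

section charts

variable {p l : ℕ} {H : Set (ℂ × ℂ)} {w₀ : ℂ × ℂ}

/-- A local parametrization `W` of the curve `S_p` at a point `w₀` of the hyperbolic component `H`,
inverse to the coordinate `π`. -/
structure IsChart (p : ℕ) (H : Set (ℂ × ℂ)) (w₀ : ℂ × ℂ) (π : ℂ × ℂ → ℂ) (ε : ℝ)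
    (W : ℂ → ℂ × ℂ) : Prop where
  pos : 0 < ε
  diff_proj : Differentiable ℂ π
  diff : DifferentiableOn ℂ W (ball 0 ε)
  zero : W 0 = w₀
  mem : ∀ s ∈ ball (0 : ℂ) ε, W s ∈ H
  proj : ∀ s ∈ ball (0 : ℂ) ε, π (W s) = s
  eventually : ∀ᶠ w in 𝓝 w₀, w ∈ Sp p → π w ∈ ball (0 : ℂ) ε ∧ W (π w) = w

theorem IsChart.deriv_ne_zero {π : ℂ × ℂ → ℂ} {ε : ℝ} {W : ℂ → ℂ × ℂ} (h : IsChart p H w₀ π ε W)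
    {s : ℂ} (hs : s ∈ ball (0 : ℂ) ε) : deriv W s ≠ 0 := by
  intro h0
  have h1 := (h.diff.differentiableAt (isOpen_ball.mem_nhds hs)).hasDerivAt
  have h2 := (h.diff_proj (W s)).hasFDerivAt.comp_hasDerivAt s h1
  rw [h0, map_zero] at h2
  have h3 : HasDerivAt (π ∘ W) 1 s := by
    refine (hasDerivAt_id s).congr_of_eventuallyEq ?_
    filter_upwards [isOpen_ball.mem_nhds hs] with t ht using h.proj t ht
  exact zero_ne_one (h2.unique h3)

theorem eventually_mem_Sp (hw : w₀ ∈ Sp p) :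
    ∀ᶠ w : ℂ × ℂ in 𝓝 w₀, (cubic w.1 w.2)^[p] w.1 = w.1 → w ∈ Sp p := by
  have h1 : ∀ᶠ w : ℂ × ℂ in 𝓝 w₀, ∀ k ∈ Finset.Ico 1 p, (cubic w.1 w.2)^[k] w.1 ≠ w.1 := by
    rw [Finset.eventually_all]
    intro k hk
    rw [Finset.mem_Ico] at hk
    exact (isOpen_ne_fun (continuous_iterate_crit k) continuous_fst).mem_nhds (hw.2 k hk.1 hk.2)
  filter_upwards [h1] with w hw1 hw2
  exact ⟨hw2, fun k hk hkp => hw1 k (Finset.mem_Ico.2 ⟨hk, hkp⟩)⟩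

theorem TypeB.tendsto_critReturn (hB : TypeB p l w₀) :
    Tendsto (fun n => critReturn p l n w₀) atTop (𝓝 w₀.1) := by
  refine hB.tendsto_iterate.congr fun n => ?_
  rw [critReturn_eq, iterate_add_apply, iterate_mul]

theorem TypeB.eventually_mem_hypLocus (hB : TypeB p l w₀) :
    ∀ᶠ w : ℂ × ℂ in 𝓝 w₀, (cubic w.1 w.2)^[p] w.1 = w.1 → w ∈ hypLocus p := by
  filter_upwards [eventually_mem_Sp hB.mem,
    eventually_tendsto_critReturn hB.one_le_p hB.tendsto_critReturn] with w h1 h2 h3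
  exact mem_hypLocus_of_tendsto hB.lt.le hB.one_le_p (h1 h3) (h2 (h1 h3))

theorem IsHyperbolicComponent.subset_of_isPreconnected (hH : IsHyperbolicComponent p H)
    (hw₀ : w₀ ∈ H) {S : Set (ℂ × ℂ)} (hS : IsPreconnected S) (hwS : w₀ ∈ S)
    (hSh : S ⊆ hypLocus p) : S ⊆ H := by
  obtain ⟨w, hw, rfl⟩ := hH
  rw [connectedComponentIn_eq hw₀]
  exact hS.subset_connectedComponentIn hwS hSh

theorem contDiff_iterate_crit (k : ℕ) {m : WithTop ℕ∞} :
    ContDiff ℂ m fun w : ℂ × ℂ => (cubic w.1 w.2)^[k] w.1 :=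
  ContDiff.comp (g := fun q : (ℂ × ℂ) × ℂ => (cubic q.1.1 q.1.2)^[k] q.2)
    (f := fun w : ℂ × ℂ => (w, w.1)) (contDiff_cubic_iterate k) (contDiff_id.prodMk contDiff_fst)

theorem fderiv_iterate_crit {k : ℕ} (hk : 1 ≤ k) (dc da : ℂ) :
    fderiv ℂ (fun w : ℂ × ℂ => (cubic w.1 w.2)^[k] w.1) w₀ (dc, da) =
      paramIter w₀.1 w₀.2 dc da k w₀.1 := by
  have h1 : HasDerivAt (fun s : ℂ => w₀ + s • ((dc, da) : ℂ × ℂ)) ((1 : ℂ) • (dc, da)) 0 :=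
    ((hasDerivAt_id (0 : ℂ)).smul_const _).const_add w₀
  rw [one_smul] at h1
  have h2 : HasFDerivAt (fun w : ℂ × ℂ => (cubic w.1 w.2)^[k] w.1)
      (fderiv ℂ (fun w : ℂ × ℂ => (cubic w.1 w.2)^[k] w.1) w₀)
      (w₀ + (0 : ℂ) • ((dc, da) : ℂ × ℂ)) := by
    rw [zero_smul, add_zero]
    exact ((contDiff_iterate_crit k (m := 1)).differentiable (by simp) w₀).hasFDerivAt
  have h3 := h2.comp_hasDerivAt (0 : ℂ) h1
  have h4 := hasDerivAt_iterate_curve h1.fst h1.snd h1.fst k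
  simp only [zero_smul, add_zero] at h4
  rw [multIter_self _ _ hk, zero_mul, zero_add] at h4
  exact h3.unique h4

theorem TypeB.exists_isChart (hB : TypeB p l w₀) (hH : IsHyperbolicComponent p H) (hw₀ : w₀ ∈ H)
    {π : ℂ × ℂ → ℂ} (hπ : ContDiff ℂ 1 π) (hπ0 : π w₀ = 0)
    (hind : ∀ dc da, paramIter w₀.1 w₀.2 dc da p w₀.1 = dc → fderiv ℂ π w₀ (dc, da) = 0 →
      dc = 0 ∧ da = 0) : ∃ ε W, IsChart p H w₀ π ε W := by
  obtain ⟨G, hG⟩ : ∃ G : ℂ × ℂ → ℂ × ℂ, G = fun w => ((cubic w.1 w.2)^[p] w.1 - w.1, π w) :=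
    ⟨_, rfl⟩
  have hp := hB.one_le_p
  have hGc : ContDiff ℂ 1 G := by
    rw [hG]
    exact ((contDiff_iterate_crit p).sub contDiff_fst).prodMk hπ
  have hGd : HasFDerivAt G ((fderiv ℂ (fun w : ℂ × ℂ => (cubic w.1 w.2)^[p] w.1) w₀ -
      ContinuousLinearMap.fst ℂ ℂ ℂ).prod (fderiv ℂ π w₀)) w₀ := by
    rw [hG]
    exact ((((contDiff_iterate_crit p (m := 1)).differentiable (by simp) w₀).hasFDerivAt).sub
      hasFDerivAt_fst).prodMk (hπ.differentiable (by simp) w₀).hasFDerivAt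
  obtain ⟨T, hT⟩ : ∃ T, T = (fderiv ℂ (fun w : ℂ × ℂ => (cubic w.1 w.2)^[p] w.1) w₀ -
      ContinuousLinearMap.fst ℂ ℂ ℂ).prod (fderiv ℂ π w₀) := ⟨_, rfl⟩
  rw [← hT] at hGd
  have hTinj : Injective (T : ℂ × ℂ →ₗ[ℂ] ℂ × ℂ) := by
    refine (injective_iff_map_eq_zero _).2 ?_
    rintro ⟨dc, da⟩ h
    have h' : T (dc, da) = 0 := h
    rw [hT, ContinuousLinearMap.prod_apply, Prod.mk_eq_zero, sub_apply,
      fderiv_iterate_crit hp, sub_eq_zero] at h'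
    obtain ⟨h1, h2⟩ := hind dc da h'.1 h'.2
    rw [h1, h2]; rfl
  obtain ⟨E, hE⟩ : ∃ E : (ℂ × ℂ) ≃L[ℂ] (ℂ × ℂ), (E : ℂ × ℂ →L[ℂ] ℂ × ℂ) = T :=
    ⟨(LinearEquiv.ofInjectiveEndo (T : ℂ × ℂ →ₗ[ℂ] ℂ × ℂ) hTinj).toContinuousLinearEquiv,
      by ext <;> rfl⟩
  rw [← hE] at hGd
  have hGw : G w₀ = (0, 0) := by
    rw [hG]
    simp only [hB.mem.1, sub_self, hπ0]
  obtain ⟨r, hr, ψ, hψd, hψ0, hψ1, V, hVU, hVo, hwV, hV⟩ :=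
    exists_local_inverse hGc.contDiffAt hGd hB.eventually_mem_hypLocus
  rw [hGw] at hψd hψ0 hψ1 hV
  have hball : ∀ s : ℂ, s ∈ ball (0 : ℂ) r ↔ ((0, s) : ℂ × ℂ) ∈ ball ((0, 0) : ℂ × ℂ) r := by
    intro s
    rw [mem_ball, mem_ball, Prod.dist_eq, max_lt_iff]
    simp [hr]
  have hWd : DifferentiableOn ℂ (fun s => ψ (0, s)) (ball 0 r) := by
    refine hψd.comp ((differentiable_const (0 : ℂ)).prodMk differentiable_id).differentiableOn ?_
    intro s hs
    exact (hball s).1 hs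
  have hGW : ∀ s ∈ ball (0 : ℂ) r, (cubic (ψ (0, s)).1 (ψ (0, s)).2)^[p] (ψ (0, s)).1 =
      (ψ (0, s)).1 ∧ π (ψ (0, s)) = s := by
    intro s hs
    have h1 := (hψ1 _ ((hball s).1 hs)).2
    rw [hG, Prod.mk_inj, sub_eq_zero] at h1
    exact h1
  refine ⟨r, fun s => ψ (0, s), hr, hπ.differentiable (by simp), hWd, hψ0, ?_,
    fun s hs => (hGW s hs).2, ?_⟩
  · have h1 : IsPreconnected ((fun s => ψ (0, s)) '' ball (0 : ℂ) r) :=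
      (convex_ball _ _).isPreconnected.image _ hWd.continuousOn
    have h2 := hH.subset_of_isPreconnected hw₀ h1 ⟨0, mem_ball_self hr, hψ0⟩ (by
      rintro _ ⟨s, hs, rfl⟩
      exact (hψ1 _ ((hball s).1 hs)).1 (hGW s hs).1)
    exact fun s hs => h2 ⟨s, hs, rfl⟩
  · filter_upwards [hVo.mem_nhds hwV] with w hw hwS
    have h1 := hV w hw
    have h2 : G w = (0, π w) := by
      rw [hG]
      simp only [hwS.1, sub_self]
    rw [h2] at h1
    exact ⟨(hball _).2 h1.1, h1.2⟩

theorem TypeB.exists_isChart_of_eq (hB : TypeB p l w₀) (hH : IsHyperbolicComponent p H)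
    (hw₀ : w₀ ∈ H) (hc : (cubic w₀.1 w₀.2)^[l] w₀.1 = -w₀.1) :
    ∃ ε W, IsChart p H w₀ (fun w => (cubic w.1 w.2)^[l] w.1 + w.1) ε W := by
  have hd := (contDiff_iterate_crit l (m := 1)).differentiable (by simp) w₀
  refine hB.exists_isChart hH hw₀ ((contDiff_iterate_crit l).add contDiff_fst)
    (by simp [hc]) ?_
  intro dc da h1 h2
  refine eq_zero_of_paramIter_eq hB.one_le_p hB.one_le hB.mem.1 hc h1 ?_
  have h3 := (hd.hasFDerivAt.add (hasFDerivAt_fst (𝕜 := ℂ) (p := w₀))).fderiv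
  have h4 : fderiv ℂ (fun w : ℂ × ℂ => (cubic w.1 w.2)^[l] w.1 + w.1) w₀ = _ := h3
  rw [h4, add_apply, fderiv_iterate_crit hB.one_le] at h2
  exact eq_neg_of_add_eq_zero_left h2

theorem TypeB.exists_isChart_of_ne (hB : TypeB p l w₀) (hH : IsHyperbolicComponent p H)
    (hw₀ : w₀ ∈ H) (hc : (cubic w₀.1 w₀.2)^[l] w₀.1 ≠ -w₀.1) :
    ∃ π ε W, IsChart p H w₀ π ε W := by
  obtain ⟨dc₁, da₁, h1⟩ := hB.exists_paramIter_ne hc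
  have hlin : ∀ dc da, paramIter w₀.1 w₀.2 dc da p w₀.1 =
      dc * paramIter w₀.1 w₀.2 1 0 p w₀.1 + da * paramIter w₀.1 w₀.2 0 1 p w₀.1 := by
    intro dc da
    have := paramIter_linear w₀.1 w₀.2 dc da 1 0 0 1 p w₀.1
    simpa using this
  by_cases hβ : paramIter w₀.1 w₀.2 0 1 p w₀.1 = 0
  · refine ⟨fun w => w.2 - w₀.2, hB.exists_isChart hH hw₀ (contDiff_snd.sub contDiff_const)
      (sub_self _) ?_⟩
    intro dc da h2 h3
    have h4 : fderiv ℂ (fun w : ℂ × ℂ => w.2 - w₀.2) w₀ = _ :=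
      ((hasFDerivAt_snd (𝕜 := ℂ) (p := w₀)).sub_const w₀.2).fderiv
    rw [h4] at h3
    have h5 : da = 0 := h3
    refine ⟨?_, h5⟩
    by_contra hdc
    rw [hlin, hβ, mul_zero, add_zero] at h1 h2
    have h6 := mul_left_cancel₀ hdc (h2.trans (mul_one dc).symm)
    rw [h6, mul_one] at h1
    exact h1 rfl
  · refine ⟨fun w => w.1 - w₀.1, hB.exists_isChart hH hw₀ (contDiff_fst.sub contDiff_const)
      (sub_self _) ?_⟩
    intro dc da h2 h3
    have h4 : fderiv ℂ (fun w : ℂ × ℂ => w.1 - w₀.1) w₀ = _ :=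
      ((hasFDerivAt_fst (𝕜 := ℂ) (p := w₀)).sub_const w₀.1).fderiv
    rw [h4] at h3
    have h5 : dc = 0 := h3
    refine ⟨h5, ?_⟩
    rw [hlin, h5, zero_mul, zero_add, mul_eq_zero] at h2
    exact h2.resolve_right hβ

end charts

section center

variable {p l : ℕ} {H : Set (ℂ × ℂ)} {w₀ : ℂ × ℂ} {R : ℝ}

/-- The cofactor of the cube of `f^l(c) + c` in the leading term of the position map. -/
noncomputable def centerUnit (p l : ℕ) (w : ℂ × ℂ) : ℂ :=
  -(3 * w.1 * ((3 * ((cubic w.1 w.2)^[l] w.1 - w.1)) *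
    ∏ j ∈ (Finset.range (p - 1)).erase (l - 1), (3 * (((cubic w.1 w.2)^[j + 1] w.1) ^ 2 - w.1 ^ 2)))) *
    critQuot (p - l - 1) (-w.1) w.2 ((cubic w.1 w.2)^[l] w.1)

theorem critCoeff_mul_critReturn_sub (hl : 1 ≤ l) (hlp : l < p) {w : ℂ × ℂ} (hw : w ∈ Sp p) :
    critCoeff p w * (critReturn p l 0 w - w.1) =
      ((cubic w.1 w.2)^[l] w.1 + w.1) ^ 3 * centerUnit p l w := by
  have h1 := iterate_sub_iterate_neg (p - l - 1) w.1 w.2 ((cubic w.1 w.2)^[l] w.1)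
  rw [show p - l - 1 + 1 = p - l by omega, ← iterate_add_apply, show p - l + l = p by omega,
    hw.1] at h1
  have h2 : critReturn p l 0 w - w.1 = -(((cubic w.1 w.2)^[l] w.1 + w.1) ^ 2 *
      critQuot (p - l - 1) (-w.1) w.2 ((cubic w.1 w.2)^[l] w.1)) := by
    rw [← h1, critReturn_eq]; simp
  have h3 : l - 1 ∈ Finset.range (p - 1) := Finset.mem_range.2 (by omega)
  rw [h2, critCoeff, critQuot_crit, ← Finset.mul_prod_erase _ _ h3,
    show l - 1 + 1 = l by omega, centerUnit]
  ring

theorem contDiff_centerUnit (p l : ℕ) : ContDiff ℂ 1 (centerUnit p l) := by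
  unfold centerUnit
  have h1 : ∀ k, ContDiff ℂ 1 fun w : ℂ × ℂ => (cubic w.1 w.2)^[k] w.1 :=
    fun k => contDiff_iterate_crit k
  have h2 : ContDiff ℂ 1 fun w : ℂ × ℂ =>
      critQuot (p - l - 1) (-w.1) w.2 ((cubic w.1 w.2)^[l] w.1) :=
    ContDiff.comp (g := fun q : (ℂ × ℂ) × ℂ => critQuot (p - l - 1) q.1.1 q.1.2 q.2)
      (f := fun w : ℂ × ℂ => ((-w.1, w.2), (cubic w.1 w.2)^[l] w.1)) (contDiff_critQuot _)
      ((contDiff_fst.neg.prodMk contDiff_snd).prodMk (h1 l))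
  refine ContDiff.mul (ContDiff.neg (ContDiff.mul (contDiff_const.mul contDiff_fst)
    (ContDiff.mul (contDiff_const.mul ((h1 l).sub contDiff_fst)) ?_))) h2
  exact contDiff_prod fun j _ => contDiff_const.mul (((h1 (j + 1)).pow 2).sub (contDiff_fst.pow 2))

theorem TypeB.centerUnit_ne_zero {w : ℂ × ℂ} (hB : TypeB p l w)
    (hc : (cubic w.1 w.2)^[l] w.1 = -w.1) : centerUnit p l w ≠ 0 := by
  have h1 := hB.one_le
  have h2 := hB.lt
  have h3 := hB.fst_ne_zero
  rw [centerUnit, hc]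
  refine mul_ne_zero (neg_ne_zero.2 (mul_ne_zero (mul_ne_zero three_ne_zero h3)
    (mul_ne_zero (mul_ne_zero three_ne_zero ?_) ?_))) (hB.critQuot_neg_ne_zero hc (by omega))
  · rw [show -w.1 - w.1 = -2 * w.1 by ring]
    exact mul_ne_zero (by norm_num) h3
  · refine Finset.prod_ne_zero_iff.2 fun j hj => ?_
    rw [Finset.mem_erase, Finset.mem_range] at hj
    exact mul_ne_zero three_ne_zero (sub_ne_zero.2
      (hB.iterate_sq_ne_of_ne (by omega) (by omega) (by omega)))

variable {ε : ℝ} {W : ℂ → ℂ × ℂ} {π : ℂ × ℂ → ℂ}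
  (hT : ∀ w ∈ H, TypeB p l w) (hR : ∀ w ∈ H, ∀ z ∈ filledJulia (cubic w.1 w.2), ‖z‖ ≤ R)

include hT hR

theorem IsChart.continuousOn_posMap (h : IsChart p H w₀ π ε W) :
    ContinuousOn (fun s => posMap p l (W s)) (ball 0 ε) :=
  continuousOn_posMap_comp h.diff (fun s hs => hT _ (h.mem s hs)) fun s hs => hR _ (h.mem s hs)

theorem IsChart.differentiableAt_posMap (h : IsChart p H w₀ π ε W) {s : ℂ}
    (hs : s ∈ ball (0 : ℂ) ε) (hx : posMap p l (W s) ≠ 0) :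
    DifferentiableAt ℂ (fun s => posMap p l (W s)) s ∧
      deriv (fun s => posMap p l (W s)) s ≠ 0 := by
  obtain ⟨δ, hδ, hsub⟩ := Metric.isOpen_iff.1 isOpen_ball s hs
  exact ⟨(differentiableAt_posMap_comp hδ (h.diff.mono hsub)
    (fun t ht => hT _ (h.mem t (hsub ht))) (fun t ht => hR _ (h.mem t (hsub ht))) hx).1,
    deriv_posMap_comp_ne_zero hδ (h.diff.mono hsub)
    (fun t ht => hT _ (h.mem t (hsub ht))) (fun t ht => hR _ (h.mem t (hsub ht))) hx
    (h.deriv_ne_zero hs)⟩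

theorem IsChart.analyticAt_posMap (h : IsChart p H w₀ π ε W) (hx : posMap p l w₀ ≠ 0) :
    AnalyticAt ℂ (fun s => posMap p l (W s)) 0 := by
  rw [Complex.analyticAt_iff_eventually_differentiableAt]
  have h0 := ball_mem_nhds (0 : ℂ) h.pos
  have h1 := (h.continuousOn_posMap hT hR).continuousAt h0
  have h2 : ∀ᶠ s in 𝓝 (0 : ℂ), posMap p l (W s) ≠ 0 := by
    refine h1.eventually_ne ?_
    rwa [h.zero]
  filter_upwards [h2, h0] with s hs hs' using (h.differentiableAt_posMap hT hR hs' hs).1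

theorem IsChart.exists_cubic_form
    (h : IsChart p H w₀ (fun w => (cubic w.1 w.2)^[l] w.1 + w.1) ε W) :
    ∃ u : ℂ → ℂ, AnalyticAt ℂ u 0 ∧ u 0 ≠ 0 ∧ ∀ᶠ s in 𝓝 0, posMap p l (W s) = s ^ 3 * u s := by
  have h0 := ball_mem_nhds (0 : ℂ) h.pos
  have h0' : (0 : ℂ) ∈ ball (0 : ℂ) ε := mem_ball_self h.pos
  have hw₀ : w₀ ∈ H := h.zero ▸ h.mem 0 h0'
  have hB := hT w₀ hw₀
  have hl := hB.one_le
  have hlp := hB.lt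
  have hR0 := hB.radius_nonneg (hR _ hw₀)
  have hWc : ContinuousAt W 0 := h.diff.continuousOn.continuousAt h0
  have hδ : ∀ s ∈ ball (0 : ℂ) ε, (cubic (W s).1 (W s).2)^[l] (W s).1 + (W s).1 = s := h.proj
  have hc : (cubic w₀.1 w₀.2)^[l] w₀.1 = -w₀.1 := by
    have := hδ 0 h0'
    rw [h.zero] at this
    exact eq_neg_of_add_eq_zero_left this
  have hx0 : ∀ s ∈ ball (0 : ℂ) ε, s ≠ 0 → posMap p l (W s) ≠ 0 := by
    intro s hs hs0 h1
    rw [(hT _ (h.mem s hs)).posMap_eq_zero_iff] at h1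
    apply hs0
    rw [← hδ s hs, h1, neg_add_cancel]
  obtain ⟨U, hU⟩ : ∃ U : ℂ → ℂ, U = fun s => centerUnit p l (W s) := ⟨_, rfl⟩
  have hUd : DifferentiableOn ℂ U (ball 0 ε) := by
    rw [hU]
    exact ((contDiff_centerUnit p l).differentiable (by simp)).comp_differentiableOn h.diff
  have hU0 : U 0 ≠ 0 := by
    rw [hU]
    simp only [h.zero]
    exact hB.centerUnit_ne_zero hc
  have hUa : AnalyticAt ℂ U 0 := hUd.analyticAt h0
  have hUe : ∀ᶠ s in 𝓝 (0 : ℂ), U s ≠ 0 := hUa.continuousAt.eventually_ne hU0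
  have hform : ∀ s ∈ ball (0 : ℂ) ε,
      critCoeff p (W s) * (critReturn p l 0 (W s) - (W s).1) = s ^ 3 * U s := by
    intro s hs
    rw [critCoeff_mul_critReturn_sub hl hlp (hT _ (h.mem s hs)).mem, hδ s hs, hU]
  have hest : ∀ s ∈ ball (0 : ℂ) ε, ‖s ^ 3 * U s - posMap p l (W s)‖ ≤
      4 * R * ‖critCoeff p (W s)‖ * ‖posMap p l (W s)‖ := by
    intro s hs
    have := (hT _ (h.mem s hs)).norm_critCoeff_mul_sub_le (hR _ (h.mem s hs)) 0
    rw [hform s hs] at this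
    simpa using this
  have hκ : Tendsto (fun s => 4 * R * ‖critCoeff p (W s)‖) (𝓝 0) (𝓝 0) := by
    have h1 : ContinuousAt (fun s => ‖critCoeff p (W s)‖) 0 :=
      ((continuous_critCoeff p).continuousAt.comp hWc).norm
    have h2 := h1.tendsto.const_mul (4 * R)
    rwa [h.zero, hB.critCoeff_eq_zero hc, norm_zero, mul_zero] at h2
  obtain ⟨q, hq⟩ : ∃ q : ℂ → ℂ, q = fun s => if s = 0 then 1 else posMap p l (W s) / (s ^ 3 * U s) :=
    ⟨_, rfl⟩
  have hqc : ContinuousAt q 0 := by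
    have hq0 : q 0 = 1 := by rw [hq]; simp
    rw [ContinuousAt, hq0, tendsto_iff_norm_sub_tendsto_zero]
    refine squeeze_zero' (Eventually.of_forall fun s => norm_nonneg _)
      (g := fun s => 2 * (4 * R * ‖critCoeff p (W s)‖)) ?_ (by simpa using hκ.const_mul 2)
    filter_upwards [h0, hUe, hκ.eventually_lt_const (show (0 : ℝ) < 1 / 2 by norm_num)]
      with s hs hsU hsκ
    by_cases hs0 : s = 0
    · rw [hs0, hq0]; simp; positivity
    · have h2 := hest s hs
      have h3 : s ^ 3 * U s ≠ 0 := mul_ne_zero (pow_ne_zero _ hs0) hsU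
      have h4 : q s - 1 = -(s ^ 3 * U s - posMap p l (W s)) / (s ^ 3 * U s) := by
        rw [hq]
        simp only [if_neg hs0]
        field_simp
        ring
      rw [h4, norm_div, norm_neg, div_le_iff₀ (norm_pos_iff.2 h3)]
      have h5 : ‖posMap p l (W s)‖ ≤ ‖s ^ 3 * U s‖ + ‖s ^ 3 * U s - posMap p l (W s)‖ := by
        have := norm_sub_le (s ^ 3 * U s) (s ^ 3 * U s - posMap p l (W s))
        rwa [sub_sub_cancel] at this
      have h6 : 0 ≤ 4 * R * ‖critCoeff p (W s)‖ := by positivity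
      have h7 : 4 * R * ‖critCoeff p (W s)‖ * ‖posMap p l (W s)‖ ≤ 1 / 2 * ‖posMap p l (W s)‖ :=
        mul_le_mul_of_nonneg_right hsκ.le (norm_nonneg _)
      have h8 : ‖posMap p l (W s)‖ ≤ 2 * ‖s ^ 3 * U s‖ := by linarith
      calc _ ≤ 4 * R * ‖critCoeff p (W s)‖ * ‖posMap p l (W s)‖ := h2
        _ ≤ 4 * R * ‖critCoeff p (W s)‖ * (2 * ‖s ^ 3 * U s‖) := by gcongr
        _ = _ := by ring
  have hqa : AnalyticAt ℂ q 0 := by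
    refine Complex.analyticAt_of_differentiable_on_punctured_nhds_of_continuousAt ?_ hqc
    have h1 : ∀ᶠ s in 𝓝 (0 : ℂ), s ∈ ball (0 : ℂ) ε ∧ U s ≠ 0 := by
      filter_upwards [h0, hUe] with s h1 h2 using ⟨h1, h2⟩
    filter_upwards [h1.filter_mono nhdsWithin_le_nhds, self_mem_nhdsWithin] with s hs hs0
    have hs0' : s ≠ 0 := hs0
    have h2 : DifferentiableAt ℂ (fun s => posMap p l (W s) / (s ^ 3 * U s)) s :=
      ((h.differentiableAt_posMap hT hR hs.1 (hx0 s hs.1 hs0')).1).div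
        ((differentiableAt_id.pow 3).mul (hUd.differentiableAt (isOpen_ball.mem_nhds hs.1)))
        (mul_ne_zero (pow_ne_zero _ hs0') hs.2)
    refine h2.congr_of_eventuallyEq ?_
    filter_upwards [isOpen_ne.mem_nhds hs0'] with t ht
    rw [hq]
    simp only [if_neg ht]
  refine ⟨fun s => U s * q s, hUa.mul hqa, ?_, ?_⟩
  · rw [hq]; simpa using hU0
  · filter_upwards [h0, hUe] with s hs hsU
    by_cases hs0 : s = 0
    · rw [hs0, h.zero, hB.posMap_eq_zero hc]; simp
    · rw [hq]
      simp only [if_neg hs0]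
      field_simp

theorem IsHyperbolicComponent.analyticOnSlice_posMap (hH : IsHyperbolicComponent p H) :
    AnalyticOnSlice (posMap p l) H := by
  intro U γ hU h1 h2 hγ t₀ ht₀
  have hB := hT _ (hγ t₀ ht₀)
  obtain ⟨π, ε, W, h, ha⟩ : ∃ π ε W, IsChart p H (γ t₀) π ε W ∧
      AnalyticAt ℂ (fun s => posMap p l (W s)) 0 := by
    by_cases hc : (cubic (γ t₀).1 (γ t₀).2)^[l] (γ t₀).1 = -(γ t₀).1
    · obtain ⟨ε, W, h⟩ := hB.exists_isChart_of_eq hH (hγ t₀ ht₀) hc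
      obtain ⟨u, hu, -, hue⟩ := h.exists_cubic_form hT hR
      exact ⟨_, ε, W, h, ((analyticAt_id.pow 3).mul hu).congr (hue.mono fun s hs => hs.symm)⟩
    · obtain ⟨π, ε, W, h⟩ := hB.exists_isChart_of_ne hH (hγ t₀ ht₀) hc
      exact ⟨π, ε, W, h, h.analyticAt_posMap hT hR fun h0 => hc (hB.posMap_eq_zero_iff.1 h0)⟩
  have hγd : DifferentiableOn ℂ γ U := fun t ht =>
    ((h1 t ht).differentiableAt.prodMk (h2 t ht).differentiableAt).differentiableWithinAt
  have hγc : ContinuousAt γ t₀ := hγd.continuousOn.continuousAt (hU.mem_nhds ht₀)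
  have hπ : AnalyticAt ℂ (fun t => π (γ t)) t₀ :=
    (h.diff_proj.comp_differentiableOn hγd).analyticAt (hU.mem_nhds ht₀)
  have h0 : π (γ t₀) = 0 := by
    have := h.proj 0 (mem_ball_self h.pos)
    rwa [h.zero] at this
  have h3 := ha.comp_of_eq hπ h0
  refine h3.congr ?_
  filter_upwards [hγc.eventually h.eventually, hU.mem_nhds ht₀] with t ht htU
  simp only [comp_apply]
  rw [(ht (hT _ (hγ t htU)).mem).2]

end center

section abstractCover

variable {E : Type*} [TopologicalSpace E]

/-- A proper map to the open unit disk that is a local homeomorphism over the punctured disk and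
a branched cover of local degree three at every point of the fibre over the origin. -/
structure IsCubicBranched (Φ : E → ℂ) : Prop where
  cont : Continuous Φ
  lt : ∀ w, ‖Φ w‖ < 1
  proper : ∀ r < 1, IsCompact {w | ‖Φ w‖ ≤ r}
  regular : ∀ w₀, Φ w₀ ≠ 0 → ∃ r > 0, ∃ Γ : ℂ → E, ContinuousOn Γ (ball (Φ w₀) r) ∧
    (∀ y ∈ ball (Φ w₀) r, Φ (Γ y) = y) ∧ ∀ᶠ w in 𝓝 w₀, Γ (Φ w) = w
  center : ∀ w₀, Φ w₀ = 0 → ∃ r > 0, ∃ γ : ℂ → E, ContinuousOn γ (ball 0 r) ∧ γ 0 = w₀ ∧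
    InjOn γ (ball 0 r) ∧ (∀ t ∈ ball (0 : ℂ) r, Φ (γ t) = t ^ 3) ∧
    ∀ᶠ w in 𝓝 w₀, w ∈ γ '' ball 0 r

namespace IsCubicBranched

variable {Φ : E → ℂ} (h : IsCubicBranched Φ)
include h

theorem exists_zero [Nonempty E] : ∃ w, Φ w = 0 := by
  obtain ⟨w₁⟩ := ‹Nonempty E›
  obtain ⟨w₀, -, hw⟩ := (h.proper _ (h.lt w₁)).exists_isMinOn
    (f := fun w => ‖Φ w‖) ⟨w₁, le_refl ‖Φ w₁‖⟩ h.cont.norm.continuousOn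
  by_contra! hne
  have hmin : ∀ w, ‖Φ w₀‖ ≤ ‖Φ w‖ := by
    intro w
    by_cases h1 : ‖Φ w‖ ≤ ‖Φ w₁‖
    · exact hw h1
    · exact (hw (le_refl ‖Φ w₁‖)).trans (not_le.1 h1).le
  obtain ⟨r, hr, Γ, -, h2, -⟩ := h.regular w₀ (hne w₀)
  have h3 : Tendsto (fun δ : ℝ => ((1 - δ : ℝ) : ℂ) * Φ w₀) (𝓝[>] 0) (𝓝 (Φ w₀)) := by
    have : Continuous fun δ : ℝ => ((1 - δ : ℝ) : ℂ) * Φ w₀ := by fun_prop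
    simpa using (this.tendsto 0).mono_left nhdsWithin_le_nhds
  have h4 : ∀ᶠ δ : ℝ in 𝓝[>] 0, δ < 1 := nhdsWithin_le_nhds (gt_mem_nhds one_pos)
  obtain ⟨δ, h5, h6, h7⟩ := ((h3.eventually (ball_mem_nhds _ hr)).and
    (h4.and self_mem_nhdsWithin)).exists
  have h8 := hmin (Γ (((1 - δ : ℝ) : ℂ) * Φ w₀))
  rw [h2 _ h5, norm_mul, Complex.norm_real, Real.norm_of_nonneg (by linarith)] at h8
  have h9 : 0 < ‖Φ w₀‖ := norm_pos_iff.2 (hne w₀)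
  have h10 : (0 : ℝ) < δ := h7
  nlinarith

/-- Over the punctured disk, the corestriction to the open unit disk is a covering map. -/
theorem exists_isCoveringMapOn [T2Space E] :
    IsCoveringMapOn (fun w => (⟨Φ w, mem_ball_zero_iff.2 (h.lt w)⟩ : ball (0 : ℂ) 1))
      {v | (v : ℂ) ≠ 0} := by
  set f : E → ball (0 : ℂ) 1 := fun w => ⟨Φ w, mem_ball_zero_iff.2 (h.lt w)⟩ with hf
  have hfc : Continuous f := h.cont.subtype_mk _
  have hloc : ∀ e, Φ e ≠ 0 → ∃ φ : OpenPartialHomeomorph E (ball (0 : ℂ) 1),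
      e ∈ φ.source ∧ φ = f := by
    intro e he
    obtain ⟨r, hr, Γ, h1, h2, h3⟩ := h.regular e he
    obtain ⟨V, hV, hVo, heV⟩ := eventually_nhds_iff.1 h3
    have hb : IsOpen {v : ball (0 : ℂ) 1 | (v : ℂ) ∈ ball (Φ e) r} :=
      isOpen_ball.preimage continuous_subtype_val
    have hΓ : ContinuousOn (fun v : ball (0 : ℂ) 1 => Γ v) {v | (v : ℂ) ∈ ball (Φ e) r} :=
      h1.comp continuous_subtype_val.continuousOn fun v hv => hv
    refine ⟨{ toFun := f
              invFun := fun v => Γ v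
              source := V ∩ Φ ⁻¹' ball (Φ e) r
              target := {v | (v : ℂ) ∈ ball (Φ e) r} ∩ (fun v : ball (0 : ℂ) 1 => Γ v) ⁻¹' V
              map_source' := ?_
              map_target' := ?_
              left_inv' := ?_
              right_inv' := ?_
              continuousOn_toFun := hfc.continuousOn
              continuousOn_invFun := hΓ.mono inter_subset_left
              open_source := hVo.inter (isOpen_ball.preimage h.cont)
              open_target := hΓ.isOpen_inter_preimage hb hVo }, ⟨heV, mem_ball_self hr⟩, rfl⟩
    · rintro w ⟨hw, hw'⟩
      refine ⟨hw', ?_⟩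
      change Γ (Φ w) ∈ V
      rwa [hV w hw]
    · rintro v ⟨hv, hv'⟩
      refine ⟨hv', ?_⟩
      change Φ (Γ v) ∈ ball (Φ e) r
      rw [h2 v hv]; exact hv
    · rintro w ⟨hw, -⟩
      exact hV w hw
    · rintro v ⟨hv, -⟩
      exact Subtype.ext (h2 v hv)
  have hcl : IsProperMap f := by
    refine isProperMap_iff_isCompact_preimage.2 ⟨hfc, fun K hK => ?_⟩
    have h1 : IsCompact (Subtype.val '' K) := hK.image continuous_subtype_val
    obtain ⟨r, hr, hKr⟩ : ∃ r < 1, ∀ v ∈ K, ‖(v : ℂ)‖ ≤ r := by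
      rcases K.eq_empty_or_nonempty with rfl | hne
      · exact ⟨0, one_pos, by simp⟩
      · obtain ⟨v, -, hv⟩ := hK.exists_isMaxOn hne
          (f := fun v : ball (0 : ℂ) 1 => ‖(v : ℂ)‖) (by fun_prop)
        exact ⟨_, mem_ball_zero_iff.1 v.2, hv⟩
    exact (h.proper r hr).of_isClosed_subset (hK.isClosed.preimage hfc) fun w hw => hKr _ hw
  refine hcl.isClosedMap.isCoveringMapOn_of_isLocalHomeomorphOn (fun v hv => ?_) fun e he => ?_
  · refine (hcl.isCompact_preimage isCompact_singleton).finite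
      (.of_openPartialHomeomorph f (x := v) subset_rfl fun e he => hloc e ?_)
    have : (f e : ℂ) = v := congrArg _ he
    change (f e : ℂ) ≠ 0
    rw [this]; exact hv
  · obtain ⟨φ, h1, h2⟩ := hloc e he
    exact ⟨φ, h1, h2.symm⟩

theorem eqOn_of_comp_eqOn [T2Space E] {A : Type*} [TopologicalSpace A] {S : Set A}
    (hS : IsPreconnected S) {g₁ g₂ : A → E} (h1 : ContinuousOn g₁ S) (h2 : ContinuousOn g₂ S)
    (h0 : ∀ s ∈ S, Φ (g₁ s) ≠ 0) (he : ∀ s ∈ S, Φ (g₁ s) = Φ (g₂ s)) {a : A} (ha : a ∈ S)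
    (hga : g₁ a = g₂ a) : EqOn g₁ g₂ S := by
  have hc := h.exists_isCoveringMapOn.isCoveringMap_restrictPreimage
  have := isPreconnected_iff_preconnectedSpace.1 hS
  have h3 := hc.eq_of_comp_eq (A := S) (g₁ := fun s => ⟨g₁ s, h0 s s.2⟩)
    (g₂ := fun s => ⟨g₂ s, fun h4 => h0 s s.2 ((he s s.2).trans h4)⟩)
    ((continuousOn_iff_continuous_domRestrict.1 h1).subtype_mk _)
    ((continuousOn_iff_continuous_domRestrict.1 h2).subtype_mk _)
    (by ext s; exact he s s.2) ⟨a, ha⟩ (Subtype.ext hga)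
  intro s hs
  exact congrArg Subtype.val (congrFun h3 ⟨s, hs⟩)

theorem exists_lift [T2Space E] {s₀ : ℂ} (hs₀ : s₀.re < 0) {e₀ : E}
    (he : Φ e₀ = Complex.exp (3 * s₀)) : ∃ G : ℂ → E, ContinuousOn G {s | s.re < 0} ∧ G s₀ = e₀ ∧
      ∀ s : ℂ, s.re < 0 → Φ (G s) = Complex.exp (3 * s) := by
  have hconv : Convex ℝ {s : ℂ | s.re < 0} := convex_halfSpace_re_lt 0
  have := hconv.contractibleSpace ⟨s₀, hs₀⟩
  have := (isOpen_lt Complex.continuous_re continuous_const :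
    IsOpen {s : ℂ | s.re < 0}).locallyPathConnectedSpace
  have hlt : ∀ s : {s : ℂ | s.re < 0}, Complex.exp (3 * s) ∈ ball (0 : ℂ) 1 := by
    rintro ⟨s, hs : s.re < 0⟩
    rw [mem_ball_zero_iff, Complex.norm_exp, Real.exp_lt_one_iff]
    have : (3 * s).re = 3 * s.re := by simp
    rw [this]; linarith
  obtain ⟨F, ⟨h1, h2⟩, -⟩ := h.exists_isCoveringMapOn.existsUnique_continuousMap_lifts
    (A := {s : ℂ | s.re < 0}) ⟨fun s => ⟨Complex.exp (3 * s), hlt s⟩, by fun_prop⟩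
    (a₀ := ⟨s₀, hs₀⟩) (e₀ := e₀) (Subtype.ext he) fun a => Complex.exp_ne_zero _
  refine ⟨fun s => if hs : s.re < 0 then F ⟨s, hs⟩ else e₀, ?_, by simp [hs₀, h1], fun s hs => ?_⟩
  · rw [continuousOn_iff_continuous_domRestrict]
    convert F.continuous using 1
    ext s
    have : (s : ℂ).re < 0 := s.2
    simp [this]
  · simp only [hs, dite_true]
    exact congrArg Subtype.val (congrFun h2 ⟨s, hs⟩)

end IsCubicBranched

end abstractCover

section abstractCover

variable {E : Type*} [TopologicalSpace E]

namespace IsCubicBranched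

variable {Φ : E → ℂ} (h : IsCubicBranched Φ)
include h

/-- The universal cover of the punctured disk lifts through a local cubing parameter. -/
theorem exists_log_parametrization [T2Space E] {w₀ : E} (hw₀ : Φ w₀ = 0) :
    ∃ (G : ℂ → E) (γ : ℂ → E) (r : ℝ), 0 < r ∧ r ≤ 1 ∧ ContinuousOn G {s | s.re < 0} ∧
      (∀ s : ℂ, s.re < 0 → Φ (G s) = Complex.exp (3 * s)) ∧ ContinuousOn γ (ball 0 r) ∧
      γ 0 = w₀ ∧ InjOn γ (ball 0 r) ∧ (∀ t ∈ ball (0 : ℂ) r, Φ (γ t) = t ^ 3) ∧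
      (∀ᶠ w in 𝓝 w₀, w ∈ γ '' ball 0 r) ∧
      ∀ s : ℂ, Complex.exp s ∈ ball (0 : ℂ) r → G s = γ (Complex.exp s) := by
  obtain ⟨r, hr, γ, h1, h2, h3, h4, h5⟩ := h.center w₀ hw₀
  have hr1 : r ≤ 1 := by
    by_contra! hr1
    have h6 := h.lt (γ 1)
    rw [h4 1 (by simpa using hr1)] at h6
    simp at h6
  have hexp : ∀ s : ℂ, Complex.exp s ∈ ball (0 : ℂ) r ↔ s.re < Real.log r := by
    intro s
    rw [mem_ball_zero_iff, Complex.norm_exp, Real.lt_log_iff_exp_lt hr]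
  have hlog : Real.log r ≤ 0 := Real.log_nonpos hr.le hr1
  obtain ⟨s₀, hs₀⟩ : ∃ s₀ : ℂ, s₀.re < Real.log r := ⟨((Real.log r - 1 : ℝ) : ℂ), by simp⟩
  have hexp3 : ∀ s : ℂ, Complex.exp (3 * s) = Complex.exp s ^ 3 := by
    intro s
    rw [← Complex.exp_nat_mul]; norm_num
  obtain ⟨G, hG1, hG2, hG3⟩ := h.exists_lift (hs₀.trans_le hlog) (e₀ := γ (Complex.exp s₀))
    (by rw [h4 _ ((hexp s₀).2 hs₀), hexp3])
  refine ⟨G, γ, r, hr, hr1, hG1, hG3, h1, h2, h3, h4, h5, fun s hs => ?_⟩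
  refine h.eqOn_of_comp_eqOn (S := {s : ℂ | s.re < Real.log r})
    (convex_halfSpace_re_lt _).isPreconnected (hG1.mono fun s hs => ?_)
    (h1.comp Complex.continuous_exp.continuousOn fun s hs => (hexp s).2 hs) (fun s hs => ?_)
    (fun s hs => ?_) hs₀ hG2 ((hexp s).1 hs)
  · exact lt_of_lt_of_le hs hlog
  · rw [hG3 s (lt_of_lt_of_le hs hlog)]; exact Complex.exp_ne_zero _
  · rw [hG3 s (lt_of_lt_of_le hs hlog), comp_apply, h4 _ ((hexp s).2 hs), hexp3]

theorem exists_parametrization [T2Space E] [PreconnectedSpace E] [Nonempty E] :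
    ∃ θ : ℂ → E, ContinuousOn θ (ball 0 1) ∧ InjOn θ (ball 0 1) ∧ θ '' ball 0 1 = univ ∧
      ∀ t ∈ ball (0 : ℂ) 1, Φ (θ t) = t ^ 3 := by
  obtain ⟨w₀, hw₀⟩ := h.exists_zero
  obtain ⟨G, γ, r, hr, hr1, hG, hΦG, hγ, hγ0, hγi, hΦγ, hγn, hGγ⟩ :=
    h.exists_log_parametrization hw₀
  have hexp3 : ∀ s : ℂ, Complex.exp (3 * s) = Complex.exp s ^ 3 := by
    intro s
    rw [← Complex.exp_nat_mul]; norm_num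
  have hre : ∀ t : ℂ, t ∈ ball (0 : ℂ) 1 → t ≠ 0 → (Complex.log t).re < 0 := by
    intro t ht ht0
    rw [Complex.log_re]
    exact Real.log_neg (norm_pos_iff.2 ht0) (mem_ball_zero_iff.1 ht)
  obtain ⟨s₀, hs₀, hs₀r⟩ : ∃ s₀ : ℂ, s₀.re < 0 ∧ Complex.exp s₀ ∈ ball (0 : ℂ) r := by
    refine ⟨((Real.log r - 1 : ℝ) : ℂ), ?_, ?_⟩
    · have := Real.log_nonpos hr.le hr1
      rw [Complex.ofReal_re]; linarith
    · rw [mem_ball_zero_iff, Complex.norm_exp, Complex.ofReal_re, ← Real.lt_log_iff_exp_lt hr]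
      linarith
  have hrot : ∀ σ : ℂ, σ.re = 0 → Complex.exp (3 * σ) = 1 → ∀ s₁ : ℂ, s₁.re < 0 →
      G (s₁ + σ) = G s₁ → ∀ s : ℂ, s.re < 0 → G (s + σ) = G s := by
    intro σ hσ hσ1 s₁ hs₁ hG₁ s hs
    have hre : ∀ s : ℂ, s.re < 0 → (s + σ).re < 0 := by
      intro s hs
      rw [Complex.add_re, hσ, add_zero]; exact hs
    refine h.eqOn_of_comp_eqOn (S := {s : ℂ | s.re < 0}) (g₁ := fun s => G (s + σ)) (g₂ := G)
      (convex_halfSpace_re_lt _).isPreconnected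
      (hG.comp (by fun_prop) fun s hs => hre s hs) hG (fun s hs => ?_) (fun s hs => ?_)
      hs₁ hG₁ hs
    · rw [hΦG _ (hre s hs)]; exact Complex.exp_ne_zero _
    · rw [hΦG _ (hre s hs), hΦG s hs, mul_add, Complex.exp_add, hσ1, mul_one]
  have hper : ∀ s s' : ℂ, s.re < 0 → Complex.exp s = Complex.exp s' → G s = G s' := by
    intro s s' hs hss
    obtain ⟨n, hn⟩ := Complex.exp_eq_exp_iff_exists_int.1 hss
    have h1 : ((n : ℂ) * (2 * Real.pi * Complex.I)).re = 0 := by simp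
    have h2 : Complex.exp ((n : ℂ) * (2 * Real.pi * Complex.I)) = 1 :=
      Complex.exp_int_mul_two_pi_mul_I n
    have hs' : s'.re < 0 := by
      rw [hn, Complex.add_re, h1, add_zero] at hs; exact hs
    rw [hn]
    refine hrot _ h1 (by rw [hexp3, h2, one_pow]) s₀ hs₀ ?_ s' hs'
    have h3 : Complex.exp (s₀ + n * (2 * Real.pi * Complex.I)) = Complex.exp s₀ := by
      rw [Complex.exp_add, h2, mul_one]
    rw [hGγ _ hs₀r, hGγ _ (h3.symm ▸ hs₀r), h3]
  obtain ⟨θ, hθ⟩ : ∃ θ : ℂ → E, θ = fun t => if t = 0 then w₀ else G (Complex.log t) := ⟨_, rfl⟩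
  have hθ0 : θ 0 = w₀ := by simp [hθ]
  have hθG : ∀ s : ℂ, s.re < 0 → θ (Complex.exp s) = G s := by
    intro s hs
    simp only [hθ, Complex.exp_ne_zero, if_false]
    exact (hper _ _ hs (Complex.exp_log (Complex.exp_ne_zero s)).symm).symm
  have hθγ : ∀ t ∈ ball (0 : ℂ) r, θ t = γ t := by
    intro t ht
    by_cases ht0 : t = 0
    · rw [ht0, hθ0, hγ0]
    · simp only [hθ, ht0, if_false]
      rw [hGγ _ (by rwa [Complex.exp_log ht0]), Complex.exp_log ht0]
  have hΦθ : ∀ t ∈ ball (0 : ℂ) 1, Φ (θ t) = t ^ 3 := by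
    intro t ht
    by_cases ht0 : t = 0
    · rw [ht0, hθ0, hw₀]; simp
    · have := hθG _ (hre t ht ht0)
      rw [Complex.exp_log ht0] at this
      rw [this, hΦG _ (hre t ht ht0), hexp3, Complex.exp_log ht0]
  have hcont : ContinuousOn θ (ball 0 1) := by
    intro t ht
    refine ContinuousAt.continuousWithinAt ?_
    by_cases ht0 : t = 0
    · subst ht0
      refine (hγ.continuousAt (ball_mem_nhds _ hr)).congr ?_
      filter_upwards [ball_mem_nhds _ hr] with t ht using (hθγ t ht).symm
    · have h1 : ContinuousAt (fun t' : ℂ => Complex.log t + Complex.log (t' / t)) t := by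
        refine continuousAt_const.add (ContinuousAt.clog (by fun_prop) ?_)
        rw [div_self ht0]; exact Complex.one_mem_slitPlane
      have h2 : Complex.log t + Complex.log (t / t) = Complex.log t := by
        rw [div_self ht0, Complex.log_one, add_zero]
      have h3 : {s : ℂ | s.re < 0} ∈ 𝓝 (Complex.log t + Complex.log (t / t)) := by
        rw [h2]
        exact (isOpen_lt Complex.continuous_re continuous_const).mem_nhds (hre t ht ht0)
      have h4 : ContinuousAt (fun t' => G (Complex.log t + Complex.log (t' / t))) t :=
        ContinuousAt.comp (g := G) (hG.continuousAt h3) h1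
      refine h4.congr ?_
      filter_upwards [h1.preimage_mem_nhds h3, isOpen_ne.mem_nhds ht0] with t' ht' ht0'
      rw [← hθG _ ht', Complex.exp_add, Complex.exp_log ht0, Complex.exp_log (div_ne_zero ht0' ht0),
        mul_div_cancel₀ _ ht0]
  have hinj : InjOn θ (ball 0 1) := by
    intro t ht t' ht' he
    have h1 : t ^ 3 = t' ^ 3 := by rw [← hΦθ t ht, ← hΦθ t' ht', he]
    by_cases ht0 : t = 0
    · subst ht0
      exact (pow_eq_zero_iff three_ne_zero).1 (h1.symm.trans (by simp)) |>.symm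
    have ht0' : t' ≠ 0 := by
      rintro rfl
      exact ht0 ((pow_eq_zero_iff three_ne_zero).1 (h1.trans (by simp)))
    have h2 : (t' / t) ^ 3 = 1 := by
      rw [div_pow, ← h1, div_self (pow_ne_zero _ ht0)]
    have h3 : t' / t ≠ 0 := div_ne_zero ht0' ht0
    have h4 : (Complex.log (t' / t)).re = 0 := by
      rw [Complex.log_re, Complex.norm_eq_one_of_pow_eq_one h2 three_ne_zero, Real.log_one]
    have h5 : Complex.exp (Complex.log t + Complex.log (t' / t)) = t' := by
      rw [Complex.exp_add, Complex.exp_log ht0, Complex.exp_log h3, mul_div_cancel₀ _ ht0]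
    have h6 := hrot _ h4 (by rw [hexp3, Complex.exp_log h3, h2]) (Complex.log t) (hre t ht ht0) (by
      rw [← hθG _ (hre t ht ht0), ← hθG _ (by rw [Complex.add_re, h4, add_zero]; exact hre t ht ht0),
        h5, Complex.exp_log ht0, he]) s₀ hs₀
    have h7 : Complex.exp (s₀ + Complex.log (t' / t)) ∈ ball (0 : ℂ) r := by
      rw [mem_ball_zero_iff, Complex.norm_exp, Complex.add_re, h4, add_zero, ← Complex.norm_exp]
      exact mem_ball_zero_iff.1 hs₀r
    rw [hGγ _ h7, hGγ _ hs₀r] at h6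
    have h8 := hγi h7 hs₀r h6
    rw [Complex.exp_add, Complex.exp_log h3] at h8
    have h9 : t' / t = 1 := mul_left_cancel₀ (Complex.exp_ne_zero s₀) (h8.trans (mul_one _).symm)
    exact ((div_eq_one_iff_eq ht0).1 h9).symm
  have hclosed : IsClosed (θ '' ball 0 1) := by
    refine isClosed_of_closure_subset fun w hw => ?_
    obtain ⟨x, hx, hx1⟩ := exists_between (h.lt w)
    obtain ⟨ρ, hρ0, hρ⟩ : ∃ ρ : ℝ, 0 ≤ ρ ∧ ρ ^ 3 = x :=
      ⟨x ^ (3⁻¹ : ℝ), Real.rpow_nonneg ((norm_nonneg _).trans hx.le) _, by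
        rw [← Real.rpow_natCast, ← Real.rpow_mul ((norm_nonneg _).trans hx.le)]; norm_num⟩
    have hρ1 : ρ < 1 := by
      by_contra! h1
      have := one_le_pow₀ h1 (n := 3)
      linarith
    have hK : IsCompact (θ '' closedBall 0 ρ) :=
      (isCompact_closedBall _ _).image_of_continuousOn
        (hcont.mono (closedBall_subset_ball hρ1))
    have hN : {w | ‖Φ w‖ < x} ∈ 𝓝 w := (isOpen_lt h.cont.norm continuous_const).mem_nhds hx
    have h1 : w ∈ closure (θ '' closedBall 0 ρ) := by
      rw [mem_closure_iff_nhds] at hw ⊢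
      intro V hV
      obtain ⟨w', ⟨h2, h3⟩, t, ht, rfl⟩ := hw _ (inter_mem hV hN)
      refine ⟨θ t, h2, t, ?_, rfl⟩
      have h4 : ‖Φ (θ t)‖ < x := h3
      rw [hΦθ t ht, norm_pow, ← hρ] at h4
      exact mem_closedBall_zero_iff.2 (lt_of_pow_lt_pow_left₀ 3 hρ0 h4).le
    rw [hK.isClosed.closure_eq] at h1
    exact image_mono (closedBall_subset_ball hρ1) h1
  have hopen : IsOpen (θ '' ball 0 1) := by
    rw [isOpen_iff_mem_nhds]
    rintro _ ⟨t, ht, rfl⟩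
    by_cases ht0 : t = 0
    · rw [ht0, hθ0]
      filter_upwards [hγn]
      rintro _ ⟨t', ht', rfl⟩
      exact ⟨t', ball_subset_ball hr1 ht', hθγ t' ht'⟩
    · have hv0 : Φ (θ t) ≠ 0 := by rw [hΦθ t ht]; exact pow_ne_zero _ ht0
      obtain ⟨_, -, Γ, -, -, hΓ⟩ := h.regular (θ t) hv0
      obtain ⟨V, hV, hVo, hVt⟩ := eventually_nhds_iff.1 hΓ
      have h1 : ContinuousAt (fun w => Complex.log t + Complex.log (Φ w / Φ (θ t)) / 3) (θ t) := by
        have := h.cont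
        refine continuousAt_const.add
          ((ContinuousAt.clog (by fun_prop) ?_).div_const _)
        rw [div_self hv0]; exact Complex.one_mem_slitPlane
      have h2 : Complex.log t + Complex.log (Φ (θ t) / Φ (θ t)) / 3 = Complex.log t := by
        rw [div_self hv0, Complex.log_one, zero_div, add_zero]
      have h3 : {s : ℂ | s.re < 0} ∈ 𝓝 (Complex.log t + Complex.log (Φ (θ t) / Φ (θ t)) / 3) := by
        rw [h2]
        exact (isOpen_lt Complex.continuous_re continuous_const).mem_nhds (hre t ht ht0)
      have h4 : ContinuousAt
          (fun w => G (Complex.log t + Complex.log (Φ w / Φ (θ t)) / 3)) (θ t) :=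
        ContinuousAt.comp (g := G) (hG.continuousAt h3) h1
      have h5 : G (Complex.log t + Complex.log (Φ (θ t) / Φ (θ t)) / 3) = θ t := by
        rw [h2, ← hθG _ (hre t ht ht0), Complex.exp_log ht0]
      filter_upwards [h1.preimage_mem_nhds h3, hVo.mem_nhds hVt,
        h4.preimage_mem_nhds (by rw [h5]; exact hVo.mem_nhds hVt),
        h.cont.continuousAt.eventually_ne hv0] with w h6 h7 h8 h9
      obtain ⟨s, hs⟩ : ∃ s, s = Complex.log t + Complex.log (Φ w / Φ (θ t)) / 3 := ⟨_, rfl⟩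
      have h6' : s.re < 0 := hs ▸ h6
      have h8' : G s ∈ V := hs ▸ h8
      have h10 : Φ (G s) = Φ w := by
        rw [hΦG s h6', hs, mul_add, mul_div_cancel₀ _ (three_ne_zero' ℂ), Complex.exp_add, hexp3,
          Complex.exp_log ht0, Complex.exp_log (div_ne_zero h9 hv0), ← hΦθ t ht,
          mul_div_cancel₀ _ hv0]
      refine ⟨Complex.exp s, ?_, ?_⟩
      · rwa [mem_ball_zero_iff, Complex.norm_exp, Real.exp_lt_one_iff]
      · rw [hθG s h6', ← hV _ h8', h10, hV _ h7]
  refine ⟨θ, hcont, hinj, ?_, hΦθ⟩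
  exact IsClopen.eq_univ ⟨hclosed, hopen⟩ ⟨_, 0, mem_ball_self one_pos, rfl⟩

theorem image_eq_ball [T2Space E] [PreconnectedSpace E] [Nonempty E] : range Φ = ball 0 1 := by
  obtain ⟨θ, -, -, -, hθ⟩ := h.exists_parametrization
  refine Subset.antisymm (range_subset_iff.2 fun w => mem_ball_zero_iff.2 (h.lt w)) fun v hv => ?_
  obtain ⟨t, ht⟩ := IsAlgClosed.exists_pow_nat_eq v (n := 3) (by norm_num)
  have ht1 : t ∈ ball (0 : ℂ) 1 := by
    rw [mem_ball_zero_iff, ← ht, norm_pow] at hv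
    rw [mem_ball_zero_iff]
    exact (pow_lt_one_iff_of_nonneg (norm_nonneg _) three_ne_zero).1 hv
  exact ⟨θ t, (hθ t ht1).trans ht⟩

theorem exists_ramification [T2Space E] [PreconnectedSpace E] [Nonempty E] :
    ∃ w₀, Φ w₀ = 0 ∧ (∀ w, Φ w = 0 → w = w₀) ∧
      ∀ v ∈ ball (0 : ℂ) 1, v ≠ 0 → {w | Φ w = v}.ncard = 3 := by
  obtain ⟨θ, -, hinj, hsurj, hθ⟩ := h.exists_parametrization
  have hfib : ∀ v ∈ ball (0 : ℂ) 1, {w | Φ w = v} = θ '' {t | t ^ 3 = v} ∧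
      {t : ℂ | t ^ 3 = v} ⊆ ball 0 1 := by
    intro v hv
    have h1 : {t : ℂ | t ^ 3 = v} ⊆ ball 0 1 := by
      intro t ht
      have ht' : t ^ 3 = v := ht
      rw [mem_ball_zero_iff, ← ht', norm_pow] at hv
      exact mem_ball_zero_iff.2 ((pow_lt_one_iff_of_nonneg (norm_nonneg _) three_ne_zero).1 hv)
    refine ⟨Subset.antisymm (fun w hw => ?_) ?_, h1⟩
    · obtain ⟨t, ht, rfl⟩ : w ∈ θ '' ball 0 1 := hsurj ▸ mem_univ w
      exact ⟨t, (hθ t ht).symm.trans hw, rfl⟩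
    · rintro _ ⟨t, ht, rfl⟩
      exact (hθ t (h1 ht)).trans ht
  have h0 : (0 : ℂ) ∈ ball (0 : ℂ) 1 := mem_ball_self one_pos
  refine ⟨θ 0, by rw [hθ 0 h0]; simp, fun w hw => ?_, fun v hv hv0 => ?_⟩
  · obtain ⟨t, ht, rfl⟩ : w ∈ θ '' {t | t ^ 3 = 0} := (hfib 0 h0).1 ▸ hw
    rw [(pow_eq_zero_iff three_ne_zero).1 ht]
  · rw [(hfib v hv).1, (hinj.mono (hfib v hv).2).ncard_image]
    have hω := Complex.isPrimitiveRoot_exp 3 three_ne_zero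
    have h2 : {t : ℂ | t ^ 3 = v} = ((Polynomial.nthRoots 3 v).toFinset : Set ℂ) := by
      ext t
      simp [Polynomial.mem_nthRoots]
    rw [h2, ncard_coe_finset, Multiset.toFinset_card_of_nodup (hω.nthRoots_nodup hv0),
      hω.card_nthRoots, if_pos (IsAlgClosed.exists_pow_nat_eq v (by norm_num))]

end IsCubicBranched

end abstractCover

theorem ContinuousOn.exists_codRestrict {X Y : Type*} [TopologicalSpace X] [TopologicalSpace Y]
    {f : X → Y} {s : Set X} {t : Set Y} (hf : ContinuousOn f s) (hst : MapsTo f s t) (y₀ : t) :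
    ∃ g : X → t, ContinuousOn g s ∧ ∀ x ∈ s, (g x : Y) = f x := by
  classical
  have h1 : ∀ x ∈ s, ((if h : f x ∈ t then (⟨f x, h⟩ : t) else y₀ : t) : Y) = f x := by
    intro x hx
    simp [hst hx]
  exact ⟨_, IsInducing.subtypeVal.continuousOn_iff.2 (hf.congr h1), h1⟩

section localSections

variable {p l : ℕ} {H : Set (ℂ × ℂ)} {R : ℝ}
  (hT : ∀ w ∈ H, TypeB p l w) (hR : ∀ w ∈ H, ∀ z ∈ filledJulia (cubic w.1 w.2), ‖z‖ ≤ R)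
include hT hR

theorem continuousOn_posMap : ContinuousOn (posMap p l) H :=
  fun _ hw => continuousWithinAt_posMap hT hR hw

theorem IsHyperbolicComponent.isCompact_sublevel (hH : IsHyperbolicComponent p H)
    (hb : Bornology.IsBounded H) {K : Set ℂ} (hK : K ⊆ ball (0 : ℂ) 1) (hKc : IsCompact K) :
    IsCompact (H ∩ posMap p l ⁻¹' K) := by
  obtain ⟨r, hr, hKr⟩ : ∃ r < 1, ∀ v ∈ K, ‖v‖ ≤ r := by
    rcases K.eq_empty_or_nonempty with rfl | hne
    · exact ⟨0, one_pos, by simp⟩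
    · obtain ⟨v, hvK, hv⟩ := hKc.exists_isMaxOn hne continuous_norm.continuousOn
      exact ⟨_, mem_ball_zero_iff.1 (hK hvK), hv⟩
  refine isCompact_of_isClosed_isBounded (isClosed_of_closure_subset fun w hw => ?_)
    (hb.subset inter_subset_left)
  have hsub : H ∩ posMap p l ⁻¹' K ⊆ {w ∈ H | ‖posMap p l w‖ ≤ r} :=
    fun w hw => ⟨hw.1, hKr _ hw.2⟩
  have hwH : w ∈ H := hH.mem_of_mem_closure_sublevel hT hR hr (closure_mono hsub hw)
  refine ⟨hwH, ?_⟩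
  have h1 : ContinuousWithinAt (posMap p l) (H ∩ posMap p l ⁻¹' K) w :=
    (continuousOn_posMap hT hR w hwH).mono inter_subset_left
  have h2 := h1.mem_closure_image hw
  exact hKc.isClosed.closure_subset_iff.2 (image_subset_iff.2 inter_subset_right) h2

theorem IsHyperbolicComponent.exists_section (hH : IsHyperbolicComponent p H) {w₀ : ℂ × ℂ}
    (hw₀ : w₀ ∈ H) (hx : posMap p l w₀ ≠ 0) :
    ∃ r > 0, ∃ Γ : ℂ → ℂ × ℂ, ContinuousOn Γ (ball (posMap p l w₀) r) ∧
      (∀ y ∈ ball (posMap p l w₀) r, Γ y ∈ H ∧ posMap p l (Γ y) = y) ∧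
      ∀ᶠ w in 𝓝 w₀, w ∈ H → Γ (posMap p l w) = w := by
  obtain ⟨π, ε, W, h⟩ := (hT w₀ hw₀).exists_isChart_of_ne hH hw₀
    fun hc => hx ((hT w₀ hw₀).posMap_eq_zero hc)
  have h0 : (0 : ℂ) ∈ ball (0 : ℂ) ε := mem_ball_self h.pos
  obtain ⟨r, hr, ψ, hψ, hψ0, h1, V, hVU, hVo, hV0, h2⟩ := exists_local_inverse_complex
    (h.analyticAt_posMap hT hR hx)
    (h.differentiableAt_posMap hT hR h0 (by rwa [h.zero])).2 (ball_mem_nhds 0 h.pos)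
  simp only [h.zero] at hψ hψ0 h1 h2
  have hπ0 : π w₀ = 0 := by
    have := h.proj 0 h0
    rwa [h.zero] at this
  refine ⟨r, hr, fun y => W (ψ y), h.diff.continuousOn.comp hψ.continuousOn fun y hy => (h1 y hy).1,
    fun y hy => ⟨h.mem _ (h1 y hy).1, (h1 y hy).2⟩, ?_⟩
  filter_upwards [h.eventually, h.diff_proj.continuous.continuousAt.preimage_mem_nhds
    (by rw [hπ0]; exact hVo.mem_nhds hV0)] with w h3 h4 hw
  have h5 := (h3 (hT w hw).mem).2
  have h6 := (h2 _ h4).2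
  rw [h5] at h6
  rw [h6, h5]

theorem IsHyperbolicComponent.exists_cube_section (hH : IsHyperbolicComponent p H) {w₀ : ℂ × ℂ}
    (hw₀ : w₀ ∈ H) (hx : posMap p l w₀ = 0) :
    ∃ r > 0, ∃ γ : ℂ → ℂ × ℂ, ContinuousOn γ (ball 0 r) ∧ γ 0 = w₀ ∧ InjOn γ (ball 0 r) ∧
      (∀ t ∈ ball (0 : ℂ) r, γ t ∈ H ∧ posMap p l (γ t) = t ^ 3) ∧
      ∀ᶠ w in 𝓝 w₀, w ∈ H → w ∈ γ '' ball 0 r := by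
  obtain ⟨ε, W, h⟩ := (hT w₀ hw₀).exists_isChart_of_eq hH hw₀
    ((hT w₀ hw₀).posMap_eq_zero_iff.1 hx)
  obtain ⟨π, hπ⟩ : ∃ π : ℂ × ℂ → ℂ, π = fun w => (cubic w.1 w.2)^[l] w.1 + w.1 := ⟨_, rfl⟩
  obtain ⟨u, hu, hu0, hXu⟩ := h.exists_cubic_form hT hR
  rw [← hπ] at h
  obtain ⟨φ, hφ, hφ0, hφ', hφu⟩ := exists_pow_normal_form hu hu0 three_ne_zero
  have h0 : (0 : ℂ) ∈ ball (0 : ℂ) ε := mem_ball_self h.pos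
  obtain ⟨r, hr, ψ, hψ, hψ0, h1, V, hVU, hVo, hV0, h2⟩ := exists_local_inverse_complex hφ hφ'
    (inter_mem (ball_mem_nhds 0 h.pos) (hXu.and hφu))
  rw [hφ0] at hψ hψ0 h1 h2
  have hπ0 : π w₀ = 0 := by
    have := h.proj 0 h0
    rwa [h.zero] at this
  refine ⟨r, hr, fun y => W (ψ y),
    h.diff.continuousOn.comp hψ.continuousOn fun y hy => (h1 y hy).1.1, ?_, ?_, ?_, ?_⟩
  · simp only [hψ0, h.zero]
  · intro t ht t' ht' he
    have h3 : ψ t = ψ t' := by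
      rw [← h.proj _ (h1 t ht).1.1, ← h.proj _ (h1 t' ht').1.1]
      exact congrArg π he
    rw [← (h1 t ht).2, ← (h1 t' ht').2, h3]
  · intro t ht
    obtain ⟨⟨h3, h4, h5⟩, h6⟩ := h1 t ht
    refine ⟨h.mem _ h3, ?_⟩
    rw [h4, ← h6, h5, sub_zero, h6]
  · filter_upwards [h.eventually, h.diff_proj.continuous.continuousAt.preimage_mem_nhds
      (by rw [hπ0]; exact hVo.mem_nhds hV0)] with w h3 h4 hw
    have h5 := h2 _ h4
    refine ⟨φ (π w), h5.1, ?_⟩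
    simp only [h5.2]
    exact (h3 (hT w hw).mem).2

theorem IsHyperbolicComponent.isCubicBranched (hH : IsHyperbolicComponent p H)
    (hb : Bornology.IsBounded H) : IsCubicBranched fun w : H => posMap p l w where
  cont := continuousOn_iff_continuous_domRestrict.1 (continuousOn_posMap hT hR)
  lt w := (hT w w.2).norm_posMap_lt_one
  proper r hr := by
    rw [Subtype.isCompact_iff]
    convert hH.isCompact_sublevel hT hR hb (closedBall_subset_ball hr)
      (isCompact_closedBall (0 : ℂ) r) using 1
    ext w
    simp [and_comm]
  regular w₀ hx := by
    obtain ⟨r, hr, Γ, h1, h2, h3⟩ := hH.exists_section hT hR w₀.2 hx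
    obtain ⟨g, hg, hgΓ⟩ := h1.exists_codRestrict (fun y hy => (h2 y hy).1) w₀
    refine ⟨r, hr, g, hg, fun y hy => by rw [hgΓ y hy]; exact (h2 y hy).2, ?_⟩
    have hc : Continuous fun w : H => posMap p l w :=
      continuousOn_iff_continuous_domRestrict.1 (continuousOn_posMap hT hR)
    filter_upwards [continuous_subtype_val.continuousAt.eventually h3,
      hc.continuousAt.preimage_mem_nhds (ball_mem_nhds _ hr)] with w h4 h5
    exact Subtype.ext ((hgΓ _ h5).trans (h4 w.2))
  center w₀ hx := by
    obtain ⟨r, hr, γ, h1, h2, h3, h4, h5⟩ := hH.exists_cube_section hT hR w₀.2 hx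
    obtain ⟨g, hg, hgγ⟩ := h1.exists_codRestrict (fun y hy => (h4 y hy).1) w₀
    have h0 : (0 : ℂ) ∈ ball (0 : ℂ) r := mem_ball_self hr
    refine ⟨r, hr, g, hg, Subtype.ext ((hgγ 0 h0).trans h2), fun t ht t' ht' he => ?_,
      fun t ht => by rw [hgγ t ht]; exact (h4 t ht).2, ?_⟩
    · exact h3 ht ht' (by rw [← hgγ t ht, ← hgγ t' ht', he])
    · filter_upwards [continuous_subtype_val.continuousAt.eventually h5] with w h6
      obtain ⟨t, ht, htw⟩ := h6 w.2
      exact ⟨t, ht, Subtype.ext ((hgγ t ht).trans htw)⟩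

end localSections

/-- On a bounded Type B hyperbolic component `H` of `S_p`, the map
`Φ(c,a) = B_{c,a}(-c)` (Böttcher coordinate of `f_{c,a}^p` at the superattracting
periodic point `f_{c,a}^l(c)`, evaluated at `-c`) is a proper triple cover of the unit
disk, ramified at exactly one point. -/
theorem typeB_bottcher_is_triple_cover
    (p : ℕ) (hp : 1 ≤ p) (H : Set (ℂ × ℂ))
    (hH : IsHyperbolicComponent p H) (hb : Bornology.IsBounded H)
    (l : ℕ) (hl : 1 ≤ l) (hlp : l < p)
    (htypeB : ∀ w ∈ H, -w.1 ∈ fatouComponent (cubic w.1 w.2) ((cubic w.1 w.2)^[l] w.1)) :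
    ∃ Φ : ℂ × ℂ → ℂ,
      (∀ w ∈ H, ∃ B U d, IsBottcherAt ((cubic w.1 w.2)^[p]) ((cubic w.1 w.2)^[l] w.1) B U d ∧
        -w.1 ∈ U ∧ Φ w = B (-w.1)) ∧
      ContinuousOn Φ H ∧ AnalyticOnSlice Φ H ∧ Φ '' H = ball (0 : ℂ) 1 ∧
      (∀ K : Set ℂ, K ⊆ ball (0 : ℂ) 1 → IsCompact K → IsCompact (H ∩ Φ ⁻¹' K)) ∧
      ∃ w₀ ∈ H, {w ∈ H | Φ w = Φ w₀} = {w₀} ∧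
        ∀ v ∈ ball (0 : ℂ) 1, v ≠ Φ w₀ → ({w ∈ H | Φ w = v}).ncard = 3 := by
  have hsub : H ⊆ Sp p := by
    obtain ⟨w, -, rfl⟩ := hH
    exact fun w hw => (connectedComponentIn_subset _ _ hw).1
  have hT : ∀ w ∈ H, TypeB p l w := fun w hw => ⟨hl, hlp, hsub hw, htypeB w hw⟩
  obtain ⟨M, hM⟩ := hb.exists_norm_le
  have hR : ∀ w ∈ H, ∀ z ∈ filledJulia (cubic w.1 w.2), ‖z‖ ≤ 3 * M ^ 2 + M + 2 :=
    fun w hw z hz => (norm_lt_of_mem_filledJulia ((norm_fst_le w).trans (hM w hw))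
      ((norm_snd_le w).trans (hM w hw)) hz).le
  have hcb := hH.isCubicBranched hT hR hb
  have hconn : PreconnectedSpace H := by
    obtain ⟨w, -, rfl⟩ := hH
    exact isPreconnected_iff_preconnectedSpace.1 isPreconnected_connectedComponentIn
  have hne : Nonempty H := by
    obtain ⟨w, hw, rfl⟩ := hH
    exact ⟨⟨w, mem_connectedComponentIn hw⟩⟩
  obtain ⟨w₀, h0, h1, h2⟩ := hcb.exists_ramification
  refine ⟨posMap p l, fun w hw => (hT w hw).exists_isBottcherAt, continuousOn_posMap hT hR,
    IsHyperbolicComponent.analyticOnSlice_posMap hT hR hH, ?_,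
    fun K hK hKc => hH.isCompact_sublevel hT hR hb hK hKc, w₀, w₀.2, ?_, fun v hv hv0 => ?_⟩
  · rw [← hcb.image_eq_ball]
    exact image_eq_range _ _
  · ext w
    refine ⟨fun hw => ?_, fun hw => ?_⟩
    · exact congrArg Subtype.val (h1 ⟨w, hw.1⟩ (hw.2.trans h0))
    · rw [mem_singleton_iff.1 hw]
      exact ⟨w₀.2, rfl⟩
  · rw [← h2 v hv (by rwa [h0] at hv0), ← ncard_image_of_injective _ Subtype.val_injective]
    congr 1
    ext w
    simp [and_comm]
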